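/- Let k, l, m, n ≥ 0 be integers and let f ∈ C_simple(ℤ^{k+l} × ℚ_p^{m+n}). Define I_{k,m}(f) : ℤ^k × ℚ_p^m → ℚ by I_{k,m}(f)(z,λ) = ∑_{z' ∈ ℤ^l} ∫_{ℚ_p^n} f(z,z',λ,x) |dx| if the function (z',x) ↦ f(z,z',λ,x) is absolutely integrable for all (z,λ) ∈ ℤ^k × ℚ_p^m (with respect to the product of the counting measure on ℤ^l and the Haar measure on ℚ_p^n), and I_{k,m}(f)(z,λ) = 0 otherwise. Then I_{k,m}(f) ∈ C_simple(ℤ^k × ℚ_p^m). -/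

import Mathlib

open Filter MeasureTheory
open scoped ENNReal

namespace PadicSub

variable (p : ℕ) [Fact p.Prime]

/-- The coefficients (indexed by multi-indices) of a restricted power series:
they tend to `0` along the cofinite filter. -/
def IsRestrictedCoeffs {m : ℕ} (a : (Fin m → ℕ) → ℚ_[p]) : Prop :=
  Filter.Tendsto a Filter.cofinite (nhds 0)

/-- The restricted analytic function associated to a family of coefficients:
the sum of the power series on `ℤ_p^m`, and `0` outside `ℤ_p^m`. -/
noncomputable def ranalFn {m : ℕ} (a : (Fin m → ℕ) → ℚ_[p]) (x : Fin m → ℚ_[p]) : ℚ_[p] :=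
  if ∀ j, ‖x j‖ ≤ 1 then ∑' i : (Fin m → ℕ), a i * ∏ j, x j ^ i j else 0

/-- `D`-functions: the functions obtained from restricted analytic functions, polynomial
maps, and the inverse function (with the convention `0⁻¹ = 0`) by repeated composition. -/
inductive IsDFunction : {m : ℕ} → ((Fin m → ℚ_[p]) → ℚ_[p]) → Prop where
  | ranal {m : ℕ} (a : (Fin m → ℕ) → ℚ_[p]) (ha : IsRestrictedCoeffs p a) :
      IsDFunction (ranalFn p a)
  | poly {m : ℕ} (q : MvPolynomial (Fin m) ℚ_[p]) :
      IsDFunction (fun x => MvPolynomial.eval x q)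
  | inv : IsDFunction (fun x : Fin 1 → ℚ_[p] => (x 0)⁻¹)
  | comp {m n : ℕ} (f : (Fin n → ℚ_[p]) → ℚ_[p]) (g : Fin n → (Fin m → ℚ_[p]) → ℚ_[p]) :
      IsDFunction f → (∀ i, IsDFunction (g i)) →
      IsDFunction (fun x => f (fun i => g i x))

/-- `P_n`: the set of nonzero `n`-th powers in `ℚ_p`. -/
def Pset (n : ℕ) : Set ℚ_[p] := {x | ∃ y : ℚ_[p], y ≠ 0 ∧ y ^ n = x}

/-- The coset `μ P_n`. -/
def cosetP (μ : ℚ_[p]) (n : ℕ) : Set ℚ_[p] := {x | ∃ y ∈ Pset p n, x = μ * y}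

/-- A (globally) subanalytic subset of `ℚ_p^m`: a finite union of finite intersections of
sets of the form `{x | f x = 0}` and `{x | f x ∈ P_n}`, `f` a `D`-function, `n > 0`. -/
def IsSubanalytic {m : ℕ} (X : Set (Fin m → ℚ_[p])) : Prop :=
  ∃ (r s : ℕ) (F : Fin r → Fin s → Set (Fin m → ℚ_[p])),
    (∀ i j, (∃ f, IsDFunction p f ∧ F i j = {x | f x = 0}) ∨
            (∃ f n, IsDFunction p f ∧ 0 < n ∧ F i j = {x | f x ∈ Pset p n})) ∧
    X = ⋃ i, ⋂ j, F i j

/-- A semialgebraic subset of `ℚ_p^m`: a finite union of finite intersections of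
sets of the form `{x | f x = 0}` and `{x | f x ∈ P_n}`, `f` a polynomial, `n > 0`. -/
def IsSemialgebraic {m : ℕ} (X : Set (Fin m → ℚ_[p])) : Prop :=
  ∃ (r s : ℕ) (F : Fin r → Fin s → Set (Fin m → ℚ_[p])),
    (∀ i j, (∃ f : MvPolynomial (Fin m) ℚ_[p], F i j = {x | MvPolynomial.eval x f = 0}) ∨
            (∃ (f : MvPolynomial (Fin m) ℚ_[p]) (n : ℕ), 0 < n ∧
              F i j = {x | MvPolynomial.eval x f ∈ Pset p n})) ∧
    X = ⋃ i, ⋂ j, F i j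

/-- The graph of the restriction to `X` of a map `ℚ_p^m → ℚ_p^n`, inside `ℚ_p^(m+n)`. -/
def graphMap {m n : ℕ} (X : Set (Fin m → ℚ_[p])) (F : (Fin m → ℚ_[p]) → (Fin n → ℚ_[p])) :
    Set (Fin (m + n) → ℚ_[p]) :=
  {z | (fun i => z (Fin.castAdd n i)) ∈ X ∧
    F (fun i => z (Fin.castAdd n i)) = fun j => z (Fin.natAdd m j)}

/-- The graph of the restriction to `X` of a function `ℚ_p^m → ℚ_p`, inside `ℚ_p^(m+1)`. -/
def graphFun {m : ℕ} (X : Set (Fin m → ℚ_[p])) (f : (Fin m → ℚ_[p]) → ℚ_[p]) :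
    Set (Fin (m + 1) → ℚ_[p]) :=
  {z | (fun i : Fin m => z i.castSucc) ∈ X ∧ f (fun i : Fin m => z i.castSucc) = z (Fin.last m)}

/-- A function `ℚ_p^m → ℚ_p` is subanalytic on `X` if its graph over `X` is subanalytic. -/
def IsSubanalyticFnOn {m : ℕ} (X : Set (Fin m → ℚ_[p])) (f : (Fin m → ℚ_[p]) → ℚ_[p]) : Prop :=
  IsSubanalytic p (graphFun p X f)

/-- A (totally defined) subanalytic function `ℚ_p^m → ℚ_p`. -/
def IsSubanalyticFn {m : ℕ} (f : (Fin m → ℚ_[p]) → ℚ_[p]) : Prop :=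
  IsSubanalyticFnOn p Set.univ f

/-- A function `ℚ_p^m → ℚ_p` is semialgebraic on `X` if its graph over `X` is
semialgebraic. -/
def IsSemialgebraicFnOn {m : ℕ} (X : Set (Fin m → ℚ_[p])) (f : (Fin m → ℚ_[p]) → ℚ_[p]) :
    Prop :=
  IsSemialgebraic p (graphFun p X f)

/-- A subanalytic subset of `ℚ_p` (one-variable version). -/
def IsSubanalytic1 (X : Set ℚ_[p]) : Prop :=
  IsSubanalytic p {z : Fin 1 → ℚ_[p] | z 0 ∈ X}

/-- A semialgebraic subset of `ℚ_p` (one-variable version). -/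
def IsSemialgebraic1 (X : Set ℚ_[p]) : Prop :=
  IsSemialgebraic p {z : Fin 1 → ℚ_[p] | z 0 ∈ X}

/-- A function `ℚ_p → ℚ_p` subanalytic on `X ⊆ ℚ_p`: its graph over `X` is a subanalytic
subset of `ℚ_p²`. -/
def IsSubanalyticFnOn1 (X : Set ℚ_[p]) (f : ℚ_[p] → ℚ_[p]) : Prop :=
  IsSubanalytic p {z : Fin 2 → ℚ_[p] | z 0 ∈ X ∧ f (z 0) = z 1}

/-- A function `ℚ_p → ℚ_p` semialgebraic on `X ⊆ ℚ_p`: its graph over `X` is a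
semialgebraic subset of `ℚ_p²`. -/
def IsSemialgebraicFnOn1 (X : Set ℚ_[p]) (f : ℚ_[p] → ℚ_[p]) : Prop :=
  IsSemialgebraic p {z : Fin 2 → ℚ_[p] | z 0 ∈ X ∧ f (z 0) = z 1}

/-- Interpretation of the symbols `□ᵢ` in the definition of cells: `true` means `<` and
`false` means "no condition". -/
def sqRel (b : Bool) (x y : ℝ) : Prop := b = true → x < y

/-- A cell in `ℚ_p`, presented with its center `γ` and coset data `μ`, `n`. -/
def IsCell1 (A : Set ℚ_[p]) (γ μ : ℚ_[p]) (n : ℕ) : Prop :=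
  0 < n ∧ A.Nonempty ∧
  ∃ (α β : ℚ_[p]) (b₁ b₂ : Bool), α ≠ 0 ∧ β ≠ 0 ∧
    A = {t | sqRel b₁ ‖α‖ ‖t - γ‖ ∧ sqRel b₂ ‖t - γ‖ ‖β‖ ∧ t - γ ∈ cosetP p μ n}

/-- Subanalytic cells in `ℚ_p^(m+1)`, defined inductively, presented with their center
`γ : ℚ_p^m → ℚ_p` and coset data `μ`, `n`.  The projection of the cell onto the first `m`
coordinates is required to be a cell. -/
inductive IsCell : {m : ℕ} → Set (Fin (m + 1) → ℚ_[p]) →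
    ((Fin m → ℚ_[p]) → ℚ_[p]) → ℚ_[p] → ℕ → Prop where
  | base (n : ℕ) (hn : 0 < n) (μ γ0 α β : ℚ_[p]) (hα : α ≠ 0) (hβ : β ≠ 0)
      (b₁ b₂ : Bool) (A : Set (Fin 1 → ℚ_[p])) (hne : A.Nonempty)
      (hA : A = {z | sqRel b₁ ‖α‖ ‖z 0 - γ0‖ ∧ sqRel b₂ ‖z 0 - γ0‖ ‖β‖ ∧
        z 0 - γ0 ∈ cosetP p μ n}) :
      IsCell A (fun _ => γ0) μ n
  | succ {m : ℕ} {D : Set (Fin (m + 1) → ℚ_[p])} {γD : (Fin m → ℚ_[p]) → ℚ_[p]}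
      {μD : ℚ_[p]} {nD : ℕ} (hD : IsCell D γD μD nD)
      (n : ℕ) (hn : 0 < n) (μ : ℚ_[p]) (α β γ : (Fin (m + 1) → ℚ_[p]) → ℚ_[p])
      (hα : IsSubanalyticFn p α) (hβ : IsSubanalyticFn p β) (hγ : IsSubanalyticFn p γ)
      (hα0 : ∀ x, α x ≠ 0) (hβ0 : ∀ x, β x ≠ 0)
      (b₁ b₂ : Bool) (A : Set (Fin (m + 2) → ℚ_[p]))
      (hA : A = {z | (fun i : Fin (m + 1) => z i.castSucc) ∈ D ∧
          sqRel b₁ ‖α (fun i : Fin (m + 1) => z i.castSucc)‖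
            ‖z (Fin.last (m + 1)) - γ (fun i : Fin (m + 1) => z i.castSucc)‖ ∧
          sqRel b₂ ‖z (Fin.last (m + 1)) - γ (fun i : Fin (m + 1) => z i.castSucc)‖
            ‖β (fun i : Fin (m + 1) => z i.castSucc)‖ ∧
          z (Fin.last (m + 1)) - γ (fun i : Fin (m + 1) => z i.castSucc) ∈ cosetP p μ n})
      (hproj : (fun (z : Fin (m + 2) → ℚ_[p]) (i : Fin (m + 1)) => z i.castSucc) '' A = D) :
      IsCell A γ μ n

/-- Analytic cells in `ℚ_p^(m+1)`: as subanalytic cells, but at each stage of the inductive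
definition the functions `α`, `β`, `γ` are moreover analytic on the projection of the cell. -/
inductive IsAnalyticCell : {m : ℕ} → Set (Fin (m + 1) → ℚ_[p]) →
    ((Fin m → ℚ_[p]) → ℚ_[p]) → ℚ_[p] → ℕ → Prop where
  | base (n : ℕ) (hn : 0 < n) (μ γ0 α β : ℚ_[p]) (hα : α ≠ 0) (hβ : β ≠ 0)
      (b₁ b₂ : Bool) (A : Set (Fin 1 → ℚ_[p])) (hne : A.Nonempty)
      (hA : A = {z | sqRel b₁ ‖α‖ ‖z 0 - γ0‖ ∧ sqRel b₂ ‖z 0 - γ0‖ ‖β‖ ∧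
        z 0 - γ0 ∈ cosetP p μ n}) :
      IsAnalyticCell A (fun _ => γ0) μ n
  | succ {m : ℕ} {D : Set (Fin (m + 1) → ℚ_[p])} {γD : (Fin m → ℚ_[p]) → ℚ_[p]}
      {μD : ℚ_[p]} {nD : ℕ} (hD : IsAnalyticCell D γD μD nD)
      (n : ℕ) (hn : 0 < n) (μ : ℚ_[p]) (α β γ : (Fin (m + 1) → ℚ_[p]) → ℚ_[p])
      (hα : IsSubanalyticFn p α) (hβ : IsSubanalyticFn p β) (hγ : IsSubanalyticFn p γ)
      (hαan : AnalyticOn ℚ_[p] α D) (hβan : AnalyticOn ℚ_[p] β D)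
      (hγan : AnalyticOn ℚ_[p] γ D)
      (hα0 : ∀ x, α x ≠ 0) (hβ0 : ∀ x, β x ≠ 0)
      (b₁ b₂ : Bool) (A : Set (Fin (m + 2) → ℚ_[p]))
      (hA : A = {z | (fun i : Fin (m + 1) => z i.castSucc) ∈ D ∧
          sqRel b₁ ‖α (fun i : Fin (m + 1) => z i.castSucc)‖
            ‖z (Fin.last (m + 1)) - γ (fun i : Fin (m + 1) => z i.castSucc)‖ ∧
          sqRel b₂ ‖z (Fin.last (m + 1)) - γ (fun i : Fin (m + 1) => z i.castSucc)‖
            ‖β (fun i : Fin (m + 1) => z i.castSucc)‖ ∧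
          z (Fin.last (m + 1)) - γ (fun i : Fin (m + 1) => z i.castSucc) ∈ cosetP p μ n})
      (hproj : (fun (z : Fin (m + 2) → ℚ_[p]) (i : Fin (m + 1)) => z i.castSucc) '' A = D) :
      IsAnalyticCell A γ μ n

/-- Generators of the algebra of subanalytic constructible functions on `ℚ_p^m`:
`ℤ`-valued valuations of nonvanishing subanalytic functions, and (`ℚ`-valued) norms of
subanalytic functions. -/
def constructibleGens (m : ℕ) : Set ((Fin m → ℚ_[p]) → ℚ) :=
  {g | ∃ h : (Fin m → ℚ_[p]) → ℚ_[p], IsSubanalyticFn p h ∧ (∀ x, h x ≠ 0) ∧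
        g = fun x => ((h x).valuation : ℚ)} ∪
  {g | ∃ h : (Fin m → ℚ_[p]) → ℚ_[p], IsSubanalyticFn p h ∧
        g = fun x => (padicNormE (h x) : ℚ)}

/-- The `ℚ`-algebra `C(ℚ_p^m)` of subanalytic constructible functions on `ℚ_p^m`. -/
noncomputable def ConstructibleAlg (m : ℕ) : Subalgebra ℚ ((Fin m → ℚ_[p]) → ℚ) :=
  Algebra.adjoin ℚ (constructibleGens p m)

/-- `ℤ_p^m` as a subset of `ℚ_p^m`. -/
def ZpSet (m : ℕ) : Set (Fin m → ℚ_[p]) := {x | ∀ j, ‖x j‖ ≤ 1}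

/-- A simple subset of `ℤ^n × ℚ_p^m`. -/
def IsSimpleSet (n m : ℕ) (A : Set ((Fin n → ℤ) × (Fin m → ℚ_[p]))) : Prop :=
  IsSubanalytic p {z : Fin (n + m) → ℚ_[p] |
    (∀ i : Fin n, z (Fin.castAdd m i) ≠ 0) ∧
    ((fun i : Fin n => (z (Fin.castAdd m i)).valuation),
      fun j : Fin m => z (Fin.natAdd n j)) ∈ A}

/-- A simple function `ℤ^n × ℚ_p^m → ℤ`: one whose graph is a simple set. -/
def IsSimpleFn (n m : ℕ) (h : (Fin n → ℤ) × (Fin m → ℚ_[p]) → ℤ) : Prop :=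
  IsSimpleSet p (n + 1) m
    {w | w.1 (Fin.last n) = h (fun i : Fin n => w.1 i.castSucc, w.2)}

/-- Generators of `C_simple(ℤ^n × ℚ_p^m)`: simple functions, and `p^h` for `h` simple. -/
def simpleGens (n m : ℕ) : Set ((Fin n → ℤ) × (Fin m → ℚ_[p]) → ℚ) :=
  {g | ∃ h, IsSimpleFn p n m h ∧ g = fun w => (h w : ℚ)} ∪
  {g | ∃ h, IsSimpleFn p n m h ∧ g = fun w => (p : ℚ) ^ (h w)}

/-- The `ℚ`-algebra `C_simple(ℤ^n × ℚ_p^m)`. -/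
noncomputable def SimpleAlg (n m : ℕ) : Subalgebra ℚ ((Fin n → ℤ) × (Fin m → ℚ_[p]) → ℚ) :=
  Algebra.adjoin ℚ (simpleGens p n m)

noncomputable instance : MeasurableSpace ℚ_[p] := borel _
instance : BorelSpace ℚ_[p] := ⟨rfl⟩

end PadicSub

open MvPolynomial (eval)
open PadicInt (norm_le_one coe_sum norm_def coe_mul norm_le_pow_iff_mem_span_pow)
open Finsupp (equivFunOnFinite)
open Finset (range sum_congr mem_range mul_sum induction_on sum_range_succ mem_filter sum_insert)
open Fin (append castAdd natAdd snoc append_left append_right snoc_last snoc_castSucc)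
open Padic (valuation_mul valuation_zpow valuation_p valuation_inv norm_eq_zpow_neg_valuation norm_p_zpow)
open MvPowerSeries (coeff)
open Metric (closedBall)
open Set (mem_ofPred_eq mem_of_eq_of_mem)
open Filter MeasureTheory
set_option linter.all false
set_option linter.unusedSectionVars false
namespace PadicSub

section basics
variable {p : ℕ} [hp : Fact p.Prime]

theorem pK_ne : (p : ℚ_[p]) ≠ 0 := by exact_mod_cast hp.1.ne_zero

theorem pR_one_lt : (1 : ℝ) < p := by exact_mod_cast hp.1.one_lt

theorem normp_pos : 0 < ‖(p : ℚ_[p])‖ := norm_pos_iff.2 pK_ne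

theorem normp_lt : ‖(p : ℚ_[p])‖ < 1 := Padic.norm_p_lt_one

theorem normpow_le (M : ℕ) : ‖(p : ℚ_[p]) ^ M‖ ≤ 1 := by
  rw [norm_pow]; exact pow_le_one₀ (norm_nonneg _) normp_lt.le

theorem normpow_pos (M : ℕ) : 0 < ‖(p : ℚ_[p]) ^ M‖ := norm_pos_iff.2 (pow_ne_zero _ pK_ne)

theorem normpow_anti {M N : ℕ} (h : M ≤ N) : ‖(p : ℚ_[p]) ^ N‖ ≤ ‖(p : ℚ_[p]) ^ M‖ := by
  rw [norm_pow, norm_pow]; exact pow_le_pow_of_le_one (norm_nonneg _) normp_lt.le h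

theorem normpow_lt_one {M : ℕ} (h : 1 ≤ M) : ‖(p : ℚ_[p]) ^ M‖ < 1 := by
  rw [norm_pow]; exact pow_lt_one₀ (norm_nonneg _) normp_lt (by omega)

theorem exists_normpow_lt {ε : ℝ} (hε : 0 < ε) : ∃ M : ℕ, ‖(p : ℚ_[p]) ^ M‖ < ε := by
  obtain ⟨M, hM⟩ := exists_pow_lt_of_lt_one hε (normp_lt (p := p))
  exact ⟨M, by rwa [norm_pow]⟩

theorem add_le_max (x y : ℚ_[p]) : ‖x + y‖ ≤ max ‖x‖ ‖y‖ := Padic.nonarchimedean x y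

theorem norm_add_le_of {x y : ℚ_[p]} {r : ℝ} (hx : ‖x‖ ≤ r) (hy : ‖y‖ ≤ r) : ‖x + y‖ ≤ r :=
  (add_le_max x y).trans (max_le hx hy)

theorem norm_sub_le_of {x y : ℚ_[p]} {r : ℝ} (hx : ‖x‖ ≤ r) (hy : ‖y‖ ≤ r) : ‖x - y‖ ≤ r := by
  rw [sub_eq_add_neg]; exact norm_add_le_of hx (by rwa [norm_neg])

theorem norm_add_eq_left {x y : ℚ_[p]} (h : ‖y‖ < ‖x‖) : ‖x + y‖ = ‖x‖ := by
  rw [Padic.add_eq_max_of_ne h.ne', max_eq_left h.le]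

theorem norm_sum_le_of {ι : Type*} (s : Finset ι) (f : ι → ℚ_[p]) {r : ℝ} (hr : 0 ≤ r)
    (h : ∀ i ∈ s, ‖f i‖ ≤ r) : ‖∑ i ∈ s, f i‖ ≤ r := by
  classical
  induction s using induction_on with
  | empty => simpa using hr
  | insert a s ha ih =>
    rw [sum_insert ha]
    exact norm_add_le_of (h a (by simp)) (ih fun i hi => h i (by simp [hi]))

/-- units close to one -/
def near1 (M : ℕ) (x : ℚ_[p]) : Prop := ‖x - 1‖ ≤ ‖(p : ℚ_[p]) ^ M‖

theorem near1.norm {M : ℕ} (hM : 1 ≤ M) {x : ℚ_[p]} (h : near1 M x) : ‖x‖ = 1 := by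
  have h1 : ‖x - 1‖ < ‖(1 : ℚ_[p])‖ := by
    rw [norm_one]; exact lt_of_le_of_lt h (normpow_lt_one hM)
  have := norm_add_eq_left h1
  simpa using this

theorem near1.ne {M : ℕ} (hM : 1 ≤ M) {x : ℚ_[p]} (h : near1 M x) : x ≠ 0 := by
  intro h0; have := h.norm hM; rw [h0] at this; simp at this

theorem near1_one {M : ℕ} : near1 M (1 : ℚ_[p]) := by
  simp only [near1, sub_self, norm_zero]; exact norm_nonneg _

theorem near1.mul {M : ℕ} (hM : 1 ≤ M) {x y : ℚ_[p]} (hx : near1 M x) (hy : near1 M y) :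
    near1 M (x * y) := by
  have : x * y - 1 = x * (y - 1) + (x - 1) := by ring
  unfold near1
  rw [this]
  refine norm_add_le_of ?_ hx
  rw [norm_mul, hx.norm hM, one_mul]; exact hy

theorem near1.inv {M : ℕ} (hM : 1 ≤ M) {x : ℚ_[p]} (hx : near1 M x) : near1 M x⁻¹ := by
  have h0 := hx.ne hM
  have : x⁻¹ - 1 = -(x⁻¹ * (x - 1)) := by field_simp; ring
  unfold near1
  rw [this, norm_neg, norm_mul, norm_inv, hx.norm hM, inv_one, one_mul]
  exact hx

theorem near1.pow {M : ℕ} (hM : 1 ≤ M) {x : ℚ_[p]} (hx : near1 M x) (n : ℕ) :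
    near1 M (x ^ n) := by
  induction n with
  | zero => simpa using near1_one
  | succ n ih => rw [pow_succ]; exact ih.mul hM hx

theorem near1.zpow {M : ℕ} (hM : 1 ≤ M) {x : ℚ_[p]} (hx : near1 M x) (n : ℤ) :
    near1 M (x ^ n) := by
  cases n with
  | ofNat n => simpa using hx.pow hM n
  | negSucc n => rw [zpow_negSucc]; exact (hx.pow hM _).inv hM

theorem near1.mono {M N : ℕ} (h : M ≤ N) {x : ℚ_[p]} (hx : near1 N x) : near1 M x :=
  le_trans hx (normpow_anti h)

theorem pow_sub_one_norm {n : ℕ} {ρ : ℚ_[p]} (h : ‖ρ - 1‖ < ‖(n : ℚ_[p])‖) :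
    ‖ρ ^ n - 1‖ = ‖(n : ℚ_[p])‖ * ‖ρ - 1‖ := by
  have hn1 : ‖(n : ℚ_[p])‖ ≤ 1 := by simpa using Padic.norm_int_le_one (p := p) (n : ℤ)
  have hρ : ‖ρ‖ = 1 := by
    have := norm_add_eq_left (x := (1 : ℚ_[p])) (y := ρ - 1) (by rw [norm_one]; linarith)
    simpa using this
  have hi : ∀ i : ℕ, ‖ρ ^ i - 1‖ ≤ ‖ρ - 1‖ := by
    intro i
    induction i with
    | zero => simp
    | succ i ih =>
      have : ρ ^ (i + 1) - 1 = ρ * (ρ ^ i - 1) + (ρ - 1) := by ring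
      rw [this]
      refine norm_add_le_of ?_ le_rfl
      rw [norm_mul, hρ, one_mul]; exact ih
  have h2 : (ρ ^ n - 1) = (∑ i ∈ range n, ρ ^ i) * (ρ - 1) := (geom_sum_mul ρ n).symm
  have h3 : (∑ i ∈ range n, ρ ^ i) = n + ∑ i ∈ range n, (ρ ^ i - 1) := by
    rw [Finset.sum_sub_distrib]; simp
  rw [h2, norm_mul, h3, norm_add_eq_left]
  exact lt_of_le_of_lt (norm_sum_le_of _ _ (norm_nonneg _) fun i _ => hi i) h

theorem near1_root {n : ℕ} (hn : 0 < n) (k : ℕ) : ∃ M : ℕ, 1 ≤ M ∧ ∀ x : ℚ_[p], near1 M x →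
    ∃ ρ : ℚ_[p], near1 k ρ ∧ ρ ^ n = x := by
  have hn0 : (n : ℚ_[p]) ≠ 0 := by exact_mod_cast hn.ne'
  have hnp : 0 < ‖(n : ℚ_[p])‖ := norm_pos_iff.2 hn0
  obtain ⟨M, hM⟩ := exists_normpow_lt (p := p) (ε := min (‖(n : ℚ_[p])‖ ^ 2)
    (‖(n : ℚ_[p])‖ * ‖(p : ℚ_[p]) ^ k‖)) (lt_min (by positivity) (mul_pos hnp (normpow_pos k)))
  refine ⟨M + 1, by omega, fun x hx => ?_⟩
  have hxM : near1 M x := hx.mono (by omega)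
  have hx1 : ‖x‖ ≤ 1 := (hx.norm (by omega)).le
  let x' : ℤ_[p] := ⟨x, hx1⟩
  let F : Polynomial ℤ_[p] := Polynomial.X ^ n - Polynomial.C x'
  have e1 : F.aeval (1 : ℤ_[p]) = 1 - x' := by simp [F]
  have e2 : F.derivative.aeval (1 : ℤ_[p]) = n := by
    simp [F, Polynomial.derivative_X_pow]
  have hnn : ‖(n : ℤ_[p])‖ = ‖(n : ℚ_[p])‖ := by rw [norm_def]; simp
  have hle : ‖x - 1‖ < ‖(n : ℚ_[p])‖ ^ 2 := lt_of_le_of_lt hxM (hM.trans_le (min_le_left _ _))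
  have hen : ‖F.aeval (1 : ℤ_[p])‖ < ‖F.derivative.aeval (1 : ℤ_[p])‖ ^ 2 := by
    rw [e1, e2, hnn, norm_sub_rev]
    have : ‖x' - 1‖ = ‖x - 1‖ := by rw [norm_def]; rfl
    rw [this]; exact hle
  obtain ⟨z, hz, hz1, -⟩ := hensels_lemma hen
  rw [e2, hnn] at hz1
  have hz2 : (z : ℚ_[p]) ^ n = x := by
    have : z ^ n - x' = 0 := by simpa [F] using hz
    have h3 : ((z ^ n : ℤ_[p]) : ℚ_[p]) = x' := by rw [sub_eq_zero.1 this]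
    simpa using h3
  have hz1' : ‖(z : ℚ_[p]) - 1‖ < ‖(n : ℚ_[p])‖ := by
    rw [norm_def] at hz1; simpa using hz1
  refine ⟨z, ?_, hz2⟩
  have h4 := pow_sub_one_norm hz1'
  rw [hz2] at h4
  have h5 : ‖x - 1‖ < ‖(n : ℚ_[p])‖ * ‖(p : ℚ_[p]) ^ k‖ :=
    lt_of_le_of_lt hxM (hM.trans_le (min_le_right _ _))
  rw [h4] at h5
  exact (lt_of_mul_lt_mul_left h5 hnp.le).le

/-- residue approximations -/
theorem exists_approx (M : ℕ) (hM : 1 ≤ M) (x : ℚ_[p]) (hx : x ≠ 0) :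
    ∃ ξ : ℕ, ξ < p ^ M ∧ ¬ p ∣ ξ ∧ near1 M (x / ((p : ℚ_[p]) ^ x.valuation * (ξ : ℚ_[p]))) := by
  set y : ℚ_[p] := x / (p : ℚ_[p]) ^ x.valuation with hy
  have hpv : (p : ℚ_[p]) ^ x.valuation ≠ 0 := zpow_ne_zero _ pK_ne
  have hy1 : ‖y‖ = 1 := by
    rw [hy, norm_div, norm_eq_zpow_neg_valuation hx, norm_p_zpow, div_self]
    exact (zpow_pos (by exact_mod_cast hp.1.pos) _).ne'
  let z : ℤ_[p] := ⟨y, hy1.le⟩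
  have h1 := (norm_le_pow_iff_mem_span_pow _ M).2 (PadicInt.appr_spec M z)
  rw [norm_def] at h1
  have h2 : ‖y - (z.appr M : ℚ_[p])‖ ≤ ‖(p : ℚ_[p]) ^ M‖ := by
    rw [Padic.norm_p_pow]; exact h1
  have h3 : ‖(z.appr M : ℚ_[p])‖ = 1 := by
    have : ‖-(y - (z.appr M : ℚ_[p]))‖ < ‖y‖ := by
      rw [norm_neg, hy1]; exact lt_of_le_of_lt h2 (normpow_lt_one hM)
    have := norm_add_eq_left this
    rw [hy1] at this
    rw [← this]; congr 1; ring
  have h4 : (z.appr M : ℚ_[p]) ≠ 0 := by intro h; rw [h] at h3; simp at h3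
  refine ⟨z.appr M, PadicInt.appr_lt z M, ?_, ?_⟩
  · intro hd
    have := (Padic.norm_natCast_lt_one_iff (p := p)).2 hd
    linarith
  · have : x / ((p : ℚ_[p]) ^ x.valuation * (z.appr M : ℚ_[p])) - 1
        = (y - (z.appr M : ℚ_[p])) / (z.appr M : ℚ_[p]) := by
      rw [hy]; field_simp
    unfold near1
    rw [this, norm_div, h3, div_one]; exact h2

theorem natCast_unit_norm {ξ : ℕ} (h : ¬ p ∣ ξ) : ‖(ξ : ℚ_[p])‖ = 1 := by
  have h1 : ‖(ξ : ℚ_[p])‖ ≤ 1 := by simpa using Padic.norm_int_le_one (p := p) (ξ : ℤ)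
  by_contra h2
  exact h ((Padic.norm_natCast_lt_one_iff (p := p)).1 (lt_of_le_of_ne h1 h2))

theorem natCast_unit_ne {ξ : ℕ} (h : ¬ p ∣ ξ) : (ξ : ℚ_[p]) ≠ 0 := by
  intro h0; have := natCast_unit_norm h; rw [h0] at this; simp at this

theorem Pset_ne {n : ℕ} {x : ℚ_[p]} (h : x ∈ Pset p n) : x ≠ 0 := by
  obtain ⟨y, hy, rfl⟩ := h; exact pow_ne_zero _ hy

theorem Pset_mul {n : ℕ} {x y : ℚ_[p]} (h : x ∈ Pset p n) (h' : y ∈ Pset p n) :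
    x * y ∈ Pset p n := by
  obtain ⟨a, ha, rfl⟩ := h; obtain ⟨b, hb, rfl⟩ := h'
  exact ⟨a * b, mul_ne_zero ha hb, mul_pow _ _ _⟩

theorem Pset_inv {n : ℕ} {x : ℚ_[p]} (h : x ∈ Pset p n) : x⁻¹ ∈ Pset p n := by
  obtain ⟨a, ha, rfl⟩ := h
  exact ⟨a⁻¹, inv_ne_zero ha, inv_pow _ _⟩

theorem Pset_pow {n : ℕ} {x : ℚ_[p]} (h : x ≠ 0) : x ^ n ∈ Pset p n := ⟨x, h, rfl⟩

theorem Pset_near1 {n : ℕ} (hn : 0 < n) : ∃ M : ℕ, 1 ≤ M ∧ ∀ x : ℚ_[p], near1 M x →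
    x ∈ Pset p n := by
  obtain ⟨M, hM, h⟩ := near1_root (p := p) hn 1
  refine ⟨M, hM, fun x hx => ?_⟩
  obtain ⟨ρ, h1, h2⟩ := h x hx
  exact ⟨ρ, h1.ne le_rfl, h2⟩

/-- representatives of cosets -/
theorem Pset_reps {n : ℕ} (hn : 0 < n) : ∃ L : Finset ℚ_[p], (∀ l ∈ L, l ≠ 0) ∧
    ∀ x : ℚ_[p], x ≠ 0 → ∃ l ∈ L, l⁻¹ * x ∈ Pset p n := by
  classical
  obtain ⟨M, hM, h⟩ := Pset_near1 (p := p) hn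
  refine ⟨((range n ×ˢ ((range (p ^ M)).filter (fun ξ => ¬ p ∣ ξ))).image
    fun iξ => (p : ℚ_[p]) ^ iξ.1 * (iξ.2 : ℚ_[p])), ?_, ?_⟩
  · intro l hl
    simp only [Finset.mem_image, Finset.mem_product, mem_range, mem_filter] at hl
    obtain ⟨⟨i, ξ⟩, ⟨_, _, h2⟩, rfl⟩ := hl
    exact mul_ne_zero (pow_ne_zero _ pK_ne) (natCast_unit_ne h2)
  · intro x hx
    obtain ⟨ξ, h1, h2, h3⟩ := exists_approx M hM x hx
    have hnz : (0 : ℤ) < n := by exact_mod_cast hn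
    set v := x.valuation with hv
    have hm0 : 0 ≤ v % n := Int.emod_nonneg _ hnz.ne'
    have hm1 : v % n < n := Int.emod_lt_of_pos _ hnz
    refine ⟨(p : ℚ_[p]) ^ (v % n).toNat * ξ, ?_, ?_⟩
    · simp only [Finset.mem_image, Finset.mem_product, mem_range, mem_filter]
      exact ⟨((v % n).toNat, ξ), ⟨by omega, h1, h2⟩, rfl⟩
    · have e1 : (p : ℚ_[p]) ^ v = ((p : ℚ_[p]) ^ (v / n)) ^ n * (p : ℚ_[p]) ^ (v % n).toNat := by
        rw [← zpow_natCast, ← zpow_natCast, ← zpow_mul, ← zpow_add₀ pK_ne, Int.toNat_of_nonneg hm0]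
        congr 1
        rw [mul_comm]; exact (Int.mul_ediv_add_emod v n).symm
      have hξ := natCast_unit_ne (p := p) h2
      have e2 : ((p : ℚ_[p]) ^ (v % n).toNat * ξ)⁻¹ * x
          = ((p : ℚ_[p]) ^ (v / n)) ^ n * (x / ((p : ℚ_[p]) ^ v * ξ)) := by
        have := pow_ne_zero (v % n).toNat (pK_ne (p := p))
        have h5 : ((p : ℚ_[p]) ^ (v / n)) ^ n ≠ 0 := pow_ne_zero _ (zpow_ne_zero _ pK_ne)
        rw [e1]; field_simp
      rw [e2]
      exact Pset_mul (Pset_pow (zpow_ne_zero _ pK_ne)) (h _ h3)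

/-- sets of nonzero numbers that are invariant under a finite index open subgroup -/
def Tame (T : Set ℚ_[p]) : Prop := ∃ N M : ℕ, 0 < N ∧ 1 ≤ M ∧
  (∀ x, x ≠ 0 → (x ∈ T ↔ x * (p : ℚ_[p]) ^ N ∈ T)) ∧
  (∀ x u, x ≠ 0 → near1 M u → x ∈ T → x * u ∈ T)

theorem Tame.cosets {T : Set ℚ_[p]} (h : Tame T) : ∃ n : ℕ, 0 < n ∧ ∃ L : Finset ℚ_[p],
    (∀ l ∈ L, l ≠ 0) ∧ ∀ x : ℚ_[p], x ≠ 0 → (x ∈ T ↔ ∃ l ∈ L, l⁻¹ * x ∈ Pset p n) := by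
  classical
  obtain ⟨N, M, hN, hM, h1, h2⟩ := h
  have hφ : 0 < (p ^ M).totient := Nat.totient_pos.2 (pow_pos hp.1.pos _)
  have hn : 0 < N * (p ^ M).totient := Nat.mul_pos hN hφ
  set n := N * (p ^ M).totient with hnn
  have hz : ∀ (j : ℤ) (x : ℚ_[p]), x ≠ 0 → (x ∈ T ↔ x * (p : ℚ_[p]) ^ (N * j) ∈ T) := by
    intro j
    induction j using Int.induction_on with
    | zero => intro x hx; simp
    | succ j ih =>
      intro x hx
      rw [ih x hx, h1 _ (mul_ne_zero hx (zpow_ne_zero _ pK_ne)), mul_assoc, ← zpow_natCast,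
        ← zpow_add₀ pK_ne]
      ring_nf
    | pred j ih =>
      intro x hx
      rw [ih x hx, h1 (x * (p : ℚ_[p]) ^ ((N : ℤ) * (-(j : ℤ) - 1)))
        (mul_ne_zero hx (zpow_ne_zero _ pK_ne)), mul_assoc x, ← zpow_natCast (p : ℚ_[p]) N,
        ← zpow_add₀ pK_ne]
      ring_nf
  have key : ∀ y : ℚ_[p], y ∈ Pset p n → ∀ x, x ≠ 0 → x ∈ T → x * y ∈ T := by
    rintro _ ⟨y, hy, rfl⟩ x hx hxT
    obtain ⟨ξ, k1, k2, k3⟩ := exists_approx M hM y hy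
    set u := y / ((p : ℚ_[p]) ^ y.valuation * ξ) with hu
    have hξ := natCast_unit_ne (p := p) k2
    have hpv : (p : ℚ_[p]) ^ y.valuation ≠ 0 := zpow_ne_zero _ pK_ne
    have e1 : y = (p : ℚ_[p]) ^ y.valuation * ξ * u := by rw [hu]; field_simp
    have hξ1 : near1 M ((ξ : ℚ_[p]) ^ (p ^ M).totient) := by
      have hc : Nat.Coprime ξ (p ^ M) :=
        Nat.Coprime.pow_right _ ((Nat.Prime.coprime_iff_not_dvd hp.1).2 k2).symm
      have hmod := Nat.ModEq.pow_totient hc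
      have hd := (Nat.modEq_iff_dvd.1 hmod.symm)
      unfold near1
      rw [Padic.norm_p_pow]
      have := (Padic.norm_int_le_pow_iff_dvd (p := p) ((ξ ^ (p ^ M).totient : ℕ) - (1 : ℕ) : ℤ) M).2
        (by exact_mod_cast hd)
      simpa using this
    have e2 : x * y ^ n = (x * (p : ℚ_[p]) ^ (N * ((p ^ M).totient * y.valuation))) *
        ((((ξ : ℚ_[p]) ^ (p ^ M).totient)) ^ N * u ^ n) := by
      conv_lhs => rw [e1]
      rw [mul_pow, mul_pow, ← zpow_natCast ((p : ℚ_[p]) ^ y.valuation), ← zpow_mul, ← pow_mul,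
        hnn]
      push_cast
      ring_nf
    rw [e2]
    refine h2 _ _ (mul_ne_zero hx (zpow_ne_zero _ pK_ne)) ?_ ((hz _ x hx).1 hxT)
    exact (hξ1.pow hM N).mul hM (k3.pow hM n)
  obtain ⟨L, hL, hL2⟩ := Pset_reps (p := p) hn
  refine ⟨n, hn, L.filter (· ∈ T), fun l hl => hL l (mem_filter.1 hl).1, fun x hx => ?_⟩
  constructor
  · intro hxT
    obtain ⟨l, hl, hlx⟩ := hL2 x hx
    refine ⟨l, mem_filter.2 ⟨hl, ?_⟩, hlx⟩
    have := key _ (Pset_inv hlx) x hx hxT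
    have hl0 := hL l hl
    have e : x * (l⁻¹ * x)⁻¹ = l := by field_simp
    rwa [e] at this
  · rintro ⟨l, hl, hlx⟩
    have hl0 := hL l (mem_filter.1 hl).1
    have := key _ hlx l hl0 (mem_filter.1 hl).2
    have e : l * (l⁻¹ * x) = x := by field_simp
    rwa [e] at this

theorem val_mul_near1 {M : ℕ} (hM : 1 ≤ M) {x u : ℚ_[p]} (hu : near1 M u) :
    (x * u).valuation = x.valuation := by
  by_cases hx : x = 0
  · simp [hx]
  · rw [valuation_mul hx (hu.ne hM)]
    have h1 := hu.norm hM
    rw [norm_eq_zpow_neg_valuation (hu.ne hM)] at h1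
    have := (zpow_eq_one_iff_right₀ (a := (p : ℝ)) (by positivity) pR_one_lt.ne').1 h1
    omega

theorem norm_le_iff_val {x y : ℚ_[p]} (hx : x ≠ 0) (hy : y ≠ 0) :
    ‖x‖ ≤ ‖y‖ ↔ y.valuation ≤ x.valuation := by
  rw [norm_eq_zpow_neg_valuation hx, norm_eq_zpow_neg_valuation hy,
    zpow_le_zpow_iff_right₀ pR_one_lt]
  omega

theorem norm_eq_iff_val {x y : ℚ_[p]} (hx : x ≠ 0) (hy : y ≠ 0) :
    ‖x‖ = ‖y‖ ↔ x.valuation = y.valuation := by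
  rw [le_antisymm_iff, norm_le_iff_val hx hy, norm_le_iff_val hy hx]
  omega

theorem norm_lt_iff_mul {x y : ℚ_[p]} (hy : y ≠ 0) :
    ‖x‖ < ‖y‖ ↔ ‖x‖ ≤ ‖(p : ℚ_[p]) * y‖ := by
  constructor
  · intro h
    by_cases hx : x = 0
    · simp only [hx, norm_zero]; exact norm_nonneg _
    · rw [norm_le_iff_val hx (mul_ne_zero pK_ne hy), valuation_mul pK_ne hy,
        valuation_p]
      have := (norm_le_iff_val hy hx).not.1 (not_le.2 h)
      omega
  · intro h
    refine lt_of_le_of_lt h ?_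
    rw [norm_mul]
    exact mul_lt_of_lt_one_left (norm_pos_iff.2 hy) normp_lt

end basics

section dalg
variable {p : ℕ} [hp : Fact p.Prime] {Ω' Ω : Type*}

/-- sets of functions closed under the operations defining `D`-functions -/
structure IsDAlg (𝒟 : Set (Ω → ℚ_[p])) : Prop where
  const : ∀ c : ℚ_[p], (fun _ => c) ∈ 𝒟
  add : ∀ {f g}, f ∈ 𝒟 → g ∈ 𝒟 → (fun ω => f ω + g ω) ∈ 𝒟
  mul : ∀ {f g}, f ∈ 𝒟 → g ∈ 𝒟 → (fun ω => f ω * g ω) ∈ 𝒟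
  inv : ∀ {f}, f ∈ 𝒟 → (fun ω => (f ω)⁻¹) ∈ 𝒟
  ranal : ∀ {k : ℕ} (a : (Fin k → ℕ) → ℚ_[p]), IsRestrictedCoeffs p a →
    ∀ g : Fin k → Ω → ℚ_[p], (∀ i, g i ∈ 𝒟) → (fun ω => ranalFn p a (fun i => g i ω)) ∈ 𝒟

namespace IsDAlg
variable {𝒟 : Set (Ω → ℚ_[p])} (h : IsDAlg 𝒟)
include h

theorem neg {f} (hf : f ∈ 𝒟) : (fun ω => - f ω) ∈ 𝒟 := by
  have := h.mul (h.const (-1)) hf; simpa using this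

theorem sub {f g} (hf : f ∈ 𝒟) (hg : g ∈ 𝒟) : (fun ω => f ω - g ω) ∈ 𝒟 := by
  have := h.add hf (h.neg hg); simpa [sub_eq_add_neg] using this

theorem div {f g} (hf : f ∈ 𝒟) (hg : g ∈ 𝒟) : (fun ω => f ω / g ω) ∈ 𝒟 := by
  have := h.mul hf (h.inv hg); simpa [div_eq_mul_inv] using this

theorem pow {f} (hf : f ∈ 𝒟) (n : ℕ) : (fun ω => f ω ^ n) ∈ 𝒟 := by
  induction n with
  | zero => simpa using h.const 1
  | succ n ih => simpa [pow_succ] using h.mul ih hf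

theorem zpow {f} (hf : f ∈ 𝒟) (n : ℤ) : (fun ω => f ω ^ n) ∈ 𝒟 := by
  cases n with
  | ofNat n => simpa using h.pow hf n
  | negSucc n => simpa using h.inv (h.pow hf (n + 1))

theorem cmul (c : ℚ_[p]) {f} (hf : f ∈ 𝒟) : (fun ω => c * f ω) ∈ 𝒟 := h.mul (h.const c) hf

theorem sum {ι : Type*} (s : Finset ι) (f : ι → Ω → ℚ_[p]) (hf : ∀ i ∈ s, f i ∈ 𝒟) :
    (fun ω => ∑ i ∈ s, f i ω) ∈ 𝒟 := by
  classical
  induction s using induction_on with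
  | empty => simpa using h.const 0
  | insert a s ha ih =>
    simp only [sum_insert ha]
    exact h.add (hf a (by simp)) (ih fun i hi => hf i (by simp [hi]))

theorem mvpoly {σ : Type*} (q : MvPolynomial σ ℚ_[p]) (g : σ → Ω → ℚ_[p]) (hg : ∀ i, g i ∈ 𝒟) :
    (fun ω => eval (fun i => g i ω) q) ∈ 𝒟 := by
  induction q using MvPolynomial.induction_on with
  | C a => simpa using h.const a
  | add a b ha hb => simpa using h.add ha hb
  | mul_X a i ha => simpa using h.mul ha (hg i)

theorem dfun {m : ℕ} {f : (Fin m → ℚ_[p]) → ℚ_[p]} (hf : IsDFunction p f)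
    (φ : Ω → Fin m → ℚ_[p]) (hφ : ∀ i, (fun ω => φ ω i) ∈ 𝒟) : (fun ω => f (φ ω)) ∈ 𝒟 := by
  induction hf with
  | ranal a ha => exact h.ranal a ha (fun i ω => φ ω i) hφ
  | poly q => exact h.mvpoly q (fun i ω => φ ω i) hφ
  | inv => exact h.inv (hφ 0)
  | comp f g hf hg ihf ihg => exact ihf (fun ω i => g i (φ ω)) fun i => ihg i φ hφ

end IsDAlg

/-- the `D`-functions -/
def DF (p : ℕ) [Fact p.Prime] (m : ℕ) : Set ((Fin m → ℚ_[p]) → ℚ_[p]) := {f | IsDFunction p f}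

theorem DF_poly {m : ℕ} (q : MvPolynomial (Fin m) ℚ_[p]) :
    (fun x => eval x q) ∈ DF p m := IsDFunction.poly q

theorem DF_coord {m : ℕ} (i : Fin m) : (fun x => x i) ∈ DF p m := by
  have := DF_poly (p := p) (MvPolynomial.X i); simpa using this

theorem DF_isDAlg (m : ℕ) : IsDAlg (DF p m) where
  const c := by have := DF_poly (p := p) (m := m) (MvPolynomial.C c); simpa using this
  add {f g} hf hg := by
    have := IsDFunction.comp _ ![f, g]
      (IsDFunction.poly (p := p) (MvPolynomial.X 0 + MvPolynomial.X 1 : MvPolynomial (Fin 2) ℚ_[p]))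
      (by intro i; fin_cases i; exacts [hf, hg])
    simpa [DF] using this
  mul {f g} hf hg := by
    have := IsDFunction.comp _ ![f, g]
      (IsDFunction.poly (p := p) (MvPolynomial.X 0 * MvPolynomial.X 1 : MvPolynomial (Fin 2) ℚ_[p]))
      (by intro i; fin_cases i; exacts [hf, hg])
    simpa [DF] using this
  inv {f} hf := by
    have := IsDFunction.comp _ ![f] (IsDFunction.inv (p := p))
      (by intro i; fin_cases i; exact hf)
    simpa [DF] using this
  ranal a ha g hg := IsDFunction.comp _ g (IsDFunction.ranal a ha) hg

/-- quantifier free definable sets -/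
inductive QF (𝒟 : Set (Ω → ℚ_[p])) : Set Ω → Prop
  | zero (f) (hf : f ∈ 𝒟) : QF 𝒟 {ω | f ω = 0}
  | pow (f) (hf : f ∈ 𝒟) (n : ℕ) (hn : 0 < n) : QF 𝒟 {ω | f ω ∈ Pset p n}
  | compl (S) (hS : QF 𝒟 S) : QF 𝒟 Sᶜ
  | inter (S T) (hS : QF 𝒟 S) (hT : QF 𝒟 T) : QF 𝒟 (S ∩ T)

namespace QF
variable {𝒟 : Set (Ω → ℚ_[p])}

theorem of_eq {S T : Set Ω} (h : QF 𝒟 S) (e : S = T) : QF 𝒟 T := e ▸ h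

theorem union {S T : Set Ω} (hS : QF 𝒟 S) (hT : QF 𝒟 T) : QF 𝒟 (S ∪ T) :=
  ((hS.compl.inter _ _ hT.compl).compl).of_eq (by simp [Set.compl_inter])

theorem diff {S T : Set Ω} (hS : QF 𝒟 S) (hT : QF 𝒟 T) : QF 𝒟 (S \ T) :=
  hS.inter _ _ hT.compl

theorem ne {f} (hf : f ∈ 𝒟) : QF 𝒟 {ω | f ω ≠ 0} := (QF.zero f hf).compl

theorem mono {𝒟' : Set (Ω → ℚ_[p])} (h : 𝒟 ⊆ 𝒟') {S : Set Ω} (hS : QF 𝒟 S) : QF 𝒟' S := by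
  induction hS with
  | zero f hf => exact .zero f (h hf)
  | pow f hf n hn => exact .pow f (h hf) n hn
  | compl S _ ih => exact ih.compl
  | inter S T _ _ ih1 ih2 => exact ih1.inter _ _ ih2

theorem preimage {𝒟' : Set (Ω' → ℚ_[p])} (φ : Ω' → Ω) (h : ∀ f ∈ 𝒟, (fun ω => f (φ ω)) ∈ 𝒟')
    {S : Set Ω} (hS : QF 𝒟 S) : QF 𝒟' (φ ⁻¹' S) := by
  induction hS with
  | zero f hf => exact .zero _ (h f hf)
  | pow f hf n hn => exact .pow _ (h f hf) n hn
  | compl S _ ih => exact ih.compl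
  | inter S T _ _ ih1 ih2 => exact ih1.inter _ _ ih2

variable (h : IsDAlg 𝒟)
include h

theorem univ : QF 𝒟 (Set.univ : Set Ω) := (QF.zero _ (h.const 0)).of_eq (by simp)

theorem empty : QF 𝒟 (∅ : Set Ω) := (univ h).compl.of_eq (by simp)

theorem const (P : Prop) : QF 𝒟 {_ω : Ω | P} := by
  by_cases hP : P
  · simpa [hP] using univ h
  · simpa [hP] using empty h

theorem biUnion {ι : Type*} (s : Finset ι) (F : ι → Set Ω) (hF : ∀ i ∈ s, QF 𝒟 (F i)) :
    QF 𝒟 (⋃ i ∈ s, F i) := by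
  classical
  induction s using induction_on with
  | empty => simpa using empty h
  | insert a s ha ih =>
    rw [Finset.set_biUnion_insert]
    exact (hF a (by simp)).union (ih fun i hi => hF i (by simp [hi]))

theorem biInter {ι : Type*} (s : Finset ι) (F : ι → Set Ω) (hF : ∀ i ∈ s, QF 𝒟 (F i)) :
    QF 𝒟 (⋂ i ∈ s, F i) := by
  classical
  induction s using induction_on with
  | empty => simpa using univ h
  | insert a s ha ih =>
    rw [Finset.set_biInter_insert]
    exact (hF a (by simp)).inter _ _ (ih fun i hi => hF i (by simp [hi]))

theorem bex {ι : Type*} (s : Finset ι) (F : ι → Ω → Prop) (hF : ∀ i ∈ s, QF 𝒟 {ω | F i ω}) :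
    QF 𝒟 {ω | ∃ i ∈ s, F i ω} :=
  (biUnion h s (fun i => {ω | F i ω}) hF).of_eq (by ext; simp)

theorem ball {ι : Type*} (s : Finset ι) (F : ι → Ω → Prop) (hF : ∀ i ∈ s, QF 𝒟 {ω | F i ω}) :
    QF 𝒟 {ω | ∀ i ∈ s, F i ω} :=
  (biInter h s (fun i => {ω | F i ω}) hF).of_eq (by ext; simp)

theorem fex {ι : Type*} [Finite ι] (F : ι → Ω → Prop) (hF : ∀ i, QF 𝒟 {ω | F i ω}) :
    QF 𝒟 {ω | ∃ i, F i ω} := by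
  cases nonempty_fintype ι
  exact (bex h Finset.univ F fun i _ => hF i).of_eq (by ext; simp)

theorem fall {ι : Type*} [Finite ι] (F : ι → Ω → Prop) (hF : ∀ i, QF 𝒟 {ω | F i ω}) :
    QF 𝒟 {ω | ∀ i, F i ω} := by
  cases nonempty_fintype ι
  exact (ball h Finset.univ F fun i _ => hF i).of_eq (by ext; simp)

theorem tame {T : Set ℚ_[p]} (hT : Tame T) {f} (hf : f ∈ 𝒟) : QF 𝒟 {ω | f ω ∈ T} := by
  obtain ⟨n, hn, L, hL, hLT⟩ := hT.cosets
  have h1 : QF 𝒟 {ω | f ω ≠ 0 ∧ ∃ l ∈ L, l⁻¹ * f ω ∈ Pset p n} :=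
    (QF.ne hf).inter _ _ (bex h L (fun l ω => l⁻¹ * f ω ∈ Pset p n)
      fun l _ => .pow _ (h.cmul _ hf) n hn)
  have h2 : QF 𝒟 {ω | f ω = 0 ∧ (0 : ℚ_[p]) ∈ T} := (QF.zero f hf).inter _ _ (const h _)
  refine (h1.union h2).of_eq ?_
  ext ω
  simp only [Set.mem_union, mem_ofPred_eq]
  by_cases h0 : f ω = 0
  · simp [h0]
  · simp only [h0, ne_eq, not_false_eq_true, true_and, false_and, or_false]
    exact (hLT _ h0).symm

theorem norm_le_one {f} (hf : f ∈ 𝒟) : QF 𝒟 {ω | ‖f ω‖ ≤ 1} := by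
  classical
  let a : (Fin 1 → ℕ) → ℚ_[p] := fun i => if i = 0 then 1 else 0
  have ha : IsRestrictedCoeffs p a := by
    refine tendsto_const_nhds.congr' ?_
    have hfin : {i : Fin 1 → ℕ | ¬ (0 = a i)} ⊆ {0} := by
      intro i hi
      by_contra hne
      exact hi (by simp only [a]; rw [if_neg (by simpa using hne)])
    exact (Set.finite_singleton _).subset hfin
  have h1 := h.ranal a ha (fun _ => f) (fun _ => hf)
  refine (QF.ne h1).of_eq ?_
  ext ω
  have hs : ∑' i : (Fin 1 → ℕ), a i * ∏ j, (fun _ : Fin 1 => f ω) j ^ i j = 1 := by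
    rw [tsum_eq_single 0]
    · simp [a]
    · intro b hb; simp [a, hb]
  simp only [mem_ofPred_eq, ranalFn]
  rw [hs]
  by_cases h2 : ‖f ω‖ ≤ 1 <;> simp [h2]

theorem norm_le {f g} (hf : f ∈ 𝒟) (hg : g ∈ 𝒟) : QF 𝒟 {ω | ‖f ω‖ ≤ ‖g ω‖} := by
  refine (((QF.zero g hg).inter _ _ (QF.zero f hf)).union
    ((QF.ne hg).inter _ _ (norm_le_one h (h.div hf hg)))).of_eq ?_
  ext ω
  simp only [Set.mem_union, Set.mem_inter_iff, mem_ofPred_eq]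
  by_cases h0 : g ω = 0
  · simp [h0]
  · have : 0 < ‖g ω‖ := norm_pos_iff.2 h0
    simp [h0, norm_div, div_le_one this]

theorem norm_lt {f g} (hf : f ∈ 𝒟) (hg : g ∈ 𝒟) : QF 𝒟 {ω | ‖f ω‖ < ‖g ω‖} :=
  (norm_le h hg hf).compl.of_eq (by ext; simp)

theorem norm_eq {f g} (hf : f ∈ 𝒟) (hg : g ∈ 𝒟) : QF 𝒟 {ω | ‖f ω‖ = ‖g ω‖} :=
  ((norm_le h hf hg).inter _ _ (norm_le h hg hf)).of_eq (by ext; simp [le_antisymm_iff])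

end QF

/-- literals -/
def IsLit {m : ℕ} (S : Set (Fin m → ℚ_[p])) : Prop :=
  (∃ f, IsDFunction p f ∧ S = {x | f x = 0}) ∨
            (∃ f n, IsDFunction p f ∧ 0 < n ∧ S = {x | f x ∈ Pset p n})

def IsSub2 {m : ℕ} (X : Set (Fin m → ℚ_[p])) : Prop :=
  ∃ (ι κ : Type) (_ : Finite ι) (_ : Finite κ) (F : ι → κ → Set (Fin m → ℚ_[p])),
    (∀ i j, IsLit (F i j)) ∧ X = ⋃ i, ⋂ j, F i j

theorem isLit_univ {m : ℕ} : IsLit (Set.univ : Set (Fin m → ℚ_[p])) :=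
  Or.inl ⟨_, (DF_isDAlg (p := p) m).const 0, by simp⟩

theorem isSub2_lit {m : ℕ} {X : Set (Fin m → ℚ_[p])} (h : IsLit X) : IsSub2 X :=
  ⟨Unit, Unit, inferInstance, inferInstance, fun _ _ => X, fun _ _ => h,
    by ext; simp⟩

theorem isSub2_union {m : ℕ} {X Y : Set (Fin m → ℚ_[p])} (hX : IsSub2 X) (hY : IsSub2 Y) :
    IsSub2 (X ∪ Y) := by
  obtain ⟨ι, κ, _, _, F, hF, rfl⟩ := hX
  obtain ⟨ι', κ', _, _, F', hF', rfl⟩ := hY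
  refine ⟨ι ⊕ ι', κ ⊕ κ', inferInstance, inferInstance,
    fun i j => match i, j with
      | .inl i, .inl j => F i j
      | .inr i, .inr j => F' i j
      | _, _ => Set.univ, ?_, ?_⟩
  · rintro (i | i) (j | j)
    · exact hF i j
    · exact isLit_univ
    · exact isLit_univ
    · exact hF' i j
  · ext x; simp [Set.mem_iUnion, Set.mem_iInter, Sum.exists, Sum.forall]

theorem isSub2_inter {m : ℕ} {X Y : Set (Fin m → ℚ_[p])} (hX : IsSub2 X) (hY : IsSub2 Y) :
    IsSub2 (X ∩ Y) := by
  obtain ⟨ι, κ, _, _, F, hF, rfl⟩ := hX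
  obtain ⟨ι', κ', _, _, F', hF', rfl⟩ := hY
  refine ⟨ι × ι', κ ⊕ κ', inferInstance, inferInstance,
    fun i j => match j with
      | .inl j => F i.1 j
      | .inr j => F' i.2 j, ?_, ?_⟩
  · rintro i (j | j)
    · exact hF i.1 j
    · exact hF' i.2 j
  · ext x; simp [Set.mem_iUnion, Set.mem_iInter, Sum.forall, Prod.exists]

theorem isSub2_biUnion {m : ℕ} {ι : Type*} (s : Finset ι) (F : ι → Set (Fin m → ℚ_[p]))
    (hF : ∀ i ∈ s, IsSub2 (F i)) : IsSub2 (⋃ i ∈ s, F i) := by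
  classical
  induction s using induction_on with
  | empty => exact ⟨Empty, Unit, inferInstance, inferInstance, fun _ _ => Set.univ,
      fun _ _ => isLit_univ, by simp⟩
  | insert a s ha ih =>
    rw [Finset.set_biUnion_insert]
    exact isSub2_union (hF a (by simp)) (ih fun i hi => hF i (by simp [hi]))

theorem isSub2_biInter {m : ℕ} {ι : Type*} (s : Finset ι) (F : ι → Set (Fin m → ℚ_[p]))
    (hF : ∀ i ∈ s, IsSub2 (F i)) : IsSub2 (⋂ i ∈ s, F i) := by
  classical
  induction s using induction_on with
  | empty => simpa using isSub2_lit isLit_univ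
  | insert a s ha ih =>
    rw [Finset.set_biInter_insert]
    exact isSub2_inter (hF a (by simp)) (ih fun i hi => hF i (by simp [hi]))

theorem isSub2_compl_lit {m : ℕ} {X : Set (Fin m → ℚ_[p])} (h : IsLit X) : IsSub2 Xᶜ := by
  have hD := DF_isDAlg (p := p) m
  rcases h with ⟨f, hf, rfl⟩ | ⟨f, n, hf, hn, rfl⟩
  · refine isSub2_lit (Or.inr ⟨f, 1, hf, one_pos, ?_⟩)
    ext x
    simp [Pset]
  · obtain ⟨L, hL, hL2⟩ := Pset_reps (p := p) hn
    classical
    have h1 : IsSub2 (⋃ l ∈ L.filter (fun l => l ∉ Pset p n), {x | l⁻¹ * f x ∈ Pset p n}) :=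
      isSub2_biUnion _ _ fun l _ => isSub2_lit (Or.inr ⟨_, n, hD.cmul _ hf, hn, rfl⟩)
    have h2 : IsSub2 {x | f x = 0} := isSub2_lit (Or.inl ⟨f, hf, rfl⟩)
    convert isSub2_union h2 h1 using 1
    ext x
    simp only [Set.mem_compl_iff, mem_ofPred_eq, Set.mem_union, Set.mem_iUnion,
      mem_filter, exists_prop]
    constructor
    · intro hx
      by_cases h0 : f x = 0
      · exact Or.inl h0
      · obtain ⟨l, hl, hl2⟩ := hL2 _ h0
        refine Or.inr ⟨l, ⟨hl, fun hlP => hx ?_⟩, hl2⟩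
        have := Pset_mul hlP hl2
        rwa [mul_inv_cancel_left₀ (hL l hl)] at this
    · rintro (h0 | ⟨l, ⟨hl, hlP⟩, hl2⟩) hx
      · exact Pset_ne hx h0
      · apply hlP
        have := Pset_mul hx (Pset_inv hl2)
        have hx0 := Pset_ne hx
        have hl0 := hL l hl
        have e : f x * (l⁻¹ * f x)⁻¹ = l := by field_simp
        rwa [e] at this

theorem isSub2_compl {m : ℕ} {X : Set (Fin m → ℚ_[p])} (h : IsSub2 X) : IsSub2 Xᶜ := by
  obtain ⟨ι, κ, _, _, F, hF, rfl⟩ := h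
  cases nonempty_fintype ι
  cases nonempty_fintype κ
  have : IsSub2 (⋂ i ∈ (Finset.univ : Finset ι), ⋃ j ∈ (Finset.univ : Finset κ), (F i j)ᶜ) :=
    isSub2_biInter _ _ fun i _ => isSub2_biUnion _ _ fun j _ => isSub2_compl_lit (hF i j)
  simpa [Set.compl_iUnion, Set.compl_iInter] using this

theorem isSub2_iff {m : ℕ} {X : Set (Fin m → ℚ_[p])} : IsSub2 X ↔ IsSubanalytic p X := by
  constructor
  · rintro ⟨ι, κ, _, _, F, hF, rfl⟩
    obtain ⟨r, ⟨e⟩⟩ := Finite.exists_equiv_fin ι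
    obtain ⟨s, ⟨e'⟩⟩ := Finite.exists_equiv_fin κ
    refine ⟨r, s, fun i j => F (e.symm i) (e'.symm j), fun i j => hF _ _, ?_⟩
    ext x
    simp only [Set.mem_iUnion, Set.mem_iInter]
    constructor
    · rintro ⟨i, hi⟩; exact ⟨e i, fun j => by simpa using hi _⟩
    · rintro ⟨i, hi⟩; exact ⟨e.symm i, fun j => by simpa using hi (e' j)⟩
  · rintro ⟨r, s, F, hF, rfl⟩
    exact ⟨Fin r, Fin s, inferInstance, inferInstance, F, hF, rfl⟩

theorem QF_iff_sub {m : ℕ} {X : Set (Fin m → ℚ_[p])} : QF (DF p m) X ↔ IsSubanalytic p X := by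
  rw [← isSub2_iff]
  constructor
  · intro h
    induction h with
    | zero f hf => exact isSub2_lit (Or.inl ⟨f, hf, rfl⟩)
    | pow f hf n hn => exact isSub2_lit (Or.inr ⟨f, n, hf, hn, rfl⟩)
    | compl S _ ih => exact isSub2_compl ih
    | inter S T _ _ ih1 ih2 => exact isSub2_inter ih1 ih2
  · rintro ⟨ι, κ, _, _, F, hF, rfl⟩
    have hD := DF_isDAlg (p := p) m
    refine (QF.fex hD (fun i x => ∀ j, x ∈ F i j) fun i =>
      QF.fall hD (fun j x => x ∈ F i j) fun j => ?_).of_eq (by ext; simp)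
    rcases hF i j with ⟨f, hf, e⟩ | ⟨f, n, hf, hn, e⟩
    · exact (QF.zero f hf).of_eq e.symm
    · exact (QF.pow f hf n hn).of_eq e.symm

end dalg

section restricted
variable {p : ℕ} [hp : Fact p.Prime] {σ : Type}

theorem Zp_summable {ι : Type*} {f : ι → ℤ_[p]} (h : Tendsto f cofinite (nhds 0)) : Summable f :=
  NonarchimedeanAddGroup.summable_of_tendsto_cofinite_zero h

theorem Zp_tendsto {ι : Type*} {l : Filter ι} {f : ι → ℤ_[p]}
    (h : ∀ n : ℕ, ∀ᶠ i in l, (p : ℤ_[p]) ^ n ∣ f i) : Tendsto f l (nhds 0) := by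
  rw [Metric.tendsto_nhds]
  intro ε hε
  obtain ⟨n, hn⟩ := exists_normpow_lt (p := p) hε
  filter_upwards [h n] with i hi
  obtain ⟨c, hc⟩ := hi
  rw [dist_zero_right, hc, norm_mul]
  refine lt_of_le_of_lt (mul_le_of_le_one_right (norm_nonneg _) c.norm_le_one) ?_
  simpa [norm_def] using hn

theorem Zp_eventually_dvd {ι : Type*} {l : Filter ι} {f : ι → ℤ_[p]}
    (h : Tendsto f l (nhds 0)) (n : ℕ) : ∀ᶠ i in l, (p : ℤ_[p]) ^ n ∣ f i := by
  rw [Metric.tendsto_nhds] at h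
  filter_upwards [h _ (normpow_pos (p := p) n)] with i hi
  rw [dist_zero_right, Padic.norm_p_pow] at hi
  exact Ideal.mem_span_singleton.1 ((norm_le_pow_iff_mem_span_pow _ n).1 hi.le)

theorem Zp_ext {x y : ℤ_[p]} (h : ∀ n : ℕ, (p : ℤ_[p]) ^ n ∣ x - y) : x = y := by
  have h1 : Tendsto (fun _ : ℕ => x - y) atTop (nhds 0) :=
    Zp_tendsto fun n => Eventually.of_forall fun _ => h n
  exact sub_eq_zero.1 (tendsto_nhds_unique tendsto_const_nhds h1)

theorem Zp_dvd_tsum {ι : Type*} {f : ι → ℤ_[p]} {a : ℤ_[p]} (hf : HasSum f a) (n : ℕ)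
    (h : ∀ i, (p : ℤ_[p]) ^ n ∣ f i) : (p : ℤ_[p]) ^ n ∣ a := by
  choose g hg using h
  have hn0 : (p : ℤ_[p]) ^ n ≠ 0 := pow_ne_zero _ (by exact_mod_cast hp.1.ne_zero)
  have h2 : ‖a‖ ≤ (p : ℝ) ^ (-n : ℤ) := by
    have hc : IsClosed {z : ℤ_[p] | ‖z‖ ≤ (p : ℝ) ^ (-n : ℤ)} :=
      isClosed_le continuous_norm continuous_const
    refine hc.mem_of_tendsto hf (Eventually.of_forall fun s => ?_)
    change ‖∑ i ∈ s, f i‖ ≤ _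
    rw [sum_congr rfl fun i _ => hg i, ← mul_sum, norm_mul, PadicInt.norm_p_pow]
    exact mul_le_of_le_one_right (by positivity) (norm_le_one _)
  exact Ideal.mem_span_singleton.1 ((norm_le_pow_iff_mem_span_pow _ n).1 h2)

/-- restricted power series over `ℤ_p` -/
def Rsub (p : ℕ) [Fact p.Prime] (σ : Type) : Subring (MvPowerSeries σ ℤ_[p]) where
  carrier := {f | ∀ n : ℕ, ∃ (P : MvPolynomial σ ℤ_[p]) (h : MvPowerSeries σ ℤ_[p]),
    f = P + (p : MvPowerSeries σ ℤ_[p]) ^ n * h}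
  mul_mem' {f g} hf hg n := by
    obtain ⟨P, h, rfl⟩ := hf n
    obtain ⟨Q, k, rfl⟩ := hg n
    exact ⟨P * Q, P * k + h * Q + p ^ n * h * k, by push_cast; ring⟩
  one_mem' n := ⟨1, 0, by simp⟩
  add_mem' {f g} hf hg n := by
    obtain ⟨P, h, rfl⟩ := hf n
    obtain ⟨Q, k, rfl⟩ := hg n
    exact ⟨P + Q, h + k, by push_cast; ring⟩
  zero_mem' n := ⟨0, 0, by simp⟩
  neg_mem' {f} hf n := by
    obtain ⟨P, h, rfl⟩ := hf n
    refine ⟨-P, -h, ?_⟩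
    have : ((-P : MvPolynomial σ ℤ_[p]) : MvPowerSeries σ ℤ_[p]) = -(P : MvPowerSeries σ ℤ_[p]) :=
      map_neg MvPolynomial.coeToMvPowerSeries.ringHom P
    rw [this]; ring

theorem coeff_pmul (n : ℕ) (h : MvPowerSeries σ ℤ_[p]) (i : σ →₀ ℕ) :
    coeff i ((p : MvPowerSeries σ ℤ_[p]) ^ n * h) =
      (p : ℤ_[p]) ^ n * coeff i h := by
  have : (p : MvPowerSeries σ ℤ_[p]) ^ n = MvPowerSeries.C ((p : ℤ_[p]) ^ n) := by simp
  rw [this, MvPowerSeries.coeff_C_mul]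

theorem mem_Rsub_iff {f : MvPowerSeries σ ℤ_[p]} :
    f ∈ Rsub p σ ↔ Tendsto (fun i => coeff i f) cofinite (nhds 0) := by
  classical
  constructor
  · intro hf
    refine Zp_tendsto fun n => ?_
    obtain ⟨P, h, e⟩ := hf n
    refine (P.support.finite_toSet).subset ?_
    intro i hi
    by_contra hP
    apply hi
    simp only [Finset.mem_coe, MvPolynomial.mem_support_iff, not_not] at hP
    change (p : ℤ_[p]) ^ n ∣ coeff i f
    rw [e, map_add, MvPolynomial.coeff_coe, hP, zero_add, coeff_pmul]
    exact ⟨_, rfl⟩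
  · intro h n
    have h1 := Zp_eventually_dvd h n
    have hfin : {i : σ →₀ ℕ | ¬ (p : ℤ_[p]) ^ n ∣ coeff i f}.Finite := h1
    have hd : ∀ i, ∃ c, (p : ℤ_[p]) ^ n ∣ coeff i f →
      coeff i f = (p : ℤ_[p]) ^ n * c := by
      intro i
      by_cases hi : (p : ℤ_[p]) ^ n ∣ coeff i f
      · obtain ⟨c, hc⟩ := hi; exact ⟨c, fun _ => hc⟩
      · exact ⟨0, fun h => absurd h hi⟩
    choose c hc using hd
    let g : MvPowerSeries σ ℤ_[p] :=
      fun i => if (p : ℤ_[p]) ^ n ∣ coeff i f then c i else 0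
    refine ⟨∑ i ∈ hfin.toFinset, MvPolynomial.monomial i (coeff i f), g, ?_⟩
    ext i
    rw [map_add, coeff_pmul, MvPolynomial.coeff_coe, MvPolynomial.coeff_sum]
    simp only [MvPolynomial.coeff_monomial, Finset.sum_ite_eq', Set.Finite.mem_toFinset]
    have e2 : coeff i g =
      if (p : ℤ_[p]) ^ n ∣ coeff i f then c i else 0 := rfl
    rw [e2]
    by_cases hi : (p : ℤ_[p]) ^ n ∣ coeff i f
    · rw [if_neg (by simpa using hi), if_pos hi, zero_add]; exact hc i hi
    · rw [if_pos (by simpa using hi), if_neg hi]; simp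

/-- the polynomials -/
noncomputable def polyR (P : MvPolynomial σ ℤ_[p]) : Rsub p σ := ⟨P, fun n => ⟨P, 0, by simp⟩⟩

theorem Rsub_natp (n : ℕ) : (((p : Rsub p σ) ^ n : Rsub p σ) : MvPowerSeries σ ℤ_[p])
    = (p : MvPowerSeries σ ℤ_[p]) ^ n := by simp

theorem Rsub_p_ne (n : ℕ) : ((p : MvPowerSeries σ ℤ_[p]) ^ n) ≠ 0 := by
  intro h
  have := congrArg (coeff 0) h
  have e : (p : MvPowerSeries σ ℤ_[p]) ^ n = (p : MvPowerSeries σ ℤ_[p]) ^ n * 1 := by simp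
  rw [e, coeff_pmul] at this
  simp [hp.1.ne_zero] at this

theorem coe_dvd_iff {n : ℕ} {f : Rsub p σ} :
    (p : Rsub p σ) ^ n ∣ f ↔ ∀ i, (p : ℤ_[p]) ^ n ∣ coeff i f.1 := by
  constructor
  · rintro ⟨g, rfl⟩ i
    rw [Subring.coe_mul, Rsub_natp, coeff_pmul]; exact ⟨_, rfl⟩
  · intro h
    choose c hc using h
    let g : MvPowerSeries σ ℤ_[p] := fun i => c i
    have hg : ∀ i, coeff i g = c i := fun _ => rfl
    refine ⟨⟨g, ?_⟩, ?_⟩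
    · rw [mem_Rsub_iff]
      simp only [hg]
      have h1 := mem_Rsub_iff.1 f.2
      refine Zp_tendsto fun k => ?_
      filter_upwards [Zp_eventually_dvd h1 (n + k)] with i hi
      have hi' : (p : ℤ_[p]) ^ (n + k) ∣ (p : ℤ_[p]) ^ n * c i := by rw [← hc i]; exact hi
      rw [pow_add] at hi'
      exact (mul_dvd_mul_iff_left (pow_ne_zero n (by exact_mod_cast hp.1.ne_zero))).1 hi'
    · apply Subtype.ext
      ext i
      rw [Subring.coe_mul, Rsub_natp, coeff_pmul, hg]
      exact hc i

theorem Rsub_cancel {n : ℕ} {f g : Rsub p σ} (h : (p : Rsub p σ) ^ n * f = (p : Rsub p σ) ^ n * g) :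
    f = g := by
  have h1 := congrArg Subtype.val h
  rw [Subring.coe_mul, Subring.coe_mul, Rsub_natp] at h1
  exact Subtype.ext (mul_left_cancel₀ (Rsub_p_ne n) h1)

theorem Rsub_sep {f : Rsub p σ} (h : ∀ n : ℕ, (p : Rsub p σ) ^ n ∣ f) : f = 0 := by
  apply Subtype.ext
  ext i
  refine Zp_ext fun n => ?_
  simpa using coe_dvd_iff.1 (h n) i

theorem Rsub_approx (f : Rsub p σ) (n : ℕ) :
    ∃ (P : MvPolynomial σ ℤ_[p]) (h : Rsub p σ), f = polyR P + (p : Rsub p σ) ^ n * h := by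
  obtain ⟨P, h, e⟩ := f.2 n
  have : (p : Rsub p σ) ^ n ∣ f - polyR P := by
    rw [coe_dvd_iff]; intro i
    have : (f - polyR P : Rsub p σ).1 = (p : MvPowerSeries σ ℤ_[p]) ^ n * h := by
      change f.1 - (P : MvPowerSeries σ ℤ_[p]) = _
      rw [e]; ring
    rw [this, coeff_pmul]; exact ⟨_, rfl⟩
  obtain ⟨g, hg⟩ := this
  exact ⟨P, g, by rw [← hg]; ring⟩

/-- null sequences -/
def Null {R : Type*} [CommRing R] (p : ℕ) (c : ℕ → R) : Prop :=
  ∀ n : ℕ, ∃ N, ∀ i, N ≤ i → (p : R) ^ n ∣ c i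

/-- p-adic convergence of a series -/
def PSum {R : Type*} [CommRing R] (p : ℕ) (c : ℕ → R) (F : R) : Prop :=
  ∀ n : ℕ, ∃ N, ∀ k, N ≤ k → (p : R) ^ n ∣ F - ∑ i ∈ range k, c i

theorem Rsub_complete (c : ℕ → Rsub p σ) (hc : Null p c) : ∃ F, PSum p c F := by
  have hs : ∀ i, Summable fun k => coeff i (c k).1 := by
    intro i
    refine Zp_summable (Zp_tendsto fun n => ?_)
    rw [Nat.cofinite_eq_atTop]
    obtain ⟨N, hN⟩ := hc n
    filter_upwards [eventually_ge_atTop N] with k hk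
    exact coe_dvd_iff.1 (hN k hk) i
  let F : MvPowerSeries σ ℤ_[p] := fun i => ∑' k, coeff i (c k).1
  have hF : ∀ i, coeff i F = ∑' k, coeff i (c k).1 := fun i => rfl
  have key : ∀ n, ∃ N, ∀ k, N ≤ k → ∀ i, (p : ℤ_[p]) ^ n ∣
      coeff i (F - (∑ j ∈ range k, c j : Rsub p σ).1) := by
    intro n
    obtain ⟨N, hN⟩ := hc n
    refine ⟨N, fun k hk i => ?_⟩
    have e : coeff i (∑ j ∈ range k, c j : Rsub p σ).1 =
      ∑ j ∈ range k, coeff i (c j).1 := by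
      rw [AddSubmonoidClass.coe_finsetSum, map_sum]
    rw [map_sub, e, hF, ← (hs i).sum_add_tsum_nat_add k, add_sub_cancel_left]
    exact Zp_dvd_tsum ((summable_nat_add_iff k).2 (hs i)).hasSum n fun j =>
      coe_dvd_iff.1 (hN _ (by omega)) i
  have hFm : F ∈ Rsub p σ := by
    rw [mem_Rsub_iff]
    refine Zp_tendsto fun n => ?_
    obtain ⟨N, hN⟩ := key n
    filter_upwards [Zp_eventually_dvd (mem_Rsub_iff.1 (∑ j ∈ range N, c j : Rsub p σ).2) n]
      with i hi
    have := dvd_add (hN N le_rfl i) hi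
    rwa [map_sub, sub_add_cancel] at this
  refine ⟨⟨F, hFm⟩, fun n => ?_⟩
  obtain ⟨N, hN⟩ := key n
  exact ⟨N, fun k hk => coe_dvd_iff.2 fun i => hN k hk i⟩

/-- evaluation -/
noncomputable def evFun (x : σ → ℤ_[p]) (f : MvPowerSeries σ ℤ_[p]) : ℤ_[p] :=
  ∑' i : σ →₀ ℕ, coeff i f * i.prod fun s k => x s ^ k

theorem ev_summable (x : σ → ℤ_[p]) (f : Rsub p σ) :
    Summable fun i : σ →₀ ℕ => coeff i f.1 * i.prod fun s k => x s ^ k := by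
  refine Zp_summable (Zp_tendsto fun n => ?_)
  filter_upwards [Zp_eventually_dvd (mem_Rsub_iff.1 f.2) n] with i hi
  exact Dvd.dvd.mul_right hi _

theorem evFun_add (x : σ → ℤ_[p]) (f g : Rsub p σ) :
    evFun x (f.1 + g.1) = evFun x f.1 + evFun x g.1 := by
  unfold evFun
  rw [← (ev_summable x f).tsum_add (ev_summable x g)]
  congr 1; ext i; rw [map_add]; rw [add_mul]

theorem evFun_poly (x : σ → ℤ_[p]) (P : MvPolynomial σ ℤ_[p]) :
    evFun x (P : MvPowerSeries σ ℤ_[p]) = eval x P := by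
  unfold evFun
  rw [MvPolynomial.eval_eq, tsum_eq_sum (s := P.support)]
  · rfl
  · intro i hi
    rw [MvPolynomial.coeff_coe, MvPolynomial.notMem_support_iff.1 hi, zero_mul]

theorem evFun_p (x : σ → ℤ_[p]) (n : ℕ) (f : Rsub p σ) :
    evFun x ((p : MvPowerSeries σ ℤ_[p]) ^ n * f.1) = (p : ℤ_[p]) ^ n * evFun x f.1 := by
  unfold evFun
  rw [← (ev_summable x f).tsum_mul_left]
  congr 1; ext i; rw [coeff_pmul, mul_assoc]

theorem evFun_approx (x : σ → ℤ_[p]) (n : ℕ) (P : MvPolynomial σ ℤ_[p]) (h : Rsub p σ) :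
    evFun x (polyR P + (p : Rsub p σ) ^ n * h).1 = eval x P +
      (p : ℤ_[p]) ^ n * evFun x h.1 := by
  have e := evFun_add x (polyR P) ((p : Rsub p σ) ^ n * h)
  have e3 : evFun x (polyR P).1 = eval x P := evFun_poly x P
  have e2 : evFun x ((p : Rsub p σ) ^ n * h).1 = (p : ℤ_[p]) ^ n * evFun x h.1 := by
    rw [Subring.coe_mul, Rsub_natp]; exact evFun_p x n h
  rw [e3, e2] at e
  exact e

theorem polyR_mul (P Q : MvPolynomial σ ℤ_[p]) : polyR (P * Q) = polyR P * polyR Q :=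
  Subtype.ext (by simp [polyR])

theorem polyR_add (P Q : MvPolynomial σ ℤ_[p]) : polyR (P + Q) = polyR P + polyR Q :=
  Subtype.ext (by simp [polyR])

theorem polyR_one : polyR (1 : MvPolynomial σ ℤ_[p]) = 1 := Subtype.ext (by simp [polyR])

theorem polyR_zero : polyR (0 : MvPolynomial σ ℤ_[p]) = 0 := Subtype.ext (by simp [polyR])

/-- polynomials as a ring hom -/
noncomputable def polyRh : MvPolynomial σ ℤ_[p] →+* Rsub p σ where
  toFun := polyR
  map_one' := polyR_one
  map_zero' := polyR_zero
  map_mul' := polyR_mul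
  map_add' := polyR_add

noncomputable def ev (x : σ → ℤ_[p]) : Rsub p σ →+* ℤ_[p] where
  toFun f := evFun x f.1
  map_one' := by
    have : ((1 : Rsub p σ) : MvPowerSeries σ ℤ_[p]) = ((1 : MvPolynomial σ ℤ_[p]) :) := by simp
    rw [this, evFun_poly]; simp
  map_zero' := by
    have : ((0 : Rsub p σ) : MvPowerSeries σ ℤ_[p]) = ((0 : MvPolynomial σ ℤ_[p]) :) := by simp
    rw [this, evFun_poly]; simp
  map_add' f g := evFun_add x f g
  map_mul' f g := by
    refine Zp_ext fun n => ?_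
    obtain ⟨P, h, rfl⟩ := Rsub_approx f n
    obtain ⟨Q, k, rfl⟩ := Rsub_approx g n
    have e : (polyR P + (p : Rsub p σ) ^ n * h) * (polyR Q + (p : Rsub p σ) ^ n * k) =
        polyR (P * Q) + (p : Rsub p σ) ^ n * (polyR P * k + h * polyR Q +
          (p : Rsub p σ) ^ n * h * k) := by
      rw [polyR_mul]; ring
    rw [e, evFun_approx, evFun_approx, evFun_approx, map_mul]
    refine ⟨evFun x (polyR P * k + h * polyR Q + (p : Rsub p σ) ^ n * h * k).1
        - eval x P * evFun x k.1 - evFun x h.1 * eval x Q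
        - (p : ℤ_[p]) ^ n * evFun x h.1 * evFun x k.1, ?_⟩
    ring

theorem ev_poly (x : σ → ℤ_[p]) (P : MvPolynomial σ ℤ_[p]) :
    ev x (polyR P) = eval x P := evFun_poly x P

theorem ev_dvd (x : σ → ℤ_[p]) {n : ℕ} {f : Rsub p σ} (h : (p : Rsub p σ) ^ n ∣ f) :
    (p : ℤ_[p]) ^ n ∣ ev x f := by
  have := map_dvd (ev x) h; simpa using this

theorem Null.hasSum {c : ℕ → ℤ_[p]} {a : ℤ_[p]} (h : PSum p c a) (hc : Null p c) :
    HasSum c a := by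
  have hs : Summable c := by
    refine Zp_summable (Zp_tendsto fun n => ?_)
    rw [Nat.cofinite_eq_atTop]
    obtain ⟨N, hN⟩ := hc n
    filter_upwards [eventually_ge_atTop N] with k hk using hN k hk
  have h1 : Tendsto (fun k => a - ∑ i ∈ range k, c i) atTop (nhds 0) :=
    Zp_tendsto fun n => by
      obtain ⟨N, hN⟩ := h n
      filter_upwards [eventually_ge_atTop N] with k hk using hN k hk
  have h2 := hs.hasSum.tendsto_sum_nat
  have h3 : Tendsto (fun k => ∑ i ∈ range k, c i) atTop (nhds a) := by
    simpa using (tendsto_const_nhds (x := a)).sub h1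
  rw [tendsto_nhds_unique h3 h2]; exact hs.hasSum

theorem Null.evNull {c : ℕ → Rsub p σ} (hc : Null p c) (x : σ → ℤ_[p]) :
    Null p fun i => ev x (c i) := fun n => by
  obtain ⟨N, hN⟩ := hc n
  exact ⟨N, fun i hi => ev_dvd x (hN i hi)⟩

theorem PSum.ev_hasSum {c : ℕ → Rsub p σ} (hc : Null p c) {F : Rsub p σ} (hF : PSum p c F)
    (x : σ → ℤ_[p]) : HasSum (fun i => ev x (c i)) (ev x F) := by
  refine Null.hasSum (fun n => ?_) (hc.evNull x)
  obtain ⟨N, hN⟩ := hF n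
  refine ⟨N, fun k hk => ?_⟩
  have := ev_dvd x (hN k hk)
  simpa using this

end restricted

section series
variable {p : ℕ} [hp : Fact p.Prime] {σ τ : Type}

theorem hs_congr {ι : Type*} {f g : ι → ℤ_[p]} {a b : ℤ_[p]} (h : HasSum f a)
    (hf : ∀ i, g i = f i) (ha : b = a) : HasSum g b := by
  have : g = f := funext hf
  rw [this, ha]; exact h

theorem Rsub_series (f : Rsub p σ) : ∃ P : ℕ → MvPolynomial σ ℤ_[p],
    PSum p (fun n => (p : Rsub p σ) ^ n * polyR (P n)) f := by
  choose P h hP using fun f : Rsub p σ => Rsub_approx f 1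
  let r : ℕ → Rsub p σ := fun n => h^[n] f
  have hr : ∀ k, f = ∑ i ∈ range k, (p : Rsub p σ) ^ i * polyR (P (r i)) +
      (p : Rsub p σ) ^ k * r k := by
    intro k
    induction k with
    | zero => simp [r]
    | succ k ih =>
      rw [sum_range_succ]
      have e : r k = polyR (P (r k)) + (p : Rsub p σ) ^ 1 * r (k + 1) := by
        have := hP (r k)
        simp only [r, Function.iterate_succ_apply'] at this ⊢
        exact this
      have e2 : (p : Rsub p σ) ^ k * r k = (p : Rsub p σ) ^ k * polyR (P (r k)) +
          (p : Rsub p σ) ^ (k + 1) * r (k + 1) := by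
        conv_lhs => rw [e]
        ring
      rw [add_assoc, ← e2]; exact ih
  refine ⟨fun i => P (r i), fun n => ⟨n, fun k hk => ?_⟩⟩
  have := hr k
  refine (pow_dvd_pow _ hk).trans ⟨r k, ?_⟩
  rw [sub_eq_iff_eq_add, add_comm]; exact this

theorem Null_pow_mul {R : Type*} [CommRing R] {n : ℕ → ℕ} (hn : Tendsto n atTop atTop) (e : ℕ → R) :
    Null p fun k => (p : R) ^ n k * e k := fun m => by
  obtain ⟨N, hN⟩ := eventually_atTop.1 (hn.eventually_ge_atTop m)
  exact ⟨N, fun i hi => ((pow_dvd_pow _ (hN i hi)).mul_right _)⟩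

/-- a uniform lower bound of divisibility tending to infinity -/
theorem Null_exp {D : ℕ → ℕ → Prop} (h0 : ∀ i, D 0 i)
    (h : ∀ n, ∃ N, ∀ i, N ≤ i → D n i) :
    ∃ m : ℕ → ℕ, Tendsto m atTop atTop ∧ ∀ i, D (m i) i := by
  classical
  refine ⟨fun i => Nat.findGreatest (fun n => D n i) i, ?_, fun i => ?_⟩
  · refine tendsto_atTop.2 fun n => ?_
    obtain ⟨N, hN⟩ := h n
    filter_upwards [eventually_ge_atTop N, eventually_ge_atTop n] with i hi hi'
    exact Nat.le_findGreatest hi' (hN i hi)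
  · exact Nat.findGreatest_spec (P := fun n => D n i) (Nat.zero_le i) (h0 i)

theorem Null.factor {R : Type*} [CommRing R] {c : ℕ → R} (hc : Null p c) :
    ∃ (n : ℕ → ℕ) (e : ℕ → R), Tendsto n atTop atTop ∧ ∀ k, c k = (p : R) ^ n k * e k := by
  obtain ⟨m, hm, h⟩ := Null_exp (D := fun n i => (p : R) ^ n ∣ c i) (by simp) hc
  choose e he using h
  exact ⟨m, e, hm, he⟩

theorem exists_subst (G : σ → Rsub p τ) (F : Rsub p σ) :
    ∃ F' : Rsub p τ, ∀ y, ev y F' = ev (fun i => ev y (G i)) F := by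
  obtain ⟨P, hP⟩ := Rsub_series F
  let L : MvPolynomial σ ℤ_[p] →+* Rsub p τ :=
    MvPolynomial.eval₂Hom (polyRh.comp MvPolynomial.C) G
  have hL : ∀ y Q, ev y (L Q) = eval (fun i => ev y (G i)) Q := by
    intro y Q
    have : (ev y).comp L = eval (fun i => ev y (G i)) := by
      apply MvPolynomial.ringHom_ext
      · intro r; simp [L, polyRh, ev_poly]
      · intro i; simp [L]
    exact congrArg (fun f => f Q) this
  have hn : Null p fun n => (p : Rsub p τ) ^ n * L (P n) := Null_pow_mul tendsto_id _
  obtain ⟨F', hF'⟩ := Rsub_complete _ hn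
  refine ⟨F', fun y => ?_⟩
  have h1 := hF'.ev_hasSum hn y
  have h2 := hP.ev_hasSum (Null_pow_mul tendsto_id _) (fun i => ev y (G i))
  have : (fun n => ev y ((p : Rsub p τ) ^ n * L (P n))) = fun n =>
    ev (fun i => ev y (G i)) ((p : Rsub p σ) ^ n * polyR (P n)) := by
    ext1 n; simp [hL, ev_poly]
  rw [this] at h1
  exact h1.unique h2

/-- a polynomial variable -/
noncomputable def RX (i : σ) : Rsub p σ := polyR (MvPolynomial.X i)

@[simp] theorem ev_RX (x : σ → ℤ_[p]) (i : σ) : ev x (RX i) = x i := by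
  simp [RX, ev_poly]

theorem exists_rename (r : σ → τ) (F : Rsub p σ) :
    ∃ F' : Rsub p τ, ∀ y, ev y F' = ev (fun i => y (r i)) F := by
  obtain ⟨F', h⟩ := exists_subst (fun i => RX (p := p) (r i)) F
  exact ⟨F', fun y => by simpa using h y⟩

theorem Null.subst {c : ℕ → Rsub p σ} (hc : Null p c) (G : σ → Rsub p τ) :
    ∃ c' : ℕ → Rsub p τ, Null p c' ∧ ∀ y k, ev y (c' k) = ev (fun i => ev y (G i)) (c k) := by
  obtain ⟨n, e, hn, he⟩ := hc.factor
  choose e' he' using fun k => exists_subst G (e k)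
  refine ⟨fun k => (p : Rsub p τ) ^ n k * e' k, Null_pow_mul hn _, fun y k => ?_⟩
  rw [he]; simp [he']

theorem Null.rename {c : ℕ → Rsub p σ} (hc : Null p c) (r : σ → τ) :
    ∃ c' : ℕ → Rsub p τ, Null p c' ∧ ∀ y k, ev y (c' k) = ev (fun i => y (r i)) (c k) := by
  obtain ⟨c', h1, h⟩ := hc.subst (fun i => RX (p := p) (r i))
  exact ⟨c', h1, fun y => by simpa using h y⟩

/-- extend a point by one coordinate -/
def ext1 {α : Type*} (x : σ → α) (t : α) : Option σ → α := fun o => o.elim t x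

theorem Null.mul_right {R : Type*} [CommRing R] {c : ℕ → R} (hc : Null p c) (e : ℕ → R) :
    Null p fun k => c k * e k := fun n => by
  obtain ⟨N, hN⟩ := hc n
  exact ⟨N, fun i hi => (hN i hi).mul_right _⟩

theorem Null.summable {c : ℕ → ℤ_[p]} (hc : Null p c) : Summable c := by
  refine Zp_summable (Zp_tendsto fun n => ?_)
  rw [Nat.cofinite_eq_atTop]
  obtain ⟨N, hN⟩ := hc n
  filter_upwards [eventually_ge_atTop N] with k hk using hN k hk

theorem Null.toSeries {c : ℕ → Rsub p σ} (hc : Null p c) :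
    ∃ F : Rsub p (Option σ), ∀ x t, HasSum (fun k => ev x (c k) * t ^ k) (ev (ext1 x t) F) := by
  obtain ⟨c', h1, h2⟩ := hc.rename (fun i => some i)
  have h3 : Null p fun k => c' k * RX (p := p) (none : Option σ) ^ k := h1.mul_right _
  obtain ⟨F, hF⟩ := Rsub_complete _ h3
  refine ⟨F, fun x t => ?_⟩
  have := hF.ev_hasSum h3 (ext1 x t)
  simp only [map_mul, h2, map_pow, ev_RX] at this
  exact this

/-- families of series depending on `i` -/
theorem Null.toSeries_family {c : ℕ → ℕ → Rsub p σ} (hc : ∀ i, Null p (c i))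
    (hu : ∀ n, ∃ N, ∀ i, N ≤ i → ∀ k, (p : Rsub p σ) ^ n ∣ c i k) :
    ∃ F : ℕ → Rsub p (Option σ), Null p F ∧
      ∀ i x t, HasSum (fun k => ev x (c i k) * t ^ k) (ev (ext1 x t) (F i)) := by
  obtain ⟨m, hm, h⟩ := Null_exp (D := fun n i => ∀ k, (p : Rsub p σ) ^ n ∣ c i k) (by simp) hu
  choose e he using h
  have hen : ∀ i, Null p (e i) := by
    intro i n
    obtain ⟨N, hN⟩ := hc i (m i + n)
    refine ⟨N, fun k hk => ?_⟩
    obtain ⟨d, hd⟩ := hN k hk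
    refine ⟨d, Rsub_cancel (n := m i) ?_⟩
    rw [← he, hd]; ring
  choose F hF using fun i => (hen i).toSeries
  refine ⟨fun i => (p : Rsub p (Option σ)) ^ m i * F i, Null_pow_mul hm _, fun i x t => ?_⟩
  have := (hF i x t).mul_left ((p : ℤ_[p]) ^ m i)
  simp only [map_mul, map_pow, map_natCast]
  refine hs_congr this (fun k => ?_) rfl
  rw [he]; simp [mul_assoc]

theorem exists_Tcoeff (F : Rsub p (Option σ)) :
    ∃ c : ℕ → Rsub p σ, Null p c ∧
      ∀ x t, HasSum (fun k => ev x (c k) * t ^ k) (ev (ext1 x t) F) := by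
  let g : ℕ → MvPowerSeries σ ℤ_[p] := fun k i => coeff (i.optionElim k) F.1
  have hg : ∀ k i, coeff i (g k) = coeff (i.optionElim k) F.1 :=
    fun _ _ => rfl
  have hF := mem_Rsub_iff.1 F.2
  have hinj : ∀ k, Function.Injective fun i : σ →₀ ℕ => i.optionElim k := by
    intro k i j hij
    have := congrArg Finsupp.some hij
    simpa using this
  have hgm : ∀ k, g k ∈ Rsub p σ := by
    intro k
    rw [mem_Rsub_iff]
    simp only [hg]
    exact hF.comp (hinj k).tendsto_cofinite
  refine ⟨fun k => ⟨g k, hgm k⟩, fun n => ?_, fun x t => ?_⟩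
  · have hfin : {i : Option σ →₀ ℕ | ¬ (p : ℤ_[p]) ^ n ∣ coeff i F.1}.Finite :=
      Zp_eventually_dvd hF n
    obtain ⟨N, hN⟩ := (hfin.image fun i => i none).bddAbove
    refine ⟨N + 1, fun k hk => coe_dvd_iff.2 fun i => ?_⟩
    by_contra hcon
    have := hN ⟨i.optionElim k, by simpa [hg] using hcon, rfl⟩
    simp at this; omega
  · have h1 := (ev_summable (ext1 x t) F).hasSum
    have h2 := (Finsupp.optionEquiv (α := σ) (M := ℕ)).symm.hasSum_iff.2 h1
    have h3 := h2.prod_fiberwise (g := fun k => ev x ⟨g k, hgm k⟩ * t ^ k) ?_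
    · exact h3
    · intro k
      have h4 := ((ev_summable x ⟨g k, hgm k⟩).hasSum).mul_right (t ^ k)
      refine hs_congr h4 (fun i => ?_) rfl
      simp only [Function.comp]
      have e : (Finsupp.optionEquiv (α := σ) (M := ℕ)).symm (k, i) = i.optionElim k := rfl
      rw [e, hg, Finsupp.prod_option_index]
      · simp [ext1]; ring
      · simp
      · intro o a b; exact pow_add _ _ _

/-- doubly null -/
def Null2 {R : Type*} [CommRing R] (p : ℕ) (c : ℕ → ℕ → R) : Prop :=
  ∀ n : ℕ, ∃ N, ∀ i j, N ≤ i + j → (p : R) ^ n ∣ c i j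

theorem Null2.summable {c : ℕ → ℕ → ℤ_[p]} (hc : Null2 p c) :
    Summable fun q : ℕ × ℕ => c q.1 q.2 := by
  refine Zp_summable (Zp_tendsto fun n => ?_)
  obtain ⟨N, hN⟩ := hc n
  refine ((range N ×ˢ range N).finite_toSet).subset ?_
  rintro ⟨i, j⟩ hij
  by_contra hcon
  apply hij
  simp at hcon
  refine hN i j ?_
  by_contra h
  have := hcon (by omega); omega

theorem exists_Tcoeff2 (F : Rsub p (Option (Option σ))) :
    ∃ c : ℕ → ℕ → Rsub p σ, Null2 p c ∧
      ∀ x s t, HasSum (fun q : ℕ × ℕ => ev x (c q.1 q.2) * s ^ q.2 * t ^ q.1)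
        (ev (ext1 (ext1 x s) t) F) := by
  obtain ⟨c, hc, h⟩ := exists_Tcoeff F
  obtain ⟨n, e, hn, he⟩ := hc.factor
  choose d hd hd2 using fun k => exists_Tcoeff (e k)
  have hN2 : Null2 p fun k j => (p : Rsub p σ) ^ n k * d k j := by
    intro m
    obtain ⟨N, hN⟩ := eventually_atTop.1 (hn.eventually_ge_atTop m)
    choose M hM using fun k => hd k m
    refine ⟨N + ∑ k ∈ range N, M k, fun k j hkj => ?_⟩
    by_cases hk : N ≤ k
    · exact (pow_dvd_pow _ (hN k hk)).mul_right _
    · refine (hM k j ?_).mul_left _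
      have : M k ≤ ∑ k ∈ range N, M k :=
        Finset.single_le_sum (f := M) (fun _ _ => Nat.zero_le _) (mem_range.2 (by omega))
      omega
  refine ⟨_, hN2, fun x s t => ?_⟩
  have hs : Summable fun q : ℕ × ℕ => ev x ((p : Rsub p σ) ^ n q.1 * d q.1 q.2) * s ^ q.2 * t ^ q.1 := by
    refine Null2.summable (c := fun k j => ev x ((p : Rsub p σ) ^ n k * d k j) * s ^ j * t ^ k) ?_
    intro m
    obtain ⟨N, hN⟩ := hN2 m
    exact ⟨N, fun i j hij => ((ev_dvd x (hN i j hij)).mul_right _).mul_right _⟩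
  have h2 := hs.hasSum.prod_fiberwise (g := fun k => ev (ext1 x s) (c k) * t ^ k) ?_
  · rw [(h (ext1 x s) t).unique h2]; exact hs.hasSum
  · intro k
    have := ((hd2 k x s).mul_left ((p : ℤ_[p]) ^ n k)).mul_right (t ^ k)
    refine hs_congr this (fun j => ?_) ?_
    · simp [mul_assoc]
    · rw [he]; simp

/-- splitting of a series in `u,v` on `u v = δ` -/
theorem exists_split (F : Rsub p (Option (Option σ))) :
    ∃ c d : ℕ → Rsub p (Option σ), Null p c ∧ Null p d ∧ ∀ x u v, ∃ A B : ℤ_[p],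
      HasSum (fun k => ev (ext1 x (u * v)) (c k) * u ^ k) A ∧
      HasSum (fun k => ev (ext1 x (u * v)) (d k) * v ^ (k + 1)) B ∧
      ev (ext1 (ext1 x u) v) F = A + B := by
  obtain ⟨f, hf, h⟩ := exists_Tcoeff2 F
  obtain ⟨c, hc, hc2⟩ := Null.toSeries_family (c := fun i k => f k (k + i))
    (fun i n => by obtain ⟨N, hN⟩ := hf n; exact ⟨N, fun k hk => hN _ _ (by omega)⟩)
    (fun n => by obtain ⟨N, hN⟩ := hf n; exact ⟨N, fun i hi k => hN _ _ (by omega)⟩)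
  obtain ⟨d, hd, hd2⟩ := Null.toSeries_family (c := fun i k => f (k + i + 1) k)
    (fun i n => by obtain ⟨N, hN⟩ := hf n; exact ⟨N, fun k hk => hN _ _ (by omega)⟩)
    (fun n => by obtain ⟨N, hN⟩ := hf n; exact ⟨N, fun i hi k => hN _ _ (by omega)⟩)
  refine ⟨c, d, hc, hd, fun x u v => ?_⟩
  have hs := (h x u v)
  set a : ℕ × ℕ → ℤ_[p] := fun q => ev x (f q.1 q.2) * u ^ q.2 * v ^ q.1 with ha
  have sub2 : ∀ (φ : ℕ × ℕ → ℕ × ℕ), (∀ q, q.1 + q.2 ≤ (φ q).1 + (φ q).2) → Summable (a ∘ φ) := by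
    intro φ hφ
    refine Null2.summable (c := fun i j => a (φ (i, j))) fun n => ?_
    obtain ⟨N, hN⟩ := hf n
    exact ⟨N, fun i j hij => ((ev_dvd x (hN _ _ (hij.trans (hφ (i, j))))).mul_right _).mul_right _⟩
  let φ : ℕ × ℕ → ℕ × ℕ := fun q => (q.2, q.2 + q.1)
  let ψ : ℕ × ℕ → ℕ × ℕ := fun q => (q.2 + q.1 + 1, q.2)
  have hφ := sub2 φ (fun q => by simp only [φ]; omega)
  have hψ := sub2 ψ (fun q => by simp only [ψ]; omega)
  have iφ : Function.Injective φ := by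
    rintro ⟨a, b⟩ ⟨c, d⟩ h; simp only [φ, Prod.mk.injEq] at h ⊢; omega
  have iψ : Function.Injective ψ := by
    rintro ⟨a, b⟩ ⟨c, d⟩ h; simp only [ψ, Prod.mk.injEq] at h ⊢; omega
  have h1 := hφ.hasSum.prod_fiberwise (g := fun k => ev (ext1 x (u * v)) (c k) * u ^ k) (by
    intro k
    refine hs_congr ((hc2 k x (u * v)).mul_right (u ^ k)) (fun j => ?_) rfl
    simp only [ha, φ, Function.comp, mul_pow, pow_add]; ring)
  have h2 := hψ.hasSum.prod_fiberwise (g := fun k => ev (ext1 x (u * v)) (d k) * v ^ (k + 1)) (by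
    intro k
    refine hs_congr ((hd2 k x (u * v)).mul_right (v ^ (k + 1))) (fun j => ?_) rfl
    simp only [ha, ψ, Function.comp, mul_pow, pow_add]; ring)
  refine ⟨_, _, h1, h2, ?_⟩
  have h3 : HasSum (fun q : ℕ × ℕ => if q.1 ≤ q.2 then a q else 0) (∑' q, (a ∘ φ) q) := by
    refine (iφ.hasSum_iff ?_).1 ?_
    · rintro ⟨i, j⟩ hq
      refine if_neg fun hij => hq ⟨(j - i, i), ?_⟩
      simp only [φ, Prod.mk.injEq, true_and] at hij ⊢; omega
    · refine hs_congr hφ.hasSum (fun q => ?_) rfl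
      simp [φ]
  have h4 : HasSum (fun q : ℕ × ℕ => if q.1 ≤ q.2 then 0 else a q) (∑' q, (a ∘ ψ) q) := by
    refine (iψ.hasSum_iff ?_).1 ?_
    · rintro ⟨i, j⟩ hq
      refine if_pos ?_
      by_contra hij
      refine hq ⟨(i - j - 1, j), ?_⟩
      simp only [ψ, Prod.mk.injEq, and_true] at hij ⊢; omega
    · refine hs_congr hψ.hasSum (fun q => ?_) rfl
      have : ¬ (ψ q).1 ≤ (ψ q).2 := by simp only [ψ]; omega
      simp [this]
  have h5 := h3.add h4
  refine hs.unique ?_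
  refine hs_congr h5 (fun q => ?_) rfl
  by_cases hq : q.1 ≤ q.2 <;> simp [hq, ha]

end series

section lemN
variable {p : ℕ} [hp : Fact p.Prime] {σ τ : Type}

theorem quot_noeth [Finite σ] :
    IsNoetherianRing (Rsub p σ ⧸ Ideal.span {(p : Rsub p σ)}) := by
  let q := Ideal.Quotient.mk (Ideal.span {(p : Rsub p σ)})
  refine isNoetherianRing_of_surjective (MvPolynomial σ ℤ_[p]) _ (q.comp polyRh) ?_
  intro y
  obtain ⟨f, rfl⟩ := Ideal.Quotient.mk_surjective y
  obtain ⟨P, h, e⟩ := Rsub_approx f 1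
  refine ⟨P, ?_⟩
  change q (polyR P) = _
  refine Ideal.Quotient.eq.2 (Ideal.mem_span_singleton.2 ⟨-h, ?_⟩)
  rw [e]; ring

theorem PSum.eq_of {R : Type*} [CommRing R] (hsep : ∀ f : R, (∀ n : ℕ, (p : R) ^ n ∣ f) → f = 0)
    {c : ℕ → R} {F G : R} (h1 : PSum p c F) (h2 : PSum p c G) : F = G := by
  refine sub_eq_zero.1 (hsep _ fun n => ?_)
  obtain ⟨N, hN⟩ := h1 n
  obtain ⟨M, hM⟩ := h2 n
  have := dvd_sub (hN (max N M) (le_max_left _ _)) (hM (max N M) (le_max_right _ _))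
  simpa using this

theorem PSum.mul_right {R : Type*} [CommRing R] {c : ℕ → R} {F : R} (h : PSum p c F) (e : R) :
    PSum p (fun k => c k * e) (F * e) := fun n => by
  obtain ⟨N, hN⟩ := h n
  refine ⟨N, fun k hk => ?_⟩
  rw [← Finset.sum_mul, ← sub_mul]; exact (hN k hk).mul_right _

theorem PSum.sum {R ι : Type*} [CommRing R] (s : Finset ι) {c : ι → ℕ → R} {F : ι → R}
    (h : ∀ i, PSum p (c i) (F i)) : PSum p (fun k => ∑ i ∈ s, c i k) (∑ i ∈ s, F i) := fun n => by
  choose N hN using fun i => h i n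
  refine ⟨∑ i ∈ s, N i, fun k hk => ?_⟩
  rw [Finset.sum_comm, ← Finset.sum_sub_distrib]
  exact Finset.dvd_sum fun i hi => hN i k
    ((Finset.single_le_sum (f := N) (fun _ _ => Nat.zero_le _) hi).trans hk)

/-- the saturated ideal is generated by finitely many elements -/
theorem sat_fg [Finite σ] (I : Ideal (Rsub p σ)) (hI : ∀ f, (p : Rsub p σ) * f ∈ I → f ∈ I) :
    ∃ (n : ℕ) (e : Fin n → Rsub p σ), (∀ l, e l ∈ I) ∧ ∀ f ∈ I, ∃ a : Fin n → Rsub p σ,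
      f = ∑ l, a l * e l := by
  classical
  let q := Ideal.Quotient.mk (Ideal.span {(p : Rsub p σ)})
  have := quot_noeth (p := p) (σ := σ)
  obtain ⟨S, hS⟩ := (I.map q).fg_of_isNoetherianRing
  have hl : ∀ s : S, ∃ f ∈ I, q f = s := by
    intro s
    have : (s : Rsub p σ ⧸ Ideal.span {(p : Rsub p σ)}) ∈ I.map q := by
      rw [← hS]; exact Ideal.subset_span s.2
    exact (Ideal.mem_map_iff_of_surjective q Ideal.Quotient.mk_surjective).1 this
  choose e0 he0 he1 using hl
  let ε := S.equivFin
  let e : Fin S.card → Rsub p σ := fun l => e0 (ε.symm l)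
  have step : ∀ f : I, ∃ (a : Fin S.card → Rsub p σ) (g : I), (f : Rsub p σ) = ∑ l, a l * e l + p * g := by
    rintro ⟨f, hf⟩
    have h1 : q f ∈ Ideal.span (Set.range fun l => q (e l)) := by
      have : q f ∈ I.map q := Ideal.mem_map_of_mem q hf
      rw [← hS] at this
      refine Ideal.span_mono ?_ this
      intro s hs
      exact ⟨ε ⟨s, hs⟩, by simp [e, he1]⟩
    obtain ⟨c, hc⟩ := Ideal.mem_span_range_iff_exists_fun.1 h1
    choose a ha using fun l => Ideal.Quotient.mk_surjective (c l)
    have h2 : q (f - ∑ l, a l * e l) = 0 := by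
      rw [map_sub, map_sum, ← hc, sub_eq_zero]
      refine sum_congr rfl fun l _ => ?_
      rw [map_mul, ← ha l]
    obtain ⟨g, hg⟩ := Ideal.mem_span_singleton.1 (Ideal.Quotient.eq_zero_iff_mem.1 h2)
    refine ⟨a, ⟨g, hI _ ?_⟩, ?_⟩
    · rw [← hg]
      exact I.sub_mem hf (I.sum_mem fun l _ => I.mul_mem_left _ (he0 _))
    · change f = _ + p * g
      rw [← hg]; ring
  choose A G hAG using step
  refine ⟨S.card, e, fun l => he0 _, fun f hf => ?_⟩
  let r : ℕ → I := fun n => G^[n] ⟨f, hf⟩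
  have hr : ∀ n, f = ∑ i ∈ range n, ∑ l, (p : Rsub p σ) ^ i * A (r i) l * e l +
      (p : Rsub p σ) ^ n * r n := by
    intro n
    induction n with
    | zero => simp [r]
    | succ k ih =>
      rw [sum_range_succ]
      have e1 : (r k : Rsub p σ) = ∑ l, A (r k) l * e l + p * r (k + 1) := by
        have := hAG (r k)
        simp only [r, Function.iterate_succ_apply'] at this ⊢
        exact this
      have e2 : (p : Rsub p σ) ^ k * r k = ∑ l, (p : Rsub p σ) ^ k * A (r k) l * e l +
          (p : Rsub p σ) ^ (k + 1) * r (k + 1) := by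
        conv_lhs => rw [e1]
        rw [mul_add, mul_sum]
        simp only [mul_assoc, pow_succ]
      rw [add_assoc, ← e2]; exact ih
  have hn : ∀ l, Null p fun i => (p : Rsub p σ) ^ i * A (r i) l := fun l =>
    Null_pow_mul tendsto_id _
  choose B hB using fun l => Rsub_complete _ (hn l)
  refine ⟨B, PSum.eq_of (p := p) (c := fun i => ∑ l, (p : Rsub p σ) ^ i * A (r i) l * e l)
    (fun f hf => Rsub_sep hf) ?_ (PSum.sum _ fun l => (hB l).mul_right (e l))⟩
  intro n
  refine ⟨n, fun k hk => ?_⟩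
  refine (pow_dvd_pow _ hk).trans ⟨r k, ?_⟩
  rw [sub_eq_iff_eq_add, add_comm]; exact hr k

theorem lemmaN [Finite σ] {c : ℕ → Rsub p σ} (hc : Null p c) (K : ℕ) :
    ∃ (D : ℕ) (b : ℕ → ℕ → Rsub p σ), (∀ j, Null p fun k => b k j) ∧
      ∀ k, D < k → c k = ∑ j ∈ range (D + 1), (p : Rsub p σ) ^ K * b k j * c j := by
  classical
  let J : ℕ → Ideal (Rsub p σ) := fun n => Ideal.span (Set.range fun j : Fin n => c j)
  have hJm : Monotone J := by
    intro a b hab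
    refine Ideal.span_mono ?_
    rintro _ ⟨j, rfl⟩
    exact ⟨⟨j, j.2.trans_le hab⟩, rfl⟩
  let I : Ideal (Rsub p σ) :=
    { carrier := {f | ∃ n, (p : Rsub p σ) ^ n * f ∈ J n}
      add_mem' := by
        rintro f g ⟨n, hn⟩ ⟨m, hm⟩
        refine ⟨n + m, ?_⟩
        have h1 := (J (n + m)).mul_mem_left ((p : Rsub p σ) ^ m) (hJm (Nat.le_add_right n m) hn)
        have h2 := (J (n + m)).mul_mem_left ((p : Rsub p σ) ^ n) (hJm (Nat.le_add_left m n) hm)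
        have := (J (n + m)).add_mem h1 h2
        convert this using 1
        ring
      zero_mem' := ⟨0, by simp⟩
      smul_mem' := by
        rintro r f ⟨n, hn⟩
        refine ⟨n, ?_⟩
        convert (J n).mul_mem_left r hn using 1
        simp only [smul_eq_mul]; ring }
  have hI : ∀ f, (p : Rsub p σ) * f ∈ I → f ∈ I := by
    rintro f ⟨n, hn⟩
    refine ⟨n + 1, hJm (Nat.le_succ n) ?_⟩
    convert hn using 1
    ring
  have hcI : ∀ k, c k ∈ I := fun k => ⟨k + 1, (J _).mul_mem_left _
    (Ideal.subset_span ⟨⟨k, Nat.lt_succ_self k⟩, rfl⟩)⟩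
  obtain ⟨N, e, he, hfe⟩ := sat_fg I hI
  choose m hm using he
  let M := ∑ l, m l
  have hM : ∀ l, m l ≤ M := fun l =>
    Finset.single_le_sum (f := m) (fun _ _ => Nat.zero_le _) (Finset.mem_univ l)
  have hMf : ∀ f ∈ I, (p : Rsub p σ) ^ M * f ∈ J M := by
    intro f hf
    obtain ⟨a, rfl⟩ := hfe f hf
    rw [mul_sum]
    refine (J M).sum_mem fun l _ => ?_
    have h1 := hJm (hM l) (hm l)
    have h2 := (J M).mul_mem_left ((p : Rsub p σ) ^ (M - m l) * a l) h1
    convert h2 using 1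
    rw [show M = (M - m l) + m l by have := hM l; omega, pow_add]
    simp only [Nat.add_sub_cancel]
    ring
  obtain ⟨N0, hN0⟩ := hc (M + K)
  obtain ⟨n, hn, hnd⟩ := Null_exp (D := fun n i => i < N0 ∨ (p : Rsub p σ) ^ (M + K + n) ∣ c i)
    (fun i => by
      by_cases h : i < N0
      · exact Or.inl h
      · exact Or.inr (by simpa using hN0 i (by omega)))
    (fun n => by
      obtain ⟨N, hN⟩ := hc (M + K + n)
      exact ⟨N, fun i hi => Or.inr (hN i hi)⟩)
  have hex : ∀ k, ∃ b : ℕ → Rsub p σ, N0 ≤ k → c k =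
      ∑ j ∈ range M, (p : Rsub p σ) ^ K * ((p : Rsub p σ) ^ n k * b j) * c j := by
    intro k
    by_cases hk : k < N0
    · exact ⟨0, fun h => absurd h (by omega)⟩
    obtain ⟨f, hf⟩ := (hnd k).resolve_left hk
    have hfI : ∀ (s : ℕ) (f : Rsub p σ), (p : Rsub p σ) ^ s * f ∈ I → f ∈ I := by
      intro s
      induction s with
      | zero => intro f h; simpa using h
      | succ s ih => intro f h; exact hI _ (ih _ (by convert h using 1; ring))
    have h1 := hMf f (hfI (M + K + n k) f (hf ▸ hcI k))
    obtain ⟨a, ha⟩ := Ideal.mem_span_range_iff_exists_fun.1 h1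
    refine ⟨fun j => if h : j < M then a ⟨j, h⟩ else 0, fun _ => ?_⟩
    rw [Finset.sum_range (fun j => (p : Rsub p σ) ^ K * ((p : Rsub p σ) ^ n k *
      (if h : j < M then a ⟨j, h⟩ else 0)) * c j), hf]
    calc _ = (p : Rsub p σ) ^ (K + n k) * ((p : Rsub p σ) ^ M * f) := by ring
      _ = _ := by
        rw [← ha, mul_sum]
        refine sum_congr rfl fun j _ => ?_
        rw [dif_pos j.2]; ring
  choose b hb using hex
  refine ⟨M + N0, fun k j => if j < M then (p : Rsub p σ) ^ n k * b k j else 0, fun j => ?_,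
    fun k hk => ?_⟩
  · by_cases hj : j < M
    · simp only [hj, if_true]; exact Null_pow_mul hn _
    · simp only [hj, if_false]; exact fun n => ⟨0, by simp⟩
  · rw [hb k (by omega)]
    refine Finset.sum_subset_zero_on_sdiff (fun j hj => ?_) (fun j hj => ?_) (fun j hj => ?_)
    · simp at hj ⊢; omega
    · simp at hj; simp [hj]
    · simp only [if_pos (mem_range.1 hj)]

/-- Taylor expansion of values -/
theorem taylor_sum {a : ℕ → ℤ_[p]} (ha : Null p a) (t s : ℤ_[p]) :
    HasSum (fun i => (∑' k, ((k + i).choose i : ℤ_[p]) * a (k + i) * t ^ k) * s ^ i)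
      (∑' k, a k * (t + s) ^ k) := by
  let f : ℕ × ℕ → ℤ_[p] := fun q => (q.1.choose q.2 : ℤ_[p]) * a q.1 * t ^ (q.1 - q.2) * s ^ q.2
  have hs : Summable f := by
    refine Zp_summable (Zp_tendsto fun n => ?_)
    obtain ⟨N, hN⟩ := ha n
    refine ((range N ×ˢ range N).finite_toSet).subset ?_
    rintro ⟨k, i⟩ hq
    by_contra hcon
    apply hq
    change (p : ℤ_[p]) ^ n ∣ f (k, i)
    simp only [Finset.coe_product, Finset.coe_range, Set.mem_prod, Set.mem_Iio, not_and, not_lt]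
      at hcon
    by_cases hk : N ≤ k
    · exact (((hN k hk).mul_left _).mul_right _).mul_right _
    · have : k.choose i = 0 := Nat.choose_eq_zero_of_lt (by have := hcon (by omega); omega)
      simp [f, this]
  have h1 := hs.hasSum.prod_fiberwise (g := fun k => a k * (t + s) ^ k) (by
    intro k
    have e : a k * (t + s) ^ k = ∑ i ∈ range (k + 1), f (k, i) := by
      rw [add_comm t s, add_pow, mul_sum]
      refine sum_congr rfl fun i _ => ?_
      simp only [f]; ring
    rw [e]
    refine hasSum_sum_of_ne_finset_zero fun i hi => ?_
    have : k.choose i = 0 := Nat.choose_eq_zero_of_lt (by simpa [Nat.lt_succ_iff] using hi)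
    simp [f, this])
  rw [h1.tsum_eq]
  have h2 := (Equiv.prodComm ℕ ℕ).hasSum_iff.2 hs.hasSum
  refine h2.prod_fiberwise (fun i => ?_)
  have hn : Null p fun k => ((k + i).choose i : ℤ_[p]) * a (k + i) * t ^ k := by
    intro n
    obtain ⟨N, hN⟩ := ha n
    exact ⟨N, fun k hk => ((hN _ (by omega)).mul_left _).mul_right _⟩
  have h3 := hn.summable.hasSum.mul_right (s ^ i)
  refine ((add_left_injective i).hasSum_iff ?_).1 (hs_congr h3 (fun k => ?_) rfl)
  · intro k hk
    have : k < i := by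
      by_contra h
      exact hk ⟨k - i, by simp; omega⟩
    simp [f, Nat.choose_eq_zero_of_lt this]
  · simp [f]

theorem exists_taylor {c : ℕ → Rsub p σ} (hc : Null p c) :
    ∃ F : ℕ → Rsub p (Option σ), Null p F ∧
      ∀ i x t, HasSum (fun k => ((k + i).choose i : ℤ_[p]) * ev x (c (k + i)) * t ^ k)
        (ev (ext1 x t) (F i)) := by
  obtain ⟨F, hF, h⟩ := Null.toSeries_family (c := fun i k => ((k + i).choose i : Rsub p σ) * c (k + i))
    (fun i n => by obtain ⟨N, hN⟩ := hc n; exact ⟨N, fun k hk => (hN _ (by omega)).mul_left _⟩)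
    (fun n => by obtain ⟨N, hN⟩ := hc n; exact ⟨N, fun i hi k => (hN _ (by omega)).mul_left _⟩)
  refine ⟨F, hF, fun i x t => ?_⟩
  simpa using h i x t

theorem taylor_hasSum {c : ℕ → Rsub p σ} (hc : Null p c) {F : ℕ → Rsub p (Option σ)}
    (hF : ∀ i x t, HasSum (fun k => ((k + i).choose i : ℤ_[p]) * ev x (c (k + i)) * t ^ k)
        (ev (ext1 x t) (F i))) (x : σ → ℤ_[p]) (t s : ℤ_[p]) :
    HasSum (fun i => ev (ext1 x t) (F i) * s ^ i) (∑' k, ev x (c k) * (t + s) ^ k) := by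
  have := taylor_sum (hc.evNull x) t s
  simp only [(hF _ x t).tsum_eq] at this
  exact this

/-- fixed point of `r = a + p ∑ b_k r^k` -/
theorem exists_root (a : Rsub p σ) {b : ℕ → Rsub p σ} (hb : Null p b) :
    ∃ ρ : Rsub p σ, ∀ x, HasSum (fun k => (p : ℤ_[p]) * (ev x (b k) * ev x ρ ^ k)) (ev x ρ - ev x a) := by
  choose S hS using fun r : Rsub p σ => Rsub_complete _ (hb.mul_right (fun k => r ^ k))
  have hlip : ∀ (m : ℕ) (r r' : Rsub p σ), (p : Rsub p σ) ^ m ∣ r - r' →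
      (p : Rsub p σ) ^ m ∣ S r - S r' := by
    intro m r r' h
    obtain ⟨N, hN⟩ := hS r m
    obtain ⟨N', hN'⟩ := hS r' m
    have h1 := hN (max N N') (le_max_left _ _)
    have h2 := hN' (max N N') (le_max_right _ _)
    have h3 : (p : Rsub p σ) ^ m ∣ ∑ i ∈ range (max N N'), b i * r ^ i -
        ∑ i ∈ range (max N N'), b i * r' ^ i := by
      rw [← Finset.sum_sub_distrib]
      refine Finset.dvd_sum fun i _ => ?_
      rw [← mul_sub]
      exact (h.trans (sub_dvd_pow_sub_pow r r' i)).mul_left _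
    have := dvd_add (dvd_sub h1 h2) h3
    convert this using 1
    ring
  let Φ : Rsub p σ → Rsub p σ := fun r => a + p * S r
  let r : ℕ → Rsub p σ := fun n => Φ^[n] 0
  have hrs : ∀ n, r (n + 1) = Φ (r n) := fun n => Function.iterate_succ_apply' _ _ _
  have hd : ∀ n, (p : Rsub p σ) ^ n ∣ r (n + 1) - r n := by
    intro n
    induction n with
    | zero => simp
    | succ n ih =>
      obtain ⟨q, hq⟩ := hlip n _ _ ih
      refine ⟨q, ?_⟩
      rw [hrs (n + 1), hrs n]
      rw [hrs n] at hq
      simp only [Φ] at hq ⊢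
      calc _ = p * (S (a + p * S (r n)) - S (r n)) := by ring
        _ = _ := by rw [hq]; ring
  have hn : Null p fun n => r (n + 1) - r n := fun m => ⟨m, fun i hi =>
    (pow_dvd_pow _ hi).trans (hd i)⟩
  obtain ⟨ρ, hρ⟩ := Rsub_complete _ hn
  have hρr : ∀ m, ∃ N, (p : Rsub p σ) ^ m ∣ ρ - r N ∧ (p : Rsub p σ) ^ m ∣ ρ - r (N + 1) := by
    intro m
    obtain ⟨N, hN⟩ := hρ m
    have h0 : r 0 = 0 := rfl
    have hk : ∀ k, N ≤ k → (p : Rsub p σ) ^ m ∣ ρ - r k := by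
      intro k hk
      have := hN k hk
      rwa [Finset.sum_range_sub, h0, sub_zero] at this
    exact ⟨N, hk N le_rfl, hk (N + 1) (by omega)⟩
  have hfix : ρ = a + p * S ρ := by
    refine sub_eq_zero.1 (Rsub_sep fun m => ?_)
    obtain ⟨N, h1, h2⟩ := hρr m
    have h3 := (hlip m _ _ h1).mul_left (p : Rsub p σ)
    have := dvd_sub h2 h3
    convert this using 1
    rw [hrs]; simp only [Φ]; ring
  refine ⟨ρ, fun x => ?_⟩
  have h1 := ((hS ρ).ev_hasSum (hb.mul_right _) x).mul_left (p : ℤ_[p])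
  refine hs_congr h1 (fun k => by simp) ?_
  have := congrArg (ev x) hfix
  simp only [map_add, map_mul, map_natCast] at this
  rw [this];
  conv_lhs => rw [add_sub_cancel_left]

end lemN

section an
variable {p : ℕ} [hp : Fact p.Prime] {Ω : Type*}

/-- truncation to `ℤ_p` -/
noncomputable def toZ (x : ℚ_[p]) : ℤ_[p] := if h : ‖x‖ ≤ 1 then ⟨x, h⟩ else 0

theorem toZ_coe {x : ℚ_[p]} (h : ‖x‖ ≤ 1) : ((toZ x : ℤ_[p]) : ℚ_[p]) = x := by
  simp [toZ, h]

@[simp] theorem coe_toZ (x : ℤ_[p]) : toZ (x : ℚ_[p]) = x := by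
  apply Subtype.ext; exact toZ_coe x.2

theorem toZ_mul {x y : ℚ_[p]} (hx : ‖x‖ ≤ 1) (hy : ‖y‖ ≤ 1) : toZ (x * y) = toZ x * toZ y := by
  have : x * y = ((toZ x * toZ y : ℤ_[p]) : ℚ_[p]) := by
    rw [coe_mul, toZ_coe hx, toZ_coe hy]
  rw [this, coe_toZ]

theorem ev_eq_fin {m : ℕ} (x : Fin m → ℤ_[p]) (F : Rsub p (Fin m)) :
    ((ev x F : ℤ_[p]) : ℚ_[p]) = ranalFn p (fun i : Fin m → ℕ =>
      ((coeff (equivFunOnFinite.symm i) F.1 : ℤ_[p]) : ℚ_[p]))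
      (fun j => (x j : ℚ_[p])) := by
  unfold ranalFn
  rw [if_pos (fun j => (x j).2)]
  have h := (ev_summable x F).hasSum
  have h2 : HasSum (fun i : Fin m →₀ ℕ => ((coeff i F.1 *
      i.prod fun s k => x s ^ k : ℤ_[p]) : ℚ_[p])) ((ev x F : ℤ_[p]) : ℚ_[p]) := by
    exact h.map (PadicInt.Coe.ringHom (p := p)) continuous_subtype_val
  rw [← h2.tsum_eq, ← equivFunOnFinite.symm.tsum_eq]
  congr 1; ext i
  rw [Finsupp.prod_fintype _ _ (by simp), coe_mul]
  congr 1
  exact map_prod (PadicInt.Coe.ringHom (p := p)) _ _ |>.trans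
    (Finset.prod_congr rfl fun j _ => by
      simp only [map_pow]; rfl)

theorem coeffs_restricted {m : ℕ} (F : Rsub p (Fin m)) :
    IsRestrictedCoeffs p (fun i : Fin m → ℕ =>
      ((coeff (equivFunOnFinite.symm i) F.1 : ℤ_[p]) : ℚ_[p])) := by
  have h := mem_Rsub_iff.1 F.2
  have h2 : Tendsto (fun x : ℤ_[p] => (x : ℚ_[p])) (nhds 0) (nhds 0) := by
    have : Continuous (fun x : ℤ_[p] => (x : ℚ_[p])) := continuous_subtype_val
    simpa using this.tendsto 0
  exact (h2.comp h).comp (equivFunOnFinite.symm.injective.tendsto_cofinite)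

theorem IsDAlg.ev {𝒟 : Set (Ω → ℚ_[p])} (h : IsDAlg 𝒟) {σ : Type} [Finite σ] (F : Rsub p σ)
    (g : σ → Ω → ℤ_[p]) (hg : ∀ i, (fun ω => (g i ω : ℚ_[p])) ∈ 𝒟) :
    (fun ω => ((PadicSub.ev (fun i => g i ω) F : ℤ_[p]) : ℚ_[p])) ∈ 𝒟 := by
  obtain ⟨n, ⟨e⟩⟩ := Finite.exists_equiv_fin σ
  obtain ⟨F', hF'⟩ := exists_rename e F
  have h1 := h.ranal _ (coeffs_restricted F') (fun i ω => (g (e.symm i) ω : ℚ_[p]))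
    (fun i => hg _)
  have : (fun ω => ((PadicSub.ev (fun i => g i ω) F : ℤ_[p]) : ℚ_[p])) = fun ω =>
     ranalFn p (fun i : Fin n → ℕ =>
      ((coeff (equivFunOnFinite.symm i) F'.1 : ℤ_[p]) : ℚ_[p]))
      (fun i => (g (e.symm i) ω : ℚ_[p])) := by
    ext ω
    rw [← ev_eq_fin (fun i => g (e.symm i) ω) F', hF']
    simp
  rw [this]; exact h1

theorem restricted_scale {m : ℕ} {a : (Fin m → ℕ) → ℚ_[p]} (ha : IsRestrictedCoeffs p a) :
    ∃ (c : ℕ) (F : Rsub p (Fin m)), ∀ x : Fin m → ℤ_[p],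
      ((ev x F : ℤ_[p]) : ℚ_[p]) = (p : ℚ_[p]) ^ c * ranalFn p a (fun i => (x i : ℚ_[p])) := by
  have hb : ∃ c : ℕ, ∀ i, ‖(p : ℚ_[p]) ^ c * a i‖ ≤ 1 := by
    have h1 : ∀ᶠ i in cofinite, ‖a i‖ < 1 := by
      have := (tendsto_zero_iff_norm_tendsto_zero.1 ha)
      exact this.eventually (gt_mem_nhds one_pos)
    have hfin : {i | ¬ ‖a i‖ < 1}.Finite := h1
    obtain ⟨B, hB⟩ := (hfin.image (fun i => ‖a i‖)).bddAbove
    obtain ⟨c, hc⟩ := exists_normpow_lt (p := p) (ε := (max B 1)⁻¹) (by positivity)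
    refine ⟨c, fun i => ?_⟩
    rw [norm_mul]
    have hai : ‖a i‖ ≤ max B 1 := by
      by_cases hi : ‖a i‖ < 1
      · exact le_max_of_le_right hi.le
      · exact le_max_of_le_left (hB ⟨i, hi, rfl⟩)
    calc _ ≤ (max B 1)⁻¹ * max B 1 := by gcongr
      _ = 1 := inv_mul_cancel₀ (by positivity)
  obtain ⟨c, hc⟩ := hb
  let g : MvPowerSeries (Fin m) ℤ_[p] := fun i => ⟨(p : ℚ_[p]) ^ c * a i, hc i⟩
  have hg : ∀ i, ((coeff i g : ℤ_[p]) : ℚ_[p]) = (p : ℚ_[p]) ^ c * a i := fun _ => rfl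
  have hgm : g ∈ Rsub p (Fin m) := by
    rw [mem_Rsub_iff]
    rw [tendsto_zero_iff_norm_tendsto_zero]
    have h1 : Tendsto (fun i => ‖(p : ℚ_[p]) ^ c * a i‖) cofinite (nhds 0) := by
      have := (ha.const_mul ((p : ℚ_[p]) ^ c)).norm
      simpa using this
    exact h1.comp (DFunLike.coe_injective.tendsto_cofinite)
  refine ⟨c, ⟨g, hgm⟩, fun x => ?_⟩
  rw [ev_eq_fin]
  unfold ranalFn
  rw [if_pos (fun j => (x j).2), if_pos (fun j => (x j).2), ← tsum_mul_left]
  congr 1; ext i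
  have := hg (equivFunOnFinite.symm i)
  simp only
  rw [this, mul_assoc]
  simp

/-- functions analytic in bounded generators from `𝒢`, on `Z` -/
def An (Z : Set Ω) (𝒢 : Set (Ω → ℚ_[p])) (f : Ω → ℚ_[p]) : Prop :=
  ∃ (σ : Type) (_ : Finite σ) (G : σ → Ω → ℚ_[p]) (F : Rsub p σ), (∀ i, G i ∈ 𝒢) ∧
    (∀ i, ∀ ω ∈ Z, ‖G i ω‖ ≤ 1) ∧ ∀ ω ∈ Z, f ω = ev (fun i => toZ (G i ω)) F

namespace An
variable {Z Z' : Set Ω} {𝒢 𝒢' : Set (Ω → ℚ_[p])} {f g : Ω → ℚ_[p]}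

theorem bdd (h : An Z 𝒢 f) {ω} (hω : ω ∈ Z) : ‖f ω‖ ≤ 1 := by
  obtain ⟨σ, _, G, F, _, _, h⟩ := h
  rw [h ω hω]; exact (ev _ F).2

theorem congr (h : An Z 𝒢 f) (e : ∀ ω ∈ Z, g ω = f ω) : An Z 𝒢 g := by
  obtain ⟨σ, hσ, G, F, h1, h2, h⟩ := h
  exact ⟨σ, hσ, G, F, h1, h2, fun ω hω => by rw [e ω hω, h ω hω]⟩

theorem gen (hg : g ∈ 𝒢) (hb : ∀ ω ∈ Z, ‖g ω‖ ≤ 1) : An Z 𝒢 g :=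
  ⟨Unit, inferInstance, fun _ => g, RX (), fun _ => hg, fun _ => hb, fun ω hω => by
    rw [ev_RX, toZ_coe (hb ω hω)]⟩

theorem comp {σ : Type} [Finite σ] (F : Rsub p σ) {f : σ → Ω → ℚ_[p]} (hf : ∀ i, An Z 𝒢 (f i)) :
    An Z 𝒢 (fun ω => ev (fun i => toZ (f i ω)) F) := by
  choose τ hτ G H h1 h2 h3 using hf
  choose H' hH' using fun i => exists_rename (fun j : τ i => (⟨i, j⟩ : Σ i, τ i)) (H i)
  obtain ⟨F', hF'⟩ := exists_subst H' F
  have := hτ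
  refine ⟨Σ i, τ i, inferInstance, fun s => G s.1 s.2, F', fun s => h1 _ _, fun s => h2 _ _, ?_⟩
  intro ω hω
  have e : (fun i => toZ (f i ω)) =
      fun i => ev (fun s : Σ i, τ i => toZ (G s.1 s.2 ω)) (H' i) := by
    ext1 i
    rw [hH', h3 i ω hω, coe_toZ]
  rw [hF']
  simp only [e]

theorem bind (h : An Z 𝒢 f) (hZ : Z' ⊆ Z)
    (hg : ∀ g ∈ 𝒢, (∀ ω ∈ Z, ‖g ω‖ ≤ 1) → An Z' 𝒢' g) : An Z' 𝒢' f := by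
  obtain ⟨σ, hσ, G, F, h1, h2, h⟩ := h
  refine (comp F (fun i => hg (G i) (h1 i) (h2 i))).congr fun ω hω => h ω (hZ hω)

theorem constZ (c : ℤ_[p]) : An Z 𝒢 (fun _ => (c : ℚ_[p])) :=
  ⟨Empty, inferInstance, fun i => i.elim, polyR (MvPolynomial.C c), fun i => i.elim,
    fun i => i.elim, fun ω _ => by rw [ev_poly]; simp⟩

theorem const {c : ℚ_[p]} (hc : ‖c‖ ≤ 1) : An Z 𝒢 (fun _ => c) :=
  (constZ (toZ c)).congr fun _ _ => by rw [toZ_coe hc]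

theorem poly {σ : Type} [Finite σ] (P : MvPolynomial σ ℤ_[p]) {f : σ → Ω → ℚ_[p]}
    (hf : ∀ i, An Z 𝒢 (f i)) {g : Ω → ℚ_[p]}
    (hg : ∀ ω, (∀ i, ‖f i ω‖ ≤ 1) → g ω = (eval (fun i => toZ (f i ω)) P : ℤ_[p])) :
    An Z 𝒢 g :=
  (comp (polyR P) hf).congr fun ω hω => by
    rw [ev_poly]; exact hg ω fun i => (hf i).bdd hω

theorem add (hf : An Z 𝒢 f) (hg : An Z 𝒢 g) : An Z 𝒢 (fun ω => f ω + g ω) :=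
  poly (σ := Bool) (MvPolynomial.X true + MvPolynomial.X false) (f := fun b => if b then f else g)
    (by intro b; cases b <;> simpa) (by
      intro ω h
      have h1 := h true; have h2 := h false
      simp only [if_true, Bool.false_eq_true, if_false] at h1 h2
      simp [toZ_coe h1, toZ_coe h2])

theorem mul (hf : An Z 𝒢 f) (hg : An Z 𝒢 g) : An Z 𝒢 (fun ω => f ω * g ω) :=
  poly (σ := Bool) (MvPolynomial.X true * MvPolynomial.X false) (f := fun b => if b then f else g)
    (by intro b; cases b <;> simpa) (by
      intro ω h
      have h1 := h true; have h2 := h false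
      simp only [if_true, Bool.false_eq_true, if_false] at h1 h2
      simp [toZ_coe h1, toZ_coe h2])

theorem neg (hf : An Z 𝒢 f) : An Z 𝒢 (fun ω => - f ω) :=
  ((const (c := -1) (by simp)).mul hf).congr fun ω _ => by simp

theorem pow (hf : An Z 𝒢 f) (n : ℕ) : An Z 𝒢 (fun ω => f ω ^ n) := by
  induction n with
  | zero => exact (const (c := 1) (by simp)).congr fun ω _ => by simp
  | succ n ih => exact (ih.mul hf).congr fun ω _ => by ring

theorem sum {ι : Type*} (s : Finset ι) {f : ι → Ω → ℚ_[p]} (hf : ∀ i ∈ s, An Z 𝒢 (f i)) :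
    An Z 𝒢 (fun ω => ∑ i ∈ s, f i ω) := by
  classical
  induction s using induction_on with
  | empty => exact (const (c := 0) (by simp)).congr fun ω _ => by simp
  | insert a s ha ih =>
    simp only [sum_insert ha]
    exact (hf a (by simp)).add (ih fun i hi => hf i (by simp [hi]))

theorem series {σ : Type} [Finite σ] {c : ℕ → Rsub p σ} (hc : Null p c) {G : σ → Ω → ℚ_[p]}
    (hG : ∀ i, An Z 𝒢 (G i)) {w : Ω → ℚ_[p]} (hw : An Z 𝒢 w) {φ : Ω → ℚ_[p]}
    (h : ∀ ω ∈ Z, ∃ a : ℤ_[p], φ ω = a ∧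
      HasSum (fun k => ev (fun i => toZ (G i ω)) (c k) * toZ (w ω) ^ k) a) : An Z 𝒢 φ := by
  obtain ⟨F, hF⟩ := hc.toSeries
  refine (comp F (f := fun o : Option σ => o.elim w G) (by rintro (_ | i) <;> simp [hw, hG])).congr ?_
  intro ω hω
  obtain ⟨a, e, ha⟩ := h ω hω
  rw [e, ha.unique (hF _ _)]
  congr 3; ext1 o; cases o <;> rfl

theorem inv1 (hf : An Z 𝒢 f) : An Z 𝒢 (fun ω => (1 + p * f ω)⁻¹) := by
  have hb : Null p (fun k => if k = 1 then - RX (p := p) () else 0) := fun n =>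
    ⟨2, fun i hi => by simp [show i ≠ 1 by omega]⟩
  obtain ⟨ρ, hρ⟩ := exists_root 1 hb
  refine (comp ρ (f := fun _ : Unit => f) (fun _ => hf)).congr fun ω hω => ?_
  have hfb := hf.bdd hω
  have h1 := hρ (fun _ => toZ (f ω))
  have h2 := hasSum_single (f := fun k => (p : ℤ_[p]) * (ev (fun _ => toZ (f ω))
    (if k = 1 then - RX (p := p) () else 0) * ev (fun _ => toZ (f ω)) ρ ^ k)) 1
    (by intro k hk; simp [hk])
  have h3 := h1.unique h2
  simp only [if_true, map_neg, ev_RX, map_one, pow_one] at h3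
  have h4 : (1 + p * f ω) * ((ev (fun _ : Unit => toZ (f ω)) ρ : ℤ_[p]) : ℚ_[p]) = 1 := by
    have := congrArg (fun z : ℤ_[p] => (z : ℚ_[p])) h3
    simp only [PadicInt.coe_sub, coe_mul, PadicInt.coe_neg, PadicInt.coe_one,
      PadicInt.coe_natCast, toZ_coe hfb] at this
    linear_combination this
  exact inv_eq_of_mul_eq_one_right h4

/-- one-variable form -/
theorem one_var {w : Ω → ℚ_[p]} (h : An Z (𝒢 ∪ {w}) f) :
    ∃ (σ : Type) (_ : Finite σ) (G : σ → Ω → ℚ_[p]) (c : ℕ → Rsub p σ), (∀ i, G i ∈ 𝒢) ∧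
    (∀ i, ∀ ω ∈ Z, ‖G i ω‖ ≤ 1) ∧ Null p c ∧
     ∀ ω ∈ Z, HasSum (fun k => ev (fun i => toZ (G i ω)) (c k) * toZ (w ω) ^ k) (toZ (f ω)) := by
  classical
  obtain ⟨σ, hσ, G, F, h1, h2, h⟩ := h
  let τ := {i : σ // G i ∈ 𝒢}
  obtain ⟨F', hF'⟩ := exists_rename (fun i : σ => if hi : G i ∈ 𝒢 then (some ⟨i, hi⟩ : Option τ) else none) F
  obtain ⟨c, hc, hc2⟩ := exists_Tcoeff F'
  refine ⟨τ, inferInstance, fun i => G i.1, c, fun i => i.2, fun i => h2 i.1, hc, fun ω hω => ?_⟩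
  have := hc2 (fun i : τ => toZ (G i.1 ω)) (toZ (w ω))
  rw [hF'] at this
  refine hs_congr this (fun _ => rfl) ?_
  rw [h ω hω, coe_toZ]
  congr 2; ext1 i
  by_cases hi : G i ∈ 𝒢
  · simp [hi, ext1]
  · have : G i = w := by simpa [hi] using h1 i
    rw [dif_neg hi, this]; rfl

/-- two-variable form -/
theorem two_var {u v δ : Ω → ℚ_[p]} (hu : ∀ ω ∈ Z, ‖u ω‖ ≤ 1) (hv : ∀ ω ∈ Z, ‖v ω‖ ≤ 1)
    (hδ : δ ∈ 𝒢) (hδ2 : ∀ ω ∈ Z, u ω * v ω = δ ω) (h : An Z (𝒢 ∪ {u, v}) f) :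
    ∃ (σ : Type) (_ : Finite σ) (G : σ → Ω → ℚ_[p]) (c d : ℕ → Rsub p σ), (∀ i, G i ∈ 𝒢) ∧
    (∀ i, ∀ ω ∈ Z, ‖G i ω‖ ≤ 1) ∧ Null p c ∧ Null p d ∧
     ∀ ω ∈ Z, ∃ A B : ℤ_[p], HasSum (fun k => ev (fun i => toZ (G i ω)) (c k) * toZ (u ω) ^ k) A ∧
      HasSum (fun k => ev (fun i => toZ (G i ω)) (d k) * toZ (v ω) ^ (k + 1)) B ∧
      f ω = A + B := by
  classical
  obtain ⟨σ, hσ, G, F, h1, h2, h⟩ := h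
  let τ := {i : σ // G i ∈ 𝒢}
  obtain ⟨F', hF'⟩ := exists_rename (fun i : σ => if hi : G i ∈ 𝒢 then
    (some (some ⟨i, hi⟩) : Option (Option τ)) else if G i = u then some none else none) F
  obtain ⟨c, d, hc, hd, hs⟩ := exists_split F'
  refine ⟨Option τ, inferInstance, fun o => o.elim δ (fun i => G i.1), c, d, ?_, ?_, hc, hd, ?_⟩
  · rintro (_ | i); exacts [hδ, i.2]
  · rintro (_ | i) ω hω
    · change ‖δ ω‖ ≤ 1
      rw [← hδ2 ω hω, norm_mul]; exact mul_le_one₀ (hu ω hω) (norm_nonneg _) (hv ω hω)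
    · exact h2 i.1 ω hω
  · intro ω hω
    obtain ⟨A, B, hA, hB, e⟩ := hs (fun i : τ => toZ (G i.1 ω)) (toZ (u ω)) (toZ (v ω))
    have e2 : (fun o : Option τ => toZ ((o.elim δ (fun i => G i.1) : Ω → ℚ_[p]) ω)) =
      ext1 (fun i : τ => toZ (G i.1 ω)) (toZ (u ω) * toZ (v ω)) := by
      ext1 o
      cases o with
      | none =>
        change toZ (δ ω) = toZ (u ω) * toZ (v ω)
        rw [← hδ2 ω hω, toZ_mul (hu ω hω) (hv ω hω)]
      | some i => rfl
    rw [e2]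
    refine ⟨A, B, hA, hB, ?_⟩
    rw [h ω hω, ← PadicInt.coe_add, ← e, hF']
    congr 3; ext1 i
    by_cases hi : G i ∈ 𝒢
    · simp [hi, ext1]
    · by_cases hi2 : G i = u
      · rw [dif_neg hi, if_pos hi2, hi2]; rfl
      · have : G i = v := by simpa [hi, hi2] using h1 i
        rw [dif_neg hi, if_neg hi2, this]; rfl

end An

/-- units `1 + p^K φ`, `φ` analytic -/
def U1 (Z : Set Ω) (𝒢 : Set (Ω → ℚ_[p])) (K : ℕ) (f : Ω → ℚ_[p]) : Prop :=
  ∃ φ, An Z 𝒢 φ ∧ ∀ ω ∈ Z, f ω = 1 + p ^ K * φ ω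

namespace U1
variable {Z Z' : Set Ω} {𝒢 𝒢' : Set (Ω → ℚ_[p])} {f g : Ω → ℚ_[p]} {K : ℕ}

theorem congr (h : U1 Z 𝒢 K f) (e : ∀ ω ∈ Z, g ω = f ω) : U1 Z 𝒢 K g := by
  obtain ⟨φ, h1, h2⟩ := h
  exact ⟨φ, h1, fun ω hω => by rw [e ω hω, h2 ω hω]⟩

theorem near (h : U1 Z 𝒢 K f) {ω} (hω : ω ∈ Z) : near1 K (f ω) := by
  obtain ⟨φ, h1, h2⟩ := h
  rw [near1, h2 ω hω, add_sub_cancel_left, norm_mul]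
  exact mul_le_of_le_one_right (norm_nonneg _) (h1.bdd hω)

theorem one : U1 Z 𝒢 K (fun _ => 1) := ⟨fun _ => 0, An.const (by simp), by simp⟩

theorem pp_bdd (n : ℕ) : ‖(p : ℚ_[p]) ^ n‖ ≤ 1 := normpow_le n

theorem toAn (h : U1 Z 𝒢 K f) : An Z 𝒢 f := by
  obtain ⟨φ, h1, h2⟩ := h
  exact ((An.const (c := 1) (by simp)).add ((An.const (c := (p : ℚ_[p]) ^ K) (pp_bdd K)).mul h1)).congr h2

theorem mul (hf : U1 Z 𝒢 K f) (hg : U1 Z 𝒢 K g) : U1 Z 𝒢 K (fun ω => f ω * g ω) := by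
  have hfA := hf.toAn
  obtain ⟨φ, h1, h2⟩ := hf
  obtain ⟨ψ, h3, h4⟩ := hg
  exact ⟨fun ω => φ ω + f ω * ψ ω, h1.add (hfA.mul h3), fun ω hω => by
    simp only; rw [h4 ω hω, mul_add, h2 ω hω]; ring⟩

theorem inv (hK : 1 ≤ K) (hf : U1 Z 𝒢 K f) : U1 Z 𝒢 K (fun ω => (f ω)⁻¹) := by
  have hnear := fun ω hω => (hf.near (ω := ω) hω).ne hK
  obtain ⟨φ, h1, h2⟩ := hf
  have h3 : An Z 𝒢 (fun ω => (f ω)⁻¹) := by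
    refine (((An.const (c := (p : ℚ_[p]) ^ (K - 1)) (pp_bdd _)).mul h1).inv1).congr fun ω hω => ?_
    rw [h2 ω hω, ← mul_assoc, ← pow_succ', Nat.sub_add_cancel hK]
  refine ⟨fun ω => - (φ ω * (f ω)⁻¹), (h1.mul h3).neg, fun ω hω => ?_⟩
  have := hnear ω hω
  simp only
  field_simp
  rw [h2 ω hω]; ring

theorem pow (hf : U1 Z 𝒢 K f) (n : ℕ) : U1 Z 𝒢 K (fun ω => f ω ^ n) := by
  induction n with
  | zero => exact one.congr fun ω _ => by simp
  | succ n ih => exact (ih.mul hf).congr fun ω _ => by ring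

theorem zpow (hK : 1 ≤ K) (hf : U1 Z 𝒢 K f) (n : ℤ) : U1 Z 𝒢 K (fun ω => f ω ^ n) := by
  cases n with
  | ofNat n => simpa using hf.pow n
  | negSucc n => simpa using (hf.pow (n + 1)).inv hK

theorem mono_K {L : ℕ} (h : U1 Z 𝒢 L f) (hL : K ≤ L) : U1 Z 𝒢 K f := by
  obtain ⟨φ, h1, h2⟩ := h
  refine ⟨fun ω => p ^ (L - K) * φ ω, (An.const (c := (p : ℚ_[p]) ^ (L - K)) (pp_bdd _)).mul h1,
    fun ω hω => ?_⟩
  rw [h2 ω hω, ← mul_assoc, ← pow_add, Nat.add_sub_cancel' hL]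

end U1
end an

section ext
variable {p : ℕ} [hp : Fact p.Prime] {Ω : Type*}

theorem QF.and {𝒟 : Set (Ω → ℚ_[p])} {P Q : Ω → Prop} (h : QF 𝒟 {ω | P ω}) (h' : QF 𝒟 {ω | Q ω}) :
    QF 𝒟 {ω | P ω ∧ Q ω} := h.inter _ _ h'

theorem QF.or {𝒟 : Set (Ω → ℚ_[p])} {P Q : Ω → Prop} (h : QF 𝒟 {ω | P ω}) (h' : QF 𝒟 {ω | Q ω}) :
    QF 𝒟 {ω | P ω ∨ Q ω} := h.union h'

theorem QF.not {𝒟 : Set (Ω → ℚ_[p])} {P : Ω → Prop} (h : QF 𝒟 {ω | P ω}) :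
    QF 𝒟 {ω | ¬ P ω} := h.compl

/-- extensions with the same definable sets -/
structure Ext (𝒟 ℰ : Set (Ω → ℚ_[p])) : Prop where
  dalg : IsDAlg ℰ
  sub : 𝒟 ⊆ ℰ
  qf : ∀ S, QF ℰ S → QF 𝒟 S
  val : ∀ e ∈ ℰ, ∃ N : ℕ, 0 < N ∧ ∃ l : Set (Ω → ℚ_[p]), l.Finite ∧ l ⊆ 𝒟 ∧
    ∀ ω, ∃ d ∈ l, ‖e ω‖ ^ N = ‖d ω‖

theorem Ext.refl {𝒟 : Set (Ω → ℚ_[p])} (h : IsDAlg 𝒟) : Ext 𝒟 𝒟 :=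
  ⟨h, le_rfl, fun _ h => h, fun e he => ⟨1, one_pos, {e}, Set.finite_singleton e,
    by simpa using he, fun ω => ⟨e, rfl, by simp⟩⟩⟩

theorem Ext.trans {𝒟 ℰ ℱ : Set (Ω → ℚ_[p])} (hD : IsDAlg 𝒟) (h : Ext 𝒟 ℰ) (h' : Ext ℰ ℱ) :
    Ext 𝒟 ℱ := by
  refine ⟨h'.dalg, h.sub.trans h'.sub, fun S hS => h.qf S (h'.qf S hS), fun e he => ?_⟩
  obtain ⟨N, hN, l, hl, hl2, h1⟩ := h'.val e he
  have key : ∀ l : Set (Ω → ℚ_[p]), l.Finite → l ⊆ ℰ → ∃ N : ℕ, 0 < N ∧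
    ∃ l' : Set (Ω → ℚ_[p]), l'.Finite ∧ l' ⊆ 𝒟 ∧ ∀ e ∈ l, ∀ ω, ∃ d ∈ l', ‖e ω‖ ^ N = ‖d ω‖ := by
    intro l hl
    induction l, hl using Set.Finite.induction_on with
    | empty => exact fun _ => ⟨1, one_pos, ∅, Set.finite_empty, by simp, by simp⟩
    | @insert a l ha hl ih =>
      intro hsub
      obtain ⟨N, hN, l1, hl1, hl1D, h1⟩ := ih fun x hx => hsub (Set.mem_insert_of_mem _ hx)
      obtain ⟨M, hM, l2, hl2, hl2D, h2⟩ := h.val a (hsub (Set.mem_insert _ _))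
      refine ⟨N * M, Nat.mul_pos hN hM, (fun d ω => d ω ^ M) '' l1 ∪ (fun d ω => d ω ^ N) '' l2,
        (hl1.image _).union (hl2.image _), ?_, ?_⟩
      · rintro _ (⟨d, hd, rfl⟩ | ⟨d, hd, rfl⟩)
        · exact hD.pow (hl1D hd) M
        · exact hD.pow (hl2D hd) N
      · rintro e (rfl | he) ω
        · obtain ⟨d, hd, e1⟩ := h2 ω
          exact ⟨_, Or.inr ⟨d, hd, rfl⟩, by simp only [norm_pow]; rw [mul_comm N, pow_mul, e1]⟩
        · obtain ⟨d, hd, e1⟩ := h1 e he ω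
          exact ⟨_, Or.inl ⟨d, hd, rfl⟩, by simp only [norm_pow]; rw [pow_mul, e1]⟩
  obtain ⟨M, hM, l', hl', hl'D, h2⟩ := key l hl hl2
  refine ⟨N * M, Nat.mul_pos hN hM, l', hl', hl'D, fun ω => ?_⟩
  obtain ⟨d, hd, e1⟩ := h1 ω
  obtain ⟨d', hd', e2⟩ := h2 d hd ω
  exact ⟨d', hd', by rw [pow_mul, e1, e2]⟩

theorem chain_fin {c : Set (Set (Ω → ℚ_[p]))} (hc : IsChain (· ⊆ ·) c) (hne : c.Nonempty)
    {k : ℕ} (g : Fin k → Ω → ℚ_[p]) (hg : ∀ i, g i ∈ ⋃₀ c) : ∃ ℰ ∈ c, ∀ i, g i ∈ ℰ := by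
  have hf : (Set.range g) ⊆ ⋃₀ c := by rintro _ ⟨i, rfl⟩; exact hg i
  obtain ⟨ℰ, h1, h2⟩ := hc.directedOn.exists_mem_subset_of_finite_of_subset_sUnion hne (Set.finite_range g) hf
  exact ⟨ℰ, h1, fun i => h2 ⟨i, rfl⟩⟩

theorem exists_max {𝒟 : Set (Ω → ℚ_[p])} (h : IsDAlg 𝒟) :
    ∃ ℰ, Ext 𝒟 ℰ ∧ ∀ ℱ, Ext ℰ ℱ → ℱ ⊆ ℰ := by
  obtain ⟨ℰ, _, hm⟩ := zorn_subset_nonempty {ℰ | Ext 𝒟 ℰ} (by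
    intro c hcE hc hne
    refine ⟨⋃₀ c, ?_, fun s hs => Set.subset_sUnion_of_mem hs⟩
    obtain ⟨ℰ0, h0⟩ := hne
    have hne : c.Nonempty := ⟨ℰ0, h0⟩
    have two : ∀ {f g}, f ∈ ⋃₀ c → g ∈ ⋃₀ c → ∃ ℰ ∈ c, f ∈ ℰ ∧ g ∈ ℰ := by
      intro f g hf hg
      obtain ⟨ℰ, h1, h2⟩ := chain_fin hc hne ![f, g] (by
        intro i; fin_cases i; exacts [hf, hg])
      exact ⟨ℰ, h1, h2 0, h2 1⟩
    refine ⟨⟨?_, ?_, ?_, ?_, ?_⟩, ?_, ?_, ?_⟩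
    · exact fun x => ⟨ℰ0, h0, (hcE h0).dalg.const x⟩
    · intro f g hf hg
      obtain ⟨ℰ, h1, h2, h3⟩ := two hf hg
      exact ⟨ℰ, h1, (hcE h1).dalg.add h2 h3⟩
    · intro f g hf hg
      obtain ⟨ℰ, h1, h2, h3⟩ := two hf hg
      exact ⟨ℰ, h1, (hcE h1).dalg.mul h2 h3⟩
    · rintro f ⟨ℰ, h1, h2⟩
      exact ⟨ℰ, h1, (hcE h1).dalg.inv h2⟩
    · intro k a ha g hg
      obtain ⟨ℰ, h1, h2⟩ := chain_fin hc hne g hg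
      exact ⟨ℰ, h1, (hcE h1).dalg.ranal a ha g h2⟩
    · exact (hcE h0).sub.trans (Set.subset_sUnion_of_mem h0)
    · intro S hS
      suffices ∃ ℰ ∈ c, QF ℰ S by
        obtain ⟨ℰ, h1, h2⟩ := this
        exact (hcE h1).qf S h2
      induction hS with
      | zero f hf => obtain ⟨ℰ, h1, h2⟩ := hf; exact ⟨ℰ, h1, QF.zero f h2⟩
      | pow f hf n hn =>
        obtain ⟨ℰ, h1, h2⟩ := hf
        exact ⟨ℰ, h1, QF.pow f h2 n hn⟩
      | compl S hS ih => obtain ⟨ℰ, h1, h2⟩ := ih; exact ⟨ℰ, h1, h2.compl⟩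
      | inter S T hS hT ih ih' =>
        obtain ⟨ℰ, h1, h2⟩ := ih
        obtain ⟨ℰ', h1', h2'⟩ := ih'
        rcases hc.total h1 h1' with hh | hh
        · exact ⟨ℰ', h1', (h2.mono hh).inter _ _ h2'⟩
        · exact ⟨ℰ, h1, h2.inter _ _ (h2'.mono hh)⟩
    · rintro e ⟨ℰ, h1, h2⟩
      exact (hcE h1).val e h2) 𝒟 (Ext.refl h)
  exact ⟨ℰ, hm.1, fun ℱ hF => hm.2 (Ext.trans h hm.1 hF) hF.sub⟩

/-- piecewise `ℰ` functions -/
def PW (ℰ : Set (Ω → ℚ_[p])) : Set (Ω → ℚ_[p]) :=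
  {f | ∃ (ι : Type) (_ : Finite ι) (S : ι → Set Ω) (g : ι → Ω → ℚ_[p]),
    (∀ i, QF ℰ (S i) ∧ g i ∈ ℰ ∧ ∀ ω ∈ S i, f ω = g i ω) ∧ ∀ ω, ∃ i, ω ∈ S i}

theorem PW.fin {ℰ : Set (Ω → ℚ_[p])} (h : IsDAlg ℰ) {τ : Type} [Finite τ] {f : τ → Ω → ℚ_[p]}
    (hf : ∀ t, f t ∈ PW ℰ) {F : Ω → ℚ_[p]} (T : (τ → Ω → ℚ_[p]) → Ω → ℚ_[p])
    (hT : ∀ g : τ → Ω → ℚ_[p], (∀ t, g t ∈ ℰ) → T g ∈ ℰ)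
    (hF : ∀ g ω, (∀ t, f t ω = g t ω) → F ω = T g ω) : F ∈ PW ℰ := by
  choose ι hι S g h1 h2 using hf
  refine ⟨∀ t, ι t, inferInstance, fun i => {ω | ∀ t, ω ∈ S t (i t)},
    fun i => T (fun t => g t (i t)), fun i => ⟨QF.fall h _ fun t => (h1 t (i t)).1,
      hT _ fun t => (h1 t (i t)).2.1, fun ω hω => ?_⟩, fun ω => ?_⟩
  · exact hF _ _ fun t => (h1 t (i t)).2.2 ω (hω t)
  · choose i hi using fun t => h2 t ω
    exact ⟨i, hi⟩

theorem PW_ext {ℰ : Set (Ω → ℚ_[p])} (h : IsDAlg ℰ) : Ext ℰ (PW ℰ) := by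
  have hsub : ℰ ⊆ PW ℰ := fun f hf => ⟨Unit, inferInstance, fun _ => Set.univ, fun _ => f,
    fun _ => ⟨QF.univ h, hf, fun _ _ => rfl⟩, fun _ => ⟨(), trivial⟩⟩
  have glue : ∀ (R : ℚ_[p] → Prop), (∀ g ∈ ℰ, QF ℰ {ω | R (g ω)}) → ∀ f ∈ PW ℰ, QF ℰ {ω | R (f ω)} := by
    rintro R hR f ⟨ι, hι, S, g, h1, h2⟩
    refine (QF.fex h (fun i ω => ω ∈ S i ∩ {ω | R (g i ω)}) fun i =>
      (h1 i).1.inter _ _ (hR _ (h1 i).2.1)).of_eq ?_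
    ext ω
    simp only [mem_ofPred_eq, Set.mem_inter_iff]
    constructor
    · rintro ⟨i, hi, hi2⟩
      rwa [(h1 i).2.2 ω hi]
    · intro hR
      obtain ⟨i, hi⟩ := h2 ω
      exact ⟨i, hi, by rwa [← (h1 i).2.2 ω hi]⟩
  refine ⟨⟨fun c => hsub (h.const c), ?_, ?_, ?_, ?_⟩, hsub, ?_, ?_⟩
  · intro f g hf hg
    exact PW.fin h (τ := Bool) (f := fun b => if b then f else g) (by intro b; cases b <;> simpa)
      (fun g ω => g true ω + g false ω) (fun g hg => h.add (hg _) (hg _))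
      (fun k ω hk => by rw [← hk, ← hk]; simp)
  · intro f g hf hg
    exact PW.fin h (τ := Bool) (f := fun b => if b then f else g) (by intro b; cases b <;> simpa)
      (fun g ω => g true ω * g false ω) (fun g hg => h.mul (hg _) (hg _))
      (fun k ω hk => by rw [← hk, ← hk]; simp)
  · intro f hf
    exact PW.fin h (τ := Unit) (f := fun _ => f) (fun _ => hf)
      (fun g ω => (g () ω)⁻¹) (fun g hg => h.inv (hg _)) (fun k ω hk => by rw [← hk])
  · intro k a ha g hg
    exact PW.fin h (f := g) hg (fun g ω => ranalFn p a (fun i => g i ω)) (fun g hg => h.ranal a ha g hg)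
      (fun k ω hk => by simp only [hk])
  · intro S hS
    induction hS with
    | zero f hf => exact glue (fun x => x = 0) (fun g hg => QF.zero g hg) f hf
    | pow f hf n hn => exact glue (fun x => x ∈ Pset p n) (fun g hg => QF.pow g hg n hn) f hf
    | compl S hS ih => exact ih.compl
    | inter S T hS hT ih ih' => exact ih.inter _ _ ih'
  · rintro f ⟨ι, hι, S, g, h1, h2⟩
    refine ⟨1, one_pos, Set.range g, Set.finite_range g, ?_, fun ω => ?_⟩
    · rintro _ ⟨i, rfl⟩; exact (h1 i).2.1
    · obtain ⟨i, hi⟩ := h2 ω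
      exact ⟨g i, ⟨i, rfl⟩, by rw [pow_one, (h1 i).2.2 ω hi]⟩

end ext

section tt
variable {p : ℕ} [hp : Fact p.Prime] {Ω : Type*}

/-- the group `p^ℤ (1 + p^M ℤ_p)` -/
def TT (M : ℕ) (x : ℚ_[p]) : Prop := ∃ j : ℤ, near1 M (x / (p : ℚ_[p]) ^ j)

theorem TT.ne {M : ℕ} (hM : 1 ≤ M) {x : ℚ_[p]} (h : TT M x) : x ≠ 0 := by
  obtain ⟨j, h⟩ := h
  rintro rfl
  exact (h.ne hM) (by simp)

theorem TT.mul {M : ℕ} (hM : 1 ≤ M) {x y : ℚ_[p]} (hx : TT M x) (hy : TT M y) : TT M (x * y) := by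
  obtain ⟨j, h⟩ := hx
  obtain ⟨k, h'⟩ := hy
  refine ⟨j + k, ?_⟩
  have := h.mul hM h'
  rwa [div_mul_div_comm, ← zpow_add₀ pK_ne] at this

theorem TT.inv {M : ℕ} (hM : 1 ≤ M) {x : ℚ_[p]} (hx : TT M x) : TT M x⁻¹ := by
  obtain ⟨j, h⟩ := hx
  refine ⟨-j, ?_⟩
  have := h.inv hM
  have e : x⁻¹ / (p : ℚ_[p]) ^ (-j) = (x / (p : ℚ_[p]) ^ j)⁻¹ := by
    rw [zpow_neg, inv_div, div_inv_eq_mul, mul_comm, ← div_eq_mul_inv]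
  rwa [e]

theorem TT.near {M : ℕ} (hM : 1 ≤ M) {x : ℚ_[p]} (hx : TT M x) (h1 : ‖x‖ = 1) : near1 M x := by
  obtain ⟨j, h⟩ := hx
  have := h.norm hM
  rw [norm_div, h1, norm_p_zpow, one_div, ← zpow_neg, neg_neg] at this
  have hj : j = 0 := by
    have h2 : ((p : ℝ)) ^ j = (p : ℝ) ^ (0 : ℤ) := by simpa using this
    exact zpow_right_injective₀ (by linarith [pR_one_lt (p := p)]) (pR_one_lt (p := p)).ne' h2
  simpa [hj] using h

theorem TT.of_near {M : ℕ} {x : ℚ_[p]} (h : near1 M x) : TT M x := ⟨0, by simpa using h⟩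

theorem TT_p (M : ℕ) (n : ℤ) : TT M ((p : ℚ_[p]) ^ n) :=
  ⟨n, by rw [div_self (zpow_ne_zero _ pK_ne)]; exact near1_one⟩

theorem TT_tame {M : ℕ} (hM : 1 ≤ M) : Tame {x : ℚ_[p] | TT M x} := by
  refine ⟨1, M, one_pos, hM, fun x hx => ?_, fun x u hx hu h => h.mul hM (.of_near hu)⟩
  simp only [mem_ofPred_eq, pow_one]
  constructor
  · intro h; have := h.mul hM (TT_p M 1); simpa using this
  · intro h; have := h.mul hM (TT_p M (-1)); simpa [mul_assoc, pK_ne] using this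

theorem q_norm {q : ℕ} (hq : q.Prime) : ‖(p : ℚ_[p]) ^ 2‖ < ‖(q : ℚ_[p])‖ := by
  by_cases h : p ∣ q
  · have : p = q := (Nat.prime_dvd_prime_iff_eq hp.1 hq).1 h
    rw [← this, norm_pow, sq]
    exact mul_lt_of_lt_one_left normp_pos normp_lt
  · rw [natCast_unit_norm h]; exact normpow_lt_one (by norm_num)

theorem near_uniq {q : ℕ} (hq : q.Prime) {z : ℚ_[p]} (h : near1 2 z) (h1 : z ^ q = 1) : z = 1 := by
  have h2 : ‖z - 1‖ < ‖(q : ℚ_[p])‖ := lt_of_le_of_lt h (q_norm hq)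
  have h3 := pow_sub_one_norm h2
  rw [h1, sub_self, norm_zero] at h3
  rcases mul_eq_zero.1 h3.symm with h4 | h4
  · rw [h4] at h2; exact absurd h2 (not_lt.2 (norm_nonneg _))
  · exact sub_eq_zero.1 (norm_eq_zero.1 h4)

theorem TT_uniq {q : ℕ} (hq : q.Prime) {s s' : ℚ_[p]} (h : TT 2 s) (h' : TT 2 s')
    (e : s ^ q = s' ^ q) : s = s' := by
  have hs := h.ne (by norm_num); have hs' := h'.ne (by norm_num)
  have h1 : (s * s'⁻¹) ^ q = 1 := by
    rw [mul_pow, e, ← mul_pow, mul_inv_cancel₀ hs', one_pow]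
  have h2 : ‖s * s'⁻¹‖ = 1 := by
    have := congrArg norm h1
    rw [norm_pow, norm_one] at this
    exact (pow_eq_one_iff_of_nonneg (norm_nonneg _) hq.ne_zero).1 this
  have h3 := near_uniq hq ((h.mul (by norm_num) (h'.inv (by norm_num))).near (by norm_num) h2) h1
  field_simp at h3
  exact h3

theorem root_series {q : ℕ} (hq : q.Prime) : ∃ ρ : Rsub p Unit, ∀ w : ℤ_[p],
    (1 + (p : ℤ_[p]) ^ 2 * ev (fun _ => w) ρ) ^ q = 1 + q * p ^ 2 * w := by
  have hqp : (q : ℤ_[p]) ∣ p := by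
    by_cases h : p ∣ q
    · have : p = q := (Nat.prime_dvd_prime_iff_eq hp.1 hq).1 h
      have : (q : ℤ_[p]) = p := by exact_mod_cast congrArg (Nat.cast (R := ℤ_[p])) this.symm
      rw [this]
    · have : IsUnit (q : ℤ_[p]) := by
        rw [PadicInt.isUnit_iff, norm_def, PadicInt.coe_natCast]
        exact natCast_unit_norm h
      exact this.dvd
  have hd : ∀ i : ℕ, ∃ b : ℤ_[p], 2 ≤ i → (q : ℤ_[p]) * p * b = q.choose i * p ^ (2 * (i - 1)) := by
    intro i
    by_cases hi : 2 ≤ i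
    · have h1 : (q : ℤ_[p]) ∣ q.choose i * p := by
        rcases lt_trichotomy i q with h | h | h
        · have : q ∣ q.choose i := hq.dvd_choose_self (by omega) h
          exact (Nat.cast_dvd_cast this).mul_right _
        · exact hqp.mul_left _
        · rw [Nat.choose_eq_zero_of_lt h]; simp
      obtain ⟨b, hb⟩ := h1
      refine ⟨b * p ^ (2 * (i - 1) - 2), fun _ => ?_⟩
      have e2 : (p : ℤ_[p]) ^ (2 * (i - 1)) = p ^ (2 * (i - 1) - 2) * p * p := by
        rw [← pow_succ, ← pow_succ]; congr 1; omega
      rw [e2]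
      linear_combination (-(p : ℤ_[p]) ^ (2 * (i - 1) - 2) * p) * hb
    · exact ⟨0, fun h => absurd h hi⟩
  choose b hb using hd
  let B : ℕ → Rsub p Unit := fun i => if 2 ≤ i ∧ i ≤ q then polyR (MvPolynomial.C (- b i)) else 0
  have hB : Null p B := fun n => ⟨q + 1, fun i hi => by
    simp [B, show ¬ (2 ≤ i ∧ i ≤ q) by omega]⟩
  obtain ⟨ρ, hρ⟩ := exists_root (RX ()) hB
  refine ⟨ρ, fun w => ?_⟩
  have h1 := hρ (fun _ => w)
  have h2 : HasSum (fun k => (p : ℤ_[p]) * (ev (fun _ => w) (B k) * ev (fun _ => w) ρ ^ k))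
      (∑ k ∈ Finset.Icc 2 q, (p : ℤ_[p]) * (ev (fun _ => w) (B k) * ev (fun _ => w) ρ ^ k)) := by
    apply hasSum_sum_of_ne_finset_zero
    intro k hk
    have : ¬ (2 ≤ k ∧ k ≤ q) := by simpa using hk
    simp [B, this]
  have h3 := h1.unique h2
  set r := ev (fun _ => w) ρ with hr
  rw [ev_RX] at h3
  have h4 : r - w = - ∑ k ∈ Finset.Icc 2 q, (p : ℤ_[p]) * (b k * r ^ k) := by
    rw [h3, ← Finset.sum_neg_distrib]
    refine sum_congr rfl fun k hk => ?_
    have : (2 ≤ k ∧ k ≤ q) := by simpa using hk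
    simp only [B, this, and_self, if_true, ev_poly, MvPolynomial.eval_C]; ring
  have h5 : (1 + (p : ℤ_[p]) ^ 2 * r) ^ q = 1 + q * p ^ 2 * r +
      ∑ k ∈ Finset.Icc 2 q, q * p ^ 2 * ((p : ℤ_[p]) * (b k * r ^ k)) := by
    rw [add_comm, add_pow]
    have : range (q + 1) = insert 0 (insert 1 (Finset.Icc 2 q)) := by
      ext k; simp; have := hq.two_le; omega
    rw [this, sum_insert (by simp), sum_insert (by simp)]
    simp only [one_pow, mul_one, pow_zero, Nat.choose_zero_right, pow_one, Nat.choose_one_right,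
      Nat.cast_one]
    rw [← add_assoc]
    congr 1
    · ring
    refine sum_congr rfl fun k hk => ?_
    have hk2 : 2 ≤ k := by simp at hk; exact hk.1
    have e : (p : ℤ_[p]) ^ (2 * k) = p ^ 2 * p ^ (2 * (k - 1)) := by
      rw [← pow_add]; congr 1; omega
    rw [mul_pow, ← pow_mul, e]
    linear_combination (-(p : ℤ_[p]) ^ 2 * r ^ k) * hb k hk2
  rw [h5, ← mul_sum]
  linear_combination (q * (p : ℤ_[p]) ^ 2) * h4

theorem pw_ite {ℰ : Set (Ω → ℚ_[p])} (hpw : PW ℰ ⊆ ℰ) {S : Set Ω} (hS : QF ℰ S)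
    {f g : Ω → ℚ_[p]} (hf : f ∈ ℰ) (hg : g ∈ ℰ) {k : Ω → ℚ_[p]} (h1 : ∀ ω ∈ S, k ω = f ω)
    (h2 : ∀ ω ∉ S, k ω = g ω) : k ∈ ℰ := by
  refine hpw ⟨Bool, inferInstance, fun b => if b then S else Sᶜ, fun b => if b then f else g, ?_, ?_⟩
  · intro b; cases b
    · exact ⟨hS.compl, hg, h2⟩
    · exact ⟨hS, hf, h1⟩
  · intro ω
    by_cases h : ω ∈ S
    · exact ⟨true, h⟩
    · exact ⟨false, h⟩

/-- choose, from a finite cover, a function -/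
theorem pw_cover {ℰ : Set (Ω → ℚ_[p])} (hpw : PW ℰ ⊆ ℰ) {ι : Type} [Finite ι] {S : ι → Set Ω}
    (hS : ∀ i, QF ℰ (S i)) (hc : ∀ ω, ∃ i, ω ∈ S i) {τ : Type*} {g : ι → τ → Ω → ℚ_[p]}
    (hg : ∀ i t, g i t ∈ ℰ) : ∃ k : τ → Ω → ℚ_[p], (∀ t, k t ∈ ℰ) ∧
      ∀ ω, ∃ i, ω ∈ S i ∧ ∀ t, k t ω = g i t ω := by
  classical
  obtain ⟨n, ⟨e⟩⟩ := Finite.exists_equiv_fin ι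
  -- first index
  have hex : ∀ ω, ∃ j : ℕ, ∃ h : j < n, ω ∈ S (e.symm ⟨j, h⟩) := fun ω => by
    obtain ⟨i, hi⟩ := hc ω
    exact ⟨e i, (e i).2, by simpa using hi⟩
  let idx : Ω → ι := fun ω => e.symm ⟨Nat.find (hex ω), (Nat.find_spec (hex ω)).1⟩
  have hidx : ∀ ω, ω ∈ S (idx ω) := fun ω => (Nat.find_spec (hex ω)).2
  refine ⟨fun t ω => g (idx ω) t ω, fun t => ?_, fun ω => ⟨idx ω, hidx ω, fun t => rfl⟩⟩
  have hE : ∀ i, ∀ j : ι, QF ℰ {ω | ω ∈ S i ∧ (¬ (e j < e i ∧ ω ∈ S j))} := by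
    intro i j
    by_cases h : e j < e i
    · exact ((hS i).diff (hS j)).of_eq (by ext; simp [h])
    · exact (hS i).of_eq (by ext; simp [h])
  refine hpw ⟨ι, inferInstance, fun i => {ω | idx ω = i}, fun i => g i t, fun i => ⟨?_, hg i t, ?_⟩,
    fun ω => ⟨idx ω, rfl⟩⟩
  · have hfin := Fintype.ofFinite ι
    have h1 : {ω | idx ω = i} = ⋂ j ∈ (Finset.univ : Finset ι), {ω | ω ∈ S i ∧ (¬ (e j < e i ∧ ω ∈ S j))} := by
      ext ω
      simp only [mem_ofPred_eq, Finset.mem_univ, Set.iInter_true, Set.mem_iInter]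
      constructor
      · rintro rfl j
        refine ⟨hidx ω, fun ⟨h1, h2⟩ => ?_⟩
        have h3 : (e j : ℕ) < Nat.find (hex ω) := by simpa [idx, Fin.lt_def] using h1
        exact Nat.find_min (hex ω) h3 ⟨(e j).2, by simpa using h2⟩
      · intro h
        have h1 := (h i).1
        have h2 := (h (idx ω)).2
        have h3 : ¬ (e (idx ω) < e i) := fun h3 => h2 ⟨h3, hidx ω⟩
        have h4 : Nat.find (hex ω) ≤ e i := Nat.find_min' (hex ω) ⟨(e i).2, by simpa using h1⟩
        apply e.injective
        apply le_antisymm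
        · simpa [idx, Fin.le_def] using h4
        · exact not_lt.1 h3
    change QF ℰ {ω | idx ω = i}
    rw [h1]
    clear h1
    have : ∀ s : Finset ι, s.Nonempty → QF ℰ (⋂ j ∈ s, {ω | ω ∈ S i ∧ (¬ (e j < e i ∧ ω ∈ S j))}) := by
      intro s hs
      induction hs using Finset.Nonempty.cons_induction with
      | singleton a => simpa using hE i a
      | cons a s ha hs ih =>
        have := (hE i a).inter _ _ ih
        simpa using this
    exact this _ ⟨i, Finset.mem_univ _⟩
  · rintro ω rfl; rfl

theorem toT {ℰ : Set (Ω → ℚ_[p])} (hE : IsDAlg ℰ) (hpw : PW ℰ ⊆ ℰ) {M : ℕ} (hM : 1 ≤ M)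
    {h : Ω → ℚ_[p]} (hh : h ∈ ℰ) : ∃ x ∈ ℰ, ∀ ω, ‖x ω‖ = ‖h ω‖ ∧ (h ω ≠ 0 → TT M (x ω)) := by
  let ι := {ξ : Fin (p ^ M) // ¬ p ∣ ξ.1}
  obtain ⟨k, hk, h2⟩ := pw_cover hpw (ι := Option ι)
    (S := fun o => o.elim {ω | h ω = 0} (fun ξ => {ω | h ω / (ξ.1.1 : ℚ_[p]) ∈ {x | TT M x}}))
    (by
      rintro (_ | ξ)
      · exact QF.zero h hh
      · exact QF.tame hE (TT_tame hM) (hE.div hh (hE.const _)))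
    (by
      intro ω
      by_cases h0 : h ω = 0
      · exact ⟨none, h0⟩
      · obtain ⟨ξ, h1, h2, h3⟩ := exists_approx M hM (h ω) h0
        refine ⟨some ⟨⟨ξ, h1⟩, h2⟩, (h ω).valuation, ?_⟩
        convert h3 using 1
        field_simp)
    (τ := Unit) (g := fun o _ => o.elim h (fun ξ ω => h ω / (ξ.1.1 : ℚ_[p])))
    (by
      rintro (_ | ξ) _
      · exact hh
      · exact hE.div hh (hE.const _))
  refine ⟨k (), hk (), fun ω => ?_⟩
  obtain ⟨_ | ξ, hi, e⟩ := h2 ω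
  · rw [e ()]
    exact ⟨rfl, fun h0 => absurd hi h0⟩
  · rw [e ()]
    refine ⟨?_, fun _ => hi⟩
    change ‖h ω / (ξ.1.1 : ℚ_[p])‖ = _
    rw [norm_div, natCast_unit_norm ξ.2, div_one]

theorem toZ_mem {ℰ : Set (Ω → ℚ_[p])} (hE : IsDAlg ℰ) (hpw : PW ℰ ⊆ ℰ) {f : Ω → ℚ_[p]}
    (hf : f ∈ ℰ) : (fun ω => ((toZ (f ω) : ℤ_[p]) : ℚ_[p])) ∈ ℰ :=
  pw_ite hpw (QF.norm_le_one hE hf) hf (hE.const 0) (fun ω hω => toZ_coe hω)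
    (fun ω hω => by
      have : ¬ ‖f ω‖ ≤ 1 := hω
      simp [toZ, this])

/-- monomial decomposition modulo `q`-th powers -/
theorem poly_decomp {τ : Type} [Fintype τ] [DecidableEq τ] {q : ℕ} (hq : 0 < q) (P : MvPolynomial τ ℤ_[p]) :
    ∃ Q : (τ → Fin q) → MvPolynomial τ ℤ_[p], ∀ x : τ → ℤ_[p], eval x P =
      ∑ r, (∏ i, x i ^ (r i : ℕ)) * eval (fun i => x i ^ q) (Q r) := by
  classical
  let md : (τ →₀ ℕ) → (τ → Fin q) := fun d i => ⟨d i % q, Nat.mod_lt _ hq⟩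
  refine ⟨fun r => ∑ d ∈ P.support with md d = r,
    MvPolynomial.monomial (equivFunOnFinite.symm fun i => d i / q) (P.coeff d), fun x => ?_⟩
  rw [MvPolynomial.eval_eq', ← Finset.sum_fiberwise _ md]
  refine sum_congr rfl fun r _ => ?_
  rw [map_sum, mul_sum]
  refine sum_congr rfl fun d hd => ?_
  have hr : md d = r := (mem_filter.1 hd).2
  rw [MvPolynomial.eval_monomial, Finsupp.prod_fintype _ _ (by simp), mul_left_comm,
    ← Finset.prod_mul_distrib]
  congr 1
  refine Finset.prod_congr rfl fun i _ => ?_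
  rw [← hr, ← pow_mul, ← pow_add]
  simp only [Finsupp.equivFunOnFinite_symm_apply_apply, md]
  rw [Nat.mod_add_div]

theorem series_decomp {τ : Type} [Fintype τ] [DecidableEq τ] {q : ℕ} (hq : 0 < q) (F : Rsub p τ) :
    ∃ Q : (τ → Fin q) → Rsub p τ, ∀ x : τ → ℤ_[p], ev x F =
      ∑ r, (∏ i, x i ^ (r i : ℕ)) * ev (fun i => x i ^ q) (Q r) := by
  classical
  obtain ⟨P, hP⟩ := Rsub_series F
  choose Q hQ using fun n => poly_decomp hq (P n)
  have hn : ∀ r, Null p fun n => (p : Rsub p τ) ^ n * polyR (Q n r) := fun r =>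
    Null_pow_mul tendsto_id _
  choose G hG using fun r => Rsub_complete _ (hn r)
  refine ⟨G, fun x => ?_⟩
  have h1 := hP.ev_hasSum (Null_pow_mul tendsto_id _) x
  have h2 : HasSum (fun n => ∑ r, (∏ i, x i ^ (r i : ℕ)) *
      ev (fun i => x i ^ q) ((p : Rsub p τ) ^ n * polyR (Q n r)))
      (∑ r, (∏ i, x i ^ (r i : ℕ)) * ev (fun i => x i ^ q) (G r)) := by
    apply hasSum_sum
    intro r _
    exact ((hG r).ev_hasSum (hn r) _).mul_left _
  refine h1.unique (hs_congr h2 (fun n => ?_) rfl)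
  simp only [map_mul, map_pow, map_natCast, ev_poly, hQ, mul_sum]
  refine sum_congr rfl fun r _ => by simp only [id]; ring

end tt

section root
variable {p : ℕ} [hp : Fact p.Prime] {Ω : Type*}

/-- data for adjoining a root -/
structure RootData (ℰ : Set (Ω → ℚ_[p])) (q : ℕ) (x s : Ω → ℚ_[p]) : Prop where
  dalg : IsDAlg ℰ
  pw : PW ℰ ⊆ ℰ
  hq : q.Prime
  hx : x ∈ ℰ
  hs : ∀ ω, s ω ^ q = x ω
  tt : ∀ ω, TT 2 (s ω)

def MM (ℰ : Set (Ω → ℚ_[p])) (q : ℕ) (s : Ω → ℚ_[p]) : Set (Ω → ℚ_[p]) :=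
  {f | ∃ φ : ℕ → Ω → ℚ_[p], (∀ j, φ j ∈ ℰ) ∧ ∀ ω, f ω = ∑ j ∈ range q, s ω ^ j * φ j ω}

namespace RootData
variable {ℰ : Set (Ω → ℚ_[p])} {q : ℕ} {x s : Ω → ℚ_[p]} (R : RootData ℰ q x s)
include R

theorem sne (ω : Ω) : s ω ≠ 0 := (R.tt ω).ne (by norm_num)

theorem norm_q (ω : Ω) (a : ℚ_[p]) (j : ℕ) : ‖s ω ^ j * a‖ ^ q = ‖x ω ^ j * a ^ q‖ := by
  rw [← norm_pow, mul_pow, ← R.hs, ← pow_mul, ← pow_mul, mul_comm j]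

theorem le_iff (ω : Ω) (a b : ℚ_[p]) (i j : ℕ) :
    ‖s ω ^ i * a‖ ≤ ‖s ω ^ j * b‖ ↔ ‖x ω ^ i * a ^ q‖ ≤ ‖x ω ^ j * b ^ q‖ := by
  rw [← R.norm_q, ← R.norm_q, pow_le_pow_iff_left₀ (norm_nonneg _) (norm_nonneg _) R.hq.ne_zero]

theorem mon_mem {a : Ω → ℚ_[p]} (ha : a ∈ ℰ) (j : ℕ) : (fun ω => x ω ^ j * a ω ^ q) ∈ ℰ :=
  R.dalg.mul (R.dalg.pow R.hx j) (R.dalg.pow ha q)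

theorem qf_le {a b : Ω → ℚ_[p]} (ha : a ∈ ℰ) (hb : b ∈ ℰ) (i j : ℕ) :
    QF ℰ {ω | ‖s ω ^ i * a ω‖ ≤ ‖s ω ^ j * b ω‖} := by
  refine (QF.norm_le R.dalg (R.mon_mem ha i) (R.mon_mem hb j)).of_eq ?_
  ext ω; exact (R.le_iff ω _ _ i j).symm

theorem collide {c : Ω → ℚ_[p]} (hc : c ∈ ℰ) : ∃ g ∈ ℰ, ∀ ω, ‖s ω‖ = ‖c ω‖ → s ω = g ω := by
  obtain ⟨c', hc', h1⟩ := toT R.dalg R.pw (M := 2) (by norm_num) hc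
  obtain ⟨ρ, hρ⟩ := root_series (p := p) R.hq
  have hq0 : (q : ℚ_[p]) ≠ 0 := by exact_mod_cast R.hq.ne_zero
  let w : Ω → ℚ_[p] := fun ω => (x ω / c' ω ^ q - 1) / (q * p ^ 2)
  have hw : w ∈ ℰ := R.dalg.div (R.dalg.sub (R.dalg.div R.hx (R.dalg.pow hc' q)) (R.dalg.const 1))
    (R.dalg.const _)
  have hev := R.dalg.ev ρ (fun _ ω => toZ (w ω)) (fun _ => toZ_mem R.dalg R.pw hw)
  refine ⟨fun ω => c' ω * (1 + p ^ 2 * (ev (fun _ => toZ (w ω)) ρ : ℤ_[p])),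
    R.dalg.mul hc' (R.dalg.add (R.dalg.const 1) (R.dalg.cmul _ hev)), fun ω hω => ?_⟩
  have hc0 : c ω ≠ 0 := by
    rw [← norm_pos_iff, ← hω, norm_pos_iff]; exact R.sne ω
  obtain ⟨h2, h3⟩ := h1 ω
  have h3 := h3 hc0
  have hc'0 := h3.ne (by norm_num)
  have hn : near1 2 (s ω * (c' ω)⁻¹) := ((R.tt ω).mul (by norm_num) (h3.inv (by norm_num))).near
    (by norm_num) (by rw [norm_mul, norm_inv, h2, hω, mul_inv_cancel₀ (norm_ne_zero_iff.2 hc0)])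
  have h4 : ‖s ω * (c' ω)⁻¹ - 1‖ < ‖(q : ℚ_[p])‖ := lt_of_le_of_lt hn (q_norm R.hq)
  have h5 := pow_sub_one_norm h4
  have e : (s ω * (c' ω)⁻¹) ^ q = x ω / c' ω ^ q := by
    rw [mul_pow, R.hs, inv_pow, div_eq_mul_inv]
  have hwb : ‖w ω‖ ≤ 1 := by
    simp only [w]
    rw [norm_div, ← e, h5, norm_mul]
    rw [div_le_one (mul_pos (norm_pos_iff.2 hq0) (normpow_pos 2))]
    exact mul_le_mul_of_nonneg_left hn (norm_nonneg _)
  have h6 := congrArg (fun z : ℤ_[p] => (z : ℚ_[p])) (hρ (toZ (w ω)))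
  simp only [PadicInt.coe_pow, PadicInt.coe_add, coe_mul, PadicInt.coe_one,
    PadicInt.coe_natCast, toZ_coe hwb] at h6
  have h7 : (q : ℚ_[p]) * p ^ 2 * w ω = x ω / c' ω ^ q - 1 :=
    mul_div_cancel₀ _ (mul_ne_zero hq0 (pow_ne_zero _ pK_ne))
  rw [h7] at h6
  refine TT_uniq R.hq (R.tt ω) (h3.mul (by norm_num) (TT.of_near ?_)) ?_
  · rw [near1, add_sub_cancel_left, norm_mul]
    exact mul_le_of_le_one_right (norm_nonneg _) (norm_le_one _)
  · rw [mul_pow, h6, R.hs]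
    field_simp
    ring

theorem cover {ι : Type} [Finite ι] {S : ι → Set Ω} (hS : ∀ i, QF ℰ (S i))
    (hc : ∀ ω, ∃ i, ω ∈ S i) {g : ι → Ω → ℚ_[p]} (hg : ∀ i, g i ∈ MM ℰ q s) {F : Ω → ℚ_[p]}
    (hF : ∀ i, ∀ ω ∈ S i, F ω = g i ω) : F ∈ MM ℰ q s := by
  choose φ h1 h2 using hg
  obtain ⟨k, hk, h3⟩ := pw_cover R.pw hS hc h1
  refine ⟨k, hk, fun ω => ?_⟩
  obtain ⟨i, hi, h4⟩ := h3 ω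
  rw [hF i ω hi, h2]
  exact sum_congr rfl fun j _ => by rw [h4]

theorem ite {S : Set Ω} (hS : QF ℰ S) {f g F : Ω → ℚ_[p]} (hf : f ∈ MM ℰ q s) (hg : g ∈ MM ℰ q s)
    (h1 : ∀ ω ∈ S, F ω = f ω) (h2 : ∀ ω ∉ S, F ω = g ω) : F ∈ MM ℰ q s :=
  R.cover (ι := Bool) (S := fun b => if b then S else Sᶜ) (g := fun b => if b then f else g)
    (by intro b; cases b; exacts [hS.compl, hS])
    (fun ω => by
      by_cases h : ω ∈ S
      exacts [⟨true, h⟩, ⟨false, h⟩])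
    (by intro b; cases b; exacts [hg, hf])
    (by intro b; cases b; exacts [h2, h1])

theorem mon (n : ℕ) {a : Ω → ℚ_[p]} (ha : a ∈ ℰ) : (fun ω => s ω ^ n * a ω) ∈ MM ℰ q s := by
  refine ⟨fun j => if j = n % q then (fun ω => x ω ^ (n / q) * a ω) else fun _ => 0, fun j => ?_,
    fun ω => ?_⟩
  · by_cases h : j = n % q
    · simp only [h, if_true]; exact R.dalg.mul (R.dalg.pow R.hx _) ha
    · simp only [h, if_false]; exact R.dalg.const 0
  · rw [Finset.sum_eq_single (n % q)]
    · simp only [if_true]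
      rw [← R.hs, ← pow_mul, ← mul_assoc, ← pow_add, Nat.mod_add_div]
    · intro j _ h; simp [h]
    · intro h; exact absurd (mem_range.2 (Nat.mod_lt _ R.hq.pos)) h

theorem base {a : Ω → ℚ_[p]} (ha : a ∈ ℰ) : a ∈ MM ℰ q s := by
  have := R.mon 0 ha
  simpa using this

theorem add {f g : Ω → ℚ_[p]} (hf : f ∈ MM ℰ q s) (hg : g ∈ MM ℰ q s) :
    (fun ω => f ω + g ω) ∈ MM ℰ q s := by
  obtain ⟨φ, h1, h2⟩ := hf
  obtain ⟨ψ, h3, h4⟩ := hg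
  refine ⟨fun j ω => φ j ω + ψ j ω, fun j => R.dalg.add (h1 j) (h3 j), fun ω => ?_⟩
  change f ω + g ω = _
  rw [h2, h4, ← Finset.sum_add_distrib]
  exact sum_congr rfl fun j _ => by ring

theorem sum {ι : Type*} (t : Finset ι) {f : ι → Ω → ℚ_[p]} (hf : ∀ i ∈ t, f i ∈ MM ℰ q s) :
    (fun ω => ∑ i ∈ t, f i ω) ∈ MM ℰ q s := by
  classical
  induction t using induction_on with
  | empty => simpa using R.base (R.dalg.const 0)
  | insert a t ha ih =>
    simp only [sum_insert ha]
    exact R.add (hf a (by simp)) (ih fun i hi => hf i (by simp [hi]))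

theorem mul {f g : Ω → ℚ_[p]} (hf : f ∈ MM ℰ q s) (hg : g ∈ MM ℰ q s) :
    (fun ω => f ω * g ω) ∈ MM ℰ q s := by
  obtain ⟨φ, h1, h2⟩ := hf
  obtain ⟨ψ, h3, h4⟩ := hg
  have : (fun ω => f ω * g ω) = fun ω => ∑ i ∈ range q, ∑ j ∈ range q,
      s ω ^ (i + j) * (φ i ω * ψ j ω) := by
    ext ω
    rw [h2, h4, Finset.sum_mul_sum]
    exact sum_congr rfl fun i _ => sum_congr rfl fun j _ => by ring
  rw [this]
  exact R.sum _ fun i _ => R.sum _ fun j _ => R.mon _ (R.dalg.mul (h1 i) (h3 j))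

theorem prod {ι : Type*} (t : Finset ι) {f : ι → Ω → ℚ_[p]} (hf : ∀ i ∈ t, f i ∈ MM ℰ q s) :
    (fun ω => ∏ i ∈ t, f i ω) ∈ MM ℰ q s := by
  classical
  induction t using induction_on with
  | empty => simpa using R.base (R.dalg.const 1)
  | insert a t ha ih =>
    simp only [Finset.prod_insert ha]
    exact R.mul (hf a (by simp)) (ih fun i hi => hf i (by simp [hi]))

theorem pow {f : Ω → ℚ_[p]} (hf : f ∈ MM ℰ q s) (n : ℕ) : (fun ω => f ω ^ n) ∈ MM ℰ q s := by
  have := R.prod (range n) (f := fun _ => f) fun _ _ => hf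
  simpa using this

/-- structured representation -/
theorem struct (κ : ℕ) {f : Ω → ℚ_[p]} (hf : f ∈ MM ℰ q s) : ∃ φ : ℕ → Ω → ℚ_[p],
    (∀ j, φ j ∈ ℰ) ∧ (∀ ω, f ω = ∑ j ∈ range q, s ω ^ j * φ j ω) ∧
    ∀ ω, ∃ j < q, ∀ l < q, l ≠ j → ‖s ω ^ l * φ l ω‖ ≤ ‖s ω ^ j * (p ^ κ * φ j ω)‖ := by
  obtain ⟨φ, h1, h2⟩ := hf
  have hcol : ∀ (j l : Fin q) (i : Fin κ), ∃ g ∈ ℰ, ∀ ω, l ≠ j → φ j ω ≠ 0 →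
      ‖s ω ^ (l : ℕ) * φ l ω‖ = ‖s ω ^ (j : ℕ) * (p ^ (i : ℕ) * φ j ω)‖ → s ω = g ω := by
    intro j l i
    by_cases hlj : l = j
    · exact ⟨_, R.hx, fun ω h => absurd hlj h⟩
    have hcop : IsCoprime ((l : ℤ) - j) (q : ℤ) := by
      refine ((Irreducible.coprime_iff_not_dvd (Nat.prime_iff_prime_int.1 R.hq).irreducible).2
        fun hd => hlj ?_).symm
      have := Int.eq_zero_of_abs_lt_dvd hd (by
        rw [abs_lt]; have := l.2; have := j.2; constructor <;> omega)
      exact Fin.ext (by omega)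
    obtain ⟨a, b, hab⟩ := hcop
    obtain ⟨g, hg, hg2⟩ := R.collide (c := fun ω => (p ^ (i : ℕ) * φ j ω / φ l ω) ^ a * x ω ^ b)
      (R.dalg.mul (R.dalg.zpow (R.dalg.div (R.dalg.cmul _ (h1 _)) (h1 _)) _) (R.dalg.zpow R.hx _))
    refine ⟨g, hg, fun ω _ hj0 he => hg2 ω ?_⟩
    have hs0 := R.sne ω
    have hl0 : φ l ω ≠ 0 := by
      intro h0
      rw [h0, mul_zero, norm_zero, eq_comm, norm_eq_zero] at he
      exact mul_ne_zero (pow_ne_zero _ hs0) (mul_ne_zero (pow_ne_zero _ pK_ne) hj0) he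
    have e1 : ‖s ω‖ ^ ((l : ℤ) - j) = ‖(p : ℚ_[p]) ^ (i : ℕ) * φ j ω / φ l ω‖ := by
      have hsn := norm_ne_zero_iff.2 hs0
      have hln := norm_ne_zero_iff.2 hl0
      rw [zpow_sub₀ hsn, zpow_natCast, zpow_natCast, norm_div]
      rw [norm_mul, norm_mul (s ω ^ (j : ℕ)), norm_pow, norm_pow] at he
      field_simp
      rw [he]
    rw [norm_mul, norm_zpow, ← e1, ← R.hs, norm_zpow, norm_pow, ← zpow_mul, ← zpow_natCast (‖s ω‖) q,
      ← zpow_mul, ← zpow_add₀ (norm_ne_zero_iff.2 hs0), mul_comm _ a, mul_comm _ b, hab, zpow_one]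
  choose G hG1 hG2 using hcol
  let S : Option (Fin q) ⊕ (Fin q × Fin q × Fin κ) → Set Ω := fun o => match o with
    | .inl none => {ω | ∀ j : Fin q, φ j ω = 0}
    | .inl (some j) => {ω | ∀ l : Fin q, l ≠ j → ‖s ω ^ (l : ℕ) * φ l ω‖ ≤ ‖s ω ^ (j : ℕ) * (p ^ κ * φ j ω)‖}
    | .inr (j, l, i) => {ω | l ≠ j ∧ φ j ω ≠ 0 ∧
      ‖s ω ^ (l : ℕ) * φ l ω‖ = ‖s ω ^ (j : ℕ) * (p ^ (i : ℕ) * φ j ω)‖}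
  let ψ : Option (Fin q) ⊕ (Fin q × Fin q × Fin κ) → ℕ → Ω → ℚ_[p] := fun o => match o with
    | .inl _ => φ
    | .inr (j, l, i) => fun n => if n = 0 then fun ω => ∑ m ∈ range q, G j l i ω ^ m * φ m ω
        else fun _ => 0
  obtain ⟨k, hk, h3⟩ := pw_cover R.pw (S := S) (g := ψ)
    (by
      rintro ((_ | j) | ⟨j, l, i⟩)
      · exact QF.fall R.dalg _ fun j => QF.zero _ (h1 j)
      · refine QF.fall R.dalg _ fun l => ?_
        by_cases h : l = j
        · exact (QF.univ R.dalg).of_eq (by ext; simp [h])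
        · exact (R.qf_le (h1 l) (R.dalg.cmul ((p : ℚ_[p]) ^ κ) (h1 j)) l j).of_eq (by ext; simp [h])
      · refine (QF.const R.dalg _).and ((QF.ne (h1 j)).and ?_)
        exact ((R.qf_le (h1 l) (R.dalg.cmul ((p : ℚ_[p]) ^ (i : ℕ)) (h1 j)) l j).and
          (R.qf_le (R.dalg.cmul ((p : ℚ_[p]) ^ (i : ℕ)) (h1 j)) (h1 l) j l)).of_eq (by ext; simp [le_antisymm_iff]))
    (by
      intro ω
      by_contra hno
      push Not at hno
      have hex : ∃ j : Fin q, φ j ω ≠ 0 := by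
        by_contra h
        push Not at h
        exact hno (.inl none) h
      obtain ⟨j0, hj0⟩ := hex
      have : Nonempty (Fin q) := ⟨j0⟩
      obtain ⟨j, hj⟩ := Finite.exists_max fun j : Fin q => ‖s ω ^ (j : ℕ) * φ j ω‖
      have hjn : φ j ω ≠ 0 := by
        intro h
        have := hj j0
        rw [h, mul_zero, norm_zero, norm_le_zero_iff] at this
        exact mul_ne_zero (pow_ne_zero _ (R.sne ω)) hj0 this
      have := hno (.inl (some j))
      simp only [S, mem_ofPred_eq] at this
      push Not at this
      obtain ⟨l, hl, hlt⟩ := this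
      have hln : s ω ^ (l : ℕ) * φ l ω ≠ 0 := by
        intro h; rw [h, norm_zero] at hlt; exact absurd hlt (not_lt.2 (norm_nonneg _))
      have hjn' : s ω ^ (j : ℕ) * φ j ω ≠ 0 := mul_ne_zero (pow_ne_zero _ (R.sne ω)) hjn
      -- valuation
      let r : ℚ_[p] := (s ω ^ (l : ℕ) * φ l ω) / (s ω ^ (j : ℕ) * φ j ω)
      have hr : ‖r‖ ≤ 1 := by
        simp only [r]; rw [norm_div, div_le_one (norm_pos_iff.2 hjn')]; exact hj l
      have hr2 : ‖(p : ℚ_[p]) ^ κ‖ < ‖r‖ := by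
        simp only [r]; rw [norm_div, lt_div_iff₀ (norm_pos_iff.2 hjn'), ← norm_mul]
        rwa [mul_left_comm] at hlt
      have hr0 : r ≠ 0 := div_ne_zero hln hjn'
      obtain ⟨i, hi⟩ : ∃ i : ℕ, ‖r‖ = ‖(p : ℚ_[p]) ^ i‖ := by
        have h0 := norm_eq_zpow_neg_valuation hr0
        have hv : 0 ≤ r.valuation := by
          rw [h0] at hr
          by_contra hneg
          push Not at hneg
          have := one_lt_zpow₀ (pR_one_lt (p := p)) (show 0 < - r.valuation by omega)
          linarith
        refine ⟨r.valuation.toNat, ?_⟩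
        rw [h0, Padic.norm_p_pow, Int.toNat_of_nonneg hv]
      have hik : i < κ := by
        by_contra h
        exact absurd (hi ▸ hr2) (not_lt.2 (normpow_anti (by omega)))
      refine hno (.inr (j, l, ⟨i, hik⟩)) ⟨hl, hjn, ?_⟩
      have : ‖s ω ^ (l : ℕ) * φ l ω‖ = ‖r‖ * ‖s ω ^ (j : ℕ) * φ j ω‖ := by
        rw [← norm_mul]; simp only [r]; rw [div_mul_cancel₀ _ hjn']
      rw [this, hi, ← norm_mul]; congr 1; ring)
    (by
      rintro (_ | ⟨j, l, i⟩) n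
      · exact h1 n
      · simp only [ψ]
        split_ifs
        · exact R.dalg.sum _ _ fun m _ => R.dalg.mul (R.dalg.pow (hG1 _ _ _) _) (h1 m)
        · exact R.dalg.const 0)
  refine ⟨k, hk, fun ω => ?_, fun ω => ?_⟩
  · obtain ⟨(_ | ⟨j, l, i⟩), hi, h4⟩ := h3 ω
    · rw [h2]; exact sum_congr rfl fun m _ => by rw [h4]
    · obtain ⟨hi1, hi2, hi3⟩ := hi
      have := hG2 j l i ω hi1 hi2 hi3
      rw [Finset.sum_eq_single 0]
      · rw [h4, h2]; simp only [ψ, if_true, pow_zero, one_mul]; rw [this]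
      · intro m _ hm; rw [h4]; simp [ψ, hm]
      · intro h; exact absurd (mem_range.2 R.hq.pos) h
  · obtain ⟨((_ | j) | ⟨j, l, i⟩), hi, h4⟩ := h3 ω
    · refine ⟨0, R.hq.pos, fun l hl _ => ?_⟩
      have := hi ⟨l, hl⟩
      rw [h4]; simp only [ψ]; rw [this, mul_zero, norm_zero]; exact norm_nonneg _
    · refine ⟨j, j.2, fun l hl hlj => ?_⟩
      rw [h4, h4]
      exact hi ⟨l, hl⟩ (by intro h; exact hlj (by rw [← h]))
    · refine ⟨0, R.hq.pos, fun l hl hl0 => ?_⟩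
      rw [h4]; simp only [ψ, hl0, if_false, mul_zero, norm_zero]; exact norm_nonneg _

end RootData
end root

section root
variable {p : ℕ} [hp : Fact p.Prime] {Ω : Type*}

theorem dom_sum {q κ : ℕ} (a : ℕ → ℚ_[p]) {j : ℕ} (hj : j < q)
    (h : ∀ l < q, l ≠ j → ‖a l‖ ≤ ‖(p : ℚ_[p]) ^ κ * a j‖) :
    ∃ u, near1 κ u ∧ ∑ l ∈ range q, a l = a j * u := by
  by_cases h0 : a j = 0
  · refine ⟨1, near1_one, ?_⟩
    rw [h0, zero_mul]
    refine Finset.sum_eq_zero fun l hl => ?_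
    by_cases hlj : l = j
    · rw [hlj, h0]
    · have := h l (mem_range.1 hl) hlj
      rw [h0, mul_zero, norm_zero] at this
      exact norm_le_zero_iff.1 this
  · refine ⟨1 + (∑ l ∈ (range q).erase j, a l) / a j, ?_, ?_⟩
    · rw [near1, add_sub_cancel_left, norm_div, div_le_iff₀ (norm_pos_iff.2 h0), ← norm_mul]
      exact norm_sum_le_of _ _ (norm_nonneg _) fun l hl => by
        rw [Finset.mem_erase, mem_range] at hl
        exact h l hl.2 hl.1
    · rw [← Finset.add_sum_erase _ _ (mem_range.2 hj)]
      field_simp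

namespace RootData
variable {ℰ : Set (Ω → ℚ_[p])} {q : ℕ} {x s : Ω → ℚ_[p]} (R : RootData ℰ q x s)
include R

theorem struct' {κ : ℕ} (hκ : 1 ≤ κ) {f : Ω → ℚ_[p]} (hf : f ∈ MM ℰ q s) : ∃ φ : ℕ → Ω → ℚ_[p],
    (∀ j, φ j ∈ ℰ) ∧ (∀ ω, f ω = ∑ j ∈ range q, s ω ^ j * φ j ω) ∧
    (∀ ω, ∃ j < q, (∀ l < q, l ≠ j → ‖s ω ^ l * φ l ω‖ ≤ ‖s ω ^ j * (p ^ κ * φ j ω)‖)) ∧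
    (∀ ω, ∀ j < q, (∀ l < q, l ≠ j → ‖s ω ^ l * φ l ω‖ ≤ ‖s ω ^ j * (p ^ κ * φ j ω)‖) →
      (∃ u, near1 κ u ∧ f ω = s ω ^ j * φ j ω * u) ∧ ‖f ω‖ = ‖s ω ^ j * φ j ω‖ ∧
      ∀ l < q, ‖s ω ^ l * φ l ω‖ ≤ ‖f ω‖) := by
  obtain ⟨φ, h1, h2, h3⟩ := R.struct κ hf
  refine ⟨φ, h1, h2, h3, fun ω j hj h => ?_⟩
  obtain ⟨u, hu, e⟩ := dom_sum (κ := κ) (fun l => s ω ^ l * φ l ω) hj (fun l hl hlj => by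
    have := h l hl hlj
    rwa [mul_left_comm] at this)
  rw [← h2] at e
  have hn : ‖f ω‖ = ‖s ω ^ j * φ j ω‖ := by rw [e, norm_mul, hu.norm hκ, mul_one]
  refine ⟨⟨u, hu, e⟩, hn, fun l hl => ?_⟩
  rw [hn]
  by_cases hlj : l = j
  · rw [hlj]
  · refine (h l hl hlj).trans ?_
    rw [mul_left_comm, norm_mul]
    exact mul_le_of_le_one_left (norm_nonneg _) (normpow_le κ)

theorem ev_mem {σ : Type} [Finite σ] (F : Rsub p σ) {f : σ → Ω → ℚ_[p]} (hf : ∀ i, f i ∈ MM ℰ q s)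
    {g : Ω → ℚ_[p]} (h1 : ∀ ω, (∀ i, ‖f i ω‖ ≤ 1) → g ω = ev (fun i => toZ (f i ω)) F)
    (h2 : ∀ ω, ¬ (∀ i, ‖f i ω‖ ≤ 1) → g ω = 0) : g ∈ MM ℰ q s := by
  classical
  cases nonempty_fintype σ
  choose φ p1 p2 p3 p4 using fun i => R.struct' (κ := 1) le_rfl (hf i)
  obtain ⟨F', hF'⟩ := exists_subst (fun i => ∑ j : Fin q, RX (p := p) ((i, j) : σ × Fin q)) F
  obtain ⟨Q, hQ⟩ := series_decomp R.hq.pos F'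
  have hB : ∀ ω, (∀ i, ‖f i ω‖ ≤ 1) ↔ ∀ (i : σ × Fin q), ‖s ω ^ (i.2 : ℕ) * φ i.1 i.2 ω‖ ≤ 1 := by
    intro ω
    constructor
    · intro h i
      obtain ⟨j, hj, hd⟩ := p3 i.1 ω
      exact ((p4 i.1 ω j hj hd).2.2 i.2 i.2.2).trans (h i.1)
    · intro h i
      rw [p2]
      exact norm_sum_le_of _ _ zero_le_one fun j hj => h (i, ⟨j, mem_range.1 hj⟩)
  have hB2 : ∀ ω (i : σ × Fin q), ‖s ω ^ (i.2 : ℕ) * φ i.1 i.2 ω‖ ≤ 1 ↔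
      ‖x ω ^ (i.2 : ℕ) * φ i.1 i.2 ω ^ q‖ ≤ 1 := by
    intro ω i
    rw [← R.norm_q, pow_le_one_iff_of_nonneg (norm_nonneg _) R.hq.ne_zero]
  have hBq : QF ℰ {ω | ∀ i, ‖f i ω‖ ≤ 1} := by
    refine (QF.fall R.dalg (fun (i : σ × Fin q) ω => ‖x ω ^ (i.2 : ℕ) * φ i.1 i.2 ω ^ q‖ ≤ 1)
      fun i => QF.norm_le_one R.dalg (R.mon_mem (p1 _ _) _)).of_eq ?_
    ext ω
    simp only [mem_ofPred_eq]
    rw [hB]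
    exact forall_congr' fun i => (hB2 ω i).symm
  refine R.ite hBq (f := fun ω => ∑ r : σ × Fin q → Fin q,
      (∏ i, (s ω ^ (i.2 : ℕ) * φ i.1 i.2 ω) ^ (r i : ℕ)) *
      (ev (fun i : σ × Fin q => toZ (x ω ^ (i.2 : ℕ) * φ i.1 i.2 ω ^ q)) (Q r) : ℤ_[p]))
    (g := fun _ => 0) ?_ (R.base (R.dalg.const 0)) ?_ (fun ω hω => h2 ω hω)
  · refine R.sum _ fun r _ => R.mul (R.prod _ fun i _ => R.pow (R.mon _ (p1 _ _)) _) (R.base ?_)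
    exact R.dalg.ev (Q r) _ fun i => toZ_mem R.dalg R.pw (R.mon_mem (p1 _ _) _)
  · intro ω hω
    have hω' := (hB ω).1 hω
    rw [h1 ω hω]
    have e1 : ev (fun i => toZ (f i ω)) F =
        ev (fun i : σ × Fin q => toZ (s ω ^ (i.2 : ℕ) * φ i.1 i.2 ω)) F' := by
      rw [hF']
      have : (fun i => toZ (f i ω)) = fun i => ev (fun i : σ × Fin q => toZ (s ω ^ (i.2 : ℕ) * φ i.1 i.2 ω))
          (∑ j : Fin q, RX (p := p) ((i, j) : σ × Fin q)) := by
        ext1 i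
        apply Subtype.ext
        rw [toZ_coe (hω i), map_sum, coe_sum, p2, Finset.sum_range]
        refine sum_congr rfl fun j _ => ?_
        rw [ev_RX, toZ_coe (hω' (i, j))]
      rw [this]
    rw [e1, hQ, coe_sum]
    refine sum_congr rfl fun r _ => ?_
    rw [coe_mul]
    congr 1
    · refine (map_prod PadicInt.Coe.ringHom _ _).trans ?_
      refine Finset.prod_congr rfl fun i _ => ?_
      change ((toZ (s ω ^ (i.2 : ℕ) * φ i.1 i.2 ω) ^ (r i : ℕ) : ℤ_[p]) : ℚ_[p]) = _
      rw [PadicInt.coe_pow, toZ_coe (hω' i)]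
    · have : (fun i : σ × Fin q => toZ (s ω ^ (i.2 : ℕ) * φ i.1 i.2 ω) ^ q) =
          fun i : σ × Fin q => toZ (x ω ^ (i.2 : ℕ) * φ i.1 i.2 ω ^ q) := by
        ext1 i
        apply Subtype.ext
        rw [PadicInt.coe_pow, toZ_coe (hω' i), toZ_coe ((hB2 ω i).1 (hω' i)), mul_pow, ← R.hs,
          ← pow_mul, ← pow_mul, mul_comm q]
      rw [this]

theorem sinv {a : Ω → ℚ_[p]} (ha : a ∈ ℰ) (j : ℕ) : (fun ω => (s ω ^ j)⁻¹ * a ω) ∈ MM ℰ q s := by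
  have h1 := R.mon ((q - 1) * j) (R.dalg.mul (R.dalg.inv (R.dalg.pow R.hx j)) ha)
  convert h1 using 1
  ext ω
  have h0 := R.sne ω
  have e : s ω ^ ((q - 1) * j) * s ω ^ j = x ω ^ j := by
    rw [← pow_add, ← R.hs, ← pow_mul, ← Nat.succ_mul, Nat.succ_eq_add_one,
      Nat.sub_add_cancel R.hq.one_le]
  have hx0 : x ω ^ j ≠ 0 := by rw [← R.hs]; exact pow_ne_zero _ (pow_ne_zero _ h0)
  have : (s ω ^ j)⁻¹ = s ω ^ ((q - 1) * j) * (x ω ^ j)⁻¹ := by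
    rw [← e] at hx0 ⊢
    field_simp
  rw [this, mul_assoc]

theorem inv {f : Ω → ℚ_[p]} (hf : f ∈ MM ℰ q s) : (fun ω => (f ω)⁻¹) ∈ MM ℰ q s := by
  classical
  obtain ⟨φ, p1, p2, p3, p4⟩ := R.struct' (κ := 1) le_rfl hf
  let m : Fin q → Ω → ℚ_[p] := fun j ω => ∑ l ∈ (range q).erase j,
    s ω ^ l * φ l ω * ((s ω ^ (j : ℕ))⁻¹ * (p * φ j ω)⁻¹)
  have hm : ∀ j, m j ∈ MM ℰ q s := fun j => R.sum _ fun l _ => R.mul (R.mon _ (p1 l))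
    (R.sinv (R.dalg.inv (R.dalg.cmul _ (p1 _))) _)
  let D : Fin q → Set Ω := fun j => {ω | φ j ω ≠ 0 ∧
    ∀ l : Fin q, l ≠ j → ‖s ω ^ (l : ℕ) * φ l ω‖ ≤ ‖s ω ^ (j : ℕ) * (p ^ 1 * φ j ω)‖}
  have hDq : ∀ j, QF ℰ (D j) := fun j => by
    refine (QF.ne (p1 j)).and (QF.fall R.dalg _ fun l => ?_)
    by_cases h : l = j
    · exact (QF.univ R.dalg).of_eq (by ext; simp [h])
    · exact (R.qf_le (p1 l) (R.dalg.cmul ((p : ℚ_[p]) ^ 1) (p1 j)) l j).of_eq (by ext; simp [h])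
  have hb : ∀ j, ∀ ω ∈ D j, ‖m j ω‖ ≤ 1 := by
    rintro j ω ⟨h0, hω⟩
    have hs0 := pow_ne_zero j (R.sne ω)
    refine norm_sum_le_of _ _ zero_le_one fun l hl => ?_
    rw [Finset.mem_erase, mem_range] at hl
    have := hω ⟨l, hl.2⟩ (by intro h; exact hl.1 (by rw [← h]))
    rw [← mul_inv, ← div_eq_mul_inv, norm_div, div_le_one (norm_pos_iff.2
      (mul_ne_zero hs0 (mul_ne_zero pK_ne h0)))]
    simpa only [pow_one] using this
  have hfe : ∀ j, ∀ ω ∈ D j, f ω = s ω ^ (j : ℕ) * φ j ω * (1 + p * m j ω) := by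
    rintro j ω ⟨h0, hω⟩
    have hs0 := pow_ne_zero j (R.sne ω)
    rw [p2, ← Finset.add_sum_erase _ _ (mem_range.2 j.2), mul_add, mul_one]
    congr 1
    simp only [m]
    rw [mul_sum, mul_sum]
    refine sum_congr rfl fun l _ => ?_
    have := pK_ne (p := p)
    field_simp
  have hinv : ∀ j, ∃ g ∈ MM ℰ q s, ∀ ω ∈ D j, g ω = (1 + p * m j ω)⁻¹ := by
    intro j
    obtain ⟨σ, hσ, G, F, hG, _, hF⟩ := (An.gen (Z := D j) (𝒢 := {m j}) (g := m j) rfl (hb j)).inv1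
    refine ⟨fun ω => if (∀ i, ‖G i ω‖ ≤ 1) then (ev (fun i => toZ (G i ω)) F : ℤ_[p]) else 0,
      R.ev_mem F (f := G) (fun i => by rw [hG i]; exact hm j) (fun ω h => if_pos h)
      (fun ω h => if_neg h), fun ω hω => ?_⟩
    simp only
    rw [if_pos (fun i => by rw [hG i]; exact hb j ω hω)]
    exact (hF ω hω).symm
  choose g hg1 hg2 using hinv
  refine R.cover (ι := Option (Fin q)) (S := fun o => o.elim {ω | ∀ j : Fin q, φ j ω = 0} D)
    (g := fun o => o.elim (fun _ => 0) fun j ω => (s ω ^ (j : ℕ))⁻¹ * (φ j ω)⁻¹ * g j ω) ?_ ?_ ?_ ?_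
  · rintro (_ | j)
    · exact QF.fall R.dalg _ fun j => QF.zero _ (p1 j)
    · exact hDq j
  · intro ω
    obtain ⟨j, hj, h⟩ := p3 ω
    by_cases h0 : φ j ω = 0
    · refine ⟨none, fun l => ?_⟩
      by_cases hl : (l : ℕ) = j
      · rw [hl, h0]
      · have := h l l.2 hl
        rw [h0, mul_zero, mul_zero, norm_zero, norm_le_zero_iff] at this
        exact (mul_eq_zero.1 this).resolve_left (pow_ne_zero _ (R.sne ω))
    · exact ⟨some ⟨j, hj⟩, h0, fun l hl => h l l.2 fun h => hl (Fin.ext h)⟩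
  · rintro (_ | j)
    · exact R.base (R.dalg.const 0)
    · exact R.mul (R.sinv (R.dalg.inv (p1 j)) j) (hg1 j)
  · rintro (_ | j) ω hω
    · have : f ω = 0 := by
        rw [p2]; refine Finset.sum_eq_zero fun j hj => ?_
        rw [show φ j ω = 0 from hω ⟨j, mem_range.1 hj⟩, mul_zero]
      rw [this, inv_zero]; rfl
    · change _ = (s ω ^ (j : ℕ))⁻¹ * (φ j ω)⁻¹ * g j ω
      rw [hg2 j ω hω, hfe j ω hω, mul_inv, mul_inv]

theorem tameT {n : ℕ} (hn : 0 < n) (c : ℚ_[p]) (j : ℕ) :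
    Tame {x : ℚ_[p] | ∃ t, TT 2 t ∧ t ^ q = x ∧ c * t ^ j ∈ Pset p n} := by
  obtain ⟨κ, hκ, hP⟩ := Pset_near1 (p := p) hn
  obtain ⟨M, hM, hroot⟩ := near1_root (p := p) R.hq.pos (max 2 κ)
  have key : ∀ (y : ℚ_[p]) (m : ℤ), (∃ t, TT 2 t ∧ t ^ q = y ∧ c * t ^ j ∈ Pset p n) →
      (∃ t, TT 2 t ∧ t ^ q = y * (((p : ℚ_[p]) ^ m) ^ n) ^ q ∧ c * t ^ j ∈ Pset p n) := by
    rintro y m ⟨t, h1, h2, h3⟩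
    have e : ((p : ℚ_[p]) ^ m) ^ n = (p : ℚ_[p]) ^ (m * n) := by rw [zpow_mul, zpow_natCast]
    refine ⟨t * ((p : ℚ_[p]) ^ m) ^ n, h1.mul (by norm_num) (by rw [e]; exact TT_p _ _), ?_, ?_⟩
    · rw [mul_pow, h2]
    · have := Pset_mul h3 (Pset_pow (n := n) (pow_ne_zero j (zpow_ne_zero m (pK_ne (p := p)))))
      convert this using 1
      ring
  refine ⟨n * q, M, Nat.mul_pos hn R.hq.pos, hM, fun x hx => ⟨fun h => ?_, fun h => ?_⟩, ?_⟩
  · have := key x 1 h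
    rwa [zpow_one, ← pow_mul] at this
  · have := key _ (-1) h
    have e : x * (p : ℚ_[p]) ^ (n * q) * (((p : ℚ_[p]) ^ (-1 : ℤ)) ^ n) ^ q = x := by
      rw [← pow_mul, zpow_neg_one, inv_pow, mul_assoc, mul_inv_cancel₀ (pow_ne_zero _ pK_ne), mul_one]
    rwa [e] at this
  · rintro x u hx hu ⟨t, h1, h2, h3⟩
    obtain ⟨ρ, r1, r2⟩ := hroot u hu
    refine ⟨t * ρ, h1.mul (by norm_num) (.of_near (r1.mono (le_max_left _ _))), ?_, ?_⟩
    · rw [mul_pow, h2, r2]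
    · have := Pset_mul h3 (hP _ ((r1.mono (le_max_right _ _)).pow hκ j))
      convert this using 1
      ring

theorem mm_dalg : IsDAlg (MM ℰ q s) := by
  refine ⟨fun c => R.base (R.dalg.const c), R.add, R.mul, R.inv, fun {k} a ha g hg => ?_⟩
  obtain ⟨c, F, hF⟩ := restricted_scale ha
  classical
  have h1 : (fun ω => if (∀ i, ‖g i ω‖ ≤ 1) then ((ev (fun i => toZ (g i ω)) F : ℤ_[p]) : ℚ_[p])
      else 0) ∈ MM ℰ q s :=
    R.ev_mem F hg (fun ω h => if_pos h) (fun ω h => if_neg h)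
  have h2 := R.mul (R.base (R.dalg.const ((p : ℚ_[p]) ^ c)⁻¹)) h1
  convert h2 using 1
  ext ω
  by_cases h : ∀ i, ‖g i ω‖ ≤ 1
  · rw [if_pos h, hF, inv_mul_cancel_left₀ (pow_ne_zero _ pK_ne)]
    have : (fun i => g i ω) = fun i => ((toZ (g i ω) : ℤ_[p]) : ℚ_[p]) := by
      ext1 i; rw [toZ_coe (h i)]
    rw [this]
  · rw [if_neg h, mul_zero, ranalFn, if_neg h]

theorem qf_zero {f : Ω → ℚ_[p]} (hf : f ∈ MM ℰ q s) : QF ℰ {ω | f ω = 0} := by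
  obtain ⟨φ, p1, p2, p3, p4⟩ := R.struct' (κ := 1) le_rfl hf
  refine (QF.fall R.dalg (fun (j : Fin q) ω => φ j ω = 0) fun j => QF.zero _ (p1 j)).of_eq ?_
  ext ω
  simp only [mem_ofPred_eq]
  constructor
  · intro h
    rw [p2]
    refine Finset.sum_eq_zero fun j hj => ?_
    rw [show φ j ω = 0 from h ⟨j, mem_range.1 hj⟩, mul_zero]
  · intro h j
    obtain ⟨i, hi, hd⟩ := p3 ω
    have := (p4 ω i hi hd).2.2 j j.2
    rw [h, norm_zero, norm_le_zero_iff] at this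
    exact (mul_eq_zero.1 this).resolve_left (pow_ne_zero _ (R.sne ω))

theorem qf_mon {n : ℕ} (hn : 0 < n) {φ : Ω → ℚ_[p]} (hφ : φ ∈ ℰ) (j : ℕ) :
    QF ℰ {ω | s ω ^ j * φ ω ∈ Pset p n} := by
  obtain ⟨L, hL, hr⟩ := Pset_reps (p := p) hn
  refine (QF.bex R.dalg L (fun l ω => l⁻¹ * φ ω ∈ Pset p n ∧
    x ω ∈ {y : ℚ_[p] | ∃ t, TT 2 t ∧ t ^ q = y ∧ l * t ^ j ∈ Pset p n}) fun l _ =>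
    (QF.pow _ (R.dalg.cmul l⁻¹ hφ) n hn).and (QF.tame R.dalg (R.tameT hn l j) R.hx)).of_eq ?_
  ext ω
  simp only [mem_ofPred_eq]
  constructor
  · rintro ⟨l, hl, h1, t, ht, h2, h3⟩
    have : t = s ω := TT_uniq R.hq ht (R.tt ω) (by rw [h2, R.hs])
    have := Pset_mul h1 h3
    rw [‹t = s ω›] at this
    have h0 := hL l hl
    convert this using 1
    field_simp
  · intro h
    have h0 : φ ω ≠ 0 := right_ne_zero_of_mul (Pset_ne h)
    obtain ⟨l, hl, h1⟩ := hr _ h0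
    refine ⟨l, hl, h1, s ω, R.tt ω, R.hs ω, ?_⟩
    have := Pset_mul h (Pset_inv h1)
    have h0' := hL l hl
    convert this using 1
    field_simp

theorem qf_pow {n : ℕ} (hn : 0 < n) {f : Ω → ℚ_[p]} (hf : f ∈ MM ℰ q s) :
    QF ℰ {ω | f ω ∈ Pset p n} := by
  obtain ⟨κ, hκ, hP⟩ := Pset_near1 (p := p) hn
  obtain ⟨φ, p1, p2, p3, p4⟩ := R.struct' hκ hf
  refine (QF.fex R.dalg (fun (j : Fin q) ω =>
      (∀ l : Fin q, l ≠ j → ‖s ω ^ (l : ℕ) * φ l ω‖ ≤ ‖s ω ^ (j : ℕ) * (p ^ κ * φ j ω)‖) ∧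
      s ω ^ (j : ℕ) * φ j ω ∈ Pset p n) fun j => QF.and (QF.fall R.dalg _ fun l => ?_)
      (R.qf_mon hn (p1 j) j)).of_eq ?_
  · by_cases h : l = j
    · exact (QF.univ R.dalg).of_eq (by ext; simp [h])
    · exact (R.qf_le (p1 l) (R.dalg.cmul ((p : ℚ_[p]) ^ κ) (p1 j)) l j).of_eq (by ext; simp [h])
  · ext ω
    simp only [mem_ofPred_eq]
    constructor
    · rintro ⟨j, h1, h2⟩
      obtain ⟨⟨u, hu, e⟩, _⟩ := p4 ω j j.2 (fun l hl hlj => h1 ⟨l, hl⟩ fun h => hlj (congrArg Fin.val h))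
      rw [e]
      exact Pset_mul h2 (hP u hu)
    · intro h
      obtain ⟨j, hj, hd⟩ := p3 ω
      obtain ⟨⟨u, hu, e⟩, _⟩ := p4 ω j hj hd
      refine ⟨⟨j, hj⟩, fun l hlj => hd l l.2 fun h => hlj (Fin.ext h), ?_⟩
      have := Pset_mul h (Pset_inv (hP u hu))
      rw [e, mul_inv_cancel_right₀ (hu.ne hκ)] at this
      exact this

theorem ext : Ext ℰ (MM ℰ q s) := by
  refine ⟨R.mm_dalg, fun f hf => R.base hf, fun S hS => ?_, fun f hf => ?_⟩
  · induction hS with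
    | zero f hf => exact R.qf_zero hf
    | pow f hf n hn => exact R.qf_pow hn hf
    | compl S hS ih => exact ih.compl
    | inter S T hS hT ih ih' => exact ih.inter _ _ ih'
  · obtain ⟨φ, p1, p2, p3, p4⟩ := R.struct' (κ := 1) le_rfl hf
    refine ⟨q, R.hq.pos, Set.range fun (j : Fin q) ω => x ω ^ (j : ℕ) * φ j ω ^ q,
      Set.finite_range _, ?_, fun ω => ?_⟩
    · rintro _ ⟨j, rfl⟩
      exact R.mon_mem (p1 j) j
    · obtain ⟨j, hj, hd⟩ := p3 ω
      refine ⟨_, ⟨⟨j, hj⟩, rfl⟩, ?_⟩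
      rw [(p4 ω j hj hd).2.1, R.norm_q]

theorem s_mem (hmax : ∀ ℱ, Ext ℰ ℱ → ℱ ⊆ ℰ) : s ∈ ℰ :=
  hmax _ R.ext (by simpa using R.mon 1 (R.dalg.const 1))

end RootData

structure Full (ℰ : Set (Ω → ℚ_[p])) : Prop where
  dalg : IsDAlg ℰ
  pw : PW ℰ ⊆ ℰ
  fr : ∀ h ∈ ℰ, ∀ a : ℕ, 0 < a → ∃ e ∈ ℰ, ∀ ω, (h ω = 0 → e ω = 0) ∧
    (h ω ≠ 0 → e ω ≠ 0 ∧ (e ω).valuation = (h ω).valuation / a)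

theorem val_tame {q : ℕ} (hq : 0 < q) (i : ℕ) :
    Tame {x : ℚ_[p] | x ≠ 0 ∧ x.valuation % q = i} := by
  refine ⟨q, 1, hq, le_rfl, fun x hx => ?_, fun x u hx hu h => ?_⟩
  · simp only [mem_ofPred_eq]
    rw [valuation_mul hx (pow_ne_zero _ pK_ne), Padic.valuation_pow, valuation_p]
    simp [hx, pK_ne (p := p)]
  · exact ⟨mul_ne_zero hx (hu.ne le_rfl), by rw [val_mul_near1 le_rfl hu]; exact h.2⟩

theorem fr_prime {ℰ : Set (Ω → ℚ_[p])} (hE : IsDAlg ℰ) (hmax : ∀ ℱ, Ext ℰ ℱ → ℱ ⊆ ℰ)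
    {q : ℕ} (hq : q.Prime) {h : Ω → ℚ_[p]} (hh : h ∈ ℰ) : ∃ e ∈ ℰ, ∀ ω, (h ω = 0 → e ω = 0) ∧
    (h ω ≠ 0 → e ω ≠ 0 ∧ (e ω).valuation = (h ω).valuation / q) := by
  classical
  have hpw : PW ℰ ⊆ ℰ := hmax _ (PW_ext hE)
  obtain ⟨M, hM, hroot⟩ := near1_root (p := p) hq.pos 2
  obtain ⟨x0, hx0, h1⟩ := toT hE hpw hM hh
  obtain ⟨k, hk, h2⟩ := pw_cover hpw (ι := Option (Fin q)) (τ := Unit)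
    (S := fun o => o.elim {ω | h ω = 0} (fun i => {ω | h ω ∈ {x : ℚ_[p] | x ≠ 0 ∧ x.valuation % q = (i : ℕ)}}))
    (g := fun o _ => o.elim (fun _ => 1) (fun i ω => x0 ω / (p : ℚ_[p]) ^ (i : ℕ))) (by
      rintro (_ | i)
      · exact QF.zero _ hh
      · exact QF.tame hE (val_tame hq.pos i) hh) (by
      intro ω
      by_cases h0 : h ω = 0
      · exact ⟨none, h0⟩
      · have hq0 : (q : ℤ) ≠ 0 := by exact_mod_cast hq.ne_zero
        refine ⟨some ⟨((h ω).valuation % q).toNat, ?_⟩, h0, ?_⟩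
        · rw [Int.toNat_lt (Int.emod_nonneg _ hq0)]
          exact Int.emod_lt_of_pos _ (by exact_mod_cast hq.pos)
        · exact (Int.toNat_of_nonneg (Int.emod_nonneg _ hq0)).symm) (by
      rintro (_ | i) _
      · exact hE.const 1
      · exact hE.div hx0 (hE.const _))
  have hs : ∀ ω, ∃ t : ℚ_[p], TT 2 t ∧ t ^ q = k () ω ∧ (h ω ≠ 0 → t.valuation = (h ω).valuation / q) := by
    intro ω
    obtain ⟨o, ho, e⟩ := h2 ω
    rw [e]
    match o with
    | none => exact ⟨1, .of_near near1_one, one_pow _, fun h => absurd ho h⟩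
    | some i =>
      obtain ⟨h0, hi⟩ := ho
      obtain ⟨hn, ht⟩ := h1 ω
      obtain ⟨j, hj⟩ := ht h0
      have hx00 : x0 ω ≠ 0 := (ht h0).ne hM
      have hv : (h ω).valuation = j := by
        rw [norm_eq_iff_val hx00 h0] at hn
        rw [← hn]
        have : x0 ω = (p : ℚ_[p]) ^ j * (x0 ω / (p : ℚ_[p]) ^ j) := by
          rw [mul_div_cancel₀ _ (zpow_ne_zero _ pK_ne)]
        rw [this, val_mul_near1 hM hj, valuation_zpow, valuation_p, mul_one]
      obtain ⟨ρ, r1, r2⟩ := hroot _ hj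
      refine ⟨ρ * (p : ℚ_[p]) ^ (j / q), (TT.of_near r1).mul (by norm_num) (TT_p _ _), ?_, fun _ => ?_⟩
      · change _ = x0 ω / (p : ℚ_[p]) ^ (i : ℕ)
        have hq0 : (p : ℚ_[p]) ^ j = ((p : ℚ_[p]) ^ (j / q)) ^ q * (p : ℚ_[p]) ^ (i : ℕ) := by
          rw [← zpow_natCast, ← zpow_natCast, ← zpow_mul, ← zpow_add₀ pK_ne, ← hi, hv,
            Int.ediv_mul_add_emod]
        rw [mul_pow, r2, hq0]
        have := pow_ne_zero q (zpow_ne_zero (j / q) (pK_ne (p := p)))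
        have := pow_ne_zero (i : ℕ) (pK_ne (p := p))
        field_simp
      · rw [mul_comm, val_mul_near1 (by norm_num) r1, valuation_zpow, valuation_p, mul_one, hv]
  choose s s1 s2 s3 using hs
  have R : RootData ℰ q (k ()) s := ⟨hE, hpw, hq, hk _, s2, s1⟩
  have hs := R.s_mem hmax
  refine ⟨fun ω => if h ω = 0 then 0 else s ω, pw_ite hpw (QF.zero _ hh) (hE.const 0) hs
    (fun ω hω => if_pos hω) (fun ω hω => if_neg hω), fun ω => ⟨fun h => if_pos h, fun h => ?_⟩⟩
  simp only
  rw [if_neg h]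
  exact ⟨(s1 ω).ne (by norm_num), s3 ω h⟩

theorem full_of_max {ℰ : Set (Ω → ℚ_[p])} (hE : IsDAlg ℰ) (hmax : ∀ ℱ, Ext ℰ ℱ → ℱ ⊆ ℰ) :
    Full ℰ := by
  refine ⟨hE, hmax _ (PW_ext hE), fun h hh a => ?_⟩
  induction a using Nat.recOnMul generalizing h with
  | zero => intro h; exact absurd h (lt_irrefl _)
  | one => exact fun _ => ⟨h, hh, fun ω => ⟨id, fun h => ⟨h, by simp⟩⟩⟩
  | prime q hq => exact fun _ => fr_prime hE hmax hq hh
  | mul a b iha ihb =>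
    intro hab
    obtain ⟨e, he, h1⟩ := iha h hh (Nat.pos_of_mul_pos_right hab)
    obtain ⟨e', he', h2⟩ := ihb e he (Nat.pos_of_mul_pos_left hab)
    refine ⟨e', he', fun ω => ⟨fun h0 => (h2 ω).1 ((h1 ω).1 h0), fun h0 => ?_⟩⟩
    obtain ⟨a1, a2⟩ := (h1 ω).2 h0
    obtain ⟨b1, b2⟩ := (h2 ω).2 a1
    refine ⟨b1, ?_⟩
    rw [b2, a2, Int.ediv_ediv_of_nonneg (by positivity)]
    push_cast
    rfl

theorem exists_full {𝒟 : Set (Ω → ℚ_[p])} (h : IsDAlg 𝒟) : ∃ ℰ, Ext 𝒟 ℰ ∧ Full ℰ := by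
  obtain ⟨ℰ, h1, h2⟩ := exists_max h
  exact ⟨ℰ, h1, full_of_max h1.dalg h2⟩

end root

section cell
variable {p : ℕ} [hp : Fact p.Prime] {Y : Type*}

/-- functions pulled back from the base -/
def pull (ℰ : Set (Y → ℚ_[p])) : Set (Y × ℚ_[p] → ℚ_[p]) := {g | ∃ e ∈ ℰ, g = fun w => e w.1}

structure Cell (ℰ : Set (Y → ℚ_[p])) where
  B : Set Y
  c : Y → ℚ_[p]
  α : Y → ℚ_[p]
  b : Y → ℚ_[p]
  hB : QF ℰ B
  hc : c ∈ ℰ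
  hα : α ∈ ℰ
  hb : b ∈ ℰ
  hab : ∀ y ∈ B, ‖α y * b y‖ ≤ 1

variable {ℰ : Set (Y → ℚ_[p])}

namespace Cell

noncomputable def τ (C : Cell ℰ) (w : Y × ℚ_[p]) : ℚ_[p] := w.2 - C.c w.1

def carrier (C : Cell ℰ) : Set (Y × ℚ_[p]) :=
  {w | w.1 ∈ C.B ∧ C.τ w ≠ 0 ∧ ‖C.α w.1‖ ≤ ‖C.τ w‖ ∧ ‖C.b w.1 * C.τ w‖ ≤ 1}

noncomputable def gens (C : Cell ℰ) : Set (Y × ℚ_[p] → ℚ_[p]) :=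
  pull ℰ ∪ {fun w => C.b w.1 * C.τ w, fun w => C.α w.1 / C.τ w}

def AN (C : Cell ℰ) (f : Y × ℚ_[p] → ℚ_[p]) : Prop := An C.carrier C.gens f

/-- prepared functions -/
def Prep (K : ℕ) (C : Cell ℰ) (f : Y × ℚ_[p] → ℚ_[p]) : Prop :=
  ∃ h ∈ ℰ, ∃ (a : ℤ) (U : Y × ℚ_[p] → ℚ_[p]), U1 C.carrier C.gens K U ∧
    ∀ w ∈ C.carrier, f w = h w.1 * C.τ w ^ a * U w

def Good (K : ℕ) (C' C : Cell ℰ) : Prop :=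
  C'.carrier ⊆ C.carrier ∧ (∀ f, C.AN f → C'.AN f) ∧ C'.Prep K C.τ

def SameC (C' C : Cell ℰ) : Prop := C'.c = C.c ∧ C'.carrier ⊆ C.carrier ∧ C'.B ⊆ C.B

variable {C C' C'' : Cell ℰ} {K : ℕ}

theorem SameC.refl : SameC C C := ⟨rfl, le_rfl, le_rfl⟩

theorem SameC.trans (h : SameC C'' C') (h' : SameC C' C) : SameC C'' C :=
  ⟨h.1.trans h'.1, h.2.1.trans h'.2.1, h.2.2.trans h'.2.2⟩

theorem SameC.τ_eq (h : SameC C' C) : C'.τ = C.τ := by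
  ext w; simp [τ, h.1]

/-- points on the fibre -/
theorem mem_α (C : Cell ℰ) {y : Y} (hy : y ∈ C.B) (h : C.α y ≠ 0) :
    (y, C.c y + C.α y) ∈ C.carrier ∧ C.τ (y, C.c y + C.α y) = C.α y := by
  have e : C.τ (y, C.c y + C.α y) = C.α y := by simp [τ]
  refine ⟨⟨hy, by rwa [e], by rw [e], ?_⟩, e⟩
  rw [e, mul_comm]; exact C.hab y hy

theorem mem_b (C : Cell ℰ) {y : Y} (hy : y ∈ C.B) (h : C.b y ≠ 0) :
    (y, C.c y + (C.b y)⁻¹) ∈ C.carrier ∧ C.τ (y, C.c y + (C.b y)⁻¹) = (C.b y)⁻¹ := by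
  have e : C.τ (y, C.c y + (C.b y)⁻¹) = (C.b y)⁻¹ := by simp [τ]
  refine ⟨⟨hy, by rw [e]; exact inv_ne_zero h, ?_, by rw [e, mul_inv_cancel₀ h, norm_one]⟩, e⟩
  have := C.hab y hy
  rw [e]
  change ‖C.α y‖ ≤ ‖(C.b y)⁻¹‖
  rw [norm_inv, ← one_div ‖C.b y‖, le_div_iff₀ (norm_pos_iff.2 h), ← norm_mul]
  exact this

theorem mem_small (C : Cell ℰ) {y : Y} (hy : y ∈ C.B) (h : C.α y = 0) {t : ℚ_[p]} (ht : t ≠ 0)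
    (hb : ‖C.b y * t‖ ≤ 1) :
    (y, C.c y + t) ∈ C.carrier ∧ C.τ (y, C.c y + t) = t := by
  have e : C.τ (y, C.c y + t) = t := by simp [τ]
  exact ⟨⟨hy, by rwa [e], by rw [e, h, norm_zero]; exact norm_nonneg _, by rwa [e]⟩, e⟩

theorem mem_large (C : Cell ℰ) {y : Y} (hy : y ∈ C.B) (h : C.b y = 0) {t : ℚ_[p]} (ht : t ≠ 0)
    (hb : ‖C.α y‖ ≤ ‖t‖) :
    (y, C.c y + t) ∈ C.carrier ∧ C.τ (y, C.c y + t) = t := by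
  have e : C.τ (y, C.c y + t) = t := by simp [τ]
  exact ⟨⟨hy, by rwa [e], by rwa [e], by rw [e, h, zero_mul, norm_zero]; exact zero_le_one⟩, e⟩

theorem mem_pull {e : Y → ℚ_[p]} (he : e ∈ ℰ) : (fun w : Y × ℚ_[p] => e w.1) ∈ pull ℰ := ⟨e, he, rfl⟩

theorem AN.base {e : Y → ℚ_[p]} (he : e ∈ ℰ) (hb : ∀ y ∈ C.B, ‖e y‖ ≤ 1) :
    C.AN (fun w => e w.1) := An.gen (Or.inl (mem_pull he)) fun w hw => hb _ hw.1

theorem AN.u (C : Cell ℰ) : C.AN (fun w => C.b w.1 * C.τ w) :=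
  An.gen (Or.inr (Or.inl rfl)) fun w hw => hw.2.2.2

theorem AN.v (C : Cell ℰ) : C.AN (fun w => C.α w.1 / C.τ w) :=
  An.gen (Or.inr (Or.inr rfl)) fun w hw => by
    change ‖C.α w.1 / C.τ w‖ ≤ 1
    rw [norm_div, div_le_one (norm_pos_iff.2 hw.2.1)]; exact hw.2.2.1

theorem exists_large (h r : ℚ_[p]) (hh : h ≠ 0) {n : ℕ} (hn : 0 < n) :
    ∃ t : ℚ_[p], t ≠ 0 ∧ ‖r‖ ≤ ‖t‖ ∧ 1 < ‖h * t ^ n‖ := by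
  obtain ⟨N, hN⟩ := NormedField.exists_lt_norm ℚ_[p] (max (max ‖r‖ 1) ‖h‖⁻¹)
  have h1 : 1 < ‖N‖ := lt_of_le_of_lt ((le_max_right _ _).trans (le_max_left _ _)) hN
  refine ⟨N, norm_pos_iff.1 (zero_lt_one.trans h1), ((le_max_left _ _).trans (le_max_left _ _)).trans hN.le, ?_⟩
  rw [norm_mul, norm_pow]
  have h2 : ‖N‖ ≤ ‖N‖ ^ n := le_self_pow₀ h1.le hn.ne'
  have h3 : ‖h‖⁻¹ < ‖N‖ := (le_max_right _ _).trans_lt hN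
  have h4 : 0 < ‖h‖ := norm_pos_iff.2 hh
  calc 1 = ‖h‖ * ‖h‖⁻¹ := (mul_inv_cancel₀ h4.ne').symm
    _ < ‖h‖ * ‖N‖ ^ n := mul_lt_mul_of_pos_left (h3.trans_le h2) h4

theorem exists_small (h r : ℚ_[p]) (hh : h ≠ 0) {n : ℕ} (hn : 0 < n) :
    ∃ t : ℚ_[p], t ≠ 0 ∧ ‖r * t‖ ≤ 1 ∧ 1 < ‖h * (t ^ n)⁻¹‖ := by
  obtain ⟨t, h0, h1, h2⟩ := exists_large h r hh hn
  refine ⟨t⁻¹, inv_ne_zero h0, ?_, by simpa using h2⟩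
  rw [norm_mul, norm_inv, ← div_eq_mul_inv, div_le_one (norm_pos_iff.2 h0)]
  exact h1

/-- bounded monomials are analytic -/
theorem Bd (hE : IsDAlg ℰ) {h : Y → ℚ_[p]} (hh : h ∈ ℰ) (a : ℤ)
    (hb : ∀ w ∈ C.carrier, ‖h w.1 * C.τ w ^ a‖ ≤ 1) : C.AN (fun w => h w.1 * C.τ w ^ a) := by
  obtain ⟨n, rfl | rfl⟩ := a.eq_nat_or_neg
  · rcases Nat.eq_zero_or_pos n with rfl | hn
    · refine An.congr (An.gen (Or.inl (mem_pull hh)) fun w hw => ?_) (g := fun w => h w.1 * C.τ w ^ ((0:ℕ):ℤ)) ?_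
      · simpa using hb w hw
      · intro w _; simp
    · have key : ∀ w ∈ C.carrier, C.b w.1 = 0 → h w.1 = 0 := by
        intro w hw h0
        by_contra h1
        obtain ⟨t, h2, h3, h4⟩ := exists_large (h w.1) (C.α w.1) h1 hn
        obtain ⟨h5, h6⟩ := C.mem_large hw.1 h0 h2 h3
        have := hb _ h5
        rw [h6, zpow_natCast] at this
        exact absurd this (not_le.2 h4)
      refine An.congr ((An.gen (Or.inl (mem_pull (hE.mul hh (hE.pow (hE.inv C.hb) n)))) ?_).mul ((AN.u C).pow n)) ?_
      · intro w hw
        change ‖h w.1 * ((C.b w.1)⁻¹) ^ n‖ ≤ 1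
        by_cases h0 : C.b w.1 = 0
        · simp [key w hw h0]
        · obtain ⟨h5, h6⟩ := C.mem_b hw.1 h0
          have := hb _ h5
          rwa [h6, zpow_natCast] at this
      · intro w hw
        by_cases h0 : C.b w.1 = 0
        · simp [key w hw h0]
        · simp only [zpow_natCast]
          rw [mul_assoc, ← mul_pow, inv_mul_cancel_left₀ h0]
  · rcases Nat.eq_zero_or_pos n with rfl | hn
    · refine An.congr (An.gen (Or.inl (mem_pull hh)) fun w hw => ?_) (g := fun w => h w.1 * C.τ w ^ (-((0:ℕ):ℤ))) ?_
      · simpa using hb w hw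
      · intro w _; simp
    · have key : ∀ w ∈ C.carrier, C.α w.1 = 0 → h w.1 = 0 := by
        intro w hw h0
        by_contra h1
        obtain ⟨t, h2, h3, h4⟩ := exists_small (h w.1) (C.b w.1) h1 hn
        obtain ⟨h5, h6⟩ := C.mem_small hw.1 h0 h2 h3
        have := hb _ h5
        rw [h6, zpow_neg, zpow_natCast] at this
        exact absurd this (not_le.2 h4)
      refine An.congr ((An.gen (Or.inl (mem_pull (hE.mul hh (hE.pow (hE.inv C.hα) n)))) ?_).mul ((AN.v C).pow n)) ?_
      · intro w hw
        change ‖h w.1 * ((C.α w.1)⁻¹) ^ n‖ ≤ 1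
        by_cases h0 : C.α w.1 = 0
        · simp [key w hw h0]
        · obtain ⟨h5, h6⟩ := C.mem_α hw.1 h0
          have := hb _ h5
          rw [h6, zpow_neg, zpow_natCast] at this
          rwa [inv_pow]
      · intro w hw
        have ht := hw.2.1
        by_cases h0 : C.α w.1 = 0
        · simp [key w hw h0]
        · simp only [zpow_neg, zpow_natCast]
          rw [mul_assoc, ← mul_pow, div_eq_mul_inv, inv_mul_cancel_left₀ h0, inv_pow]

theorem U1.transfer {Z Z' : Set (Y × ℚ_[p])} {𝒢 𝒢'} (hZ : Z' ⊆ Z) (h : ∀ f, An Z 𝒢 f → An Z' 𝒢' f) {K : ℕ}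
    {U : Y × ℚ_[p] → ℚ_[p]} (hU : U1 Z 𝒢 K U) : U1 Z' 𝒢' K U := by
  obtain ⟨φ, h1, h2⟩ := hU
  exact ⟨φ, h φ h1, fun w hw => h2 w (hZ hw)⟩

theorem Prep.congr {f g : Y × ℚ_[p] → ℚ_[p]} (h : C.Prep K f) (e : ∀ w ∈ C.carrier, g w = f w) : C.Prep K g := by
  obtain ⟨k, hk, a, U, hU, h⟩ := h
  exact ⟨k, hk, a, U, hU, fun w hw => (e w hw).trans (h w hw)⟩

theorem Good.prep (hE : IsDAlg ℰ) (hK : 1 ≤ K) (hG : Good K C' C) {f} (hf : C.Prep K f) : C'.Prep K f := by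
  obtain ⟨h1, h2, k, hk, a, U, hU, h3⟩ := hG
  obtain ⟨k', hk', a', U', hU', h4⟩ := hf
  refine ⟨_, hE.mul hk' (hE.zpow hk a'), a * a', _, (hU.zpow hK a').mul (U1.transfer h1 h2 hU'), fun w hw => ?_⟩
  rw [h4 w (h1 hw), h3 w hw, mul_zpow, mul_zpow, zpow_mul]
  ring

theorem Good.trans (hE : IsDAlg ℰ) (hK : 1 ≤ K) (h : Good K C'' C') (h' : Good K C' C) : Good K C'' C :=
  ⟨h.1.trans h'.1, fun f hf => h.2.1 f (h'.2.1 f hf), h.prep hE hK h'.2.2⟩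

theorem Prep.τ (hE : IsDAlg ℰ) (K : ℕ) (C : Cell ℰ) : C.Prep K C.τ :=
  ⟨_, hE.const 1, 1, _, U1.one, fun w _ => by simp⟩

theorem Prep.base (hE : IsDAlg ℰ) (K : ℕ) (C : Cell ℰ) {h} (hh : h ∈ ℰ) : C.Prep K (fun w => h w.1) :=
  ⟨_, hh, 0, _, U1.one, fun w _ => by simp⟩

theorem Prep.mul (hE : IsDAlg ℰ) {f g} (hf : C.Prep K f) (hg : C.Prep K g) : C.Prep K (fun w => f w * g w) := by
  obtain ⟨k, hk, a, U, hU, h3⟩ := hf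
  obtain ⟨k', hk', a', U', hU', h4⟩ := hg
  refine ⟨_, hE.mul hk hk', a + a', _, hU.mul hU', fun w hw => ?_⟩
  change f w * g w = _
  rw [h4 w hw, h3 w hw, zpow_add₀ hw.2.1]; ring

theorem Prep.inv (hE : IsDAlg ℰ) (hK : 1 ≤ K) {f} (hf : C.Prep K f) : C.Prep K (fun w => (f w)⁻¹) := by
  obtain ⟨k, hk, a, U, hU, h3⟩ := hf
  refine ⟨_, hE.inv hk, -a, _, hU.inv hK, fun w hw => ?_⟩
  change (f w)⁻¹ = _
  rw [h3 w hw, mul_inv, mul_inv, zpow_neg]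

theorem SameC.good (hE : IsDAlg ℰ) (K : ℕ) (h : SameC C' C) : Good K C' C := by
  refine ⟨h.2.1, fun f hf => ?_, ?_⟩
  · refine An.bind hf h.2.1 ?_
    rintro g (hg | rfl | rfl) hb
    · exact An.gen (Or.inl hg) fun w hw => hb w (h.2.1 hw)
    · refine An.congr (Bd hE C.hb 1 ?_) ?_
      · intro w hw; rw [h.τ_eq, zpow_one]; exact hb w (h.2.1 hw)
      · intro w hw; rw [h.τ_eq, zpow_one]
    · refine An.congr (Bd hE C.hα (-1) ?_) ?_
      · intro w hw; rw [h.τ_eq, zpow_neg_one, ← div_eq_mul_inv]; exact hb w (h.2.1 hw)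
      · intro w hw; rw [h.τ_eq, zpow_neg_one, ← div_eq_mul_inv]
  · rw [← h.τ_eq]; exact Prep.τ hE K C'

def restr (hE : IsDAlg ℰ) (C : Cell ℰ) (D : Set Y) (hD : QF ℰ D) : Cell ℰ where
  B := C.B ∩ D
  c := C.c
  α := C.α
  b := C.b
  hB := C.hB.inter _ _ hD
  hc := C.hc
  hα := C.hα
  hb := C.hb
  hab := fun y hy => C.hab y hy.1

theorem restr_carrier (hE : IsDAlg ℰ) (C : Cell ℰ) (D : Set Y) (hD : QF ℰ D) :
    (C.restr hE D hD).carrier = C.carrier ∩ {w | w.1 ∈ D} := by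
  ext w; simp only [carrier, restr, τ, Set.mem_inter_iff, mem_ofPred_eq]; tauto

theorem restr_same (hE : IsDAlg ℰ) (C : Cell ℰ) (D : Set Y) (hD : QF ℰ D) :
    SameC (C.restr hE D hD) C :=
  ⟨rfl, by rw [restr_carrier]; exact Set.inter_subset_left, Set.inter_subset_left⟩

end Cell

/-- decompositions into cells with property `Q` and graphs -/
inductive Dec (Q : Cell ℰ → Prop) : Set (Y × ℚ_[p]) → Prop
  | cell (C : Cell ℰ) (h : Q C) : Dec Q C.carrier
  | pt (B : Set Y) (hB : QF ℰ B) (c : Y → ℚ_[p]) (hc : c ∈ ℰ) : Dec Q {w | w.1 ∈ B ∧ w.2 = c w.1}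
  | union (S T : Set (Y × ℚ_[p])) (hS : Dec Q S) (hT : Dec Q T) (h : Disjoint S T) : Dec Q (S ∪ T)

namespace Dec
variable {Q Q' : Cell ℰ → Prop} {S T : Set (Y × ℚ_[p])}

theorem of_eq (h : Dec Q S) (e : S = T) : Dec Q T := e ▸ h

theorem empty (hE : IsDAlg ℰ) : Dec Q (∅ : Set (Y × ℚ_[p])) :=
  (pt ∅ (QF.empty hE) _ (hE.const 0)).of_eq (by ext w; simp)

theorem bind (h : Dec Q S) (hQ : ∀ C, Q C → C.carrier ⊆ S → Dec Q' C.carrier) : Dec Q' S := by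
  induction h with
  | cell C h => exact hQ C h le_rfl
  | pt B hB c hc => exact pt B hB c hc
  | union S T hS hT h ih ih' =>
    exact union S T (ih fun C h1 h2 => hQ C h1 (h2.trans Set.subset_union_left))
      (ih' fun C h1 h2 => hQ C h1 (h2.trans Set.subset_union_right)) h

theorem mono (h : Dec Q S) (hQ : ∀ C, Q C → C.carrier ⊆ S → Q' C) : Dec Q' S :=
  h.bind fun C h1 h2 => cell C (hQ C h1 h2)

theorem union' (hS : Dec Q S) (hT : Dec Q T) (h : ∀ w ∈ S, w ∉ T) {R} (e : ∀ w, w ∈ R ↔ w ∈ S ∨ w ∈ T) : Dec Q R :=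
  (union S T hS hT (Set.disjoint_left.2 h)).of_eq (by ext w; exact (e w).symm)

/-- split according to the base -/
theorem split (hE : IsDAlg ℰ) (C : Cell ℰ) {D : Set Y} (hD : QF ℰ D) (h1 : Dec Q (C.restr hE D hD).carrier)
    (h2 : Dec Q (C.restr hE Dᶜ hD.compl).carrier) : Dec Q C.carrier := by
  rw [Cell.restr_carrier] at h1 h2
  refine h1.union' h2 (fun w hw hw' => hw'.2 hw.2) fun w => ?_
  by_cases hw : w.1 ∈ D
  · simp [hw]
  · simp [hw]

/-- disjoint finite unions -/
theorem fUnion (hE : IsDAlg ℰ) {ι : Type*} (s : Finset ι) {T : ι → Set (Y × ℚ_[p])} (h : ∀ i ∈ s, Dec Q (T i))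
    (hd : ∀ i ∈ s, ∀ j ∈ s, i ≠ j → Disjoint (T i) (T j)) : Dec Q {w | ∃ i ∈ s, w ∈ T i} := by
  classical
  induction s using induction_on with
  | empty => exact (empty hE).of_eq (by ext; simp)
  | insert a s ha ih =>
    refine (h a (by simp)).union' (ih (fun i hi => h i (by simp [hi])) (fun i hi j hj => hd i (by simp [hi]) j (by simp [hj]))) ?_ ?_
    · rintro w hw ⟨i, hi, hw'⟩
      exact Set.disjoint_left.1 (hd a (by simp) i (by simp [hi]) (by rintro rfl; exact ha hi)) hw hw'
    · intro w; simp [Finset.exists_mem_insert]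

/-- finite covers of the base -/
theorem cover (hE : IsDAlg ℰ) {ι : Type*} (s : Finset ι) {D : ι → Set Y} (hD : ∀ i, QF ℰ (D i)) (C : Cell ℰ)
    (hc : ∀ y ∈ C.B, ∃ i ∈ s, y ∈ D i)
    (h : ∀ i ∈ s, ∀ C' : Cell ℰ, Cell.SameC C' C → C'.B ⊆ D i → Dec Q C'.carrier) : Dec Q C.carrier := by
  classical
  induction s using induction_on generalizing C with
  | empty => exact (empty hE).of_eq (by ext w; simp; intro hw; simpa using hc _ hw.1)
  | insert a s ha ih =>
    refine split hE C (hD a) (h a (by simp) _ (Cell.restr_same ..) Set.inter_subset_right) (ih _ ?_ ?_)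
    · rintro y ⟨h1, h2⟩
      obtain ⟨i, hi, hy⟩ := hc y h1
      rcases Finset.mem_insert.1 hi with rfl | hi
      · exact absurd hy h2
      · exact ⟨i, hi, hy⟩
    · intro i hi C' hC'
      exact h i (by simp [hi]) C' (hC'.trans (Cell.restr_same ..))

end Dec
end cell

section cut
variable {p : ℕ} [hp : Fact p.Prime] {Y : Type*} {ℰ : Set (Y → ℚ_[p])}

theorem max_fn (hF : Full ℰ) {f g : Y → ℚ_[p]} (hf : f ∈ ℰ) (hg : g ∈ ℰ) :
    ∃ k ∈ ℰ, ∀ y, ‖k y‖ = max ‖f y‖ ‖g y‖ := by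
  classical
  refine ⟨fun y => if ‖f y‖ ≤ ‖g y‖ then g y else f y,
    pw_ite hF.pw (QF.norm_le hF.dalg hf hg) hg hf (fun y hy => if_pos hy) (fun y hy => if_neg hy), fun y => ?_⟩
  by_cases h : ‖f y‖ ≤ ‖g y‖
  · simp only [if_pos h, max_eq_right h]
  · simp only [if_neg h, max_eq_left (not_le.1 h).le]

namespace Cell
variable {C C' : Cell ℰ} {K : ℕ}

theorem norm_mul_le_one {x y : ℚ_[p]} (hx : x ≠ 0) : ‖x * y‖ ≤ 1 ↔ ‖y‖ ≤ ‖x⁻¹‖ := by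
  rw [norm_mul, norm_inv, ← one_div, le_div_iff₀ (norm_pos_iff.2 hx), mul_comm]

theorem Cut (hF : Full ℰ) (C : Cell ℰ) {e : Y → ℚ_[p]} (he : e ∈ ℰ) :
    Dec (fun C' => SameC C' C ∧ ((∀ w ∈ C'.carrier, ‖C'.τ w‖ ≤ ‖e w.1‖) ∨
      ∀ w ∈ C'.carrier, ‖e w.1‖ < ‖C'.τ w‖)) C.carrier := by
  have hE := hF.dalg
  obtain ⟨b1, hb1, hb1'⟩ := max_fn hF C.hb (hE.inv he)
  obtain ⟨α2, hα2, hα2'⟩ := max_fn hF C.hα (hE.div he (hE.const (p : ℚ_[p])))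
  let C1 : Cell ℰ :=
    { B := C.B ∩ {y | e y ≠ 0 ∧ ‖C.α y‖ ≤ ‖e y‖}
      c := C.c
      α := C.α
      b := b1
      hB := C.hB.inter _ _ (QF.and (QF.ne he) (QF.norm_le hE C.hα he))
      hc := C.hc
      hα := C.hα
      hb := hb1
      hab := fun y hy => by
        rw [norm_mul, hb1']
        rcases max_choice ‖C.b y‖ ‖(e y)⁻¹‖ with h | h <;> rw [h, ← norm_mul]
        · exact C.hab y hy.1
        · rw [mul_comm, norm_mul_le_one (inv_ne_zero hy.2.1), inv_inv]; exact hy.2.2 }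
  let C2 : Cell ℰ :=
    { B := C.B ∩ {y | ‖α2 y * C.b y‖ ≤ 1}
      c := C.c
      α := α2
      b := C.b
      hB := C.hB.inter _ _ (QF.norm_le_one hE (hE.mul hα2 C.hb))
      hc := C.hc
      hα := hα2
      hb := C.hb
      hab := fun y hy => hy.2 }
  have m1 : ∀ w, w ∈ C1.carrier ↔ w ∈ C.carrier ∧ ‖C.τ w‖ ≤ ‖e w.1‖ := by
    intro w
    constructor
    · rintro ⟨⟨h1, h2, h3⟩, h4, h5, h6⟩
      change ‖b1 w.1 * C.τ w‖ ≤ 1 at h6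
      rw [norm_mul, hb1', max_mul_of_nonneg _ _ (norm_nonneg _), max_le_iff, ← norm_mul, ← norm_mul,
        norm_mul_le_one (inv_ne_zero h2), inv_inv] at h6
      exact ⟨⟨h1, h4, h5, h6.1⟩, h6.2⟩
    · rintro ⟨⟨h1, h2, h3, h4⟩, h5⟩
      have h0 : e w.1 ≠ 0 := fun h0 => by
        rw [h0, norm_zero] at h5; exact h2 (norm_le_zero_iff.1 h5)
      refine ⟨⟨h1, h0, h3.trans h5⟩, h2, h3, ?_⟩
      change ‖b1 w.1 * C.τ w‖ ≤ 1
      rw [norm_mul, hb1', max_mul_of_nonneg _ _ (norm_nonneg _), max_le_iff, ← norm_mul, ← norm_mul,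
        norm_mul_le_one (inv_ne_zero h0), inv_inv]
      exact ⟨h4, h5⟩
  have hlt : ∀ w, C.τ w ≠ 0 → (‖e w.1‖ < ‖C.τ w‖ ↔ ‖e w.1 / p‖ ≤ ‖C.τ w‖) := by
    intro w hw
    rw [norm_lt_iff_mul hw, norm_div, norm_mul, div_le_iff₀ normp_pos, mul_comm]
  have m2 : ∀ w, w ∈ C2.carrier ↔ w ∈ C.carrier ∧ ‖e w.1‖ < ‖C.τ w‖ := by
    intro w
    constructor
    · rintro ⟨⟨h1, h2⟩, h4, h5, h6⟩
      change ‖α2 w.1‖ ≤ ‖C.τ w‖ at h5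
      rw [hα2', max_le_iff] at h5
      exact ⟨⟨h1, h4, h5.1, h6⟩, (hlt w h4).2 h5.2⟩
    · rintro ⟨⟨h1, h2, h3, h4⟩, h5⟩
      have h7 : ‖α2 w.1‖ ≤ ‖C.τ w‖ := by rw [hα2', max_le_iff]; exact ⟨h3, (hlt w h2).1 h5⟩
      refine ⟨⟨h1, ?_⟩, h2, h7, h4⟩
      change ‖α2 w.1 * C.b w.1‖ ≤ 1
      refine le_trans ?_ h4
      rw [norm_mul, norm_mul, mul_comm]
      exact mul_le_mul_of_nonneg_left h7 (norm_nonneg _)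
  refine (Dec.cell C1 ?_).union' (Dec.cell C2 ?_) (fun w h h' => ?_) (fun w => ?_)
  · exact ⟨⟨rfl, fun w hw => ((m1 w).1 hw).1, fun y hy => hy.1⟩, Or.inl fun w hw => ((m1 w).1 hw).2⟩
  · exact ⟨⟨rfl, fun w hw => ((m2 w).1 hw).1, fun y hy => hy.1⟩, Or.inr fun w hw => ((m2 w).1 hw).2⟩
  · exact absurd ((m1 w).1 h).2 (not_le.2 ((m2 w).1 h').2)
  · rw [m1, m2]
    have := le_or_gt ‖C.τ w‖ ‖e w.1‖
    tauto

/-- dichotomy -/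
def Dich (C : Cell ℰ) (h : Y → ℚ_[p]) (a : ℤ) : Prop :=
  (∀ w ∈ C.carrier, ‖h w.1 * C.τ w ^ a‖ ≤ 1) ∨ ∀ w ∈ C.carrier, 1 < ‖h w.1 * C.τ w ^ a‖

theorem Dich.same {h a} (H : C.Dich h a) (hs : SameC C' C) : C'.Dich h a := by
  rcases H with H | H
  · exact Or.inl fun w hw => by rw [hs.τ_eq]; exact H w (hs.2.1 hw)
  · exact Or.inr fun w hw => by rw [hs.τ_eq]; exact H w (hs.2.1 hw)

theorem norm_le_one_iff_val {x : ℚ_[p]} (hx : x ≠ 0) : ‖x‖ ≤ 1 ↔ 0 ≤ x.valuation := by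
  have := norm_le_iff_val hx (one_ne_zero (α := ℚ_[p]))
  rwa [norm_one, Padic.valuation_one] at this

theorem CutM (hF : Full ℰ) (C : Cell ℰ) {h : Y → ℚ_[p]} (hh : h ∈ ℰ) (a : ℤ) :
    Dec (fun C' => SameC C' C ∧ C'.Dich h a) C.carrier := by
  have hE := hF.dalg
  refine Dec.split hE C (QF.zero h hh) (Dec.cell _ ⟨restr_same .., Or.inl fun w hw => ?_⟩) ?_
  · have : h w.1 = 0 := hw.1.2
    simp [this]
  generalize hC0 : restr hE C {y | h y = 0}ᶜ _ = C0
  have hs : SameC C0 C := hC0 ▸ restr_same ..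
  have h0 : ∀ w ∈ C0.carrier, h w.1 ≠ 0 := by
    intro w hw; subst hC0; exact hw.1.2
  obtain ⟨n, hn⟩ := a.eq_nat_or_neg
  rcases Nat.eq_zero_or_pos n with rfl | hn0
  · have ha : a = 0 := by simpa using hn
    refine Dec.split hE C0 (QF.norm_le_one hE hh) (Dec.cell _ ⟨(restr_same ..).trans hs, Or.inl fun w hw => ?_⟩)
      (Dec.cell _ ⟨(restr_same ..).trans hs, Or.inr fun w hw => ?_⟩)
    · have : ‖h w.1‖ ≤ 1 := hw.1.2
      simpa [ha] using this
    · have : ¬ ‖h w.1‖ ≤ 1 := hw.1.2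
      simpa [ha] using this
  obtain ⟨e, he, hev⟩ := hF.fr h hh n hn0
  have hn0' : (0 : ℤ) < n := by exact_mod_cast hn0
  rcases hn with rfl | rfl
  · have key : ∀ w ∈ C0.carrier, (‖h w.1 * C0.τ w ^ (n : ℤ)‖ ≤ 1 ↔ ‖C0.τ w‖ ≤ ‖(e w.1)⁻¹‖) := by
      intro w hw
      have h1 := h0 w hw
      have h2 := hw.2.1
      obtain ⟨h3, h4⟩ := (hev w.1).2 h1
      rw [norm_le_one_iff_val (mul_ne_zero h1 (zpow_ne_zero _ h2)), valuation_mul h1 (zpow_ne_zero _ h2),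
        valuation_zpow, norm_le_iff_val h2 (inv_ne_zero h3), valuation_inv, h4, neg_le,
        Int.le_ediv_iff_mul_le hn0', ]
      constructor <;> intro h <;> nlinarith
    refine (Cut hF C0 (hE.inv he)).mono fun C' hC' _ => ⟨hC'.1.trans hs, ?_⟩
    have hq := hC'.1.τ_eq
    rcases hC'.2 with h | h
    · exact Or.inl fun w hw => by rw [hq, key w (hC'.1.2.1 hw), ← hq]; exact h w hw
    · exact Or.inr fun w hw => by rw [hq, ← not_le, key w (hC'.1.2.1 hw), ← hq]; exact not_le.2 (h w hw)
  · have key : ∀ w ∈ C0.carrier, (‖h w.1 * C0.τ w ^ (-(n : ℤ))‖ ≤ 1 ↔ ‖p * e w.1‖ < ‖C0.τ w‖) := by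
      intro w hw
      have h1 := h0 w hw
      have h2 := hw.2.1
      obtain ⟨h3, h4⟩ := (hev w.1).2 h1
      rw [norm_le_one_iff_val (mul_ne_zero h1 (zpow_ne_zero _ h2)), valuation_mul h1 (zpow_ne_zero _ h2),
        valuation_zpow, ← not_le, norm_le_iff_val h2 (mul_ne_zero pK_ne h3), valuation_mul pK_ne h3,
        valuation_p, h4]
      have := Int.le_ediv_iff_mul_le (a := (C0.τ w).valuation) (b := (h w.1).valuation) hn0'
      constructor
      · intro h
        have := this.2 (by nlinarith)
        omega
      · intro h
        have := this.1 (by omega)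
        nlinarith
    refine (Cut hF C0 (hE.mul (hE.const (p : ℚ_[p])) he)).mono fun C' hC' _ => ⟨hC'.1.trans hs, ?_⟩
    have hq := hC'.1.τ_eq
    rcases hC'.2 with h | h
    · exact Or.inr fun w hw => by rw [hq, ← not_le, key w (hC'.1.2.1 hw), ← hq, not_lt]; exact h w hw
    · exact Or.inl fun w hw => by rw [hq, key w (hC'.1.2.1 hw), ← hq]; exact h w hw

theorem CutAll (hF : Full ℰ) (C : Cell ℰ) {ι : Type*} (s : Finset ι) {h : ι → Y → ℚ_[p]} (hh : ∀ i, h i ∈ ℰ)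
    (a : ι → ℤ) : Dec (fun C' => SameC C' C ∧ ∀ i ∈ s, C'.Dich (h i) (a i)) C.carrier := by
  classical
  induction s using induction_on with
  | empty => exact Dec.cell _ ⟨SameC.refl, by simp⟩
  | insert i s hi ih =>
    refine ih.bind fun C1 h1 _ => (CutM hF C1 (hh i) (a i)).mono fun C2 h2 _ => ⟨h2.1.trans h1.1, fun j hj => ?_⟩
    rcases Finset.mem_insert.1 hj with rfl | hj
    · exact h2.2
    · exact (h1.2 j hj).same h2.1

/-- the norm of the coordinate is constant on fibres -/
def Sphere (C : Cell ℰ) : Prop := ∀ w ∈ C.carrier, ∀ w' ∈ C.carrier, w.1 = w'.1 → ‖C.τ w‖ = ‖C.τ w'‖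

theorem NF1 (hF : Full ℰ) (hK : 1 ≤ K) (C : Cell ℰ) (E : Finset ℤ) {Cf : ℤ → Y → ℚ_[p]} (hCf : ∀ e, Cf e ∈ ℰ)
    {U : ℤ → Y × ℚ_[p] → ℚ_[p]} (hU : ∀ e, U1 C.carrier C.gens K (U e)) {φ : Y × ℚ_[p] → ℚ_[p]}
    (hφ : ∀ w ∈ C.carrier, φ w = ∑ e ∈ E, Cf e w.1 * C.τ w ^ e * U e w)
    (hne : ∀ y ∈ C.B, ∀ e ∈ E, Cf e y ≠ 0) :
    Dec (fun C' => SameC C' C ∧ (C'.Prep K φ ∨ C'.Sphere)) C.carrier := by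
  classical
  have hE := hF.dalg
  refine (CutAll hF C (E ×ˢ E ×ˢ range (K + 1))
    (h := fun i y => ((p : ℚ_[p]) ^ i.2.2)⁻¹ * (Cf i.1 y / Cf i.2.1 y)) (fun i => hE.cmul _ (hE.div (hCf _) (hCf _)))
    (fun i => i.1 - i.2.1)).mono fun C' hC' _ => ⟨hC'.1, ?_⟩
  obtain ⟨hs, hd⟩ := hC'
  have hq := hs.τ_eq
  have hsub := hs.2.1
  rcases E.eq_empty_or_nonempty with rfl | hEne
  · refine Or.inl ⟨_, hE.const 0, 0, _, U1.one, fun w hw => ?_⟩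
    simp [hφ w (hsub hw)]
  by_cases hemp : ∀ w, w ∉ C'.carrier
  · exact Or.inr fun w hw => absurd hw (hemp w)
  push Not at hemp
  obtain ⟨w0, hw0⟩ := hemp
  obtain ⟨f, hfE, hf⟩ := Finset.exists_max_image E (fun e => ‖Cf e w0.1 * C'.τ w0 ^ e‖) hEne
  -- ratios
  have rat : ∀ w ∈ C'.carrier, ∀ e ∈ E, ∀ k : ℕ, ‖((p : ℚ_[p]) ^ k)⁻¹ * (Cf e w.1 / Cf f w.1) * C'.τ w ^ (e - f)‖ ≤ 1 ↔
      ‖Cf e w.1 * C'.τ w ^ e‖ ≤ ‖(p : ℚ_[p]) ^ k‖ * ‖Cf f w.1 * C'.τ w ^ f‖ := by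
    intro w hw e he k
    have h1 := hne w.1 (hsub hw).1 f hfE
    have h2 := zpow_ne_zero f hw.2.1
    have : ((p : ℚ_[p]) ^ k)⁻¹ * (Cf e w.1 / Cf f w.1) * C'.τ w ^ (e - f) =
        (Cf e w.1 * C'.τ w ^ e) / (p ^ k * (Cf f w.1 * C'.τ w ^ f)) := by
      rw [zpow_sub₀ hw.2.1]; have := pow_ne_zero k (pK_ne (p := p)); field_simp
    rw [this, norm_div, norm_mul ((p : ℚ_[p]) ^ k), div_le_one (mul_pos (normpow_pos k) (norm_pos_iff.2 (mul_ne_zero h1 h2)))]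
  have dic : ∀ e ∈ E, ∀ k ≤ K, ∀ w ∈ C'.carrier, ‖Cf e w.1 * C'.τ w ^ e‖ ≤ ‖(p : ℚ_[p]) ^ k‖ * ‖Cf f w.1 * C'.τ w ^ f‖ →
      ∀ w ∈ C'.carrier, ‖Cf e w.1 * C'.τ w ^ e‖ ≤ ‖(p : ℚ_[p]) ^ k‖ * ‖Cf f w.1 * C'.τ w ^ f‖ := by
    intro e he k hk w hw hle w' hw'
    rcases hd (e, f, k) (by simp [he, hfE]; omega) with h | h
    · exact (rat w' hw' e he k).1 (h w' hw')
    · exact absurd ((rat w hw e he k).2 hle) (not_le.2 (h w hw))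
  by_cases hall : ∀ e ∈ E, e ≠ f → ‖Cf e w0.1 * C'.τ w0 ^ e‖ ≤ ‖(p : ℚ_[p]) ^ K‖ * ‖Cf f w0.1 * C'.τ w0 ^ f‖
  · left
    have hU' : ∀ e, U1 C'.carrier C'.gens K (U e) := fun e => U1.transfer hsub (hs.good hE K).2.1 (hU e)
    refine ⟨Cf f, hCf f, f, fun w => U f w * (1 + p ^ K * ∑ e ∈ E.erase f,
      ((p : ℚ_[p]) ^ K)⁻¹ * (Cf e w.1 / Cf f w.1) * C'.τ w ^ (e - f) * (U e w * (U f w)⁻¹)),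
      (hU' f).mul ⟨_, An.sum (E.erase f) (f := fun e w => ((p : ℚ_[p]) ^ K)⁻¹ * (Cf e w.1 / Cf f w.1) * C'.τ w ^ (e - f) * (U e w * (U f w)⁻¹))
        fun e he => An.mul (Bd hE (hE.cmul ((p : ℚ_[p]) ^ K)⁻¹ (hE.div (hCf e) (hCf f))) (e - f) fun w hw => ?_) ?_, fun w _ => rfl⟩, fun w hw => ?_⟩
    · have he' := Finset.mem_erase.1 he
      exact (rat w hw e he'.2 K).2 (dic e he'.2 K le_rfl w0 hw0 (hall e he'.2 he'.1) w hw)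
    · exact (hU' e).toAn.mul ((hU' f).inv hK).toAn
    · rw [hφ w (hsub hw), ← Finset.add_sum_erase _ _ hfE, ← hq]
      have h1 := hne w.1 (hsub hw).1 f hfE
      have h3 := ((hU' f).near hw).ne hK
      simp only []
      rw [mul_sum, mul_add, mul_add, mul_one, mul_sum, mul_sum]
      congr 1
      refine sum_congr rfl fun e _ => ?_
      have h2 := pow_ne_zero K (pK_ne (p := p))
      rw [zpow_sub₀ hw.2.1]
      have h4 := zpow_ne_zero f hw.2.1
      field_simp
  · right
    push Not at hall
    obtain ⟨e, he, hef, hlt⟩ := hall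
    -- the largest `k`
    have h0 : ∀ w ∈ C'.carrier, ‖Cf e w.1 * C'.τ w ^ e‖ ≤ ‖(p : ℚ_[p]) ^ 0‖ * ‖Cf f w.1 * C'.τ w ^ f‖ :=
      dic e he 0 (Nat.zero_le _) w0 hw0 (by simpa using hf e he)
    obtain ⟨k, hkK, hk1, hk2⟩ : ∃ k < K, ‖Cf e w0.1 * C'.τ w0 ^ e‖ ≤ ‖(p : ℚ_[p]) ^ k‖ * ‖Cf f w0.1 * C'.τ w0 ^ f‖ ∧
        ¬ ‖Cf e w0.1 * C'.τ w0 ^ e‖ ≤ ‖(p : ℚ_[p]) ^ (k + 1)‖ * ‖Cf f w0.1 * C'.τ w0 ^ f‖ := by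
      by_contra hcon
      push Not at hcon
      have : ∀ k ≤ K, ‖Cf e w0.1 * C'.τ w0 ^ e‖ ≤ ‖(p : ℚ_[p]) ^ k‖ * ‖Cf f w0.1 * C'.τ w0 ^ f‖ := by
        intro k
        induction k with
        | zero => exact fun _ => h0 w0 hw0
        | succ k ih => exact fun hk => hcon k (by omega) (ih (by omega))
      exact absurd (this K le_rfl) (not_le.2 hlt)
    have hA := dic e he k hkK.le w0 hw0 hk1
    have hB : ∀ w ∈ C'.carrier, ‖Cf e w.1 * C'.τ w ^ e‖ = ‖(p : ℚ_[p]) ^ k‖ * ‖Cf f w.1 * C'.τ w ^ f‖ := by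
      intro w hw
      refine le_antisymm (hA w hw) ?_
      have h1 : ¬ ‖Cf e w.1 * C'.τ w ^ e‖ ≤ ‖(p : ℚ_[p]) ^ (k + 1)‖ * ‖Cf f w.1 * C'.τ w ^ f‖ :=
        fun h => hk2 (dic e he (k + 1) hkK w hw h w0 hw0)
      rw [not_le, ← norm_mul, pow_succ', mul_assoc] at h1
      rw [← norm_mul]
      by_contra h2
      rw [not_le, norm_lt_iff_mul] at h2
      · exact absurd h1 (not_lt.2 h2)
      · exact mul_ne_zero (pow_ne_zero _ pK_ne) (mul_ne_zero (hne w.1 (hsub hw).1 f hfE) (zpow_ne_zero _ hw.2.1))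
    intro w hw w' hw' hww
    have e1 := hB w hw
    have e2 := hB w' hw'
    rw [← hww] at e2
    simp only [norm_mul, norm_zpow] at e1 e2
    have p1 := norm_pos_iff.2 hw.2.1
    have p2 := norm_pos_iff.2 hw'.2.1
    have c1 := norm_pos_iff.2 (hne w.1 (hsub hw).1 e he)
    have c2 := norm_pos_iff.2 (hne w.1 (hsub hw).1 f hfE)
    have e3 : ‖C'.τ w‖ ^ (e - f) = ‖C'.τ w'‖ ^ (e - f) := by
      rw [zpow_sub₀ p1.ne', zpow_sub₀ p2.ne', div_eq_div_iff (zpow_pos p1 _).ne' (zpow_pos p2 _).ne']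
      apply mul_left_cancel₀ c1.ne'
      linear_combination (‖C'.τ w'‖ ^ f) * e1 - (‖C'.τ w‖ ^ f) * e2
    exact (zpow_left_inj₀ p1.le p2.le (sub_ne_zero.2 hef)).1 e3

theorem NF (hF : Full ℰ) (hK : 1 ≤ K) (C : Cell ℰ) (E : Finset ℤ) {Cf : ℤ → Y → ℚ_[p]} (hCf : ∀ e, Cf e ∈ ℰ)
    {U : ℤ → Y × ℚ_[p] → ℚ_[p]} (hU : ∀ e, U1 C.carrier C.gens K (U e)) {φ : Y × ℚ_[p] → ℚ_[p]}
    (hφ : ∀ w ∈ C.carrier, φ w = ∑ e ∈ E, Cf e w.1 * C.τ w ^ e * U e w) :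
    Dec (fun C' => SameC C' C ∧ (C'.Prep K φ ∨ C'.Sphere)) C.carrier := by
  classical
  have hE := hF.dalg
  refine Dec.cover hE E.powerset (D := fun E' => {y | ∀ e ∈ E, e ∈ E' ↔ Cf e y ≠ 0}) (fun E' => ?_) C (fun y _ => ?_) ?_
  · refine QF.ball hE E _ fun e _ => ?_
    by_cases h : e ∈ E'
    · simpa [h] using QF.ne (hCf e)
    · simpa [h] using QF.zero _ (hCf e)
  · exact ⟨E.filter fun e => Cf e y ≠ 0, by simp, fun e he => by simp [he]⟩
  · intro E' hE' C' hs hB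
    have hE'' := Finset.mem_powerset.1 hE'
    refine (NF1 hF hK C' E' hCf (fun e => U1.transfer hs.2.1 (hs.good hE K).2.1 (hU e)) (φ := φ) (fun w hw => ?_) ?_).mono
      fun C'' h _ => ⟨h.1.trans hs, h.2⟩
    · rw [hφ w (hs.2.1 hw), hs.τ_eq]
      symm
      refine Finset.sum_subset hE'' fun e he he' => ?_
      have : Cf e w.1 = 0 := by_contra fun h => he' ((hB hw.1 e he).2 h)
      simp [this]
    · exact fun y hy e he => (hB hy e (hE'' he)).1 he

end Cell
end cut

section ball
variable {p : ℕ} [hp : Fact p.Prime] {Y : Type*}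

structure Bal (ℰ : Set (Y → ℚ_[p])) where
  B : Set Y
  c0 : Y → ℚ_[p]
  β : Y → ℚ_[p]
  hB : QF ℰ B
  hc : c0 ∈ ℰ
  hβ : β ∈ ℰ
  hne : ∀ y ∈ B, β y ≠ 0

variable {ℰ : Set (Y → ℚ_[p])}

theorem nat_cong {L ζ ζ' : ℕ} (h : ζ < p ^ L) (h' : ζ' < p ^ L) (e : ‖(ζ : ℚ_[p]) - ζ'‖ ≤ ‖(p : ℚ_[p]) ^ L‖) :
    ζ = ζ' := by
  have h1 : ‖(((ζ : ℤ) - ζ' : ℤ) : ℚ_[p])‖ ≤ (p : ℝ) ^ (-(L : ℤ)) := by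
    push_cast; rw [norm_pow, Padic.norm_p] at e; rw [zpow_neg, zpow_natCast, ← inv_pow]; exact e
  rw [Padic.norm_int_le_pow_iff_dvd] at h1
  have h2 : |(ζ : ℤ) - ζ'| < ((p ^ L : ℕ) : ℤ) := by
    rw [abs_lt]; constructor <;> omega
  have := Int.eq_zero_of_abs_lt_dvd h1 h2
  omega

theorem nat_rep (M : ℕ) {x : ℚ_[p]} (hx : ‖x‖ ≤ 1) :
    ∃ ξ < p ^ M, ‖x - (ξ : ℕ)‖ ≤ ‖(p : ℚ_[p]) ^ M‖ := by
  refine ⟨PadicInt.appr (⟨x, hx⟩ : ℤ_[p]) M, PadicInt.appr_lt _ _, ?_⟩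
  have h := PadicInt.appr_spec M (⟨x, hx⟩ : ℤ_[p])
  rw [← norm_le_pow_iff_mem_span_pow] at h
  rw [norm_pow, Padic.norm_p]
  rw [zpow_neg, zpow_natCast, ← inv_pow] at h
  exact h

namespace Bal

def carrier (b : Bal ℰ) : Set (Y × ℚ_[p]) := {w | w.1 ∈ b.B ∧ ‖w.2 - b.c0 w.1‖ ≤ ‖b.β w.1‖}

noncomputable def W (b : Bal ℰ) (w : Y × ℚ_[p]) : ℚ_[p] := (w.2 - b.c0 w.1) / b.β w.1

def AN (b : Bal ℰ) (f : Y × ℚ_[p] → ℚ_[p]) : Prop := An b.carrier (pull ℰ ∪ {b.W}) f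

def InBall (b : Bal ℰ) (C : Cell ℰ) : Prop :=
  C.carrier ⊆ b.carrier ∧ ∀ y ∈ C.B, (y, C.c y) ∈ b.carrier

def BDec (K : ℕ) (b : Bal ℰ) (f : Y × ℚ_[p] → ℚ_[p]) : Prop :=
  Dec (fun C => b.InBall C ∧ C.Prep K f) b.carrier

variable {b b' : Bal ℰ} {K : ℕ} {C : Cell ℰ} {f : Y × ℚ_[p] → ℚ_[p]}

theorem W_le {w} (hw : w ∈ b.carrier) : ‖b.W w‖ ≤ 1 := by
  rw [W, norm_div, div_le_one (norm_pos_iff.2 (b.hne _ hw.1))]; exact hw.2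

theorem W_eq {w} (hw : w ∈ b.carrier) : w.2 = b.c0 w.1 + b.β w.1 * b.W w := by
  rw [W, mul_div_cancel₀ _ (b.hne _ hw.1)]; ring

theorem coe_W {w} (hw : w ∈ b.carrier) : ((toZ (b.W w) : ℤ_[p]) : ℚ_[p]) = b.W w := toZ_coe (W_le hw)

theorem InBall.mono (h : b'.InBall C) (hs : b'.carrier ⊆ b.carrier) : b.InBall C :=
  ⟨h.1.trans hs, fun y hy => hs (h.2 y hy)⟩

theorem BDec.sub (h : BDec K b' f) (hs : b'.carrier ⊆ b.carrier) :
    Dec (fun C => b.InBall C ∧ C.Prep K f) b'.carrier := h.mono fun C h1 _ => ⟨h1.1.mono hs, h1.2⟩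

theorem AN.W (b : Bal ℰ) : b.AN b.W := An.gen (Or.inr rfl) fun w hw => W_le hw

theorem AN.base {e : Y → ℚ_[p]} (he : e ∈ ℰ) (hb : ∀ y ∈ b.B, ‖e y‖ ≤ 1) :
    b.AN (fun w => e w.1) := An.gen (Or.inl (Cell.mem_pull he)) fun w hw => hb _ hw.1

theorem InBall.an (hE : IsDAlg ℰ) (h : b.InBall C) (hf : b.AN f) : C.AN f := by
  refine An.bind hf h.1 ?_
  rintro g (hg | rfl) hb
  · exact An.gen (Or.inl hg) fun w hw => hb w (h.1 hw)
  · have h1 : ∀ y ∈ C.B, ‖(C.c y - b.c0 y) / b.β y‖ ≤ 1 := fun y hy => W_le (h.2 y hy)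
    have e : ∀ w, b.W w = (C.c w.1 - b.c0 w.1) / b.β w.1 + (b.β w.1)⁻¹ * C.τ w ^ (1 : ℤ) := by
      intro w; rw [W, Cell.τ, zpow_one]; ring
    refine An.congr ((Cell.AN.base (hE.div (hE.sub C.hc b.hc) b.hβ) h1).add
      (Cell.Bd hE (hE.inv b.hβ) 1 fun w hw => ?_)) fun w _ => e w
    have : (b.β w.1)⁻¹ * C.τ w ^ (1 : ℤ) = b.W w - (C.c w.1 - b.c0 w.1) / b.β w.1 := by rw [e]; ring
    rw [this]
    exact norm_sub_le_of (hb w (h.1 hw)) (h1 _ hw.1)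

noncomputable def cell (hE : IsDAlg ℰ) (b : Bal ℰ) : Cell ℰ where
  B := b.B
  c := b.c0
  α := fun _ => 0
  b := fun y => (b.β y)⁻¹
  hB := b.hB
  hc := b.hc
  hα := hE.const 0
  hb := hE.inv b.hβ
  hab := fun y _ => by simp

theorem mem_cell (hE : IsDAlg ℰ) {w} : w ∈ (b.cell hE).carrier ↔ w ∈ b.carrier ∧ w.2 ≠ b.c0 w.1 := by
  simp only [Cell.carrier, carrier, cell, Cell.τ, mem_ofPred_eq, norm_zero, norm_nonneg, true_and, sub_ne_zero]
  constructor
  · rintro ⟨h1, h2, h3⟩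
    rw [Cell.norm_mul_le_one (inv_ne_zero (b.hne _ h1)), inv_inv] at h3
    exact ⟨⟨h1, h3⟩, h2⟩
  · rintro ⟨⟨h1, h3⟩, h2⟩
    refine ⟨h1, h2, ?_⟩
    rwa [Cell.norm_mul_le_one (inv_ne_zero (b.hne _ h1)), inv_inv]

theorem center_mem {y : Y} (hy : y ∈ b.B) : (y, b.c0 y) ∈ b.carrier := ⟨hy, by simp⟩

theorem cell_in (hE : IsDAlg ℰ) : b.InBall (b.cell hE) :=
  ⟨fun w hw => ((mem_cell hE).1 hw).1, fun y hy => center_mem hy⟩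

theorem of_cell (hE : IsDAlg ℰ) {Q : Cell ℰ → Prop} (h : Dec Q (b.cell hE).carrier) : Dec Q b.carrier := by
  refine h.union' (Dec.pt b.B b.hB b.c0 b.hc) (fun w hw hw' => ((mem_cell hE).1 hw).2 hw'.2) fun w => ?_
  rw [mem_cell]
  by_cases e : w.2 = b.c0 w.1
  · simp only [e, ne_eq, not_true_eq_false, and_false, false_or]
    exact ⟨fun h => ⟨h.1, e⟩, fun h => ⟨h.1, by simp [e]⟩⟩
  · simp [e]

/-- restriction of the base -/
def restr (b : Bal ℰ) (D : Set Y) (hD : QF ℰ D) : Bal ℰ where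
  B := b.B ∩ D
  c0 := b.c0
  β := b.β
  hB := b.hB.inter _ _ hD
  hc := b.hc
  hβ := b.hβ
  hne := fun y hy => b.hne y hy.1

theorem restr_sub (b : Bal ℰ) (D : Set Y) (hD : QF ℰ D) : (b.restr D hD).carrier ⊆ b.carrier :=
  fun w hw => ⟨hw.1.1, hw.2⟩

theorem BDec.split (b : Bal ℰ) {D : Set Y} (hD : QF ℰ D) (h1 : BDec K (b.restr D hD) f)
    (h2 : BDec K (b.restr Dᶜ hD.compl) f) : BDec K b f := by
  refine (h1.sub (restr_sub ..)).union' (h2.sub (restr_sub ..)) (fun w hw hw' => hw'.1.2 hw.1.2) fun w => ?_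
  simp only [carrier, restr, Set.mem_inter_iff, Set.mem_compl_iff, mem_ofPred_eq]
  tauto

/-- finite covers of the base -/
theorem BDec.cover (hE : IsDAlg ℰ) {ι : Type*} (s : Finset ι) {D : ι → Set Y} (hD : ∀ i, QF ℰ (D i)) (b : Bal ℰ)
    (hc : ∀ y ∈ b.B, ∃ i ∈ s, y ∈ D i)
    (h : ∀ i ∈ s, ∀ b' : Bal ℰ, b'.c0 = b.c0 → b'.β = b.β → b'.B ⊆ b.B → b'.B ⊆ D i → BDec K b' f) : BDec K b f := by
  classical
  induction s using induction_on generalizing b with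
  | empty => exact (Dec.empty hE).of_eq (by ext w; simp; intro hw; simpa using hc _ hw.1)
  | insert a s ha ih =>
    refine BDec.split b (hD a) (h a (by simp) _ rfl rfl Set.inter_subset_left Set.inter_subset_right) (ih _ ?_ ?_)
    · rintro y ⟨h1, h2⟩
      obtain ⟨i, hi, hy⟩ := hc y h1
      rcases Finset.mem_insert.1 hi with rfl | hi
      · exact absurd hy h2
      · exact ⟨i, hi, hy⟩
    · intro i hi b' h1 h2 h3
      exact h i (by simp [hi]) b' h1 h2 (h3.trans Set.inter_subset_left)

/-- sub-balls -/
structure SubB (b' b : Bal ℰ) (r s : Y → ℤ_[p]) : Prop where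
  hB : b'.B ⊆ b.B
  hc : ∀ y ∈ b'.B, b'.c0 y = b.c0 y + b.β y * r y
  hβ : ∀ y ∈ b'.B, b'.β y = b.β y * s y
  hr : (fun y => ((r y : ℤ_[p]) : ℚ_[p])) ∈ ℰ
  hs : (fun y => ((s y : ℤ_[p]) : ℚ_[p])) ∈ ℰ

theorem SubB.sub {r s} (h : SubB b' b r s) : b'.carrier ⊆ b.carrier := by
  rintro w ⟨h1, h2⟩
  refine ⟨h.hB h1, ?_⟩
  rw [h.hc _ h1, h.hβ _ h1, norm_mul] at h2
  have e : w.2 - b.c0 w.1 = (w.2 - (b.c0 w.1 + b.β w.1 * r w.1)) + b.β w.1 * r w.1 := by ring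
  rw [e]
  refine norm_add_le_of (h2.trans ?_) ?_
  · exact mul_le_of_le_one_right (norm_nonneg _) (norm_le_one _)
  · rw [norm_mul]; exact mul_le_of_le_one_right (norm_nonneg _) (norm_le_one _)

theorem SubB.W {r s} (h : SubB b' b r s) {w} (hw : w ∈ b'.carrier) :
    toZ (b.W w) = r w.1 + s w.1 * toZ (b'.W w) := by
  apply Subtype.ext
  push_cast
  rw [coe_W (h.sub hw), coe_W hw]
  have h0 := b'.hne _ hw.1
  have h1 := b.hne _ (h.hB hw.1)
  rw [h.hβ _ hw.1] at h0
  have h2 := right_ne_zero_of_mul h0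
  rw [Bal.W, Bal.W, h.hc _ hw.1, h.hβ _ hw.1]
  field_simp
  ring

/-- subdivision -/
noncomputable def shrink (hE : IsDAlg ℰ) (b : Bal ℰ) (M ξ : ℕ) : Bal ℰ where
  B := b.B
  c0 := fun y => b.c0 y + b.β y * ((ξ : ℤ_[p]) : ℚ_[p])
  β := fun y => b.β y * (((p : ℤ_[p]) ^ M : ℤ_[p]) : ℚ_[p])
  hB := b.hB
  hc := hE.add b.hc (hE.mul b.hβ (hE.const _))
  hβ := hE.mul b.hβ (hE.const _)
  hne := fun y hy => mul_ne_zero (b.hne y hy) (by push_cast; exact pow_ne_zero _ pK_ne)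

theorem shrink_sub (hE : IsDAlg ℰ) (b : Bal ℰ) (M ξ : ℕ) :
    SubB (b.shrink hE M ξ) b (fun _ => ξ) (fun _ => (p : ℤ_[p]) ^ M) :=
  ⟨le_rfl, fun y _ => rfl, fun y _ => rfl, hE.const _, hE.const _⟩

theorem mem_shrink (hE : IsDAlg ℰ) {M ξ : ℕ} {w} (hw : w ∈ b.carrier) :
    w ∈ (b.shrink hE M ξ).carrier ↔ ‖b.W w - (ξ : ℕ)‖ ≤ ‖(p : ℚ_[p]) ^ M‖ := by
  have h0 := b.hne _ hw.1
  have e : w.2 - (b.c0 w.1 + b.β w.1 * ((ξ : ℤ_[p]) : ℚ_[p])) = b.β w.1 * (b.W w - (ξ : ℕ)) := by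
    rw [Bal.W]; push_cast; field_simp; ring
  change (w.1 ∈ b.B ∧ ‖w.2 - (b.c0 w.1 + b.β w.1 * ((ξ : ℤ_[p]) : ℚ_[p]))‖ ≤ ‖b.β w.1 * (((p : ℤ_[p]) ^ M : ℤ_[p]) : ℚ_[p])‖) ↔ _
  rw [e, norm_mul, norm_mul, mul_le_mul_iff_right₀ (norm_pos_iff.2 h0)]
  push_cast
  exact ⟨fun h => h.2, fun h => ⟨hw.1, h⟩⟩

theorem BDec.subdiv (hE : IsDAlg ℰ) (b : Bal ℰ) (M : ℕ) (h : ∀ ξ, BDec K (b.shrink hE M ξ) f) : BDec K b f := by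
  refine (Dec.fUnion hE (range (p ^ M)) (fun ξ _ => (h ξ).sub (shrink_sub hE b M ξ).sub) ?_).of_eq ?_
  · intro ξ hξ ξ' hξ' hne
    refine Set.disjoint_left.2 fun w hw hw' => hne ?_
    have h0 := (shrink_sub hE b M ξ).sub hw
    rw [mem_shrink hE h0] at hw hw'
    refine nat_cong (mem_range.1 hξ) (mem_range.1 hξ') ?_
    have e : (ξ : ℚ_[p]) - ξ' = (b.W w - ξ') - (b.W w - ξ) := by ring
    rw [e]; exact norm_sub_le_of hw' hw
  · ext w
    constructor
    · rintro ⟨ξ, _, hw⟩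
      exact (shrink_sub hE b M ξ).sub hw
    · intro hw
      obtain ⟨ξ, h1, h2⟩ := nat_rep M (W_le hw)
      exact ⟨ξ, mem_range.2 h1, (mem_shrink hE hw).2 h2⟩

end Bal

open Bal

theorem Cell.Sphere.alpha_ne {C : Cell ℰ} (hS : C.Sphere) {y} (hy : y ∈ C.B) : C.α y ≠ 0 := by
  intro h0
  obtain ⟨t, h1, h2, -⟩ := Cell.exists_small (1 : ℚ_[p]) (C.b y) one_ne_zero one_pos
  have h3 : ‖C.b y * (p * t)‖ ≤ 1 := by
    rw [show C.b y * (p * t) = p * (C.b y * t) by ring, norm_mul]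
    exact mul_le_one₀ normp_lt.le (norm_nonneg _) h2
  obtain ⟨h4, h5⟩ := C.mem_small hy h0 h1 h2
  obtain ⟨h6, h7⟩ := C.mem_small hy h0 (mul_ne_zero pK_ne h1) h3
  have := hS _ h4 _ h6 rfl
  rw [h5, h7, norm_mul] at this
  have h8 := norm_pos_iff.2 h1
  have h9 : ‖(p : ℚ_[p])‖ < 1 := normp_lt
  nlinarith

theorem Cell.Sphere.mem {C : Cell ℰ} (hS : C.Sphere) {w} : w ∈ C.carrier ↔ w.1 ∈ C.B ∧ ‖C.τ w‖ = ‖C.α w.1‖ := by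
  constructor
  · intro hw
    obtain ⟨h1, h2⟩ := C.mem_α hw.1 (hS.alpha_ne hw.1)
    refine ⟨hw.1, ?_⟩
    rw [hS w hw _ h1 rfl, h2]
  · rintro ⟨h1, h2⟩
    have h3 := hS.alpha_ne h1
    refine ⟨h1, ?_, h2.ge, ?_⟩
    · rw [← norm_pos_iff, h2]; exact norm_pos_iff.2 h3
    · have := C.hab _ h1
      rwa [norm_mul, h2, mul_comm, ← norm_mul]

theorem Cell.Sphere.dec (hE : IsDAlg ℰ) {C : Cell ℰ} (hS : C.Sphere) {L : ℕ} (hL : 1 ≤ L) {Q : Cell ℰ → Prop}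
    (h : ∀ (ζ : ℕ), ¬ p ∣ ζ → ∀ b : Bal ℰ, b.B = C.B → (∀ y, b.c0 y = C.c y + C.α y * ζ) →
      (∀ y, b.β y = C.α y * (p : ℚ_[p]) ^ L) → b.carrier ⊆ C.carrier → Dec Q b.carrier) : Dec Q C.carrier := by
  classical
  let bb : ℕ → Bal ℰ := fun ζ =>
    { B := C.B
      c0 := fun y => C.c y + C.α y * (ζ : ℚ_[p])
      β := fun y => C.α y * (p : ℚ_[p]) ^ L
      hB := C.hB
      hc := hE.add C.hc (hE.mul C.hα (hE.const _))
      hβ := hE.mul C.hα (hE.const _)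
      hne := fun y hy => mul_ne_zero (hS.alpha_ne hy) (pow_ne_zero _ pK_ne) }
  have hm : ∀ ζ w, w ∈ (bb ζ).carrier ↔ w.1 ∈ C.B ∧ ‖C.τ w / C.α w.1 - ζ‖ ≤ ‖(p : ℚ_[p]) ^ L‖ := by
    intro ζ w
    change (w.1 ∈ C.B ∧ ‖w.2 - (C.c w.1 + C.α w.1 * ζ)‖ ≤ ‖C.α w.1 * (p : ℚ_[p]) ^ L‖) ↔ _
    refine and_congr_right fun hy => ?_
    have h0 := hS.alpha_ne hy
    have e : w.2 - (C.c w.1 + C.α w.1 * ζ) = C.α w.1 * (C.τ w / C.α w.1 - ζ) := by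
      rw [Cell.τ]; field_simp; ring
    rw [e, norm_mul, norm_mul, mul_le_mul_iff_right₀ (norm_pos_iff.2 h0)]
  have hlt : ‖(p : ℚ_[p]) ^ L‖ < 1 := normpow_lt_one hL
  have hsub : ∀ ζ, ¬ p ∣ ζ → (bb ζ).carrier ⊆ C.carrier := by
    intro ζ hζ w hw
    rw [hm] at hw
    refine hS.mem.2 ⟨hw.1, ?_⟩
    have h1 : ‖(ζ : ℚ_[p])‖ = 1 := natCast_unit_norm hζ
    have h2 : ‖C.τ w / C.α w.1‖ = 1 := by
      have := norm_add_eq_left (x := (ζ : ℚ_[p])) (y := C.τ w / C.α w.1 - ζ) (by rw [h1]; exact hw.2.trans_lt hlt)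
      rwa [add_sub_cancel, h1] at this
    rwa [norm_div, div_eq_one_iff_eq (norm_pos_iff.2 (hS.alpha_ne hw.1)).ne'] at h2
  refine (Dec.fUnion hE ((range (p ^ L)).filter fun ζ => ¬ p ∣ ζ) (T := fun ζ => (bb ζ).carrier) (fun ζ hζ => ?_) ?_).of_eq ?_
  · have := (mem_filter.1 hζ).2
    exact h ζ this (bb ζ) rfl (fun _ => rfl) (fun _ => rfl) (hsub ζ this)
  · intro ζ hζ ζ' hζ' hne
    refine Set.disjoint_left.2 fun w hw hw' => hne ?_
    rw [hm] at hw hw'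
    refine nat_cong (mem_range.1 (mem_filter.1 hζ).1) (mem_range.1 (mem_filter.1 hζ').1) ?_
    have e : (ζ : ℚ_[p]) - ζ' = (C.τ w / C.α w.1 - ζ') - (C.τ w / C.α w.1 - ζ) := by ring
    rw [e]; exact norm_sub_le_of hw'.2 hw.2
  · ext w
    constructor
    · rintro ⟨ζ, hζ, hw⟩
      exact hsub ζ (mem_filter.1 hζ).2 hw
    · intro hw
      have hn := (hS.mem.1 hw).2
      have h0 := hS.alpha_ne hw.1
      have h1 : ‖C.τ w / C.α w.1‖ = 1 := by rw [norm_div, hn, div_self (norm_pos_iff.2 h0).ne']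
      obtain ⟨ζ, h2, h3⟩ := nat_rep L h1.le
      refine ⟨ζ, mem_filter.2 ⟨mem_range.2 h2, fun hd => ?_⟩, (hm ζ w).2 ⟨hw.1, h3⟩⟩
      obtain ⟨k, rfl⟩ := hd
      have h4 : ‖((p * k : ℕ) : ℚ_[p])‖ < 1 := by
        have h6 : ‖(k : ℚ_[p])‖ ≤ 1 := norm_le_one (k : ℤ_[p])
        rw [Nat.cast_mul, norm_mul]
        exact mul_lt_one_of_nonneg_of_lt_one_left (norm_nonneg _) normp_lt h6
      have h5 := norm_add_eq_left (x := C.τ w / C.α w.1) (y := -((p * k : ℕ) : ℚ_[p])) (by rw [norm_neg, h1]; exact h4)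
      rw [← sub_eq_add_neg, h1] at h5
      rw [h5] at h3
      exact absurd hlt (not_lt.2 h3)

end ball

section ser
variable {p : ℕ} [hp : Fact p.Prime] {Y : Type*} {ℰ : Set (Y → ℚ_[p])} {σ : Type}

theorem Null.hs {c : ℕ → Rsub p σ} (hc : Null p c) (x : σ → ℤ_[p]) (t : ℤ_[p]) :
    HasSum (fun k => ev x (c k) * t ^ k) (∑' k, ev x (c k) * t ^ k) :=
  ((hc.evNull x).mul_right _).summable.hasSum

theorem unit_of_dvd {a : ℤ_[p]} (h : (p : ℤ_[p]) ∣ a - 1) : ‖(a : ℚ_[p])‖ = 1 := by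
  obtain ⟨k, hk⟩ := h
  refine near1.norm le_rfl (M := 1) (x := (a : ℚ_[p])) ?_
  have : (a : ℚ_[p]) - 1 = p * (k : ℚ_[p]) := by exact_mod_cast congrArg (fun z : ℤ_[p] => (z : ℚ_[p])) hk
  rw [near1, this, norm_mul, pow_one]
  exact mul_le_of_le_one_right (norm_nonneg _) (norm_le_one _)

def Params (ℰ : Set (Y → ℚ_[p])) (x : Y → σ → ℤ_[p]) : Prop := ∀ i, (fun y => ((x y i : ℤ_[p]) : ℚ_[p])) ∈ ℰ

theorem Params.ext1 {x : Y → σ → ℤ_[p]} (hx : Params ℰ x) {t : Y → ℤ_[p]}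
    (ht : (fun y => ((t y : ℤ_[p]) : ℚ_[p])) ∈ ℰ) : Params ℰ (fun y => ext1 (x y) (t y)) := by
  rintro (_ | i)
  · exact ht
  · exact hx i

theorem Params.ev [Finite σ] (hE : IsDAlg ℰ) {x : Y → σ → ℤ_[p]} (hx : Params ℰ x) (F : Rsub p σ) :
    (fun y => ((ev (x y) F : ℤ_[p]) : ℚ_[p])) ∈ ℰ := hE.ev F (fun i y => x y i) hx

def Ser (b : Bal ℰ) (x : Y → σ → ℤ_[p]) (c : ℕ → Rsub p σ) (ψ : Y × ℚ_[p] → ℚ_[p]) : Prop :=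
  Params ℰ x ∧ Null p c ∧
    ∀ w ∈ b.carrier, ψ w = ((∑' k, ev (x w.1) (c k) * toZ (b.W w) ^ k : ℤ_[p]) : ℚ_[p])

open Bal
variable {b b' : Bal ℰ} {K : ℕ} {x : Y → σ → ℤ_[p]} {c : ℕ → Rsub p σ} {ψ : Y × ℚ_[p] → ℚ_[p]}
  {r s : Y → ℤ_[p]} {F : ℕ → Rsub p (Option σ)}

theorem Ser.an [Finite σ] (h : Ser b x c ψ) : b.AN ψ := by
  refine An.series h.2.1 (G := fun i (w : Y × ℚ_[p]) => ((x w.1 i : ℤ_[p]) : ℚ_[p]))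
    (fun i => AN.base (h.1 i) fun y _ => norm_le_one _) (AN.W b) fun w hw => ⟨_, h.2.2 w hw, ?_⟩
  simp only [coe_toZ]
  exact h.2.1.hs _ _

theorem BDec.zero (hE : IsDAlg ℰ) (h : ∀ w ∈ b.carrier, ψ w = 0) : BDec K b ψ :=
  of_cell hE (Dec.cell _ ⟨cell_in hE, _, hE.const 0, 0, _, U1.one, fun w hw => by
    rw [h w (cell_in hE |>.1 hw)]; simp⟩)

theorem BDec.cmul (hE : IsDAlg ℰ) {φ : Y × ℚ_[p] → ℚ_[p]} (h : BDec K b φ) {a : Y → ℚ_[p]} (ha : a ∈ ℰ)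
    (e : ∀ w ∈ b.carrier, ψ w = a w.1 * φ w) : BDec K b ψ :=
  h.mono fun C h1 _ => ⟨h1.1, ((Cell.Prep.base hE K C ha).mul hE h1.2).congr fun w hw => e w (h1.1.1 hw)⟩

theorem lemmaU [Finite σ] (hE : IsDAlg ℰ) (h : Ser b x c ψ) (h0 : ∀ y ∈ b.B, ‖((ev (x y) (c 0) : ℤ_[p]) : ℚ_[p])‖ = 1)
    {e : ℕ → Rsub p σ} (he : Null p e) (hce : ∀ k, c (k + 1) = (p : Rsub p σ) ^ K * e k) : BDec K b ψ := by
  let φ : Y × ℚ_[p] → ℚ_[p] := fun w => ((∑' k, ev (x w.1) (e k) * toZ (b.W w) ^ k : ℤ_[p]) : ℚ_[p])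
  have hφ : b.AN φ := Ser.an (x := x) (c := e) ⟨h.1, he, fun w _ => rfl⟩
  have hc0 := h.1.ev hE (c 0)
  refine of_cell hE (Dec.cell _ ⟨cell_in hE, _, hc0, 0,
    fun w => 1 + (p : ℚ_[p]) ^ K * (((ev (x w.1) (c 0) : ℤ_[p]) : ℚ_[p])⁻¹ * (b.W w * φ w)), ⟨_, (cell_in hE).an hE
      ((AN.base (hE.inv hc0) fun y hy => ?_).mul ((AN.W b).mul hφ)), fun w _ => rfl⟩, fun w hw => ?_⟩)
  · change ‖((ev (x y) (c 0) : ℤ_[p]) : ℚ_[p])⁻¹‖ ≤ 1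
    rw [norm_inv, h0 y hy, inv_one]
  · have hw' := (cell_in hE).1 hw
    have hne : ((ev (x w.1) (c 0) : ℤ_[p]) : ℚ_[p]) ≠ 0 := by
      rw [← norm_pos_iff, h0 _ hw'.1]; exact one_pos
    rw [h.2.2 w hw', (h.2.1.hs _ _).summable.tsum_eq_zero_add]
    have e1 : (∑' k, ev (x w.1) (c (k + 1)) * toZ (b.W w) ^ (k + 1)) =
        (p : ℤ_[p]) ^ K * (toZ (b.W w) * ∑' k, ev (x w.1) (e k) * toZ (b.W w) ^ k) := by
      rw [← (he.hs _ _).summable.tsum_mul_left, ← ((he.hs _ _).summable.mul_left _).tsum_mul_left]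
      refine tsum_congr fun k => ?_
      rw [hce, map_mul, map_pow, map_natCast]; ring
    rw [e1]
    push_cast
    rw [coe_W hw']
    simp only [pow_zero, mul_one, zpow_zero]
    field_simp
    rfl

theorem Ser.taylor (h : Ser b x c ψ) (hb : SubB b' b r s)
    (hF : ∀ (i : ℕ) (x : σ → ℤ_[p]) (t : ℤ_[p]),
          HasSum (fun k => ((k + i).choose i : ℤ_[p]) * (ev x) (c (k + i)) * t ^ k) ((ev (ext1 x t)) (F i)))
    {w} (hw : w ∈ b'.carrier) : ∃ A : ℤ_[p], ψ w = A ∧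
      HasSum (fun i => ev (ext1 (x w.1) (r w.1)) (F i) * (s w.1 * toZ (b'.W w)) ^ i) A := by
  refine ⟨_, h.2.2 w (hb.sub hw), ?_⟩
  rw [hb.W hw]
  exact taylor_hasSum h.2.1 hF _ _ _

def PP (ℰ : Set (Y → ℚ_[p])) (K d : ℕ) : Prop := ∀ (b : Bal ℰ) (σ : Type) [Finite σ] (x : Y → σ → ℤ_[p]) (c : ℕ → Rsub p σ)
  (ψ : Y × ℚ_[p] → ℚ_[p]), Ser b x c ψ → (∀ y ∈ b.B, (p : ℤ_[p]) ∣ ev (x y) (c d) - 1) →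
  (∀ y ∈ b.B, ∀ k, d < k → (p : ℤ_[p]) ∣ ev (x y) (c k)) → BDec K b ψ

def QQ (ℰ : Set (Y → ℚ_[p])) (K D : ℕ) : Prop := ∀ (b : Bal ℰ) (σ : Type) [Finite σ] (x : Y → σ → ℤ_[p]) (_ : Params ℰ x)
  (a : ℕ → Y → ℚ_[p]) (_ : ∀ j, a j ∈ ℰ) (bb : ℕ → ℕ → Rsub p σ) (_ : ∀ j, Null p (bb j)) (ψ : Y × ℚ_[p] → ℚ_[p]),
  (∀ w ∈ b.carrier, ψ w = ∑ j ∈ range (D + 1), a j w.1 * (b.W w ^ j +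
    p * ((∑' k, ev (x w.1) (bb j k) * toZ (b.W w) ^ k : ℤ_[p]) : ℚ_[p]))) → BDec K b ψ

theorem arg_max (D : ℕ) (f : ℕ → ℝ) : ∃ j ≤ D, ∀ i ≤ D, f i ≤ f j ∧ (j < i → f i < f j) := by
  classical
  obtain ⟨m, hm, hm'⟩ := Finset.exists_max_image (range (D + 1)) f ⟨0, by simp⟩
  have hne : ((range (D + 1)).filter fun i => f i = f m).Nonempty := ⟨m, by simp at hm ⊢; exact hm⟩
  have h1 := mem_filter.1 (Finset.max'_mem _ hne)
  refine ⟨_, Nat.lt_succ_iff.1 (mem_range.1 h1.1), fun i hi => ?_⟩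
  have hi' : i ∈ range (D + 1) := mem_range.2 (Nat.lt_succ_iff.2 hi)
  refine ⟨by rw [h1.2]; exact hm' i hi', fun hlt => ?_⟩
  rw [h1.2]
  refine lt_of_le_of_ne (hm' i hi') fun he => ?_
  have := Finset.le_max' ((range (D + 1)).filter fun i => f i = f m) i (mem_filter.2 ⟨hi', he⟩)
  omega

theorem QQ_of_PP (hF : Full ℰ) {D : ℕ} (hP : ∀ j ≤ D, PP ℰ K j) : QQ ℰ K D := by
  classical
  intro b σ _ x hx a ha bb hbb ψ hψ
  have hE := hF.dalg
  refine BDec.cover hE (range (D + 2)) (D := fun j => if j = D + 1 then {y | ∀ i ∈ range (D + 1), a i y = 0}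
    else {y | a j y ≠ 0 ∧ ∀ i ∈ range (D + 1), ‖a i y‖ ≤ ‖a j y‖ ∧ (j < i → ‖a i y‖ < ‖a j y‖)}) ?_ b ?_ ?_
  · intro j
    by_cases hj : j = D + 1
    · simp only [if_pos hj]
      exact QF.ball hE _ _ fun i _ => QF.zero _ (ha i)
    · simp only [if_neg hj]
      refine QF.and (QF.ne (ha j)) (QF.ball hE _ _ fun i _ => QF.and (QF.norm_le hE (ha i) (ha j)) ?_)
      by_cases hji : j < i
      · simp only [hji, true_imp_iff]; exact QF.norm_lt hE (ha i) (ha j)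
      · simp only [hji, false_imp_iff]; exact QF.univ hE
  · intro y hy
    obtain ⟨j, hj, hj'⟩ := arg_max D fun i => ‖a i y‖
    by_cases h0 : a j y = 0
    · refine ⟨D + 1, by simp, ?_⟩
      simp only [if_true]
      intro i hi
      have := (hj' i (Nat.lt_succ_iff.1 (mem_range.1 hi))).1
      rw [h0, norm_zero] at this
      exact norm_le_zero_iff.1 this
    · refine ⟨j, by simp; omega, ?_⟩
      simp only [if_neg (show j ≠ D + 1 by omega)]
      exact ⟨h0, fun i hi => hj' i (Nat.lt_succ_iff.1 (mem_range.1 hi))⟩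
  intro j hj b' hc0 hβ hB hD
  have hsub : b'.carrier ⊆ b.carrier := by
    rintro w ⟨h1, h2⟩; exact ⟨hB h1, by rwa [hc0, hβ] at h2⟩
  have hW : b'.W = b.W := by funext w; simp only [Bal.W, hc0, hβ]
  by_cases hjD : j = D + 1
  · simp only [if_pos hjD] at hD
    refine BDec.zero hE fun w hw => ?_
    rw [hψ w (hsub hw)]
    refine Finset.sum_eq_zero fun i hi => ?_
    rw [hD hw.1 i hi, zero_mul]
  simp only [if_neg hjD] at hD
  have hjD' : j ≤ D := by have := mem_range.1 hj; omega
  choose b2 hb2 hb2' using fun i => (hbb i).rename (Sum.inl : σ → σ ⊕ Fin (D + 1))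
  let x' : Y → σ ⊕ Fin (D + 1) → ℤ_[p] := fun y => Sum.elim (x y)
    fun i => if i.1 ≤ j then toZ (a i y / a j y) else toZ (a i y / (p * a j y))
  have hx' : Params ℰ x' := by
    rintro (i | i)
    · exact hx i
    · by_cases h : i.1 ≤ j
      · simp only [x', Sum.elim_inr, if_pos h]; exact toZ_mem hE hF.pw (hE.div (ha _) (ha _))
      · simp only [x', Sum.elim_inr, if_neg h]; exact toZ_mem hE hF.pw (hE.div (ha _) (hE.cmul _ (ha _)))
  let A : Fin (D + 1) → Rsub p (σ ⊕ Fin (D + 1)) := fun i => if i.1 ≤ j then RX (Sum.inr i) else (p : Rsub p _) * RX (Sum.inr i)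
  have hA : ∀ y ∈ b'.B, ∀ i, ((ev (x' y) (A i) : ℤ_[p]) : ℚ_[p]) = a i y / a j y := by
    intro y hy i
    obtain ⟨h1, h2⟩ := hD hy
    have h3 := h2 i.1 (mem_range.2 i.2)
    have hpos := norm_pos_iff.2 h1
    by_cases h : i.1 ≤ j
    · simp only [A, if_pos h, ev_RX, x', Sum.elim_inr]
      refine toZ_coe ?_
      rw [norm_div, div_le_one hpos]; exact h3.1
    · simp only [A, if_neg h, map_mul, map_natCast, ev_RX, x', Sum.elim_inr]
      push_cast
      rw [toZ_coe]
      · have := pK_ne (p := p); field_simp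
      · rw [norm_div, div_le_one (norm_pos_iff.2 (mul_ne_zero pK_ne h1)), ← norm_lt_iff_mul h1]
        exact h3.2 (not_le.1 h)
  let cc : ℕ → Rsub p (σ ⊕ Fin (D + 1)) := fun k => ∑ i : Fin (D + 1), A i * ((if k = i.1 then 1 else 0) + p * b2 i.1 k)
  have hcc : Null p cc := by
    intro n
    choose N hN using fun i : Fin (D + 1) => hb2 i.1 n
    refine ⟨D + 1 + ∑ i, N i, fun k hk => Finset.dvd_sum fun i _ => Dvd.dvd.mul_left ?_ _⟩
    have h1 : N i ≤ ∑ i, N i := Finset.single_le_sum (f := N) (fun _ _ => Nat.zero_le _) (Finset.mem_univ i)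
    rw [if_neg (by have := i.2; omega), zero_add]
    exact Dvd.dvd.mul_left (hN i k (by omega)) _
  have hev : ∀ y k, ev (x' y) (cc k) = ∑ i : Fin (D + 1), ev (x' y) (A i) * ((if k = i.1 then 1 else 0) + p * ev (x y) (bb i k)) := by
    intro y k
    simp only [cc, map_sum, map_mul, map_add, map_natCast, hb2', x', Sum.elim_inl]
    refine sum_congr rfl fun i _ => ?_
    split_ifs <;> simp
  have hev2 : ∀ y k, ∃ R, ev (x' y) (cc k) = (∑ i : Fin (D + 1), ev (x' y) (A i) * (if k = i.1 then 1 else 0)) + p * R := by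
    intro y k
    refine ⟨∑ i : Fin (D + 1), ev (x' y) (A i) * ev (x y) (bb i k), ?_⟩
    rw [hev, mul_sum, ← Finset.sum_add_distrib]
    refine sum_congr rfl fun i _ => by ring
  have hS : Ser b' x' cc (fun w => ψ w / a j w.1) := by
    refine ⟨hx', hcc, fun w hw => ?_⟩
    change ψ w / a j w.1 = _
    rw [hψ w (hsub hw), ← hW]
    have hs : HasSum (fun k => ev (x' w.1) (cc k) * toZ (b'.W w) ^ k) (∑ i : Fin (D + 1), ev (x' w.1) (A i) *
        (toZ (b'.W w) ^ i.1 + p * ∑' k, ev (x w.1) (bb i k) * toZ (b'.W w) ^ k)) := by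
      refine hs_congr (hasSum_sum (s := Finset.univ) fun (i : Fin (D + 1)) _ => (((hasSum_ite_eq i.1 (toZ (b'.W w) ^ i.1)).add
        (((hbb i).hs (x w.1) (toZ (b'.W w))).mul_left (p : ℤ_[p])))).mul_left (ev (x' w.1) (A i))) ?_ rfl
      intro k
      rw [hev, Finset.sum_mul]
      refine sum_congr rfl fun i _ => ?_
      split_ifs with hk
      · rw [hk]; ring
      · ring
    rw [hs.tsum_eq, Finset.sum_div, ← Fin.sum_univ_eq_sum_range (fun i => a i w.1 * (b'.W w ^ i + (p : ℚ_[p]) *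
      ((∑' k, ev (x w.1) (bb i k) * toZ (b'.W w) ^ k : ℤ_[p]) : ℚ_[p])) / a j w.1) (D + 1)]
    rw [coe_sum]
    refine sum_congr rfl fun i _ => ?_
    rw [coe_mul, hA _ hw.1]
    push_cast
    rw [coe_W hw]
    ring
  refine BDec.cmul hE (hP j hjD' b' _ x' cc _ hS ?_ ?_) (ha j) fun w hw => ?_
  · intro y hy
    obtain ⟨R, hR⟩ := hev2 y j
    rw [hR, Finset.sum_eq_single (⟨j, by omega⟩ : Fin (D + 1))]
    · have : ev (x' y) (A ⟨j, by omega⟩) = 1 := by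
        apply Subtype.ext
        rw [hA y hy, div_self (hD hy).1]; rfl
      rw [this]
      exact ⟨R, by simp⟩
    · intro i _ hi
      rw [if_neg (fun h => hi (Fin.ext h.symm)), mul_zero]
    · simp
  · intro y hy k hk
    obtain ⟨R, hR⟩ := hev2 y k
    rw [hR]
    refine dvd_add (Finset.dvd_sum fun i _ => ?_) (Dvd.intro _ rfl)
    split_ifs with h
    · rw [mul_one]
      simp only [A, if_neg (show ¬ i.1 ≤ j by omega), map_mul, map_natCast]
      exact Dvd.intro _ rfl
    · simp
  · have := (hD hw.1).1
    change ψ w = a j w.1 * (ψ w / a j w.1)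
    field_simp

end ser

section pp
variable {p : ℕ} [hp : Fact p.Prime] {Y : Type*} {ℰ : Set (Y → ℚ_[p])} {σ : Type}
open Bal
variable {b b' : Bal ℰ} {K : ℕ} {x : Y → σ → ℤ_[p]} {c : ℕ → Rsub p σ} {ψ : Y × ℚ_[p] → ℚ_[p]}
  {r s : Y → ℤ_[p]} {F : ℕ → Rsub p (Option σ)}

/-- Taylor coefficients -/
def Tay (c : ℕ → Rsub p σ) (F : ℕ → Rsub p (Option σ)) : Prop :=
  Null p F ∧ ∀ (i : ℕ) (x : σ → ℤ_[p]) (t : ℤ_[p]),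
    HasSum (fun k => ((k + i).choose i : ℤ_[p]) * (ev x) (c (k + i)) * t ^ k) ((ev (ext1 x t)) (F i))

theorem lemmaA [Finite σ] (hE : Full ℰ) {e : ℕ} (hQ : QQ ℰ K e) (h : Ser b x c ψ) (hF : Tay c F) (hb : SubB b' b r s)
    (hs : ∀ y ∈ b'.B, ‖((s y : ℤ_[p]) : ℚ_[p])‖ ≤ ‖p * ((ev (ext1 (x y) (r y)) (F e) : ℤ_[p]) : ℚ_[p])‖) :
    BDec K b' ψ := by
  classical
  have hx1 := h.1.ext1 hb.hr
  have hFe := fun i => hx1.ev hE.dalg (F i)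
  let θ : Y → ℤ_[p] := fun y => toZ (s y / (p * ((ev (ext1 (x y) (r y)) (F e) : ℤ_[p]) : ℚ_[p])))
  have hθ : (fun y => ((θ y : ℤ_[p]) : ℚ_[p])) ∈ ℰ :=
    toZ_mem hE.dalg hE.pw (hE.dalg.div hb.hs (hE.dalg.cmul _ (hFe e)))
  have hsne : ∀ y ∈ b'.B, ((s y : ℤ_[p]) : ℚ_[p]) ≠ 0 := fun y hy => by
    have := b'.hne y hy; rw [hb.hβ y hy] at this; exact right_ne_zero_of_mul this
  have hθ' : ∀ y ∈ b'.B, s y = p * ev (ext1 (x y) (r y)) (F e) * θ y := by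
    intro y hy
    have h0 : (p * ((ev (ext1 (x y) (r y)) (F e) : ℤ_[p]) : ℚ_[p])) ≠ 0 := by
      rw [← norm_pos_iff]; exact (norm_pos_iff.2 (hsne y hy)).trans_le (hs y hy)
    apply Subtype.ext
    push_cast
    rw [toZ_coe, mul_div_cancel₀ _ h0]
    rw [norm_div, div_le_one (norm_pos_iff.2 h0)]; exact hs y hy
  obtain ⟨F', hF', hF2⟩ := hF.1.rename (fun o : Option σ => some (some o))
  refine hQ b' _ (fun y => ext1 (ext1 (ext1 (x y) (r y)) (s y)) (θ y)) ((hx1.ext1 hb.hs).ext1 hθ)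
    (fun j y => ((ev (ext1 (x y) (r y)) (F j) : ℤ_[p]) : ℚ_[p]) * (s y : ℚ_[p]) ^ j)
    (fun j => hE.dalg.mul (hFe j) (hE.dalg.pow hb.hs j))
    (fun j i => F' i * (if j = e ∧ e < i then RX (some none) ^ (i - e - 1) * RX none else 0))
    (fun j => hF'.mul_right _) ψ fun w hw => ?_
  obtain ⟨A, hA, hA'⟩ := h.taylor hb hF.2 hw
  set W := toZ (b'.W w) with hW
  set Fi := fun i => ev (ext1 (x w.1) (r w.1)) (F i) with hFi
  have hev : ∀ j i, ev (ext1 (ext1 (ext1 (x w.1) (r w.1)) (s w.1)) (θ w.1))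
      (F' i * (if j = e ∧ e < i then RX (some none) ^ (i - e - 1) * RX none else 0)) =
      if j = e ∧ e < i then Fi i * (s w.1 ^ (i - e - 1) * θ w.1) else 0 := by
    intro j i
    rw [map_mul, hF2]
    split_ifs
    · rw [map_mul, map_pow, ev_RX, ev_RX]; rfl
    · rw [map_zero, mul_zero]
  simp only [hev]
  have hN : Null p fun i => if e < i then Fi i * (s w.1 ^ (i - e - 1) * θ w.1) else 0 := by
    intro n
    obtain ⟨N, hN⟩ := (hF.1.evNull (ext1 (x w.1) (r w.1))) n
    refine ⟨N, fun i hi => ?_⟩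
    change _ ∣ (if e < i then Fi i * (s w.1 ^ (i - e - 1) * θ w.1) else 0)
    split_ifs
    · exact Dvd.dvd.mul_right (hN i hi) _
    · exact dvd_zero _
  have hT := ((hN.mul_right fun i => W ^ i).summable.hasSum).mul_left ((p : ℤ_[p]) * (Fi e * s w.1 ^ e))
  have hT0 : HasSum (fun i => if i ∈ range (e + 1) then Fi i * s w.1 ^ i * W ^ i else 0)
      (∑ i ∈ range (e + 1), if i ∈ range (e + 1) then Fi i * s w.1 ^ i * W ^ i else 0) :=
    hasSum_sum_of_ne_finset_zero fun i hi => if_neg hi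
  have hAA : A = _ := hA'.unique (hs_congr (hT0.add hT) (fun i => by
    simp only [mem_range]
    by_cases hi : i < e + 1
    · rw [if_pos hi, if_neg (by omega)]
      simp only [hFi]; ring
    · rw [if_neg hi, if_pos (by omega)]
      obtain ⟨k, rfl⟩ : ∃ k, i = e + 1 + k := ⟨i - (e + 1), by omega⟩
      rw [show e + 1 + k - e - 1 = k by omega, mul_pow]
      have h5 := hθ' w.1 hw.1
      simp only [hFi]
      linear_combination (ev (ext1 (x w.1) (r w.1)) (F (e + 1 + k)) * W ^ (e + 1 + k) * s w.1 ^ (e + k)) * h5) rfl)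
  rw [hA, hAA, PadicInt.coe_add, coe_sum]
  simp only [mul_add]
  rw [Finset.sum_add_distrib]
  congr 1
  · refine sum_congr rfl fun i hi => ?_
    rw [if_pos hi]; push_cast; rw [coe_W hw]
  · rw [Finset.sum_eq_single e]
    · simp only [true_and]
      push_cast
      ring
    · intro j _ hj
      simp [hj]
    · simp

theorem tay_unit (hF : Tay c F) {d : ℕ} {x : σ → ℤ_[p]} (h1 : (p : ℤ_[p]) ∣ ev x (c d) - 1)
    (h2 : ∀ k, d < k → (p : ℤ_[p]) ∣ ev x (c k)) (t : ℤ_[p]) : (p : ℤ_[p]) ∣ ev (ext1 x t) (F d) - 1 := by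
  have h := Zp_dvd_tsum ((hF.2 d x t).sub (hasSum_ite_eq 0 1)) 1 ?_
  · simpa using h
  · intro k
    rw [pow_one]
    by_cases hk : k = 0
    · subst hk; simpa using h1
    · rw [if_neg hk, sub_zero]
      exact Dvd.dvd.mul_right (Dvd.dvd.mul_left (h2 _ (by omega)) _) _

theorem PP_zero (hE : Full ℰ) (K : ℕ) : PP ℰ K 0 := by
  intro b σ _ x c ψ h h1 h2
  obtain ⟨F, hF0, hF1⟩ := exists_taylor h.2.1
  have hF : Tay c F := ⟨hF0, hF1⟩
  refine BDec.subdiv hE.dalg b K fun ξ => ?_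
  have hb := shrink_sub hE.dalg b K ξ
  refine lemmaU hE.dalg (c := fun i => F i * (p : Rsub p _) ^ (K * i)) (x := fun y => ext1 (x y) (ξ : ℤ_[p]))
    ⟨h.1.ext1 hb.hr, hF0.mul_right _, fun w hw => ?_⟩ (fun y hy => ?_) (e := fun i => F (i + 1) * (p : Rsub p _) ^ (K * i)) ?_ ?_
  · obtain ⟨A, hA, hA'⟩ := h.taylor hb hF1 hw
    rw [hA, ← hA'.tsum_eq]
    refine congrArg (fun z : ℤ_[p] => (z : ℚ_[p])) (tsum_congr fun i => ?_)
    rw [map_mul, map_pow, map_natCast, mul_pow, pow_mul]; ring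
  · simp only [mul_zero, pow_zero, mul_one]
    exact unit_of_dvd (tay_unit hF (h1 y hy) (h2 y hy) _)
  · refine Null.mul_right (c := fun i => F (i + 1)) (fun n => ?_) _
    obtain ⟨N, hN⟩ := hF0 n
    exact ⟨N, fun i hi => hN _ (by omega)⟩
  · intro k
    ring

/-- the Taylor expansion of the `e`-th Taylor coefficient -/
theorem tay2 (hc : Null p c) (hF : Tay c F) (e : ℕ) : ∃ G : ℕ → Rsub p (Option σ), Null p G ∧
    (∀ x t h, HasSum (fun i => ev (ext1 x t) (G i) * h ^ i) (ev (ext1 x (t + h)) (F e))) ∧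
    (∀ x t, ev (ext1 x t) (G 0) = ev (ext1 x t) (F e)) ∧
    ∀ x t, ev (ext1 x t) (G 1) = (e + 1 : ℕ) * ev (ext1 x t) (F (e + 1)) := by
  have hc' : Null p fun k => c (k + e) * ((k + e).choose e : Rsub p σ) := by
    refine Null.mul_right (c := fun k => c (k + e)) (fun n => ?_) _
    obtain ⟨N, hN⟩ := hc n
    exact ⟨N, fun i hi => hN _ (by omega)⟩
  obtain ⟨G, hG, hG'⟩ := exists_taylor hc'
  refine ⟨G, hG, fun x t h => ?_, fun x t => ?_, fun x t => ?_⟩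
  · have := taylor_hasSum hc' hG' x t h
    refine hs_congr this (fun _ => rfl) ?_
    rw [← (hF.2 e x (t + h)).tsum_eq]
    refine tsum_congr fun k => ?_
    rw [map_mul, map_natCast]; ring
  · refine (hG' 0 x t).unique (hs_congr (hF.2 e x t) (fun k => ?_) rfl)
    simp only [add_zero, Nat.choose_zero_right, Nat.cast_one, one_mul]
    rw [map_mul, map_natCast]; ring
  · refine (hG' 1 x t).unique (hs_congr ((hF.2 (e + 1) x t).mul_left ((e + 1 : ℕ) : ℤ_[p])) (fun k => ?_) rfl)
    rw [map_mul, map_natCast, Nat.choose_one_right, show k + 1 + e = k + (e + 1) by ring]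
    have h1 : (k + 1) * (k + (e + 1)).choose e = (e + 1) * (k + (e + 1)).choose (e + 1) := by
      have := Nat.choose_succ_right_eq (k + (e + 1)) e
      rw [show k + (e + 1) - e = k + 1 by omega] at this
      linarith
    have h2 : ((k + 1 : ℕ) : ℤ_[p]) * ((k + (e + 1)).choose e : ℕ) = ((e + 1 : ℕ) : ℤ_[p]) * ((k + (e + 1)).choose (e + 1) : ℕ) := by
      exact_mod_cast h1
    linear_combination (ev x (c (k + (e + 1))) * t ^ k) * h2

theorem deriv_lin (hc : Null p c) (hF : Tay c F) {e : ℕ} {x : σ → ℤ_[p]} {t h : ℤ_[p]}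
    (h1 : (p : ℤ_[p]) ∣ ev (ext1 x t) (F (e + 1)) - 1) (hh : ‖h‖ < ‖((e + 1 : ℕ) : ℤ_[p])‖) :
    ‖ev (ext1 x (t + h)) (F e) - ev (ext1 x t) (F e)‖ = ‖((e + 1 : ℕ) : ℤ_[p])‖ * ‖h‖ := by
  obtain ⟨G, hG, g1, g2, g3⟩ := tay2 hc hF e
  have hs := g1 x t h
  have hu : ‖ev (ext1 x t) (F (e + 1))‖ = 1 := unit_of_dvd h1
  rcases eq_or_ne h 0 with rfl | h0
  · simp
  have hs2 := (hasSum_nat_add_iff' 2).2 hs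
  rw [sum_range_succ, Finset.sum_range_one, pow_zero, pow_one, mul_one, g2, g3] at hs2
  have h3 : ‖ev (ext1 x (t + h)) (F e) - (ev (ext1 x t) (F e) + (e + 1 : ℕ) * ev (ext1 x t) (F (e + 1)) * h)‖ ≤ ‖h‖ * ‖h‖ := by
    have : (h * h) ∣ ev (ext1 x (t + h)) (F e) - (ev (ext1 x t) (F e) + (e + 1 : ℕ) * ev (ext1 x t) (F (e + 1)) * h) := by
      have hs3 : HasSum (fun i => ev (ext1 x t) (G (i + 2)) * h ^ i) (∑' i, ev (ext1 x t) (G (i + 2)) * h ^ i) := by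
        refine Null.hs (c := fun i => G (i + 2)) (fun n => ?_) _ _
        obtain ⟨N, hN⟩ := hG n
        exact ⟨N, fun i hi => hN _ (by omega)⟩
      refine ⟨_, hs2.unique (hs_congr (hs3.mul_left (h * h)) (fun i => by ring) rfl)⟩
    obtain ⟨k, hk⟩ := this
    rw [hk, norm_mul, norm_mul]
    exact mul_le_of_le_one_right (by positivity) (norm_le_one _)
  have hpos : 0 < ‖h‖ := norm_pos_iff.2 h0
  have h4 : ‖((e + 1 : ℕ) : ℤ_[p]) * ev (ext1 x t) (F (e + 1)) * h‖ = ‖((e + 1 : ℕ) : ℤ_[p])‖ * ‖h‖ := by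
    rw [norm_mul, norm_mul, hu, mul_one]
  rw [← h4]
  set Z := ((e + 1 : ℕ) : ℤ_[p]) * ev (ext1 x t) (F (e + 1)) * h
  have e1 : ev (ext1 x (t + h)) (F e) - ev (ext1 x t) (F e) = Z + (ev (ext1 x (t + h)) (F e) - (ev (ext1 x t) (F e) + Z)) := by ring
  rw [e1]
  have := norm_add_eq_left (x := (Z : ℚ_[p])) (y := ((ev (ext1 x (t + h)) (F e) - (ev (ext1 x t) (F e) + Z) : ℤ_[p]) : ℚ_[p])) (by
    refine lt_of_le_of_lt h3 ?_
    change _ < ‖Z‖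
    rw [h4]; exact mul_lt_mul_of_pos_right hh hpos)
  exact_mod_cast this

end pp

section pp2
variable {p : ℕ} [hp : Fact p.Prime] {Y : Type*} {ℰ : Set (Y → ℚ_[p])} {σ : Type}
open Bal
variable {b b' b'' : Bal ℰ} {K : ℕ} {x : Y → σ → ℤ_[p]} {c : ℕ → Rsub p σ} {ψ : Y × ℚ_[p] → ℚ_[p]}
  {r s r' s' : Y → ℤ_[p]} {F : ℕ → Rsub p (Option σ)}

theorem root_lem [Finite σ] (hE : Full ℰ) (hc : Null p c) (hF : Tay c F) (hx : Params ℰ x) (e M : ℕ) (ξ : ℤ_[p])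
    (hM : ‖((p : ℤ_[p]) : ℚ_[p]) ^ M‖ < ‖((e + 1 : ℕ) : ℚ_[p])‖) :
    ∃ ρ : Y → ℤ_[p], (fun y => ((ρ y : ℤ_[p]) : ℚ_[p])) ∈ ℰ ∧ ∀ y, (p : ℤ_[p]) ∣ ev (ext1 (x y) ξ) (F (e + 1)) - 1 →
      ‖((ev (ext1 (x y) ξ) (F e) : ℤ_[p]) : ℚ_[p])‖ ≤ ‖((e + 1 : ℕ) : ℚ_[p]) * (p : ℚ_[p]) ^ M‖ →
      ev (ext1 (x y) (ξ + p ^ M * ρ y)) (F e) = 0 := by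
  obtain ⟨G, hG, g1, g2, g3⟩ := tay2 hc hF e
  have hd0 : ((e + 1 : ℕ) : ℚ_[p]) ≠ 0 := by exact_mod_cast Nat.succ_ne_zero e
  have hξ := hx.ext1 (t := fun _ => ξ) (hE.dalg.const _)
  let a0 : Y → ℤ_[p] := fun y => toZ (((ev (ext1 (x y) ξ) (F e) : ℤ_[p]) : ℚ_[p]) / (((e + 1 : ℕ) : ℚ_[p]) * (p : ℚ_[p]) ^ M))
  let ι : Y → ℤ_[p] := fun y => toZ (((ev (ext1 (x y) ξ) (F (e + 1)) : ℤ_[p]) : ℚ_[p])⁻¹)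
  have ha0 : (fun y => ((a0 y : ℤ_[p]) : ℚ_[p])) ∈ ℰ :=
    toZ_mem hE.dalg hE.pw (hE.dalg.div (hξ.ev hE.dalg (F e)) (hE.dalg.const _))
  have hι : (fun y => ((ι y : ℤ_[p]) : ℚ_[p])) ∈ ℰ := toZ_mem hE.dalg hE.pw (hE.dalg.inv (hξ.ev hE.dalg (F (e + 1))))
  have hxx := (hξ.ext1 ha0).ext1 hι
  obtain ⟨m, hm⟩ : ∃ m : ℤ_[p], (p : ℤ_[p]) ^ M = p * ((e + 1 : ℕ) : ℤ_[p]) * m := by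
    have hne : (p : ℚ_[p]) * ((e + 1 : ℕ) : ℚ_[p]) ≠ 0 := mul_ne_zero pK_ne hd0
    refine ⟨toZ ((p : ℚ_[p]) ^ M / (p * ((e + 1 : ℕ) : ℚ_[p]))), Subtype.ext ?_⟩
    push_cast at hM hne ⊢
    rw [toZ_coe, mul_div_cancel₀ _ hne]
    rw [norm_div, div_le_one (norm_pos_iff.2 hne), ← norm_lt_iff_mul (right_ne_zero_of_mul hne)]
    exact hM
  obtain ⟨G', hG', hG2⟩ := hG.rename (fun o : Option σ => some (some o))
  have hb := hG'.mul_right (fun i => if i < 2 then 0 else -(polyR (MvPolynomial.C m)) * (p : Rsub p _) ^ (M * (i - 2)) * RX none)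
  obtain ⟨ρ, hρ⟩ := exists_root (-(RX (some none) * RX none)) hb
  refine ⟨fun y => ev (ext1 (ext1 (ext1 (x y) ξ) (a0 y)) (ι y)) ρ, hxx.ev hE.dalg ρ, fun y h1 h2 => ?_⟩
  set xx := ext1 (ext1 (ext1 (x y) ξ) (a0 y)) (ι y) with hxx'
  set R := ev xx ρ
  have k1 := hρ xx
  have hiota : ι y * ev (ext1 (x y) ξ) (F (e + 1)) = 1 := by
    have hu := unit_of_dvd h1
    apply Subtype.ext
    push_cast
    rw [toZ_coe (by rw [norm_inv, hu, inv_one])]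
    exact inv_mul_cancel₀ (by rw [← norm_pos_iff, hu]; exact one_pos)
  have ha : ev (ext1 (x y) ξ) (F e) = ((e + 1 : ℕ) : ℤ_[p]) * p ^ M * a0 y := by
    have hne : ((e + 1 : ℕ) : ℚ_[p]) * (p : ℚ_[p]) ^ M ≠ 0 := mul_ne_zero hd0 (pow_ne_zero _ pK_ne)
    apply Subtype.ext
    have h3 := toZ_coe (x := ((ev (ext1 (x y) ξ) (F e) : ℤ_[p]) : ℚ_[p]) / (((e + 1 : ℕ) : ℚ_[p]) * (p : ℚ_[p]) ^ M))
      (by rw [norm_div, div_le_one (norm_pos_iff.2 hne)]; exact h2)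
    rw [coe_mul, h3]
    push_cast at hne ⊢
    rw [mul_div_cancel₀ _ hne]
  have k2 := (hasSum_nat_add_iff' 2).2 k1
  rw [sum_range_succ, Finset.sum_range_one] at k2
  simp only [map_mul, hG2, map_neg, ev_RX, if_pos (show 0 < 2 by norm_num), if_pos (show 1 < 2 by norm_num), map_zero,
    mul_zero, zero_mul, add_zero, sub_zero] at k2
  have k3 := (hasSum_nat_add_iff' 2).2 (g1 (x y) ξ (p ^ M * R))
  rw [sum_range_succ, Finset.sum_range_one, pow_zero, pow_one, mul_one, g2, g3] at k3
  have k4 := k3.unique (hs_congr (k2.mul_left (-(((e + 1 : ℕ) : ℤ_[p]) * ev (ext1 (x y) ξ) (F (e + 1)) * p ^ M)))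
    (fun i => by
      rw [if_neg (by omega), map_mul, map_mul, map_neg, ev_poly, MvPolynomial.eval_C, map_pow, map_natCast, ev_RX,
        show i + 2 - 2 = i by omega]
      have e1 : (fun i => xx (some (some i))) = ext1 (x y) ξ := by funext o; rfl
      have e2 : xx none = ι y := rfl
      rw [e1, e2, mul_pow, ← pow_mul, mul_add, pow_add (p : ℤ_[p])]
      linear_combination (ev (ext1 (x y) ξ) (G (i + 2)) * p ^ (M * i) * R ^ (i + 2) * p ^ M) * hm -
        (p * m * ((e + 1 : ℕ) : ℤ_[p]) * ev (ext1 (x y) ξ) (G (i + 2)) * p ^ (M * i) * R ^ (i + 2) * p ^ M) * hiota) rfl)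
  have e3 : xx (some none) = a0 y := rfl
  have e4 : xx none = ι y := rfl
  rw [e3, e4] at k4
  linear_combination k4 + ha - (((e + 1 : ℕ) : ℤ_[p]) * p ^ M * a0 y) * hiota

theorem SubB.trans (hE : IsDAlg ℰ) (h' : SubB b'' b' r' s') (h : SubB b' b r s) :
    SubB b'' b (fun y => r y + s y * r' y) (fun y => s y * s' y) where
  hB := h'.hB.trans h.hB
  hc := fun y hy => by rw [h'.hc y hy, h.hc y (h'.hB hy), h.hβ y (h'.hB hy)]; push_cast; ring
  hβ := fun y hy => by rw [h'.hβ y hy, h.hβ y (h'.hB hy)]; push_cast; ring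
  hr := by push_cast; exact hE.add h.hr (hE.mul h.hs h'.hr)
  hs := by push_cast; exact hE.mul h.hs h'.hs

theorem SubB.restr (h : SubB b' b r s) {D} (hD : QF ℰ D) : SubB (b'.restr D hD) b r s where
  hB := Set.inter_subset_left.trans h.hB
  hc := fun y hy => h.hc y hy.1
  hβ := fun y hy => h.hβ y hy.1
  hr := h.hr
  hs := h.hs

/-- the ball around a root -/
theorem root_ball [Finite σ] (hE : Full ℰ) (hK : 1 ≤ K) {e M : ℕ} (hQ : QQ ℰ K e) (h : Ser b x c ψ) (hF : Tay c F)
    (h1 : ∀ y ∈ b.B, ∀ t, (p : ℤ_[p]) ∣ ev (ext1 (x y) t) (F (e + 1)) - 1) (hKM : K ≤ M)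
    (hM : ‖(p : ℚ_[p]) ^ M‖ < ‖((e + 1 : ℕ) : ℚ_[p])‖) (hb : SubB b' b r (fun _ => (p : ℤ_[p]) ^ M))
    (hr : ∀ y ∈ b'.B, ev (ext1 (x y) (r y)) (F e) = 0) : BDec K b' ψ := by
  classical
  have hA := hE.dalg
  have hx1 := h.1.ext1 hb.hr
  have hFi := fun i => hx1.ev hA (F i)
  have hu : ∀ y ∈ b.B, ‖((ev (ext1 (x y) (r y)) (F (e + 1)) : ℤ_[p]) : ℚ_[p])‖ = 1 := fun y hy => unit_of_dvd (h1 y hy _)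
  let φ1 : Y × ℚ_[p] → ℚ_[p] := fun w =>
    ((∑' j, ev (ext1 (x w.1) (r w.1)) (F (j + (e + 2)) * (p : Rsub p _) ^ (M * j)) * toZ (b'.W w) ^ j : ℤ_[p]) : ℚ_[p])
  have hN1 : Null p fun j => F (j + (e + 2)) * (p : Rsub p (Option σ)) ^ (M * j) := by
    refine Null.mul_right (c := fun j => F (j + (e + 2))) (fun n => ?_) _
    obtain ⟨N, hN⟩ := hF.1 n
    exact ⟨N, fun i hi => hN _ (by omega)⟩
  have hφ1 : b'.AN φ1 := Ser.an (x := fun y => ext1 (x y) (r y)) ⟨hx1, hN1, fun w _ => rfl⟩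
  let φ : Y × ℚ_[p] → ℚ_[p] := fun w => (((ev (ext1 (x w.1) (r w.1)) (F (e + 1)) : ℤ_[p]) : ℚ_[p]))⁻¹ * (b'.W w * φ1 w)
  have hφ : b'.AN φ := An.mul (AN.base (hA.inv (hFi (e + 1))) fun y hy => by
    change ‖(((ev (ext1 (x y) (r y)) (F (e + 1)) : ℤ_[p]) : ℚ_[p]))⁻¹‖ ≤ 1
    rw [norm_inv, hu y (hb.hB hy), inv_one]) ((AN.W b').mul hφ1)
  have hU : U1 (b'.cell hA).carrier (b'.cell hA).gens M (fun w => 1 + (p : ℚ_[p]) ^ M * φ w) :=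
    ⟨φ, (cell_in hA).an hA hφ, fun w _ => rfl⟩
  refine of_cell hA ((Cell.NF hE hK (b'.cell hA) ((range (e + 2)).map Nat.castEmbedding)
    (Cf := fun i y => ((ev (ext1 (x y) (r y)) (F i.toNat) : ℤ_[p]) : ℚ_[p]) / b.β y ^ i.toNat)
    (fun i => hA.div (hFi _) (hA.pow b.hβ _))
    (U := fun i w => if i = ((e + 1 : ℕ) : ℤ) then 1 + (p : ℚ_[p]) ^ M * φ w else 1) (fun i => ?_) (φ := ψ) (fun w hw => ?_)).bind ?_)
  · by_cases hi : i = ((e + 1 : ℕ) : ℤ)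
    · simp only [if_pos hi]; exact hU.mono_K hKM
    · simp only [if_neg hi]; exact U1.one
  · have hw' := (cell_in hA).1 hw
    have hβ := b.hne _ (hb.hB hw'.1)
    have hFne : ((ev (ext1 (x w.1) (r w.1)) (F (e + 1)) : ℤ_[p]) : ℚ_[p]) ≠ 0 := by
      rw [← norm_pos_iff, hu _ (hb.hB hw'.1)]; exact one_pos
    obtain ⟨A, hA1, hA2⟩ := h.taylor hb hF.2 hw'
    have hτ : (b'.cell hA).τ w = b.β w.1 * (p ^ M * b'.W w) := by
      have h3 := b'.hne _ hw'.1
      have h4 := hb.hβ _ hw'.1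
      push_cast at h4
      rw [← mul_assoc, ← h4, Bal.W, mul_div_cancel₀ _ h3]; rfl
    rw [hA1, ← hA2.tsum_eq, ← hA2.summable.sum_add_tsum_nat_add (e + 2)]
    have e1 : (∑' i, ev (ext1 (x w.1) (r w.1)) (F (i + (e + 2))) * ((p : ℤ_[p]) ^ M * toZ (b'.W w)) ^ (i + (e + 2))) =
        ((p : ℤ_[p]) ^ M * toZ (b'.W w)) ^ (e + 1) * (p ^ M * (toZ (b'.W w) *
          ∑' j, ev (ext1 (x w.1) (r w.1)) (F (j + (e + 2)) * (p : Rsub p _) ^ (M * j)) * toZ (b'.W w) ^ j)) := by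
      rw [← (hN1.hs _ _).summable.tsum_mul_left, ← ((hN1.hs _ _).summable.mul_left _).tsum_mul_left,
        ← (((hN1.hs _ _).summable.mul_left _).mul_left _).tsum_mul_left]
      refine tsum_congr fun i => ?_
      rw [map_mul, map_pow, map_natCast, show i + (e + 2) = i + 1 + (e + 1) by ring, pow_add _ (i + 1), pow_succ, mul_pow _ _ i, ← pow_mul]
      ring
    rw [e1, Finset.sum_map, PadicInt.coe_add, coe_sum]
    rw [sum_congr rfl (g := fun i : ℕ => ((ev (ext1 (x w.1) (r w.1)) (F i) : ℤ_[p]) : ℚ_[p]) * ((p : ℚ_[p]) ^ M * b'.W w) ^ i)]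
    · rw [sum_range_succ _ (e + 1), sum_range_succ _ (e + 1), add_assoc]
      congr 1
      · refine sum_congr rfl fun i hi => ?_
        have hi' := mem_range.1 hi
        simp only [Nat.castEmbedding_apply, Int.toNat_natCast, zpow_natCast]
        rw [if_neg (by omega), hτ, mul_pow (b.β w.1)]
        field_simp
      · simp only [Nat.castEmbedding_apply, Int.toNat_natCast, zpow_natCast, if_true]
        rw [hτ, mul_pow (b.β w.1)]
        simp only [φ, φ1]
        push_cast
        rw [coe_W hw']
        field_simp
    · intro i _
      push_cast
      rw [coe_W hw']
  rintro C ⟨hs, hC⟩ -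
  have hin : b'.InBall C := ⟨fun w hw => (cell_in hA).1 (hs.2.1 hw), fun y hy => by
    rw [hs.1]; exact center_mem (hs.2.2 hy)⟩
  rcases hC with hC | hS
  · exact Dec.cell C ⟨hin, hC⟩
  have hpM : ((p : ℚ_[p]) ^ M) ≠ 0 := pow_ne_zero _ pK_ne
  let ε : Y → ℤ_[p] := fun y => toZ (C.α y / b.β y)
  have hε : ∀ y ∈ C.B, ‖C.α y / b.β y‖ ≤ ‖(p : ℚ_[p]) ^ M‖ := by
    intro y hy
    obtain ⟨h3, h4⟩ := C.mem_α hy (hS.alpha_ne hy)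
    have h5 := (hin.1 h3).2
    have h6 : b'.c0 y = C.c y := by rw [hs.1]; rfl
    have h7 := hb.hβ y (hs.2.2 hy)
    push_cast at h7
    simp only [h6, add_sub_cancel_left, h7] at h5
    rw [norm_div, div_le_iff₀ (norm_pos_iff.2 (b.hne y (hb.hB (hs.2.2 hy)))), mul_comm, ← norm_mul]
    exact h5
  have hεc : ∀ y ∈ C.B, ((ε y : ℤ_[p]) : ℚ_[p]) = C.α y / b.β y := fun y hy =>
    toZ_coe ((hε y hy).trans (normpow_le _))
  have hεm : (fun y => ((ε y : ℤ_[p]) : ℚ_[p])) ∈ ℰ := toZ_mem hA hE.pw (hA.div C.hα b.hβ)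
  refine hS.dec hA (L := M + 1) (by omega) fun ζ hζ b4 q1 q2 q3 q4 => ?_
  refine BDec.sub (lemmaA hE hQ h hF (r := fun y => r y + ε y * ζ) (s := fun y => ε y * p ^ (M + 1)) ⟨?_, ?_, ?_, ?_, ?_⟩ ?_) (q4.trans hin.1)
  · rw [q1]; exact hs.2.2.trans hb.hB
  · intro y hy
    rw [q1] at hy
    have := b.hne y (hb.hB (hs.2.2 hy))
    have h6 : C.c y = b'.c0 y := by rw [hs.1]; rfl
    rw [q2, h6, hb.hc y (hs.2.2 hy)]
    push_cast
    rw [hεc y hy]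
    field_simp
    try ring
  · intro y hy
    rw [q1] at hy
    have := b.hne y (hb.hB (hs.2.2 hy))
    rw [q3]
    push_cast
    rw [hεc y hy]
    field_simp
  · push_cast; exact hA.add hb.hr (hA.mul hεm (hA.const _))
  · push_cast; exact hA.mul hεm (hA.const _)
  · intro y hy
    rw [q1] at hy
    have hyb := hb.hB (hs.2.2 hy)
    have hζn : ‖(ζ : ℤ_[p])‖ = 1 := natCast_unit_norm (p := p) hζ
    have hh : ‖ε y * (ζ : ℤ_[p])‖ = ‖C.α y / b.β y‖ := by
      rw [norm_mul, hζn, mul_one, ← hεc y hy]; rfl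
    have hdl := deriv_lin h.2.1 hF (h1 y hyb (r y)) (h := ε y * ζ) (by rw [hh]; exact (hε y hy).trans_lt hM)
    rw [hr y (hs.2.2 hy), sub_zero, hh] at hdl
    rw [norm_mul]
    change _ ≤ ‖(p : ℚ_[p])‖ * ‖ev (ext1 (x y) (r y + ε y * ζ)) (F e)‖
    rw [hdl]
    push_cast
    rw [hεc y hy, norm_mul, pow_succ, norm_mul]
    have h8 : ‖(p : ℚ_[p]) ^ M‖ ≤ ‖((e + 1 : ℕ) : ℤ_[p])‖ := hM.le
    push_cast at h8
    calc ‖C.α y / b.β y‖ * (‖(p : ℚ_[p]) ^ M‖ * ‖(p : ℚ_[p])‖) = ‖(p : ℚ_[p])‖ * (‖(p : ℚ_[p]) ^ M‖ * ‖C.α y / b.β y‖) := by ring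
      _ ≤ _ := by gcongr

theorem PP_succ (hE : Full ℰ) (hK : 1 ≤ K) {e : ℕ} (hQ : QQ ℰ K e) : PP ℰ K (e + 1) := by
  intro b σ _ x c ψ h h1 h2
  have hA := hE.dalg
  obtain ⟨F, hF0, hF1⟩ := exists_taylor h.2.1
  have hF : Tay c F := ⟨hF0, hF1⟩
  have h1' : ∀ y ∈ b.B, ∀ t, (p : ℤ_[p]) ∣ ev (ext1 (x y) t) (F (e + 1)) - 1 := fun y hy t =>
    tay_unit hF (h1 y hy) (h2 y hy) t
  have hd0 : ((e + 1 : ℕ) : ℚ_[p]) ≠ 0 := by exact_mod_cast Nat.succ_ne_zero e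
  obtain ⟨M0, hM0⟩ := exists_normpow_lt (p := p) (norm_pos_iff.2 hd0)
  obtain ⟨M, hM, hKM⟩ : ∃ M, ‖(p : ℚ_[p]) ^ M‖ < ‖((e + 1 : ℕ) : ℚ_[p])‖ ∧ K ≤ M := by
    refine ⟨M0 + K, lt_of_le_of_lt ?_ hM0, by omega⟩
    rw [pow_add, norm_mul]
    exact mul_le_of_le_one_right (norm_nonneg _) (normpow_le _)
  refine BDec.subdiv hA b M fun ξ => ?_
  have hb1 := shrink_sub hA b M ξ
  have hξ := h.1.ext1 hb1.hr
  have hD := QF.norm_lt hA (hA.const (((e + 1 : ℕ) : ℚ_[p]) * (p : ℚ_[p]) ^ M)) (hξ.ev hA (F e))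
  refine BDec.split _ hD ?_ ?_
  · refine BDec.subdiv hA _ (M + 1) fun ζ => ?_
    refine lemmaA hE hQ h hF (SubB.trans hA (shrink_sub hA _ (M + 1) ζ) (SubB.restr hb1 hD)) fun y hy => ?_
    have hy2 : ‖((e + 1 : ℕ) : ℚ_[p]) * (p : ℚ_[p]) ^ M‖ < ‖((ev (ext1 (x y) (ξ : ℤ_[p])) (F e) : ℤ_[p]) : ℚ_[p])‖ := hy.2
    have hn : ‖(p : ℤ_[p]) ^ M * (ζ : ℤ_[p])‖ ≤ ‖(p : ℚ_[p]) ^ M‖ := by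
      rw [norm_mul]
      refine (mul_le_of_le_one_right (norm_nonneg _) (norm_le_one _)).trans (le_of_eq ?_)
      rw [← PadicInt.padic_norm_e_of_padicInt]; push_cast; rfl
    have hdl := deriv_lin h.2.1 hF (h1' y hy.1 ξ) (h := (p : ℤ_[p]) ^ M * ζ) (hn.trans_lt hM)
    set A1 := ev (ext1 (x y) ((ξ : ℤ_[p]) + p ^ M * ζ)) (F e)
    set A0 := ev (ext1 (x y) (ξ : ℤ_[p])) (F e)
    have h3 : ‖((A1 : ℤ_[p]) : ℚ_[p]) - A0‖ ≤ ‖((e + 1 : ℕ) : ℚ_[p]) * (p : ℚ_[p]) ^ M‖ := by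
      have : ‖((A1 : ℤ_[p]) : ℚ_[p]) - A0‖ = ‖A1 - A0‖ := by rw [← PadicInt.padic_norm_e_of_padicInt]; push_cast; rfl
      rw [this, hdl, norm_mul (((e + 1 : ℕ) : ℚ_[p]))]
      exact mul_le_mul_of_nonneg_left hn (norm_nonneg (((e + 1 : ℕ) : ℤ_[p])))
    have h4 := norm_add_eq_left (h3.trans_lt hy2)
    rw [add_sub_cancel] at h4
    rw [norm_mul, h4]
    push_cast
    rw [pow_succ, ← mul_assoc, norm_mul, norm_mul, mul_comm]
    rw [norm_mul] at hy2
    refine mul_le_mul_of_nonneg_left ?_ (norm_nonneg _)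
    refine le_trans ?_ hy2.le
    exact mul_le_mul_of_nonneg_right hM.le (norm_nonneg _)
  · obtain ⟨ρ, hρ, hρ'⟩ := root_lem hE h.2.1 hF h.1 e M (ξ : ℤ_[p]) (by exact_mod_cast hM)
    have hb2 := SubB.restr hb1 hD.compl
    set b2 := (b.shrink hA M ξ).restr _ hD.compl with hb2'
    let b3 : Bal ℰ :=
      { B := b2.B
        c0 := fun y => b2.c0 y + b2.β y * (ρ y : ℚ_[p])
        β := b2.β
        hB := b2.hB
        hc := hA.add b2.hc (hA.mul b2.hβ hρ)
        hβ := b2.hβ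
        hne := b2.hne }
    have s1 : SubB b3 b2 ρ (fun _ => 1) := ⟨le_rfl, fun _ _ => rfl, fun _ _ => by simp [b3], hρ, hA.const _⟩
    have s2 : SubB b2 b3 (fun y => - ρ y) (fun _ => 1) :=
      ⟨le_rfl, fun _ _ => by simp [b3], fun _ _ => by simp [b3], by push_cast; exact hA.neg hρ, hA.const _⟩
    have s3 : SubB b3 b (fun y => (ξ : ℤ_[p]) + p ^ M * ρ y) (fun _ => p ^ M) := by
      have := SubB.trans hA s1 hb2
      simpa using this
    have hroot := root_ball hE hK hQ h hF h1' hKM hM s3 fun y hy => hρ' y (h1' y hy.1 _) (not_lt.1 hy.2)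
    exact (hroot.sub s1.sub).of_eq (Set.Subset.antisymm s1.sub s2.sub)

theorem PPQQ (hE : Full ℰ) (hK : 1 ≤ K) (D : ℕ) : (∀ j ≤ D, PP ℰ K j) ∧ QQ ℰ K D := by
  have h : ∀ j ≤ D, PP ℰ K j := by
    induction D with
    | zero => intro j hj; rw [Nat.le_zero.1 hj]; exact PP_zero hE K
    | succ n ih =>
      intro j hj
      rcases Nat.lt_or_ge j (n + 1) with h | h
      · exact ih j (by omega)
      · rw [le_antisymm hj h]; exact PP_succ hE hK (QQ_of_PP hE ih)
  exact ⟨h, QQ_of_PP hE h⟩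

end pp2

section star
variable {p : ℕ} [hp : Fact p.Prime] {Y : Type*} {ℰ : Set (Y → ℚ_[p])} {σ : Type}

theorem Null.shift {c : ℕ → Rsub p σ} (hc : Null p c) (N : ℕ) : ∃ c' : ℕ → Rsub p σ, Null p c' ∧
    ∀ x t, ∑' k, ev x (c' k) * t ^ k = t ^ N * ∑' k, ev x (c k) * t ^ k := by
  have hn : Null p (fun k => if k < N then 0 else c (k - N)) := fun n => by
    obtain ⟨M, hM⟩ := hc n
    refine ⟨M + N, fun i hi => ?_⟩
    change _ ∣ ite _ _ _
    rw [if_neg (by omega)]; exact hM _ (by omega)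
  refine ⟨_, hn, fun x t => ?_⟩
  rw [← (hn.hs x t).summable.sum_add_tsum_nat_add N, Finset.sum_eq_zero, zero_add, ← (hc.hs x t).summable.tsum_mul_left]
  · refine tsum_congr fun k => ?_
    rw [if_neg (by omega), Nat.add_sub_cancel, pow_add]; ring
  · intro k hk
    rw [if_pos (mem_range.1 hk)]; simp

theorem tail [Finite σ] {c : ℕ → Rsub p σ} (hc : Null p c) (K : ℕ) : ∃ (D : ℕ) (b : ℕ → ℕ → Rsub p σ), (∀ j, Null p (b j)) ∧
    ∀ x t, ∑' k, ev x (c k) * t ^ k =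
      ∑ j ∈ range (D + 1), ev x (c j) * (t ^ j * (1 + p ^ K * ∑' k, ev x (b j k) * t ^ k)) := by
  obtain ⟨D, b0, hb0, h⟩ := lemmaN hc K
  have hb1 : ∀ j, Null p (fun k => b0 (k + (D + 1)) j) := fun j n => by
    obtain ⟨M, hM⟩ := hb0 j n
    exact ⟨M, fun i hi => hM _ (by omega)⟩
  choose b hb hb' using fun j => (hb1 j).shift (D + 1 - j)
  refine ⟨D, b, hb, fun x t => ?_⟩
  rw [← (hc.hs x t).summable.sum_add_tsum_nat_add (D + 1)]
  have e : ∀ k, ev x (c (k + (D + 1))) * t ^ (k + (D + 1)) = ∑ j ∈ range (D + 1),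
      (p ^ K * ev x (c j) * t ^ (D + 1)) * (ev x (b0 (k + (D + 1)) j) * t ^ k) := fun k => by
    rw [h _ (by omega), map_sum, Finset.sum_mul]
    refine sum_congr rfl fun j _ => ?_
    rw [map_mul, map_mul, map_pow, map_natCast, pow_add]; ring
  rw [tsum_congr e, Summable.tsum_finsetSum (fun j _ => ((hb1 j).hs x t).summable.mul_left _), ← Finset.sum_add_distrib]
  refine sum_congr rfl fun j hj => ?_
  rw [((hb1 j).hs x t).summable.tsum_mul_left, hb', ← Nat.sub_add_cancel (mem_range.1 hj).le, pow_add]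
  rw [Nat.sub_add_cancel (mem_range.1 hj).le]; ring

/-- parameters from the base -/
theorem base_params (hE : Full ℰ) {G : σ → Y × ℚ_[p] → ℚ_[p]} (hG : ∀ i, G i ∈ pull ℰ) :
    ∃ x : Y → σ → ℤ_[p], Params ℰ x ∧ ∀ w, (fun i => toZ (G i w)) = x w.1 := by
  choose g hg hg' using hG
  exact ⟨fun y i => toZ (g i y), fun i => toZ_mem hE.dalg hE.pw (hg i), fun w => by funext i; rw [hg']⟩

theorem ball_an (hE : Full ℰ) {K : ℕ} (hK : 1 ≤ K) {b : Bal ℰ} {f} (hf : b.AN f) : b.BDec K f := by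
  obtain ⟨σ, _, G, c, h1, h2, h3, h4⟩ := An.one_var hf
  obtain ⟨x, hx, hx'⟩ := base_params hE h1
  obtain ⟨D, b', hb, h⟩ := tail h3 1
  choose b2 hb2 hb2' using fun j => (hb j).shift j
  refine (PPQQ hE hK D).2 b σ x hx (fun j y => ((ev (x y) (c j) : ℤ_[p]) : ℚ_[p])) (fun j => hx.ev hE.dalg _) b2 hb2 f fun w hw => ?_
  have h5 := (h4 w hw).tsum_eq
  rw [hx', h] at h5
  rw [← toZ_coe (An.bdd hf hw), ← h5, coe_sum]
  refine sum_congr rfl fun j _ => ?_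
  rw [hb2']
  push_cast
  rw [Bal.coe_W hw]
  ring

namespace Cell
variable {K : ℕ} {C C' : Cell ℰ}

theorem sphere_an (hE : Full ℰ) (hK : 1 ≤ K) (hS : C.Sphere) {f} (hf : C.AN f) :
    Dec (fun C' => Good K C' C ∧ C'.Prep K f) C.carrier := by
  have hA := hE.dalg
  refine hS.dec hA hK fun ζ hζ b q1 q2 q3 q4 => ?_
  have hζ0 : (ζ : ℚ_[p]) ≠ 0 := natCast_unit_ne hζ
  have hζ1 : ‖(ζ : ℚ_[p])‖ = 1 := natCast_unit_norm hζ
  have hζ2 : ‖(ζ : ℚ_[p])⁻¹‖ ≤ 1 := by rw [norm_inv, hζ1, inv_one]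
  have hτ : ∀ w ∈ b.carrier, C.τ w = C.α w.1 * ζ * (1 + p ^ K * ((ζ : ℚ_[p])⁻¹ * b.W w)) := fun w hw => by
    rw [Cell.τ, Bal.W_eq hw, q2, q3]; field_simp; ring
  have hV : b.AN (fun w => (ζ : ℚ_[p])⁻¹ * b.W w) := An.mul (An.const hζ2) (Bal.AN.W b)
  have hU : U1 b.carrier (pull ℰ ∪ {b.W}) K (fun w => 1 + p ^ K * ((ζ : ℚ_[p])⁻¹ * b.W w)) := ⟨_, hV, fun _ _ => rfl⟩
  have hα : ∀ w ∈ b.carrier, C.α w.1 ≠ 0 := fun w hw => hS.alpha_ne (by rw [← q1]; exact hw.1)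
  have ht : ∀ g, C.AN g → b.AN g := fun g hg => by
    refine An.bind hg q4 ?_
    rintro g (hg | rfl | rfl) hb
    · exact An.gen (Or.inl hg) fun w hw => hb w (q4 hw)
    · refine (An.mul (Bal.AN.base (hA.mul C.hα C.hb) fun y hy => C.hab y (by rw [← q1]; exact hy))
        (An.mul (An.const hζ1.le) hU.toAn)).congr fun w hw => ?_
      rw [hτ w hw]; ring
    · refine (An.mul (An.const hζ2) (hU.inv hK).toAn).congr fun w hw => ?_
      have := hα w hw
      rw [hτ w hw, mul_assoc, div_mul_eq_div_div, div_self this, one_div, mul_inv]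
  refine (ball_an hE hK (ht f hf)).mono fun C1 h1 _ => ⟨⟨h1.1.1.trans q4, fun g hg => h1.1.an hA (ht g hg), ?_⟩, h1.2⟩
  exact ⟨_, hA.mul C.hα (hA.const (ζ : ℚ_[p])), 0, _, U1.transfer h1.1.1 (fun g hg => h1.1.an hA hg) hU, fun w hw => by
    rw [hτ w (h1.1.1 hw), zpow_zero, mul_one]⟩

theorem an_prep (hE : Full ℰ) (hK : 1 ≤ K) {f} (hf : C.AN f) :
    Dec (fun C' => Good K C' C ∧ C'.Prep K f) C.carrier := by
  classical
  have hA := hE.dalg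
  obtain ⟨σ, _, G, c, d, h1, h2, h3, h4, h5⟩ := An.two_var (δ := fun w => C.b w.1 * C.α w.1) (fun w hw => (AN.u C).bdd hw) (fun w hw => (AN.v C).bdd hw)
    (mem_pull (hA.mul C.hb C.hα)) (fun w hw => by have := hw.2.1; field_simp) hf
  obtain ⟨x, hx, hx'⟩ := base_params hE h1
  obtain ⟨D, bc, hbc, hc⟩ := tail h3 K
  obtain ⟨D', bd, hbd, hd⟩ := tail h4 K
  have hxA : ∀ i, C.AN (fun w => ((x w.1 i : ℤ_[p]) : ℚ_[p])) := fun i => AN.base (hx i) fun y _ => norm_le_one _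
  have hU : ∀ (c' : ℕ → Rsub p σ) (u : Y × ℚ_[p] → ℚ_[p]), Null p c' → C.AN u → U1 C.carrier C.gens K
      (fun w => 1 + p ^ K * ((∑' k, ev (x w.1) (c' k) * toZ (u w) ^ k : ℤ_[p]) : ℚ_[p])) := fun c' u hc' hu =>
    ⟨_, An.series hc' hxA hu fun w _ => ⟨_, rfl, by simp only [coe_toZ]; exact hc'.hs _ _⟩, fun _ _ => rfl⟩
  let E1 : Finset ℤ := (range (D + 1)).map Nat.castEmbedding
  let E2 : Finset ℤ := (range (D' + 1)).map ⟨Int.negSucc, fun _ _ h => Int.negSucc.inj h⟩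
  refine (NF hE hK C (E1 ∪ E2)
    (Cf := fun e y => match e with
      | Int.ofNat j => ((ev (x y) (c j) : ℤ_[p]) : ℚ_[p]) * C.b y ^ j
      | Int.negSucc j => ((ev (x y) (d j) : ℤ_[p]) : ℚ_[p]) * C.α y ^ (j + 1))
    (fun e => ?_)
    (U := fun e w => match e with
      | Int.ofNat j => 1 + p ^ K * ((∑' k, ev (x w.1) (bc j k) * toZ (C.b w.1 * C.τ w) ^ k : ℤ_[p]) : ℚ_[p])
      | Int.negSucc j => 1 + p ^ K * ((∑' k, ev (x w.1) (bd j k) * toZ (C.α w.1 / C.τ w) ^ k : ℤ_[p]) : ℚ_[p]))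
    (fun e => ?_) (φ := f) (fun w hw => ?_)).bind ?_
  · cases e with
    | ofNat j => exact hA.mul (hx.ev hA _) (hA.pow C.hb _)
    | negSucc j => exact hA.mul (hx.ev hA _) (hA.pow C.hα _)
  · cases e with
    | ofNat j => exact hU _ _ (hbc j) (AN.u C)
    | negSucc j => exact hU _ _ (hbd j) (AN.v C)
  · obtain ⟨A, B, hA', hB, e⟩ := h5 w hw
    have hB' : HasSum (fun k => toZ (C.α w.1 / C.τ w) * (ev (x w.1) (d k) * toZ (C.α w.1 / C.τ w) ^ k)) B := by
      refine hs_congr hB (fun k => ?_) rfl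
      rw [hx', pow_succ]; ring
    rw [e, ← hA'.tsum_eq, ← hB'.tsum_eq, (h4.hs _ _).summable.tsum_mul_left, hx', hc, hd, Finset.sum_union, Finset.sum_map,
      Finset.sum_map, mul_sum, coe_sum, coe_sum]
    · congr 1
      · refine sum_congr rfl fun j _ => ?_
        change _ = ((ev (x w.1) (c j) : ℤ_[p]) : ℚ_[p]) * C.b w.1 ^ j * C.τ w ^ ((j : ℕ) : ℤ) * _
        rw [zpow_natCast]
        push_cast
        rw [toZ_coe ((AN.u C).bdd hw)]
        rw [mul_pow]; simp only [Nat.castEmbedding_apply]; ring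
      · refine sum_congr rfl fun j _ => ?_
        change _ = ((ev (x w.1) (d j) : ℤ_[p]) : ℚ_[p]) * C.α w.1 ^ (j + 1) * C.τ w ^ (Int.negSucc j) * _
        rw [zpow_negSucc]
        push_cast
        rw [toZ_coe ((AN.v C).bdd hw)]
        have := hw.2.1
        rw [div_pow, pow_succ, pow_succ]
        field_simp
        rfl
    · rw [Finset.disjoint_left]
      intro a ha ha'
      simp only [E1, E2, Finset.mem_map, Nat.castEmbedding_apply, Function.Embedding.coeFn_mk] at ha ha'
      obtain ⟨i, _, rfl⟩ := ha
      obtain ⟨j, _, hj⟩ := ha'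
      exact absurd hj (by simp)
  · rintro C1 ⟨hs, h | h⟩ -
    · exact Dec.cell _ ⟨hs.good hA K, h⟩
    · refine (sphere_an hE hK h ((hs.good hA K).2.1 f hf)).mono fun C2 h2 _ => ⟨h2.1.trans hA hK (hs.good hA K), h2.2⟩

end Cell
end star

section prepall
variable {p : ℕ} [hp : Fact p.Prime] {Y : Type*} {ℰ : Set (Y → ℚ_[p])}

namespace Cell
variable {K : ℕ} {C C' : Cell ℰ} {f g : Y × ℚ_[p] → ℚ_[p]}

/-- prepared functions with given data -/
def PrepD (K : ℕ) (C : Cell ℰ) (f : Y × ℚ_[p] → ℚ_[p]) (h : Y → ℚ_[p]) (a : ℤ) : Prop :=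
  ∃ U, U1 C.carrier C.gens K U ∧ ∀ w ∈ C.carrier, f w = h w.1 * C.τ w ^ a * U w

theorem PrepD.same (hE : IsDAlg ℰ) {h a} (H : C.PrepD K f h a) (hs : SameC C' C) : C'.PrepD K f h a := by
  obtain ⟨U, hU, hf⟩ := H
  exact ⟨U, U1.transfer hs.2.1 (hs.good hE K).2.1 hU, fun w hw => by rw [hs.τ_eq]; exact hf w (hs.2.1 hw)⟩

theorem PrepD.norm (hK : 1 ≤ K) {h a} (H : C.PrepD K f h a) {w} (hw : w ∈ C.carrier) : ‖f w‖ = ‖h w.1 * C.τ w ^ a‖ := by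
  obtain ⟨U, hU, hf⟩ := H
  rw [hf w hw, norm_mul, (hU.near hw).norm hK, mul_one]

def GP (K : ℕ) (C : Cell ℰ) (f : Y × ℚ_[p] → ℚ_[p]) : Prop := Dec (fun C' => Good K C' C ∧ C'.Prep K f) C.carrier

theorem Good.refl (hE : IsDAlg ℰ) : Good K C C := SameC.refl.good hE K

theorem GP.cell (hE : IsDAlg ℰ) (h : C.Prep K f) : GP K C f := Dec.cell C ⟨Good.refl hE, h⟩

theorem GP.sub (hE : IsDAlg ℰ) (hK : 1 ≤ K) (h : GP K C' f) (hs : Good K C' C) :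
    Dec (fun C' => Good K C' C ∧ C'.Prep K f) C'.carrier := h.mono fun C2 h2 _ => ⟨h2.1.trans hE hK hs, h2.2⟩

theorem GP.bind (hE : IsDAlg ℰ) (hK : 1 ≤ K) (h : GP K C f) (hg : ∀ C', Good K C' C → C'.Prep K f → GP K C' g) : GP K C g :=
  Dec.bind h fun C1 h1 _ => (hg C1 h1.1 h1.2).sub hE hK h1.1

theorem add_aux (hE : Full ℰ) (hK : 1 ≤ K) {h1 h2 a1 a2} (m1 : h1 ∈ ℰ) (m2 : h2 ∈ ℰ) (H1 : C.PrepD K f h1 a1)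
    (H2 : C.PrepD K g h2 a2) (hne : ∀ w ∈ C.carrier, h2 w.1 ≠ 0)
    (hle : ∀ w ∈ C.carrier, ‖h1 w.1 / h2 w.1 * C.τ w ^ (a1 - a2)‖ ≤ 1) : GP K C (fun w => f w + g w) := by
  obtain ⟨V1, hV1, e1⟩ := H1
  obtain ⟨V2, hV2, e2⟩ := H2
  have h3 : C.AN (fun w => 1 + h1 w.1 / h2 w.1 * C.τ w ^ (a1 - a2) * (V1 w * (V2 w)⁻¹)) :=
    An.add (An.const (by simp)) (An.mul (Bd hE.dalg (hE.dalg.div m1 m2) _ hle) (hV1.mul (hV2.inv hK)).toAn)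
  refine GP.bind hE.dalg hK (an_prep hE hK h3) fun C1 g1 p1 => GP.cell hE.dalg ?_
  refine Prep.congr (Prep.mul hE.dalg (Good.prep hE.dalg hK g1 (f := g) ⟨h2, m2, a2, V2, hV2, e2⟩) p1) fun w hw => ?_
  have hw' := g1.1 hw
  have := hne w hw'
  have h4 := hw'.2.1
  have h5 : V2 w ≠ 0 := (hV2.near hw').ne hK
  rw [e1 w hw', e2 w hw', zpow_sub₀ h4]
  have h6 := zpow_ne_zero a2 h4
  field_simp
  try ring

theorem add_prep (hE : Full ℰ) (hK : 1 ≤ K) (H1 : C.Prep K f) (H2 : C.Prep K g) : GP K C (fun w => f w + g w) := by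
  have hA := hE.dalg
  obtain ⟨h1, m1, a1, H1⟩ := H1
  obtain ⟨h2, m2, a2, H2⟩ := H2
  change C.PrepD K f h1 a1 at H1
  change C.PrepD K g h2 a2 at H2
  refine Dec.split hA C (QF.zero h2 m2) (GP.sub hA hK (GP.cell hA ?_) ((restr_same ..).good hA K)) ?_
  · refine Prep.congr ⟨h1, m1, a1, H1.same hA (restr_same ..)⟩ fun w hw => ?_
    have h0 : h2 w.1 = 0 := hw.1.2
    have : g w = 0 := by
      rw [← norm_eq_zero, H2.norm hK ((restr_same ..).2.1 hw), h0, zero_mul, norm_zero]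
    simp only [this, add_zero]
  · set C1 := C.restr hA _ (QF.zero h2 m2).compl with hC1
    have hs1 : SameC C1 C := restr_same ..
    refine (CutM hE C1 (hA.div m1 m2) (a1 - a2)).bind fun C2 h _ => ?_
    have hs2 := h.1.trans hs1
    refine GP.sub hA hK ?_ (hs2.good hA K)
    have K1 := H1.same hA hs2
    have K2 := H2.same hA hs2
    rcases h.2 with hd | hd
    · exact add_aux hE hK m1 m2 K1 K2 (fun w hw => (h.1.2.1 hw).1.2) hd
    · have h0 : ∀ w ∈ C2.carrier, h1 w.1 ≠ 0 := fun w hw h0 => by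
        have : 1 < ‖h1 w.1 / h2 w.1 * C2.τ w ^ (a1 - a2)‖ := hd w hw
        rw [h0, zero_div, zero_mul, norm_zero] at this
        linarith
      refine Dec.mono (add_aux hE hK m2 m1 K2 K1 h0 fun w hw => ?_) fun C3 h3 _ => ⟨h3.1, h3.2.congr fun w _ => add_comm _ _⟩
      have e : h2 w.1 / h1 w.1 * C2.τ w ^ (a2 - a1) = (h1 w.1 / h2 w.1 * C2.τ w ^ (a1 - a2))⁻¹ := by
        rw [mul_inv, inv_div, ← zpow_neg, neg_sub]
      rw [e, norm_inv]
      exact inv_le_one_of_one_le₀ (hd w hw).le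

end Cell
open Cell

/-- functions that can be prepared over `ℰ` -/
def WW (ℰ : Set (Y → ℚ_[p])) (K : ℕ) : Set (Y × ℚ_[p] → ℚ_[p]) :=
  {f | (∀ C : Cell ℰ, GP K C f) ∧ ∀ c ∈ ℰ, (fun y => f (y, c y)) ∈ ℰ}

variable {K : ℕ}

theorem WW_all (hE : Full ℰ) (hK : 1 ≤ K) {ι : Type*} {f : ι → Y × ℚ_[p] → ℚ_[p]} (s : Finset ι) (hf : ∀ i, f i ∈ WW ℰ K)
    (C : Cell ℰ) : Dec (fun C' => Good K C' C ∧ ∀ i ∈ s, C'.Prep K (f i)) C.carrier := by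
  classical
  have hA := hE.dalg
  induction s using induction_on with
  | empty => exact Dec.cell _ ⟨Good.refl hA, by simp⟩
  | insert i s hi ih =>
    refine ih.bind fun C1 h1 _ => Dec.mono ((hf i).1 C1) fun C2 h2 _ => ⟨h2.1.trans hA hK h1.1, fun j hj => ?_⟩
    rcases Finset.mem_insert.1 hj with rfl | hj
    · exact h2.2
    · exact h2.1.prep hA hK (h1.2 j hj)

theorem WW_base (hE : Full ℰ) {e} (he : e ∈ ℰ) : (fun w => e w.1) ∈ WW ℰ K :=
  ⟨fun C => GP.cell hE.dalg (Prep.base hE.dalg K C he), fun _ _ => he⟩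

theorem WW_snd (hE : Full ℰ) (hK : 1 ≤ K) : (fun w => w.2) ∈ WW ℰ K :=
  ⟨fun C => Dec.mono (add_prep hE hK (Prep.τ hE.dalg K C) (Prep.base hE.dalg K C C.hc)) fun C1 h1 _ =>
    ⟨h1.1, h1.2.congr fun w _ => by simp [Cell.τ]⟩, fun c hc => hc⟩

theorem WW_dalg (hE : Full ℰ) (hK : 1 ≤ K) : IsDAlg (WW ℰ K) where
  const := fun c => WW_base hE (hE.dalg.const c)
  add := fun {f g} hf hg => ⟨fun C => (hf.1 C).bind hE.dalg hK fun C1 g1 p1 => (hg.1 C1).bind hE.dalg hK fun C2 g2 p2 =>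
    add_prep hE hK (g2.prep hE.dalg hK p1) p2, fun c hc => hE.dalg.add (hf.2 c hc) (hg.2 c hc)⟩
  mul := fun {f g} hf hg => ⟨fun C => (hf.1 C).bind hE.dalg hK fun C1 g1 p1 => (hg.1 C1).bind hE.dalg hK fun C2 g2 p2 =>
    GP.cell hE.dalg ((g2.prep hE.dalg hK p1).mul hE.dalg p2), fun c hc => hE.dalg.mul (hf.2 c hc) (hg.2 c hc)⟩
  inv := fun {f} hf => ⟨fun C => (hf.1 C).bind hE.dalg hK fun C1 g1 p1 => GP.cell hE.dalg (p1.inv hE.dalg hK),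
    fun c hc => hE.dalg.inv (hf.2 c hc)⟩
  ranal := fun {k} a ha f hf => by
    have hA := hE.dalg
    refine ⟨fun C => ?_, fun c hc => hA.ranal a ha _ fun i => (hf i).2 c hc⟩
    refine (WW_all hE hK Finset.univ hf C).bind fun C1 h1 _ => ?_
    have h1' := fun i => h1.2 i (Finset.mem_univ i)
    choose h m e H using h1'
    change ∀ i, C1.PrepD K (f i) (h i) (e i) at H
    refine (CutAll hE C1 Finset.univ m e).bind fun C2 h2 _ => ?_
    have hg := (h2.1.good hA K).trans hA hK h1.1
    refine GP.sub hA hK ?_ hg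
    have H2 := fun i => (H i).same hA h2.1
    by_cases hd : ∀ i, ∀ w ∈ C2.carrier, ‖h i w.1 * C2.τ w ^ e i‖ ≤ 1
    · have hb : ∀ i, ∀ w ∈ C2.carrier, ‖f i w‖ ≤ 1 := fun i w hw => by rw [(H2 i).norm hK hw]; exact hd i w hw
      have han : ∀ i, C2.AN (f i) := fun i => by
        obtain ⟨U, hU, hU'⟩ := H2 i
        exact (An.mul (Bd hA (m i) _ (hd i)) hU.toAn).congr hU'
      obtain ⟨c, F, hF⟩ := restricted_scale ha
      refine GP.bind hA hK (an_prep hE hK (An.comp F han)) fun C3 h3 p3 => GP.cell hA ?_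
      refine ((Prep.base hA K C3 (hA.const ((p : ℚ_[p]) ^ c)⁻¹)).mul hA p3).congr fun w hw => ?_
      have hp0 : (p : ℚ_[p]) ^ c ≠ 0 := pow_ne_zero _ pK_ne
      rw [hF, inv_mul_cancel_left₀ hp0]
      congr 1; funext i
      rw [toZ_coe (hb i w (h3.1 hw))]
    · push Not at hd
      obtain ⟨i, w0, hw0, h3⟩ := hd
      have h4 := (h2.2 i (Finset.mem_univ i)).resolve_left fun h => absurd (h w0 hw0) (not_le.2 h3)
      refine GP.cell hA ((Prep.base hA K C2 (hA.const 0)).congr fun w hw => ?_)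
      simp only [ranalFn]
      rw [if_neg]
      intro h5
      have h6 := h4 w hw
      rw [← (H2 i).norm hK hw] at h6
      exact absurd (h5 i) (not_le.2 h6)

/-- cell decomposition of the whole space -/
theorem cell_dec (hE : Full ℰ) (hK : 1 ≤ K) {ι : Type*} {f : ι → Y × ℚ_[p] → ℚ_[p]} (s : Finset ι) (hf : ∀ i, f i ∈ WW ℰ K) :
    Dec (fun C : Cell ℰ => ∀ i ∈ s, C.Prep K (f i)) Set.univ := by
  have hA := hE.dalg
  let C0 : Cell ℰ := ⟨Set.univ, fun _ => 0, fun _ => 0, fun _ => 0, QF.univ hA, hA.const 0, hA.const 0, hA.const 0, by simp⟩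
  refine ((WW_all hE hK s hf C0).mono fun C h _ => h.2).union' (Dec.pt Set.univ (QF.univ hA) (fun _ => 0) (hA.const 0)) ?_ ?_
  · rintro w hw ⟨-, h⟩
    exact hw.2.1 (by simp [Cell.τ, C0, h])
  · intro w
    by_cases h : w.2 = 0
    · exact iff_of_true trivial (Or.inr ⟨trivial, h⟩)
    · exact iff_of_true trivial (Or.inl ⟨trivial, by simpa [Cell.τ, C0] using h, by simp [C0], by simp [C0]⟩)

theorem WW_snoc {m : ℕ} {ℰ : Set ((Fin m → ℚ_[p]) → ℚ_[p])} (hE : Full ℰ) (hX : DF p m ⊆ ℰ) (hK : 1 ≤ K)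
    {f : (Fin (m + 1) → ℚ_[p]) → ℚ_[p]} (hf : f ∈ DF p (m + 1)) :
    (fun w : (Fin m → ℚ_[p]) × ℚ_[p] => f (snoc w.1 w.2)) ∈ WW ℰ K := by
  refine (WW_dalg hE hK).dfun hf (fun w => snoc w.1 w.2) fun i => ?_
  refine Fin.lastCases ?_ (fun j => ?_) i
  · simp only [snoc_last]; exact WW_snd hE hK
  · simp only [snoc_castSucc]; exact WW_base hE (hX (DF_coord j))

end prepall

section skolem
variable {p : ℕ} [hp : Fact p.Prime] {Ω Y : Type*} {ℰ : Set (Y → ℚ_[p])} {N M : ℕ}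

/-- equivalence modulo `p^(N ℤ) (1 + p^M ℤ_p)` -/
def Rl (N M : ℕ) (x x' : ℚ_[p]) : Prop := ∃ (i : ℤ) (u : ℚ_[p]), near1 M u ∧ x' = x * (p : ℚ_[p]) ^ (N * i) * u

theorem Rl.symm (hM : 1 ≤ M) {x x' : ℚ_[p]} (h : Rl N M x x') : Rl N M x' x := by
  obtain ⟨i, u, hu, rfl⟩ := h
  refine ⟨-i, u⁻¹, hu.inv hM, ?_⟩
  have h1 := hu.ne hM
  have h2 : (p : ℚ_[p]) ^ (N * i) ≠ 0 := zpow_ne_zero _ pK_ne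
  rw [mul_neg, zpow_neg]
  field_simp

theorem Rl.zero (hM : 1 ≤ M) {x x' : ℚ_[p]} (h : Rl N M x x') (h0 : x = 0) : x' = 0 := by
  obtain ⟨i, u, hu, rfl⟩ := h
  simp [h0]

theorem QF_inv {𝒟 : Set (Ω → ℚ_[p])} {S : Set Ω} (hS : QF 𝒟 S) : ∃ N M : ℕ, 0 < N ∧ 1 ≤ M ∧ ∃ s : Set (Ω → ℚ_[p]), s.Finite ∧
    s ⊆ 𝒟 ∧ ∀ N', N ∣ N' → ∀ M', M ≤ M' → ∀ w w', (∀ f ∈ s, Rl N' M' (f w) (f w')) → (w ∈ S ↔ w' ∈ S) := by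
  induction hS with
  | zero f hf =>
    exact ⟨1, 1, one_pos, le_rfl, {f}, Set.finite_singleton f, by simpa using hf, fun N' _ M' hM w w' h =>
      ⟨fun h0 => (h f rfl).zero hM h0, fun h0 => ((h f rfl).symm hM).zero hM h0⟩⟩
  | pow f hf n hn =>
    obtain ⟨M, hM, hM'⟩ := Pset_near1 (p := p) hn
    have key : ∀ N', n ∣ N' → ∀ M', M ≤ M' → ∀ x x' : ℚ_[p], Rl N' M' x x' → x ∈ Pset p n → x' ∈ Pset p n := by
      rintro N' ⟨d, rfl⟩ M' h2 x x' ⟨i, u, hu, rfl⟩ hx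
      refine Pset_mul (Pset_mul hx ⟨(p : ℚ_[p]) ^ (d * i), zpow_ne_zero _ pK_ne, ?_⟩) (hM' u (hu.mono h2))
      rw [← zpow_natCast, ← zpow_mul]; congr 1; push_cast; ring
    exact ⟨n, M, hn, hM, {f}, Set.finite_singleton f, by simpa using hf, fun N' h1 M' h2 w w' h =>
      ⟨key N' h1 M' h2 _ _ (h f rfl), key N' h1 M' h2 _ _ ((h f rfl).symm (hM.trans h2))⟩⟩
  | compl S hS ih =>
    obtain ⟨N, M, h1, h2, s, h3, h4, h5⟩ := ih
    exact ⟨N, M, h1, h2, s, h3, h4, fun N' a M' b w w' h => not_congr (h5 N' a M' b w w' h)⟩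
  | inter S T hS hT ih ih' =>
    obtain ⟨N, M, h1, h2, s, h3, h4, h5⟩ := ih
    obtain ⟨N2, M2, g1, g2, s2, g3, g4, g5⟩ := ih'
    exact ⟨N * N2, max M M2, Nat.mul_pos h1 g1, le_max_of_le_left h2, s ∪ s2, h3.union g3, Set.union_subset h4 g4,
      fun N' a M' b w w' h => and_congr
        (h5 N' ((Dvd.intro _ rfl).trans a) M' ((le_max_left _ _).trans b) w w' fun f hf => h f (Or.inl hf))
        (g5 N' ((Dvd.intro_left _ rfl).trans a) M' ((le_max_right _ _).trans b) w w' fun f hf => h f (Or.inr hf))⟩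

theorem Prep_Rl {C : Cell ℰ} (hM : 1 ≤ M) {f : Y × ℚ_[p] → ℚ_[p]} (hf : C.Prep M f) {w w' : Y × ℚ_[p]}
    (hw : w ∈ C.carrier) (hw' : w' ∈ C.carrier) (h1 : w.1 = w'.1) (h : Rl N M (C.τ w) (C.τ w')) : Rl N M (f w) (f w') := by
  obtain ⟨g, hg, a, U, hU, hf⟩ := hf
  obtain ⟨i, u, hu, e⟩ := h
  have hn := hU.near hw
  refine ⟨i * a, u ^ a * U w' * (U w)⁻¹, ((hu.zpow hM a).mul hM (hU.near hw')).mul hM (hn.inv hM), ?_⟩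
  rw [hf w hw, hf w' hw', e, ← h1, mul_zpow, mul_zpow, ← zpow_mul, mul_assoc (N : ℤ)]
  have := hn.ne hM
  field_simp

theorem cand (hE : IsDAlg ℰ) (C : Cell ℰ) (hN : 0 < N) (hM : 1 ≤ M) : ∃ L : Set (Y → ℚ_[p]), L.Finite ∧ L ⊆ ℰ ∧
    ∀ w ∈ C.carrier, ∃ s ∈ L, (w.1, s w.1) ∈ C.carrier ∧ Rl N M (C.τ w) (C.τ (w.1, s w.1)) := by
  let E : Set (Y → ℚ_[p]) := {C.α, fun y => (C.b y)⁻¹, fun _ => 1}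
  have hEf : E.Finite := by simp [E]
  let F : (Y → ℚ_[p]) × ℤ × ℕ → Y → ℚ_[p] := fun t y => C.c y + t.1 y * ((p : ℚ_[p]) ^ t.2.1 * t.2.2)
  refine ⟨F '' (E ×ˢ (Set.Icc (-N : ℤ) N ×ˢ Set.Iio (p ^ M))), ((hEf.prod ((Set.finite_Icc _ _).prod (Set.finite_Iio _))).image _), ?_, ?_⟩
  · rintro _ ⟨⟨e, j, ξ⟩, ⟨he, -⟩, rfl⟩
    have he' : e ∈ ℰ := by
      rcases he with rfl | rfl | rfl
      exacts [C.hα, hE.inv C.hb, hE.const 1]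
    exact hE.add C.hc (hE.mul he' (hE.const _))
  rintro ⟨y, t⟩ hw
  obtain ⟨hB, h0, h1, h2⟩ := hw
  have hN' : (0 : ℤ) < N := by exact_mod_cast hN
  suffices ∃ e ∈ E, e y ≠ 0 ∧ ∃ j i : ℤ, (-N ≤ j ∧ j ≤ N) ∧ j = (C.τ (y, t) / e y).valuation + N * i ∧
      ‖C.α y‖ ≤ ‖e y * (p : ℚ_[p]) ^ j‖ ∧ ‖C.b y * (e y * (p : ℚ_[p]) ^ j)‖ ≤ 1 by
    obtain ⟨e, he, he0, j, i, hj, hji, h3, h4⟩ := this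
    obtain ⟨ξ, x1, x2, x3⟩ := exists_approx M hM (C.τ (y, t) / e y) (div_ne_zero h0 he0)
    refine ⟨_, ⟨(e, j, ξ), ⟨he, hj, x1⟩, rfl⟩, ?_⟩
    have e1 : C.τ (y, F (e, j, ξ) y) = e y * (p : ℚ_[p]) ^ j * ξ := by simp [F, Cell.τ, mul_assoc]
    have hξ := natCast_unit_norm (p := p) x2
    have hξ0 := natCast_unit_ne (p := p) x2
    have hp0 : ∀ n : ℤ, (p : ℚ_[p]) ^ n ≠ 0 := fun n => zpow_ne_zero _ pK_ne
    refine ⟨⟨hB, ?_, ?_, ?_⟩, ?_⟩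
    · rw [e1]; exact mul_ne_zero (mul_ne_zero he0 (hp0 _)) hξ0
    · rw [e1, norm_mul, hξ, mul_one]; exact h3
    · rw [e1, ← mul_assoc, norm_mul, hξ, mul_one]; exact h4
    · change Rl N M (C.τ (y, t)) (C.τ (y, F (e, j, ξ) y))
      rw [e1]
      refine ⟨i, _, x3.inv hM, ?_⟩
      rw [hji, zpow_add₀ pK_ne]
      have := hp0 (C.τ (y, t) / e y).valuation
      field_simp
  set x := C.τ (y, t) with hx
  by_cases ha : C.α y = 0
  · by_cases hb : C.b y = 0
    · refine ⟨_, Or.inr (Or.inr rfl), one_ne_zero, (x / 1).valuation % N, -((x / 1).valuation / N), ⟨?_, ?_⟩, ?_, by rw [ha, norm_zero]; exact norm_nonneg _, by simp [hb]⟩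
      · linarith [Int.emod_nonneg (x / 1).valuation hN'.ne']
      · exact (Int.emod_lt_of_pos _ hN').le
      · rw [Int.emod_def]; ring
    · have hD : 0 ≤ (x / (C.b y)⁻¹).valuation := by
        rw [← Cell.norm_le_one_iff_val (div_ne_zero h0 (inv_ne_zero hb)), div_inv_eq_mul, mul_comm]; exact h2
      have h5 := Int.emod_nonneg (x / (C.b y)⁻¹).valuation hN'.ne'
      refine ⟨_, Or.inr (Or.inl rfl), inv_ne_zero hb, (x / (C.b y)⁻¹).valuation % N, -((x / (C.b y)⁻¹).valuation / N), ⟨?_, ?_⟩, ?_, by rw [ha, norm_zero]; exact norm_nonneg _, ?_⟩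
      · linarith
      · exact (Int.emod_lt_of_pos _ hN').le
      · rw [Int.emod_def]; ring
      · rw [mul_inv_cancel_left₀ hb, Cell.norm_le_one_iff_val (zpow_ne_zero _ pK_ne), valuation_zpow, valuation_p]
        simpa using h5
  · set D := (x / C.α y).valuation with hD
    have hD0 : D ≤ 0 := by
      have : 0 ≤ (x / C.α y)⁻¹.valuation := by
        rw [← Cell.norm_le_one_iff_val (inv_ne_zero (div_ne_zero h0 ha)), inv_div, norm_div]
        exact div_le_one_of_le₀ h1 (norm_nonneg _)
      rw [valuation_inv] at this; omega
    have h5 := Int.emod_nonneg (-D) hN'.ne'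
    have h6 := Int.emod_lt_of_pos (-D) hN'
    have h7 : (-D) % N ≤ -D := by rw [Int.emod_def]; have := Int.ediv_nonneg (show (0:ℤ) ≤ -D by omega) hN'.le; nlinarith
    have hj : -((-D) % N) = D + N * ((-D) / N) := by rw [Int.emod_def]; ring
    refine ⟨_, Or.inl rfl, ha, -((-D) % N), (-D) / N, ⟨by linarith, by linarith⟩, hj, ?_, ?_⟩
    · rw [norm_mul]
      refine le_mul_of_one_le_right (norm_nonneg _) ?_
      rw [zpow_neg, norm_inv]
      refine one_le_inv_iff₀.2 ⟨norm_pos_iff.2 (zpow_ne_zero _ pK_ne), ?_⟩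
      rw [Cell.norm_le_one_iff_val (zpow_ne_zero _ pK_ne), valuation_zpow, valuation_p]
      simpa using h5
    · rw [norm_mul] at h2 ⊢
      refine (mul_le_mul_of_nonneg_left ?_ (norm_nonneg _)).trans h2
      have h8 : C.α y * (p : ℚ_[p]) ^ (-((-D) % N)) ≠ 0 := mul_ne_zero ha (zpow_ne_zero _ pK_ne)
      rw [norm_le_iff_val h8 h0, valuation_mul ha (zpow_ne_zero _ pK_ne), valuation_zpow, valuation_p]
      have h9 : x.valuation = (C.α y).valuation + D := by
        rw [hD, ← valuation_mul ha (div_ne_zero h0 ha), mul_div_cancel₀ _ ha]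
      rw [h9]; omega

/-- functions prepared at every precision -/
def WWi (ℰ : Set (Y → ℚ_[p])) : Set (Y × ℚ_[p] → ℚ_[p]) := {f | ∀ K, 1 ≤ K → f ∈ WW ℰ K}

theorem skolem_fin (hE : Full ℰ) {S : Set (Y × ℚ_[p])} (hS : QF (WWi ℰ) S) : ∃ L : Set (Y → ℚ_[p]), L.Finite ∧ L ⊆ ℰ ∧
    ∀ w ∈ S, ∃ s ∈ L, (w.1, s w.1) ∈ S := by
  obtain ⟨N, M, hN, hM, s, h1, h2, h3⟩ := QF_inv hS
  have := h1.to_subtype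
  cases nonempty_fintype s
  have hd := cell_dec hE hM (f := fun i : s => i.1) Finset.univ fun i => h2 i.2 M hM
  suffices ∀ T, Dec (fun C : Cell ℰ => ∀ i ∈ (Finset.univ : Finset s), C.Prep M i.1) T → ∃ L : Set (Y → ℚ_[p]), L.Finite ∧ L ⊆ ℰ ∧
      ∀ w ∈ T, w ∈ S → ∃ s ∈ L, (w.1, s w.1) ∈ S by
    obtain ⟨L, a, b, c⟩ := this _ hd
    exact ⟨L, a, b, fun w hw => c w trivial hw⟩
  intro T hT
  induction hT with
  | cell C h =>
    obtain ⟨L, a, b, c⟩ := cand hE.dalg C hN hM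
    refine ⟨L, a, b, fun w hw hwS => ?_⟩
    obtain ⟨g, hg, h4, h5⟩ := c w hw
    exact ⟨g, hg, (h3 N dvd_rfl M le_rfl w _ fun f hf => Prep_Rl hM (h ⟨f, hf⟩ (Finset.mem_univ _)) hw h4 rfl h5).1 hwS⟩
  | pt B hB c hc =>
    refine ⟨{c}, Set.finite_singleton c, by simpa using hc, fun w hw hwS => ⟨c, rfl, ?_⟩⟩
    rw [← hw.2]; exact hwS
  | union T T' _ _ _ ih ih' =>
    obtain ⟨L, a, b, c⟩ := ih
    obtain ⟨L', a', b', c'⟩ := ih'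
    refine ⟨L ∪ L', a.union a', Set.union_subset b b', fun w hw hwS => ?_⟩
    rcases hw with hw | hw
    · obtain ⟨g, hg, h⟩ := c w hw hwS
      exact ⟨g, Or.inl hg, h⟩
    · obtain ⟨g, hg, h⟩ := c' w hw hwS
      exact ⟨g, Or.inr hg, h⟩

theorem qf_sub {S : Set (Y × ℚ_[p])} (hS : QF (WWi ℰ) S) {s : Y → ℚ_[p]} (hs : s ∈ ℰ) : QF ℰ {y | (y, s y) ∈ S} :=
  hS.preimage (fun y => (y, s y)) fun f hf => (hf 1 le_rfl).2 s hs

theorem skolem (hE : Full ℰ) {S : Set (Y × ℚ_[p])} (hS : QF (WWi ℰ) S) :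
    ∃ s ∈ ℰ, ∀ w ∈ S, (w.1, s w.1) ∈ S := by
  obtain ⟨L, h1, h2, h3⟩ := skolem_fin hE hS
  suffices ∀ L : Set (Y → ℚ_[p]), L.Finite → L ⊆ ℰ → ∃ s ∈ ℰ, ∀ y, (∃ g ∈ L, (y, g y) ∈ S) → (y, s y) ∈ S by
    obtain ⟨s, hs, h⟩ := this L h1 h2
    exact ⟨s, hs, fun w hw => h w.1 (h3 w hw)⟩
  intro L hL
  induction L, hL using Set.Finite.induction_on with
  | empty => exact fun _ => ⟨_, hE.dalg.const 0, by simp⟩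
  | @insert a L _ _ ih =>
    intro hL
    obtain ⟨s, hs, h⟩ := ih ((Set.subset_insert _ _).trans hL)
    classical
    refine ⟨fun y => if (y, a y) ∈ S then a y else s y, pw_ite hE.pw (qf_sub hS (hL (Set.mem_insert _ _))) (hL (Set.mem_insert _ _)) hs
      (fun y hy => if_pos hy) (fun y hy => if_neg hy), ?_⟩
    rintro y ⟨g, rfl | hg, hy⟩
    · simp [hy]
    · by_cases h' : (y, a y) ∈ S
      · simp [h']
      · simp only [h', if_false]; exact h y ⟨g, hg, hy⟩

theorem proj (hE : Full ℰ) {S : Set (Y × ℚ_[p])} (hS : QF (WWi ℰ) S) : QF ℰ {y | ∃ t, (y, t) ∈ S} := by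
  obtain ⟨s, hs, h⟩ := skolem hE hS
  exact (qf_sub hS hs).of_eq (Set.ext fun y => ⟨fun h => ⟨_, h⟩, fun ⟨t, ht⟩ => h _ ht⟩)

variable (p) in
/-- a fixed full extension of the algebra of D-functions -/
noncomputable def EF (m : ℕ) : Set ((Fin m → ℚ_[p]) → ℚ_[p]) := (exists_full (DF_isDAlg (p := p) m)).choose

theorem EF_ext (m : ℕ) : Ext (DF p m) (EF p m) := (exists_full (DF_isDAlg (p := p) m)).choose_spec.1

theorem EF_full (m : ℕ) : Full (EF p m) := (exists_full (DF_isDAlg (p := p) m)).choose_spec.2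

theorem qf_snoc {m : ℕ} {S : Set (Fin (m + 1) → ℚ_[p])} (hS : QF (DF p (m + 1)) S) :
    QF (WWi (EF p m)) {w : (Fin m → ℚ_[p]) × ℚ_[p] | (snoc w.1 w.2 : Fin (m + 1) → ℚ_[p]) ∈ S} :=
  hS.preimage (𝒟' := WWi (EF p m)) (fun w : (Fin m → ℚ_[p]) × ℚ_[p] => (snoc w.1 w.2 : Fin (m + 1) → ℚ_[p])) fun f hf K hK => WW_snoc (EF_full m) (EF_ext m).sub hK hf

theorem skolem_DF {m : ℕ} {S : Set (Fin (m + 1) → ℚ_[p])} (hS : QF (DF p (m + 1)) S) :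
    ∃ s ∈ EF p m, ∀ y t, (snoc y t : Fin (m + 1) → ℚ_[p]) ∈ S → (snoc y (s y) : Fin (m + 1) → ℚ_[p]) ∈ S := by
  obtain ⟨s, hs, h⟩ := skolem (EF_full m) (qf_snoc hS)
  exact ⟨s, hs, fun y t h1 => h (y, t) h1⟩

theorem proj_DF {m : ℕ} {S : Set (Fin (m + 1) → ℚ_[p])} (hS : QF (DF p (m + 1)) S) :
    QF (DF p m) {y | ∃ t, (snoc y t : Fin (m + 1) → ℚ_[p]) ∈ S} :=
  (EF_ext m).qf _ (proj (EF_full m) (qf_snoc hS))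

/-- quantifier elimination for several variables -/
theorem proj_multi {m r : ℕ} {S : Set (Fin (m + r) → ℚ_[p])} (hS : QF (DF p (m + r)) S) :
    QF (DF p m) {y | ∃ t : Fin r → ℚ_[p], append y t ∈ S} := by
  induction r with
  | zero =>
    refine hS.of_eq (Set.ext fun y => ⟨fun h => ⟨Fin.elim0, ?_⟩, fun ⟨t, ht⟩ => ?_⟩)
    · rwa [Fin.append_elim0]
    · rw [Subsingleton.elim t Fin.elim0, Fin.append_elim0] at ht; exact ht
  | succ r ih =>
    refine (ih (proj_DF hS)).of_eq (Set.ext fun y => ⟨?_, ?_⟩)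
    · rintro ⟨t, x, h⟩
      refine ⟨snoc t x, ?_⟩
      rw [Fin.append_snoc]; exact h
    · rintro ⟨t, h⟩
      refine ⟨Fin.init t, t (Fin.last r), ?_⟩
      rw [← Fin.append_snoc, Fin.snoc_init_self]; exact h

end skolem

section sums
variable {p : ℕ} [hp : Fact p.Prime] {Ω Y : Type*} {ℰ : Set (Y → ℚ_[p])}

/-- constructible functions attached to `ℰ` -/
noncomputable def CA (ℰ : Set (Ω → ℚ_[p])) : Subalgebra ℚ (Ω → ℚ) :=
  Algebra.adjoin ℚ ({g | ∃ e ∈ ℰ, g = fun ω => ((e ω).valuation : ℚ)} ∪ {g | ∃ e ∈ ℰ, g = fun ω => (p : ℚ) ^ (e ω).valuation})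

theorem pQ_ne : (p : ℚ) ≠ 0 := by exact_mod_cast hp.1.ne_zero

theorem CA_val {e : Y → ℚ_[p]} (he : e ∈ ℰ) : (fun ω => ((e ω).valuation : ℚ)) ∈ CA ℰ :=
  Algebra.subset_adjoin (Or.inl ⟨e, he, rfl⟩)

theorem CA_pow {e : Y → ℚ_[p]} (he : e ∈ ℰ) : (fun ω => (p : ℚ) ^ (e ω).valuation) ∈ CA ℰ :=
  Algebra.subset_adjoin (Or.inr ⟨e, he, rfl⟩)

theorem CA_const (c : ℚ) : (fun _ => c) ∈ CA ℰ := (CA ℰ).algebraMap_mem c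

open Classical in
theorem CA_ite (hE : Full ℰ) {S : Set Y} (hS : QF ℰ S) {f g : Y → ℚ} (hf : f ∈ CA ℰ) (hg : g ∈ CA ℰ) :
    (fun y => if y ∈ S then f y else g y) ∈ CA ℰ := by
  have h1 : (fun y => if y ∈ S then (p : ℚ_[p]) else 1) ∈ ℰ :=
    pw_ite hE.pw hS (hE.dalg.const _) (hE.dalg.const _) (fun y hy => if_pos hy) (fun y hy => if_neg hy)
  have h2 := CA_val h1
  refine mem_of_eq_of_mem ?_ (add_mem (mul_mem h2 hf) (mul_mem (sub_mem (one_mem _) h2) hg))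
  funext y
  by_cases hy : y ∈ S <;> simp [hy]

/-- monomials in an integer variable with constructible coefficients -/
noncomputable def mon (p : ℕ) (c : Y → ℚ) (k : ℕ) (r : ℤ) : Y × ℤ → ℚ := fun w => c w.1 * (w.2 : ℚ) ^ k * (p : ℚ) ^ (r * w.2)

noncomputable def EP (ℰ : Set (Y → ℚ_[p])) : Submodule ℚ (Y × ℤ → ℚ) :=
  Submodule.span ℚ {Φ | ∃ c ∈ CA ℰ, ∃ k r, Φ = mon p c k r}

theorem EP_mon {c : Y → ℚ} (hc : c ∈ CA ℰ) (k : ℕ) (r : ℤ) : mon p c k r ∈ EP ℰ :=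
  Submodule.subset_span ⟨c, hc, k, r, rfl⟩

theorem EP_mul {f g : Y × ℤ → ℚ} (hf : f ∈ EP ℰ) (hg : g ∈ EP ℰ) : f * g ∈ EP ℰ := by
  induction hf using Submodule.span_induction with
  | zero => simp
  | add _ _ _ _ h1 h2 => rw [add_mul]; exact add_mem h1 h2
  | smul a _ _ h => rw [smul_mul_assoc]; exact Submodule.smul_mem _ _ h
  | mem f hf =>
    obtain ⟨c, hc, k, r, rfl⟩ := hf
    induction hg using Submodule.span_induction with
    | zero => simp
    | add _ _ _ _ h1 h2 => rw [mul_add]; exact add_mem h1 h2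
    | smul a _ _ h => rw [mul_smul_comm]; exact Submodule.smul_mem _ _ h
    | mem g hg =>
      obtain ⟨c', hc', k', r', rfl⟩ := hg
      refine mem_of_eq_of_mem ?_ (EP_mon (mul_mem hc hc') (k + k') (r + r'))
      funext w
      simp only [mon, Pi.mul_apply, pow_add, add_mul, zpow_add₀ (pQ_ne (p := p))]
      ring

theorem EP_base {c : Y → ℚ} (hc : c ∈ CA ℰ) : (fun w : Y × ℤ => c w.1) ∈ EP ℰ :=
  mem_of_eq_of_mem (by funext w; simp [mon]) (EP_mon hc 0 0)

theorem EP_refl {f : Y × ℤ → ℚ} (hf : f ∈ EP ℰ) : (fun w : Y × ℤ => f (w.1, -w.2)) ∈ EP ℰ := by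
  induction hf using Submodule.span_induction with
  | zero => exact zero_mem (EP ℰ)
  | add _ _ _ _ h1 h2 => exact add_mem h1 h2
  | smul a _ _ h => exact Submodule.smul_mem _ a h
  | mem f hf =>
    obtain ⟨c, hc, k, r, rfl⟩ := hf
    refine mem_of_eq_of_mem ?_ (Submodule.smul_mem _ ((-1 : ℚ) ^ k) (EP_mon hc k (-r)))
    funext w
    simp only [mon, Pi.smul_apply, smul_eq_mul, Int.cast_neg, neg_pow (w.2 : ℚ), neg_mul, mul_neg]
    ring

theorem EP_eval (hE : IsDAlg ℰ) {e : Y → ℚ_[p]} (he : e ∈ ℰ) (a : ℤ) {f : Y × ℤ → ℚ} (hf : f ∈ EP ℰ) :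
    (fun y => f (y, (e y).valuation + a)) ∈ CA ℰ := by
  induction hf using Submodule.span_induction with
  | zero => exact zero_mem (CA ℰ)
  | add _ _ _ _ h1 h2 => exact add_mem h1 h2
  | smul a _ _ h => exact Subalgebra.smul_mem _ h a
  | mem f hf =>
    obtain ⟨c, hc, k, r, rfl⟩ := hf
    refine mem_of_eq_of_mem ?_ (mul_mem (mul_mem hc (pow_mem (add_mem (CA_val he) (CA_const (a : ℚ))) k))
      (mul_mem (CA_pow (hE.zpow he r)) (CA_const ((p : ℚ) ^ (r * a)))))
    funext y
    simp only [mon, Pi.mul_apply, Pi.pow_apply, Pi.add_apply, valuation_zpow, mul_add, zpow_add₀ (pQ_ne (p := p)), Int.cast_add]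

/-- the difference operator -/
noncomputable def dif : (Y × ℤ → ℚ) →ₗ[ℚ] (Y × ℤ → ℚ) :=
  LinearMap.funLeft ℚ ℚ (fun w : Y × ℤ => (w.1, w.2 + 1)) - LinearMap.id

theorem dif_apply (f : Y × ℤ → ℚ) (y : Y) (l : ℤ) : dif f (y, l) = f (y, l + 1) - f (y, l) := rfl

theorem EP_anti : EP ℰ ≤ (EP ℰ).map dif := by
  refine Submodule.span_le.2 ?_
  rintro _ ⟨c, hc, k, r, rfl⟩
  induction k using Nat.strong_induction_on with
  | _ k ih =>
    have hs : ∀ (q : ℚ) (s : ℕ → ℚ), q ≠ 0 → (∃ K, dif (mon p c K r) = q • mon p c k r + ∑ i ∈ range k, s i • mon p c i r) →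
        mon p c k r ∈ (EP ℰ).map dif := by
      rintro q s hq ⟨K, h⟩
      have h1 : mon p c k r = q⁻¹ • (dif (mon p c K r) - ∑ i ∈ range k, s i • mon p c i r) := by
        rw [h, add_sub_cancel_right, smul_smul, inv_mul_cancel₀ hq, one_smul]
      rw [h1]
      exact Submodule.smul_mem _ _ (sub_mem (Submodule.mem_map_of_mem (EP_mon hc _ _))
        (sum_mem fun i hi => Submodule.smul_mem _ _ (ih i (mem_range.1 hi))))
    by_cases hr : r = 0
    · subst hr
      refine hs (k + 1) (fun i => (k + 1).choose i) (by positivity) ⟨k + 1, ?_⟩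
      funext w
      obtain ⟨y, l⟩ := w
      rw [dif_apply]
      simp only [mon, Pi.add_apply, Finset.sum_apply, Pi.smul_apply, smul_eq_mul, zero_mul, zpow_zero, mul_one, Int.cast_add, Int.cast_one]
      rw [add_pow, sum_range_succ, sum_range_succ, mul_add, mul_add, mul_sum]
      simp only [one_pow, mul_one, Nat.choose_self, Nat.choose_succ_self_right, Nat.cast_one, Nat.cast_add]
      rw [sum_congr rfl fun i _ => show (c y * ((l : ℚ) ^ i * ((k + 1).choose i : ℚ)) = ((k + 1).choose i : ℚ) * (c y * (l : ℚ) ^ i)) by ring]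
      ring
    · refine hs ((p : ℚ) ^ r - 1) (fun i => (p : ℚ) ^ r * k.choose i) (sub_ne_zero.2 fun h => hr ?_) ⟨k, ?_⟩
      · exact (zpow_eq_one_iff_right₀ (Nat.cast_nonneg _) (by exact_mod_cast hp.1.ne_one)).1 h
      funext w
      obtain ⟨y, l⟩ := w
      rw [dif_apply]
      simp only [mon, Pi.add_apply, Finset.sum_apply, Pi.smul_apply, smul_eq_mul, Int.cast_add, Int.cast_one, mul_add, mul_one, zpow_add₀ (pQ_ne (p := p))]
      rw [add_pow, sum_range_succ, mul_add, mul_sum, add_mul, Finset.sum_mul]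
      simp only [one_pow, mul_one, Nat.choose_self, Nat.cast_one]
      rw [sum_congr rfl fun i _ => show (c y * ((l : ℚ) ^ i * (k.choose i : ℚ)) * ((p : ℚ) ^ (r * l) * (p : ℚ) ^ r) = (p : ℚ) ^ r * k.choose i * (c y * (l : ℚ) ^ i * (p : ℚ) ^ (r * l))) by ring]
      ring

theorem pol_bdd {P : Polynomial ℝ} {S : ℝ} (h : Tendsto (fun n : ℕ => P.eval (n : ℝ)) atTop (nhds S)) : P = Polynomial.C S := by
  by_cases hd : 0 < P.degree
  · have h1 := (P.abs_tendsto_atTop hd).comp tendsto_natCast_atTop_atTop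
    exact absurd h.abs (not_tendsto_nhds_of_tendsto_atTop h1 _)
  · rw [Polynomial.eq_C_of_degree_le_zero (not_lt.1 hd)] at h ⊢
    simp only [Polynomial.eval_C] at h
    rw [tendsto_nhds_unique tendsto_const_nhds h]

theorem pol_exp (P : Polynomial ℝ) {q : ℝ} (h0 : 0 ≤ q) (h1 : q < 1) : Tendsto (fun n : ℕ => q ^ n * P.eval (n : ℝ)) atTop (nhds 0) := by
  induction P using Polynomial.induction_on' with
  | add P Q h1 h2 => simpa [mul_add] using h1.add h2
  | monomial k a =>
    have := (tendsto_pow_const_mul_const_pow_of_abs_lt_one k (by rwa [abs_of_nonneg h0])).const_mul a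
    rw [mul_zero] at this
    refine this.congr fun n => ?_
    rw [Polynomial.eval_monomial]; ring

theorem lim_exp (R : Finset ℤ) (P : ℤ → Polynomial ℝ) {S : ℝ}
    (h : Tendsto (fun n : ℕ => ∑ r ∈ R, ((p : ℝ) ^ r) ^ n * (P r).eval (n : ℝ)) atTop (nhds S)) :
    S = if 0 ∈ R then (P 0).coeff 0 else 0 := by
  have hp1 := pR_one_lt (p := p)
  have hp0 : ∀ r : ℤ, 0 < (p : ℝ) ^ r := fun r => zpow_pos (by linarith) r
  have hsm : ∀ r s : ℤ, r < s → (p : ℝ) ^ r / (p : ℝ) ^ s < 1 := fun r s h => (div_lt_one (hp0 s)).2 (zpow_lt_zpow_right₀ hp1 h)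
  have hlow : ∀ (R : Finset ℤ) (s : ℤ), (∀ r ∈ R, r < s) → Tendsto (fun n : ℕ => ∑ r ∈ R, ((p : ℝ) ^ r / (p : ℝ) ^ s) ^ n * (P r).eval (n : ℝ)) atTop (nhds 0) := by
    intro R s hR
    simpa using tendsto_finsetSum R fun r hr => pol_exp (P r) (div_pos (hp0 r) (hp0 s)).le (hsm r s (hR r hr))
  induction R using Finset.induction_on_max with
  | empty =>
    simp only [Finset.sum_empty] at h
    rw [if_neg (Finset.notMem_empty 0)]
    exact (tendsto_nhds_unique tendsto_const_nhds h).symm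
  | insert s R hR ih =>
    have hs : s ∉ R := fun h => lt_irrefl _ (hR s h)
    have h2 : Tendsto (fun n : ℕ => ((1 : ℝ) / (p : ℝ) ^ s) ^ n * ∑ r ∈ insert s R, ((p : ℝ) ^ r) ^ n * (P r).eval (n : ℝ) -
      ∑ r ∈ R, ((p : ℝ) ^ r / (p : ℝ) ^ s) ^ n * (P r).eval (n : ℝ)) = fun T => Tendsto (fun n : ℕ => (P s).eval (n : ℝ)) T := by
      congr 1; funext n
      rw [sum_insert hs, mul_add, ← mul_assoc, ← mul_pow, one_div_mul_cancel (hp0 s).ne', one_pow, one_mul, mul_sum,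
        add_sub_assoc, ← Finset.sum_sub_distrib, Finset.sum_eq_zero, add_zero]
      intro r _
      rw [← mul_assoc, ← mul_pow, one_div_mul_eq_div, sub_self]
    rcases lt_trichotomy s 0 with h3 | rfl | h3
    · have h4 : ∀ r ∈ insert s R, r < 0 := by
        intro r hr
        rcases Finset.mem_insert.1 hr with rfl | hr
        exacts [h3, (hR r hr).trans h3]
      rw [if_neg fun h => lt_irrefl _ (h4 0 h)]
      have h5 := hlow _ 0 h4
      simp only [zpow_zero, div_one] at h5
      exact tendsto_nhds_unique h h5
    · have h5 : Tendsto (fun n : ℕ => ((1 : ℝ) / (p : ℝ) ^ (0 : ℤ)) ^ n * ∑ r ∈ insert 0 R, ((p : ℝ) ^ r) ^ n * (P r).eval (n : ℝ)) atTop (nhds S) := by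
        simpa using h
      have h6 := h5.sub (hlow R 0 hR)
      rw [h2, sub_zero] at h6
      rw [if_pos (Finset.mem_insert_self _ _), pol_bdd h6, Polynomial.coeff_C_zero]
    · have h5 := (tendsto_pow_atTop_nhds_zero_of_lt_one (r := 1 / (p : ℝ) ^ s) (div_pos one_pos (hp0 s)).le (by simpa using hsm 0 s h3)).mul h
      have h6 := h5.sub (hlow R s hR)
      rw [h2, sub_zero, zero_mul] at h6
      have h7 := pol_bdd h6
      simp only [Finset.mem_insert, or_iff_right h3.ne]
      refine ih (h.congr fun n => ?_)
      rw [sum_insert hs, h7]; simp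

theorem EP_lim {f : Y × ℤ → ℚ} (hf : f ∈ EP ℰ) : ∃ c ∈ CA ℰ, ∀ (y : Y) (S : ℝ),
    Tendsto (fun n : ℕ => (f (y, (n : ℤ)) : ℝ)) atTop (nhds S) → S = c y := by
  suffices ∃ P : Y → ℤ →₀ Polynomial ℚ, (fun y => (P y 0).coeff 0) ∈ CA ℰ ∧ ∀ y (l : ℤ),
      f (y, l) = (P y).sum fun r q => (p : ℚ) ^ (r * l) * q.eval (l : ℚ) by
    obtain ⟨P, h1, h2⟩ := this
    refine ⟨_, h1, fun y S h => ?_⟩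
    have h3 := lim_exp (p := p) (P y).support (fun r => (P y r).map (algebraMap ℚ ℝ)) (S := S) (h.congr fun n => ?_)
    · rw [h3]
      split_ifs with h4
      · simp
      · rw [Finsupp.notMem_support_iff.1 h4]; simp
    · rw [h2, Finsupp.sum, Rat.cast_sum]
      refine sum_congr rfl fun r _ => ?_
      rw [zpow_mul]
      have := Polynomial.eval_map_apply (p := P y r) (f := algebraMap ℚ ℝ) (n : ℚ)
      simp only [eq_ratCast, Rat.cast_natCast] at this
      push_cast
      rw [zpow_natCast, this]
  induction hf using Submodule.span_induction with
  | zero => exact ⟨0, zero_mem (CA ℰ), by simp⟩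
  | add _ _ _ _ h1 h2 =>
    obtain ⟨P, a, b⟩ := h1
    obtain ⟨P', a', b'⟩ := h2
    refine ⟨P + P', mem_of_eq_of_mem (by ext; simp) (add_mem a a'), fun y l => ?_⟩
    rw [Pi.add_apply, b, b', Pi.add_apply, Finsupp.sum_add_index' (by simp) (by intros; simp [mul_add])]
  | smul q _ _ h =>
    obtain ⟨P, a, b⟩ := h
    refine ⟨q • P, mem_of_eq_of_mem (by ext; simp) (Subalgebra.smul_mem _ a q), fun y l => ?_⟩
    rw [Pi.smul_apply, b, Pi.smul_apply, Finsupp.sum_smul_index' (by simp), Finsupp.smul_sum]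
    simp [mul_left_comm]
  | mem f hf =>
    obtain ⟨c, hc, k, r, rfl⟩ := hf
    refine ⟨fun y => Finsupp.single r (Polynomial.C (c y) * Polynomial.X ^ k), ?_, fun y l => ?_⟩
    · by_cases h : r = 0 ∧ k = 0
      · obtain ⟨rfl, rfl⟩ := h
        simpa using hc
      · refine mem_of_eq_of_mem ?_ (zero_mem (CA ℰ))
        funext y
        by_cases hr : r = 0
        · subst hr
          have : k ≠ 0 := fun hk => h ⟨rfl, hk⟩
          simp [Polynomial.coeff_X_pow, this.symm]
        · simp [Finsupp.single_apply, hr]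
    · rw [Finsupp.sum_single_index (by simp)]
      simp [mon]; ring

/-- summing upwards -/
theorem sum_up (hE : IsDAlg ℰ) {f : Y × ℤ → ℚ} (hf : f ∈ EP ℰ) {e : Y → ℚ_[p]} (he : e ∈ ℰ) : ∃ G ∈ CA ℰ, ∀ (y : Y) (S : ℝ),
    HasSum (fun l : ℤ => if -(e y).valuation ≤ l then (f (y, l) : ℝ) else 0) S → S = G y := by
  obtain ⟨ψ, hψ, rfl⟩ := EP_anti hf
  obtain ⟨c, hc, h⟩ := EP_lim hψ
  refine ⟨_, sub_mem hc (EP_eval hE (hE.inv he) 0 hψ), fun y S hS => ?_⟩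
  set L := -(e y).valuation with hL
  have hinj : Function.Injective (fun n : ℕ => L + n) := fun a b h => by simpa using h
  rw [← hinj.hasSum_iff] at hS
  · have h1 := hS.tendsto_sum_nat
    have h2 : ∀ n : ℕ, ∑ i ∈ range n, ((fun l : ℤ => if L ≤ l then ((dif ψ (y, l) : ℚ) : ℝ) else 0) ∘ fun n : ℕ => L + n) i =
        ψ (y, L + n) - ψ (y, L) := by
      intro n
      have := Finset.sum_range_sub (fun i : ℕ => (ψ (y, L + i) : ℝ)) n
      simp only [Nat.cast_zero, add_zero] at this
      rw [← this]
      refine sum_congr rfl fun i _ => ?_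
      simp [dif_apply, add_assoc]
    simp only [h2] at h1
    have h3 := h1.add_const (ψ (y, L) : ℝ)
    simp only [sub_add_cancel] at h3
    have h4 : Tendsto (fun n : ℕ => (ψ (y, (n : ℤ)) : ℝ)) atTop (nhds (S + ψ (y, L))) := by
      have h5 : Tendsto (fun n : ℕ => ((n : ℤ) - L).toNat) atTop atTop :=
        tendsto_atTop.2 fun b => by
          filter_upwards [eventually_ge_atTop (L + b).toNat] with n hn
          omega
      refine (h3.comp h5).congr' ?_
      filter_upwards [eventually_ge_atTop L.toNat] with n hn
      simp only [Function.comp]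
      rw [Int.toNat_of_nonneg (by omega)]; simp
    have := h y _ h4
    simp only [Pi.sub_apply, valuation_inv, add_zero, Rat.cast_sub]
    rw [← this, ← hL]; ring
  · intro l hl
    refine if_neg fun h => hl ⟨(l - L).toNat, ?_⟩
    simp only []
    rw [Int.toNat_of_nonneg (by omega)]; ring

theorem sum_down (hE : IsDAlg ℰ) {f : Y × ℤ → ℚ} (hf : f ∈ EP ℰ) {e : Y → ℚ_[p]} (he : e ∈ ℰ) : ∃ G ∈ CA ℰ, ∀ (y : Y) (S : ℝ),
    HasSum (fun l : ℤ => if l ≤ (e y).valuation then (f (y, l) : ℝ) else 0) S → S = G y := by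
  obtain ⟨G, hG, h⟩ := sum_up hE (EP_refl hf) he
  refine ⟨G, hG, fun y S hS => h y S ?_⟩
  rw [← (Equiv.neg ℤ).hasSum_iff] at hS
  refine hS.congr_fun fun l => ?_
  simp [neg_le]

def III (e₁ e₂ : ℚ_[p]) (l : ℤ) : Prop := (e₁ ≠ 0 → l ≤ e₁.valuation) ∧ (e₂ ≠ 0 → -e₂.valuation ≤ l)

open Classical in
theorem sum_all (hE : Full ℰ) {f : Y × ℤ → ℚ} (hf : f ∈ EP ℰ) {e₁ e₂ : Y → ℚ_[p]} (h₁ : e₁ ∈ ℰ) (h₂ : e₂ ∈ ℰ) :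
    ∃ G ∈ CA ℰ, ∀ (y : Y) (S : ℝ), HasSum (fun l : ℤ => if III (e₁ y) (e₂ y) l then (f (y, l) : ℝ) else 0) S → S = G y := by
  have hA := hE.dalg
  obtain ⟨Gu, hGu, hu⟩ := sum_up hA hf h₂
  obtain ⟨Gd, hGd, hd⟩ := sum_down hA hf h₁
  obtain ⟨Hu, hHu, hu'⟩ := sum_up hA hf (hA.const 1)
  obtain ⟨Hd, hHd, hd'⟩ := sum_down hA hf (hA.const (p : ℚ_[p])⁻¹)
  obtain ⟨ψ, hψ, rfl⟩ := EP_anti hf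
  have hb := CA_ite hE (QF.norm_lt hA (hA.cmul (p : ℚ_[p]) h₁) (hA.inv h₂)) (sub_mem (EP_eval hA h₁ 1 hψ) (EP_eval hA (hA.inv h₂) 0 hψ)) (zero_mem (CA ℰ))
  refine ⟨_, CA_ite hE (QF.zero _ h₁) (CA_ite hE (QF.zero _ h₂) (add_mem hHu hHd) hGu) (CA_ite hE (QF.zero _ h₂) hGd hb), fun y S hS => ?_⟩
  by_cases a1 : e₁ y = 0 <;> by_cases a2 : e₂ y = 0
  · simp only [mem_ofPred_eq, a1, a2, if_true, Pi.add_apply, Rat.cast_add, III, ne_eq, not_true_eq_false, false_imp_iff, and_self] at hS ⊢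
    have hs := hS.summable
    have s1 := hs.indicator {l : ℤ | 0 ≤ l}
    have s2 := hs.indicator {l : ℤ | l ≤ -1}
    rw [← hu' y _ (s1.hasSum.congr_fun fun l => ?_), ← hd' y _ (s2.hasSum.congr_fun fun l => ?_)]
    · refine hS.unique ((s1.hasSum.add s2.hasSum).congr_fun fun l => ?_)
      by_cases h : 0 ≤ l
      · have : ¬ l ≤ -1 := by omega
        simp [Set.indicator, h, this]
      · have : l ≤ -1 := by omega
        simp [Set.indicator, h, this]
    · simp [Set.indicator]
    · simp [Set.indicator]
  · simp only [mem_ofPred_eq, a1, a2, if_true, if_false, III, ne_eq, not_true_eq_false, not_false_eq_true, false_imp_iff, true_imp_iff, true_and] at hS ⊢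
    exact hu y S hS
  · simp only [mem_ofPred_eq, a1, a2, if_true, if_false, III, ne_eq, not_true_eq_false, not_false_eq_true, false_imp_iff, true_imp_iff, and_true] at hS ⊢
    exact hd y S hS
  · simp only [mem_ofPred_eq, a1, a2, if_false, III, ne_eq, not_false_eq_true, true_imp_iff, Pi.sub_apply, Pi.zero_apply] at hS ⊢
    have hiff : ‖(p : ℚ_[p]) * e₁ y‖ < ‖(e₂ y)⁻¹‖ ↔ -(e₂ y).valuation < (e₁ y).valuation + 1 := by
      rw [← not_le, norm_le_iff_val (inv_ne_zero a2) (mul_ne_zero pK_ne a1), valuation_inv, valuation_mul pK_ne a1, valuation_p, not_le, add_comm]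
    simp only [hiff, valuation_inv, add_zero]
    set U := (e₁ y).valuation
    set L := -(e₂ y).valuation with hL
    by_cases hLU : L < U + 1
    · rw [if_pos hLU]
      have hfin : HasSum (fun l : ℤ => if l ≤ U ∧ L ≤ l then ((dif ψ (y, l) : ℚ) : ℝ) else 0)
          (∑ l ∈ Finset.Icc L U, if l ≤ U ∧ L ≤ l then ((dif ψ (y, l) : ℚ) : ℝ) else 0) := hasSum_sum_of_ne_finset_zero
        fun l hl => if_neg fun h => hl (Finset.mem_Icc.2 ⟨h.2, h.1⟩)
      rw [hS.unique hfin]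
      have key : ∀ n : ℕ, ∑ l ∈ Finset.Icc L (L + n - 1), (dif ψ (y, l)) = ψ (y, L + n) - ψ (y, L) := by
        intro n
        induction n with
        | zero => simp
        | succ n ih =>
          rw [show L + ((n + 1 : ℕ) : ℤ) - 1 = L + n from by push_cast; ring, ← Finset.insert_Icc_sub_one_right_eq_Icc (by omega), sum_insert (by simp), ih, dif_apply]
          push_cast; ring_nf
      have := key (U + 1 - L).toNat
      rw [Int.toNat_of_nonneg (by omega), show L + (U + 1 - L) - 1 = U by ring, show L + (U + 1 - L) = U + 1 by ring] at this
      rw [← this, Rat.cast_sum]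
      refine sum_congr rfl fun l hl => if_pos ?_
      rw [Finset.mem_Icc] at hl; exact ⟨hl.2, hl.1⟩
    · rw [if_neg hLU, Rat.cast_zero]
      refine hS.unique (hasSum_zero.congr_fun fun l => if_neg ?_)
      omega

end sums

section tm
variable {p : ℕ} [hp : Fact p.Prime] {Y : Type*} {ℰ : Set (Y → ℚ_[p])} {G G' : Y × ℚ_[p] → ℚ} {N M : ℕ}

theorem WWi_dalg (hE : Full ℰ) : IsDAlg (WWi ℰ) where
  const := fun c K hK => (WW_dalg hE hK).const c
  add := fun hf hg K hK => (WW_dalg hE hK).add (hf K hK) (hg K hK)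
  mul := fun hf hg K hK => (WW_dalg hE hK).mul (hf K hK) (hg K hK)
  inv := fun hf K hK => (WW_dalg hE hK).inv (hf K hK)
  ranal := fun a ha g hg K hK => (WW_dalg hE hK).ranal a ha g fun i => hg i K hK

/-- functions which on pieces of cells only depend on the base and the valuation of the fibre variable -/
def Tm (ℰ : Set (Y → ℚ_[p])) (G : Y × ℚ_[p] → ℚ) : Prop := ∃ N₀ M₀ : ℕ, 0 < N₀ ∧ 1 ≤ M₀ ∧ ∃ s : Set (Y × ℚ_[p] → ℚ_[p]), s.Finite ∧ s ⊆ WWi ℰ ∧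
  ∀ N, 0 < N → N₀ ∣ N → ∀ M, M₀ ≤ M → ∀ C : Cell ℰ, (∀ f ∈ s, C.Prep M f) → ∀ x₀ : ℚ_[p], x₀ ≠ 0 → ∃ Φ ∈ EP ℰ, ∀ y (l : ℤ) t,
    (y, t) ∈ C.carrier → near1 M (C.τ (y, t) / (x₀ * (p : ℚ_[p]) ^ (N * l))) → G (y, t) = Φ (y, l)

theorem Tm_const (c : ℚ) : Tm ℰ fun _ => c :=
  ⟨1, 1, one_pos, le_rfl, ∅, Set.finite_empty, Set.empty_subset _, fun _ _ _ _ _ _ _ _ _ => ⟨_, EP_base (CA_const c), fun _ _ _ _ _ => rfl⟩⟩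

theorem Tm.bin (op : ℚ → ℚ → ℚ) (hop : ∀ f ∈ EP ℰ, ∀ g ∈ EP ℰ, (fun w => op (f w) (g w)) ∈ EP ℰ) (hG : Tm ℰ G) (hG' : Tm ℰ G') :
    Tm ℰ fun w => op (G w) (G' w) := by
  obtain ⟨N, M, h1, h2, s, h3, h4, h5⟩ := hG
  obtain ⟨N2, M2, g1, g2, s2, g3, g4, g5⟩ := hG'
  refine ⟨N * N2, max M M2, Nat.mul_pos h1 g1, le_max_of_le_left h2, s ∪ s2, h3.union g3, Set.union_subset h4 g4,
      fun N' a0 a M' b C hC x₀ hx => ?_⟩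
  obtain ⟨Φ, hΦ, e⟩ := h5 N' a0 ((Dvd.intro _ rfl).trans a) M' ((le_max_left _ _).trans b) C (fun f hf => hC f (Or.inl hf)) x₀ hx
  obtain ⟨Φ', hΦ', e'⟩ := g5 N' a0 ((Dvd.intro_left _ rfl).trans a) M' ((le_max_right _ _).trans b) C (fun f hf => hC f (Or.inr hf)) x₀ hx
  exact ⟨_, hop Φ hΦ Φ' hΦ', fun y l t h h' => by simp only [e y l t h h', e' y l t h h']⟩

theorem Tm.add (hG : Tm ℰ G) (hG' : Tm ℰ G') : Tm ℰ (G + G') := hG.bin (· + ·) (fun _ hf _ hg => add_mem hf hg) hG'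

theorem Tm.mul (hG : Tm ℰ G) (hG' : Tm ℰ G') : Tm ℰ (G * G') := hG.bin (· * ·) (fun _ hf _ hg => EP_mul hf hg) hG'

open Classical in
theorem Tm_ind (hE : Full ℰ) {S : Set (Y × ℚ_[p])} (hS : QF (WWi ℰ) S) : Tm ℰ fun w => if w ∈ S then 1 else 0 := by
  obtain ⟨N₀, M₀, h1, h2, s, h3, h4, h5⟩ := QF_inv hS
  refine ⟨N₀, M₀, h1, h2, s, h3, h4, fun N hN hNN M hMM C hC x₀ hx => ?_⟩
  have hM := h2.trans hMM
  have hA := WWi_dalg hE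
  have hτ : C.τ ∈ WWi ℰ := hA.sub (fun K hK => WW_snd hE hK) fun K hK => WW_base hE C.hc
  have hT : Tame {x : ℚ_[p] | Rl N M x₀ x} := by
    refine ⟨N, M, hN, hM, fun x _ => ⟨?_, ?_⟩, ?_⟩
    · rintro ⟨i, u, hu, rfl⟩
      exact ⟨i + 1, u, hu, by rw [mul_add, zpow_add₀ pK_ne, mul_one, zpow_natCast]; ring⟩
    · rintro ⟨i, u, hu, e⟩
      refine ⟨i - 1, u, hu, ?_⟩
      have h0 : (p : ℚ_[p]) ^ N ≠ 0 := pow_ne_zero _ pK_ne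
      rw [mul_sub, zpow_sub₀ pK_ne, mul_one, zpow_natCast, ← mul_div_assoc, div_mul_eq_mul_div, ← e, mul_div_cancel_right₀ _ h0]
    · rintro x u - hu ⟨i, u', hu', rfl⟩
      exact ⟨i, u' * u, hu'.mul hM hu, by ring⟩
  have hb : ∀ e ∈ ℰ, (fun w : Y × ℚ_[p] => e w.1) ∈ WWi ℰ := fun e he K hK => WW_base hE he
  have hcar : QF (WWi ℰ) C.carrier := by
    refine (C.hB.preimage (𝒟' := WWi ℰ) Prod.fst hb).inter _ _ ((QF.ne hτ).inter _ _ ((QF.norm_le hA (hb _ C.hα) hτ).inter _ _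
      ((QF.norm_le hA (hA.mul (hb _ C.hb) hτ) (hA.const 1)).of_eq ?_)))
    simp only [norm_one]; rfl
  have hD := proj hE ((hcar.inter _ _ hS).inter _ _ (QF.tame hA hT hτ))
  refine ⟨_, EP_base (CA_ite hE hD (CA_const 1) (CA_const 0)), fun y l t h h' => ?_⟩
  have hX : x₀ * (p : ℚ_[p]) ^ (N * l) ≠ 0 := mul_ne_zero hx (zpow_ne_zero _ pK_ne)
  have hR : Rl N M x₀ (C.τ (y, t)) := ⟨l, _, h', (mul_div_cancel₀ _ hX).symm⟩
  refine if_congr ⟨fun hs => ⟨t, ⟨h, hs⟩, hR⟩, ?_⟩ rfl rfl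
  rintro ⟨t', ⟨h6, h7⟩, i, u', hu', e⟩
  refine (h5 N hNN M hMM (y, t') (y, t) fun f hf => Prep_Rl hM (hC f hf) h6 h rfl ?_).1 h7
  obtain ⟨k, u, hu, e'⟩ := hR
  refine ⟨k - i, u * u'⁻¹, hu.mul hM (hu'.inv hM), ?_⟩
  have := hu'.ne hM
  have h0 : (p : ℚ_[p]) ^ (N * i) ≠ 0 := zpow_ne_zero _ pK_ne
  rw [e', e, mul_sub, zpow_sub₀ pK_ne]
  field_simp

theorem val_near {x X : ℚ_[p]} (hM : 1 ≤ M) (hX : X ≠ 0) (h : near1 M (x / X)) : x ≠ 0 ∧ x.valuation = X.valuation := by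
  have e : x = X * (x / X) := (mul_div_cancel₀ _ hX).symm
  have h0 : x ≠ 0 := by rw [e]; exact mul_ne_zero hX (h.ne hM)
  refine ⟨h0, (norm_eq_iff_val h0 hX).1 ?_⟩
  rw [e, norm_mul, h.norm hM, mul_one]

theorem Tm_val (hE : Full ℰ) {d : Y × ℚ_[p] → ℚ_[p]} (hd : d ∈ WWi ℰ) {q : ℕ} (hq : 0 < q) {φ : ℤ → ℚ}
    (hφ : φ = (fun i : ℤ => (i : ℚ)) ∨ φ = fun i => (p : ℚ) ^ i) : Tm ℰ fun w => φ ((d w).valuation / q) := by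
  classical
  refine ⟨q, 1, hq, le_rfl, {d}, Set.finite_singleton d, by simpa using hd, fun N hN hNN M hM C hC x₀ hx => ?_⟩
  obtain ⟨h, hh, a, U, hU, e⟩ := hC d rfl
  obtain ⟨N', rfl⟩ := hNN
  obtain ⟨e', he', hfr⟩ := hE.fr _ (hE.dalg.mul hh (hE.dalg.const (x₀ ^ a))) q hq
  have h0 : QF ℰ {y | h y = 0} := QF.zero h hh
  have h1 : (fun w : Y × ℤ => φ ((e' w.1).valuation + a * N' * w.2)) ∈ EP ℰ := by
    rcases hφ with rfl | rfl
    · refine mem_of_eq_of_mem ?_ (add_mem (EP_base (CA_val he')) (EP_mon (CA_const (a * N' : ℚ)) 1 0))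
      funext w; simp [mon]
    · refine mem_of_eq_of_mem ?_ (EP_mon (CA_pow he') 0 (a * N'))
      funext w; simp [mon, zpow_add₀ (pQ_ne (p := p))]
  refine ⟨fun w => (if w.1 ∈ {y | h y = 0} then 1 else 0) * φ 0 + (if w.1 ∈ {y | h y = 0} then 0 else 1) * φ ((e' w.1).valuation + a * N' * w.2),
    add_mem (EP_mul (EP_base (CA_ite hE h0 (CA_const 1) (CA_const 0))) (EP_base (CA_const (φ 0))))
      (EP_mul (EP_base (CA_ite hE h0 (CA_const 0) (CA_const 1))) h1), fun y l t hw hn => ?_⟩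
  have hX : x₀ * (p : ℚ_[p]) ^ (((q * N' : ℕ) : ℤ) * l) ≠ 0 := mul_ne_zero hx (zpow_ne_zero _ pK_ne)
  obtain ⟨k1, k2⟩ := val_near hM hX hn
  by_cases hy : h y = 0
  · simp [hy, e _ hw]
  · simp only [mem_ofPred_eq, hy, if_false, zero_mul, one_mul, zero_add]
    have hu := hU.near hw
    have hz : x₀ ^ a ≠ 0 := zpow_ne_zero a hx
    rw [((hfr y).2 (mul_ne_zero hy hz)).2, e _ hw, val_mul_near1 hM hu, valuation_mul hy (zpow_ne_zero _ k1), valuation_zpow, k2,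
      valuation_mul hx (zpow_ne_zero _ pK_ne), valuation_mul hy hz, valuation_zpow, valuation_zpow, valuation_p]
    congr 1
    rw [← Int.add_mul_ediv_left _ _ (show (q : ℤ) ≠ 0 by exact_mod_cast hq.ne')]
    congr 1; push_cast; ring

theorem Tm_CA {m : ℕ} {F : (Fin (m + 1) → ℚ_[p]) → ℚ} (hF : F ∈ CA (EF p (m + 1))) : Tm (EF p m) fun w => F (snoc w.1 w.2) := by
  classical
  have hE := EF_full (p := p) m
  have key : ∀ e ∈ EF p (m + 1), ∀ φ : ℤ → ℚ, (φ = (fun i : ℤ => (i : ℚ)) ∨ φ = fun i => (p : ℚ) ^ i) →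
      Tm (EF p m) fun w => φ ((e (snoc w.1 w.2)).valuation) := by
    intro e he φ hφ
    obtain ⟨q, hq, L, h1, h2, h3⟩ := (EF_ext (m + 1)).val e he
    suffices ∃ H, Tm (EF p m) H ∧ ∀ w : (Fin m → ℚ_[p]) × ℚ_[p], (∃ d ∈ L, ‖e (snoc w.1 w.2)‖ ^ q = ‖d (snoc w.1 w.2)‖) →
        H w = φ ((e (snoc w.1 w.2)).valuation) by
      obtain ⟨H, hH, e⟩ := this
      rwa [show (fun w : (Fin m → ℚ_[p]) × ℚ_[p] => _) = H from funext fun w => (e w (h3 _)).symm]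
    clear h3
    induction L, h1 using Set.Finite.induction_on with
    | empty => exact ⟨_, Tm_const 0, by simp⟩
    | @insert d L _ _ ih =>
      obtain ⟨H, hH, e1⟩ := ih ((Set.subset_insert _ _).trans h2)
      have hd := h2 (Set.mem_insert _ _)
      have hS := qf_snoc ((EF_ext (m + 1)).qf _ (QF.norm_eq (EF_full _).dalg ((EF_full _).dalg.pow he q) ((EF_ext (m + 1)).sub hd)))
      have hd' : (fun w : (Fin m → ℚ_[p]) × ℚ_[p] => d (snoc w.1 w.2)) ∈ WWi (EF p m) :=
        fun K hK => WW_snoc hE (EF_ext m).sub hK hd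
      refine ⟨_, ((Tm_ind hE hS).mul (Tm_val hE hd' hq hφ)).add ((Tm_ind hE hS.compl).mul hH), ?_⟩
      rintro w ⟨d', hd', hw⟩
      by_cases hy : ‖e (snoc w.1 w.2)‖ ^ q = ‖d (snoc w.1 w.2)‖
      · simp only [Pi.add_apply, Pi.mul_apply, mem_ofPred_eq, Set.mem_compl_iff, norm_pow, hy, if_true, not_true_eq_false, if_false, one_mul, zero_mul, add_zero]
        congr 1
        by_cases h0 : e (snoc w.1 w.2) = 0
        · rw [h0, norm_zero, zero_pow hq.ne', eq_comm, norm_eq_zero] at hy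
          rw [hy, h0]; simp
        · rw [← norm_pow] at hy
          have h4 : d (snoc w.1 w.2) ≠ 0 := by
            rw [← norm_ne_zero_iff, ← hy, norm_ne_zero_iff]; exact pow_ne_zero _ h0
          rw [← (norm_eq_iff_val (pow_ne_zero _ h0) h4).1 hy, Padic.valuation_pow, Int.mul_ediv_cancel_left _ (by exact_mod_cast hq.ne')]
      · rcases hd' with rfl | hd'
        · exact absurd hw hy
        · rw [← e1 w ⟨d', hd', hw⟩]; simp [hy]
  induction hF using Algebra.adjoin_induction with
  | mem g hg =>
    rcases hg with ⟨e, he, rfl⟩ | ⟨e, he, rfl⟩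
    · exact key e he _ (Or.inl rfl)
    · exact key e he _ (Or.inr rfl)
  | algebraMap c => exact Tm_const c
  | add f g _ _ h h' => exact h.add h'
  | mul f g _ _ h h' => exact h.mul h'

end tm

section haar
variable {p : ℕ} [hp : Fact p.Prime] {Y : Type*} {ℰ : Set (Y → ℚ_[p])} {N M : ℕ} {μ : Measure ℚ_[p]}

theorem ball_center (hμ : μ.IsAddHaarMeasure) (x : ℚ_[p]) (r : ℝ) : μ (closedBall x r) = μ (closedBall 0 r) := by
  rw [← measure_preimage_add μ (-x) (closedBall 0 r)]
  congr 1; ext y; simp [dist_eq_norm, sub_eq_neg_add]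

theorem ball_step (hμ : μ.IsAddHaarMeasure) {z : ℚ_[p]} (hz : z ≠ 0) :
    μ (closedBall 0 ‖z‖) = p * μ (closedBall 0 ‖z * p‖) := by
  have h1 : closedBall (0 : ℚ_[p]) ‖z‖ = ⋃ a ∈ range p, closedBall (z * (a : ℚ_[p])) ‖z * p‖ := by
    ext t
    simp only [Set.mem_iUnion, Metric.mem_closedBall, dist_eq_norm, sub_zero, mem_range, exists_prop]
    constructor
    · intro ht
      let x : ℤ_[p] := ⟨t / z, by rw [norm_div]; exact div_le_one_of_le₀ ht (norm_nonneg _)⟩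
      have h1 := (norm_le_pow_iff_mem_span_pow _ 1).2 (PadicInt.appr_spec 1 x)
      rw [norm_def] at h1
      have h2 : ‖t / z - (x.appr 1 : ℚ_[p])‖ ≤ ‖(p : ℚ_[p]) ^ 1‖ := by rw [Padic.norm_p_pow]; exact h1
      refine ⟨x.appr 1, by simpa using PadicInt.appr_lt x 1, ?_⟩
      rw [show t - z * (x.appr 1 : ℚ_[p]) = z * (t / z - (x.appr 1 : ℚ_[p])) by field_simp, norm_mul, norm_mul]
      rw [pow_one] at h2
      gcongr
    · rintro ⟨a, -, h⟩
      have h2 : ‖z * (a : ℚ_[p])‖ ≤ ‖z‖ := by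
        rw [norm_mul]; exact mul_le_of_le_one_right (norm_nonneg _) (by simpa using Padic.norm_int_le_one (p := p) (a : ℤ))
      have h3 : ‖z * (p : ℚ_[p])‖ ≤ ‖z‖ := by
        rw [norm_mul]; exact mul_le_of_le_one_right (norm_nonneg _) normp_lt.le
      simpa using norm_add_le_of (h.trans h3) h2
  rw [h1, measure_biUnion_finset ?_ fun _ _ => Metric.isClosed_closedBall.measurableSet]
  · simp only [ball_center hμ (z * _)]; simp
  · intro a ha b hb hab
    refine Set.disjoint_left.2 fun t h h' => hab ?_
    simp only [Metric.mem_closedBall, dist_eq_norm] at h h'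
    refine nat_cong (p := p) (L := 1) (by simpa using ha) (by simpa using hb) ?_
    have h2 := norm_sub_le_of h' h
    rw [show t - z * (b : ℚ_[p]) - (t - z * (a : ℚ_[p])) = z * ((a : ℚ_[p]) - b) by ring, norm_mul, norm_mul] at h2
    rw [pow_one]
    exact le_of_mul_le_mul_left h2 (norm_pos_iff.2 hz)

/-- normalisation of the Haar measure -/
theorem ball_vol (hμ : μ.IsAddHaarMeasure) (h1 : μ (closedBall 0 1) = 1) (x : ℚ_[p]) {z : ℚ_[p]} (hz : z ≠ 0) :
    μ (closedBall x ‖z‖) = ENNReal.ofReal ‖z‖ := by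
  have hp1 := pR_one_lt (p := p)
  have hs : ∀ n : ℤ, μ (closedBall 0 ‖(p : ℚ_[p]) ^ n‖) = p * μ (closedBall 0 ‖(p : ℚ_[p]) ^ (n + 1)‖) := fun n => by
    rw [ball_step hμ (zpow_ne_zero n pK_ne), zpow_add_one₀ pK_ne]
  have hs' : ∀ n : ℤ, ENNReal.ofReal ‖(p : ℚ_[p]) ^ n‖ = p * ENNReal.ofReal ‖(p : ℚ_[p]) ^ (n + 1)‖ := fun n => by
    rw [← ENNReal.ofReal_natCast, ← ENNReal.ofReal_mul (by positivity), norm_p_zpow, norm_p_zpow, neg_add, zpow_add₀ (by positivity)]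
    congr 1; field_simp
  have hp0 : (p : ENNReal) ≠ 0 := by exact_mod_cast hp.1.ne_zero
  have key : ∀ n : ℤ, μ (closedBall 0 ‖(p : ℚ_[p]) ^ n‖) = ENNReal.ofReal ‖(p : ℚ_[p]) ^ n‖ := by
    intro n
    induction n using Int.induction_on with
    | zero => simp [h1]
    | succ n ih =>
      rw [hs, hs'] at ih
      exact (ENNReal.mul_right_inj hp0 (ENNReal.natCast_ne_top p)).1 ih
    | pred n ih => rw [hs, hs', sub_add_cancel, ih]
  rw [ball_center hμ]
  have e : ‖z‖ = ‖(p : ℚ_[p]) ^ z.valuation‖ := by rw [norm_eq_zpow_neg_valuation hz, norm_p_zpow]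
  rw [e, key]

theorem cell_piece (hE : Full ℰ) (C : Cell ℰ) (hN : 0 < N) (hM : 1 ≤ M) {x₀ : ℚ_[p]} (hx : x₀ ≠ 0) : ∃ e₁ ∈ ℰ, ∃ e₂ ∈ ℰ, ∀ y ∈ C.B, ∀ l : ℤ,
    {t | (y, t) ∈ C.carrier ∧ near1 M (C.τ (y, t) / (x₀ * (p : ℚ_[p]) ^ (N * l)))} =
      {t | III (e₁ y) (e₂ y) l ∧ t ∈ closedBall (C.c y + x₀ * (p : ℚ_[p]) ^ (N * l)) ‖x₀ * (p : ℚ_[p]) ^ (N * l) * (p : ℚ_[p]) ^ M‖} := by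
  obtain ⟨e₁, h1, f1⟩ := hE.fr _ (hE.dalg.mul C.hα (hE.dalg.const x₀⁻¹)) N hN
  obtain ⟨e₂, h2, f2⟩ := hE.fr _ (hE.dalg.mul C.hb (hE.dalg.const x₀)) N hN
  refine ⟨e₁, h1, e₂, h2, fun y hy l => Set.ext fun t => ?_⟩
  have hX : x₀ * (p : ℚ_[p]) ^ (N * l) ≠ 0 := mul_ne_zero hx (zpow_ne_zero _ pK_ne)
  have hv : (x₀ * (p : ℚ_[p]) ^ (N * l)).valuation = x₀.valuation + N * l := by
    rw [valuation_mul hx (zpow_ne_zero _ pK_ne), valuation_zpow, valuation_p, mul_one]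
  simp only [mem_ofPred_eq, Metric.mem_closedBall, dist_eq_norm]
  set X := x₀ * (p : ℚ_[p]) ^ (N * l)
  have hn : near1 M (C.τ (y, t) / X) ↔ ‖t - (C.c y + X)‖ ≤ ‖X * (p : ℚ_[p]) ^ M‖ := by
    rw [near1, div_sub_one hX, norm_div, div_le_iff₀ (norm_pos_iff.2 hX), norm_mul X, mul_comm, Cell.τ, sub_sub]
  rw [← hn]
  have hN' : (0 : ℤ) < N := by exact_mod_cast hN
  refine and_congr_left fun h => ?_
  obtain ⟨k1, k2⟩ := val_near hM hX h
  rw [Cell.carrier, III]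
  simp only [mem_ofPred_eq, hy, k1, true_and, ne_eq, not_false_eq_true]
  refine and_congr ?_ ?_
  · by_cases h0 : C.α y = 0
    · simp [h0, (f1 y).1 (by simp [h0])]
    · obtain ⟨a, b⟩ := (f1 y).2 (mul_ne_zero h0 (inv_ne_zero hx))
      simp only [a, not_false_eq_true, true_imp_iff]
      rw [norm_le_iff_val h0 k1, k2, hv, b, Int.le_ediv_iff_mul_le hN', valuation_mul h0 (inv_ne_zero hx), valuation_inv, mul_comm l]
      constructor <;> intro <;> linarith
  · by_cases h0 : C.b y = 0
    · simp [h0, (f2 y).1 (by simp [h0])]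
    · obtain ⟨a, b⟩ := (f2 y).2 (mul_ne_zero h0 hx)
      simp only [a, not_false_eq_true, true_imp_iff]
      rw [Cell.norm_le_one_iff_val (mul_ne_zero h0 k1), valuation_mul h0 k1, k2, hv, neg_le, b, Int.le_ediv_iff_mul_le hN', valuation_mul h0 hx, neg_mul, mul_comm l]
      constructor <;> intro <;> linarith

theorem int_cell (hvol : ∀ x z : ℚ_[p], z ≠ 0 → μ (closedBall x ‖z‖) = ENNReal.ofReal ‖z‖) (hE : Full ℰ) (C : Cell ℰ) (hN : 0 < N)
    (hM : 1 ≤ M) {G : Y × ℚ_[p] → ℚ} (hG : ∀ x₀ : ℚ_[p], x₀ ≠ 0 → ∃ Φ ∈ EP ℰ, ∀ y (l : ℤ) t,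
      (y, t) ∈ C.carrier → near1 M (C.τ (y, t) / (x₀ * (p : ℚ_[p]) ^ (N * l))) → G (y, t) = Φ (y, l)) :
    (∀ y, MeasurableSet {t | (y, t) ∈ C.carrier}) ∧ ∃ H ∈ CA ℰ, ∀ y, Integrable (fun t => (G (y, t) : ℝ)) μ →
      ∫ t in {t | (y, t) ∈ C.carrier}, (G (y, t) : ℝ) ∂μ = H y := by
  classical
  have hN' : (0 : ℤ) < N := by exact_mod_cast hN
  let I := Fin N × {ξ : Fin (p ^ M) // ¬ p ∣ (ξ : ℕ)}
  let x : I → ℚ_[p] := fun i => (p : ℚ_[p]) ^ (i.1 : ℕ) * ((i.2.1 : ℕ) : ℚ_[p])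
  have hx : ∀ i, x i ≠ 0 := fun i => mul_ne_zero (pow_ne_zero _ pK_ne) (natCast_unit_ne i.2.2)
  have hvx : ∀ i (l : ℤ), (x i * (p : ℚ_[p]) ^ (N * l)).valuation = i.1 + N * l := fun i l => by
    have h1 : (((i.2.1 : ℕ) : ℚ_[p])).valuation = 0 := by
      have := (norm_eq_iff_val (natCast_unit_ne (p := p) i.2.2) (one_ne_zero)).1 (by rw [natCast_unit_norm i.2.2, norm_one])
      rwa [Padic.valuation_one] at this
    rw [valuation_mul (hx i) (zpow_ne_zero _ pK_ne), valuation_mul (pow_ne_zero _ pK_ne) (natCast_unit_ne i.2.2),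
      valuation_zpow, Padic.valuation_pow, valuation_p, h1]; ring
  choose e₁ h1 e₂ h2 hp using fun i => cell_piece hE C hN hM (hx i)
  choose Φ hΦ eΦ using fun i => hG (x i) (hx i)
  choose H hH hs using fun i => sum_all hE (EP_mul (hΦ i) (EP_mon (CA_const ((p : ℚ) ^ (-(i.1 + M) : ℤ))) 0 (-N))) (h1 i) (h2 i)
  let E : Y → I × ℤ → Set ℚ_[p] := fun y k => {t | (y, t) ∈ C.carrier ∧ near1 M (C.τ (y, t) / (x k.1 * (p : ℚ_[p]) ^ (N * k.2)))}
  have hEm : ∀ y ∈ C.B, ∀ k, MeasurableSet (E y k) := by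
    intro y hy k
    simp only [E, hp k.1 y hy]
    by_cases h : III (e₁ k.1 y) (e₂ k.1 y) k.2
    · simp only [h, true_and]; exact Metric.isClosed_closedBall.measurableSet
    · simp [h]
  have hU : ∀ y, {t | (y, t) ∈ C.carrier} = ⋃ k, E y k := by
    intro y
    ext t
    simp only [Set.mem_iUnion, E, mem_ofPred_eq]
    refine ⟨fun h => ?_, fun ⟨k, h⟩ => h.1⟩
    obtain ⟨ξ, a, b, c⟩ := exists_approx M hM _ h.2.1
    set v := (C.τ (y, t)).valuation
    have h3 : ((v % N).toNat : ℤ) = v % N := Int.toNat_of_nonneg (Int.emod_nonneg _ hN'.ne')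
    have h4 := Int.emod_lt_of_pos v hN'
    refine ⟨((⟨(v % N).toNat, by omega⟩, ⟨⟨ξ, a⟩, b⟩), v / N), h, ?_⟩
    simp only [x]
    rw [← zpow_natCast, h3, mul_right_comm, ← zpow_add₀ pK_ne, Int.emod_add_mul_ediv]
    exact c
  have hd : ∀ y, Pairwise (Function.onFun Disjoint (E y)) := by
    rintro y ⟨⟨j, ξ⟩, l⟩ ⟨⟨j', ξ'⟩, l'⟩ hne
    refine Set.disjoint_left.2 fun t h h' => hne ?_
    have a := (val_near hM (mul_ne_zero (hx _) (zpow_ne_zero _ pK_ne)) h.2).2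
    have a' := (val_near hM (mul_ne_zero (hx _) (zpow_ne_zero _ pK_ne)) h'.2).2
    rw [hvx] at a a'
    simp only at a a'
    have hj : j = j' := by
      have : ((j : ℕ) : ℤ) = (j' : ℕ) := by
        rw [← Int.emod_eq_of_lt (Int.natCast_nonneg _) (show ((j : ℕ) : ℤ) < N by exact_mod_cast j.2), ← Int.add_mul_emod_self_left _ (N : ℤ) l, ← a, a',
          Int.add_mul_emod_self_left, Int.emod_eq_of_lt (Int.natCast_nonneg _) (by exact_mod_cast j'.2)]
      exact Fin.ext (by exact_mod_cast this)
    subst hj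
    have hl : l = l' := mul_left_cancel₀ hN'.ne' (by linarith)
    subst hl
    have h3 := (h'.2.mul hM (h.2.inv hM))
    have h5 := natCast_unit_ne (p := p) ξ'.2
    have h6 := natCast_unit_ne (p := p) ξ.2
    have h7 : (p : ℚ_[p]) ^ (j : ℕ) ≠ 0 := pow_ne_zero _ pK_ne
    have h8 : (p : ℚ_[p]) ^ (N * l) ≠ 0 := zpow_ne_zero _ pK_ne
    have h9 := h.1.2.1
    have e : C.τ (y, t) / (x (j, ξ') * (p : ℚ_[p]) ^ (N * l)) * (C.τ (y, t) / (x (j, ξ) * (p : ℚ_[p]) ^ (N * l)))⁻¹ - 1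
        = (((ξ.1 : ℕ) : ℚ_[p]) - ((ξ'.1 : ℕ) : ℚ_[p])) / ((ξ'.1 : ℕ) : ℚ_[p]) := by
      simp only [x]; field_simp
    simp only [near1] at h3
    rw [e, norm_div, natCast_unit_norm ξ'.2, div_one] at h3
    rw [show ξ = ξ' from Subtype.ext (Fin.ext (nat_cong ξ.1.2 ξ'.1.2 h3))]
  refine ⟨fun y => ?_, ?_⟩
  · by_cases hy : y ∈ C.B
    · rw [hU]; exact MeasurableSet.iUnion (hEm y hy)
    · rw [show {t | (y, t) ∈ C.carrier} = ∅ from Set.eq_empty_of_forall_notMem fun t h => hy h.1]; exact MeasurableSet.empty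
  refine ⟨_, CA_ite hE C.hB (sum_mem (t := Finset.univ) fun i _ => hH i) (CA_const 0), fun y hi => ?_⟩
  by_cases hy : y ∈ C.B
  · rw [if_pos hy, hU]
    have h := hasSum_integral_iUnion (hEm y hy) (hd y) hi.integrableOn
    have hv : ∀ k, ∫ t in E y k, (G (y, t) : ℝ) ∂μ = if III (e₁ k.1 y) (e₂ k.1 y) k.2 then
        (((Φ k.1 * mon p (fun _ => (p : ℚ) ^ (-(k.1.1 + M) : ℤ)) 0 (-N) : Y × ℤ → ℚ) (y, k.2) : ℚ) : ℝ) else 0 := by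
      rintro ⟨i, l⟩
      rw [setIntegral_congr_fun (hEm y hy _) (g := fun _ => (Φ i (y, l) : ℝ)) fun t ht => by simp only [eΦ i y l t ht.1 ht.2], setIntegral_const]
      have hX : x i * (p : ℚ_[p]) ^ (N * l) * (p : ℚ_[p]) ^ M ≠ 0 := mul_ne_zero (mul_ne_zero (hx i) (zpow_ne_zero _ pK_ne)) (pow_ne_zero _ pK_ne)
      simp only [E, hp i y hy]
      split_ifs with h
      · simp only [h, true_and, Set.ofPred_mem_eq]
        rw [measureReal_def, hvol _ _ hX, ENNReal.toReal_ofReal (norm_nonneg _), norm_eq_zpow_neg_valuation hX,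
          valuation_mul (mul_ne_zero (hx i) (zpow_ne_zero _ pK_ne)) (pow_ne_zero _ pK_ne), hvx, Padic.valuation_pow, valuation_p]
        have hp1 : (p : ℝ) ≠ 0 := (one_pos.trans pR_one_lt).ne'
        simp only [mon, Pi.mul_apply, smul_eq_mul, pow_zero, mul_one]
        push_cast
        rw [mul_comm, ← zpow_add₀ hp1]
        congr 2; ring
      · simp [h]
    simp only [hv] at h
    have hf := fun i => (h.summable.prod_factor i).hasSum
    have h2 := (h.prod_fiberwise hf).unique (hasSum_fintype _)
    rw [h2, Finset.sum_apply, Rat.cast_sum]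
    exact sum_congr rfl fun i _ => hs i y _ (hf i)
  · rw [if_neg hy, show {t | (y, t) ∈ C.carrier} = ∅ from Set.eq_empty_of_forall_notMem fun t h => hy h.1]; simp

end haar

section good
variable {p : ℕ} [hp : Fact p.Prime] {Y : Type*} {ℰ : Set (Y → ℚ_[p])} {μ : Measure ℚ_[p]}

theorem int_Tm (hμ : μ.IsAddHaarMeasure) (h1 : μ (closedBall 0 1) = 1) (hE : Full ℰ) {G : Y × ℚ_[p] → ℚ} (hG : Tm ℰ G) :
    ∃ H ∈ CA ℰ, ∀ y, Integrable (fun t => (G (y, t) : ℝ)) μ → ∫ t, (G (y, t) : ℝ) ∂μ = H y := by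
  obtain ⟨N, M, hN, hM, s, hs, hs', h⟩ := hG
  have := hs.to_subtype
  cases nonempty_fintype s
  have hd := cell_dec hE hM (f := fun i : s => i.1) Finset.univ fun i => hs' i.2 M hM
  suffices ∀ T, Dec (fun C : Cell ℰ => ∀ i ∈ (Finset.univ : Finset s), C.Prep M i.1) T →
      (∀ y, MeasurableSet {t | (y, t) ∈ T}) ∧ ∃ H ∈ CA ℰ, ∀ y, Integrable (fun t => (G (y, t) : ℝ)) μ →
      ∫ t in {t | (y, t) ∈ T}, (G (y, t) : ℝ) ∂μ = H y by
    obtain ⟨-, H, hH, e⟩ := this _ hd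
    exact ⟨H, hH, fun y hy => by simpa using e y hy⟩
  intro T hT
  induction hT with
  | cell C hC => exact int_cell (fun x z hz => ball_vol hμ h1 x hz) hE C hN hM (h N hN dvd_rfl M le_rfl C fun f hf => hC ⟨f, hf⟩ (Finset.mem_univ _))
  | pt B hB c hc =>
    have hsub : ∀ y, {t | (y, t) ∈ {w : Y × ℚ_[p] | w.1 ∈ B ∧ w.2 = c w.1}} ⊆ {c y} := fun y t ht => ht.2
    refine ⟨fun y => (Set.subsingleton_singleton.anti (hsub y)).measurableSet, _, CA_const 0, fun y _ => ?_⟩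
    rw [setIntegral_measure_zero _ (measure_mono_null (hsub y) (measure_singleton _)), Rat.cast_zero]
  | union S T _ _ hST ih ih' =>
    obtain ⟨m1, H, hH, e⟩ := ih
    obtain ⟨m2, H', hH', e'⟩ := ih'
    refine ⟨fun y => (m1 y).union (m2 y), _, add_mem hH hH', fun y hy => ?_⟩
    have hdis : Disjoint {t | (y, t) ∈ S} {t | (y, t) ∈ T} := Set.disjoint_left.2 fun t h h' => Set.disjoint_left.1 hST h h'
    rw [Pi.add_apply, Rat.cast_add, ← e y hy, ← e' y hy, ← setIntegral_union hdis (m2 y) hy.integrableOn hy.integrableOn]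
    rfl

/-- measures for which constructible functions are closed under integration -/
def GoodM (μ : Measure ℚ_[p]) : Prop := ∀ (m : ℕ) (F : (Fin (m + 1) → ℚ_[p]) → ℚ), F ∈ CA (EF p (m + 1)) → ∃ G ∈ CA (EF p m), ∀ y,
  Integrable (fun t => (F (snoc y t) : ℝ)) μ → ∫ t, (F (snoc y t) : ℝ) ∂μ = G y

theorem good_haar (hμ : μ.IsAddHaarMeasure) (h1 : μ (closedBall 0 1) = 1) : GoodM μ := fun m F hF =>
  int_Tm hμ h1 (EF_full m) (Tm_CA hF)

theorem good_pi [SigmaFinite μ] (hμ : GoodM μ) {a : ℕ} (r : ℕ) {F : (Fin (a + r) → ℚ_[p]) → ℚ} (hF : F ∈ CA (EF p (a + r))) :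
    ∃ G ∈ CA (EF p a), ∀ y, Integrable (fun s => (F (append y s) : ℝ)) (Measure.pi fun _ : Fin r => μ) →
      ∫ s, (F (append y s) : ℝ) ∂(Measure.pi fun _ : Fin r => μ) = G y := by
  induction r with
  | zero =>
    refine ⟨F, hF, fun y _ => ?_⟩
    rw [Measure.pi_of_empty, integral_dirac, Fin.append_right_nil _ _ rfl]; rfl
  | succ r ih =>
    obtain ⟨G1, h1, e1⟩ := hμ (a + r) F hF
    obtain ⟨G, hG, e⟩ := ih h1
    refine ⟨G, hG, fun y hy => ?_⟩
    have mp := (measurePreserving_piFinSuccAbove (fun _ : Fin (r + 1) => μ) (Fin.last r)).symm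
    have hy' := (mp.integrable_comp_emb (MeasurableEquiv.measurableEmbedding _)).2 hy
    rw [← mp.integral_comp (MeasurableEquiv.measurableEmbedding _)]
    have hs : ∀ (t : ℚ_[p]) (s : Fin r → ℚ_[p]), append y ((MeasurableEquiv.piFinSuccAbove (fun _ : Fin (r + 1) => ℚ_[p]) (Fin.last r)).symm (t, s)) =
        (snoc (append y s) t : Fin (a + r + 1) → ℚ_[p]) := fun t s => by
      rw [← Fin.append_snoc]; congr 1; exact Fin.insertNth_last' _ _
    have hae : ∀ᵐ s ∂(Measure.pi fun _ : Fin r => μ), ∫ t, (F (append y ((MeasurableEquiv.piFinSuccAbove (fun _ : Fin (r + 1) => ℚ_[p]) (Fin.last r)).symm (t, s))) : ℝ) ∂μ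
        = G1 (append y s) := by
      filter_upwards [hy'.prod_left_ae] with s hs1
      rw [← e1]
      · simp only [hs]
      · simpa only [Function.comp, hs] using hs1
    refine (integral_prod_symm _ hy').trans ((integral_congr_ae hae).trans ?_)
    exact e y (hy'.integral_prod_right.congr hae)

theorem val_meas : Measurable fun t : ℚ_[p] => t.valuation := by
  refine measurable_to_countable' fun z => ?_
  have : (fun t : ℚ_[p] => t.valuation) ⁻¹' {z} ∩ {0}ᶜ = {t | ‖t‖ = ‖(p : ℚ_[p]) ^ z‖} ∩ {0}ᶜ := by
    ext t
    simp only [Set.mem_inter_iff, Set.mem_preimage, Set.mem_singleton_iff, Set.mem_compl_iff, mem_ofPred_eq, and_congr_left_iff]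
    intro h
    rw [norm_eq_iff_val h (zpow_ne_zero _ pK_ne), valuation_zpow, valuation_p, mul_one]
  rw [← Set.inter_union_compl (_ ⁻¹' {z}) {(0 : ℚ_[p])}ᶜ, this, compl_compl]
  exact ((measurableSet_eq_fun measurable_norm measurable_const).inter (measurableSet_singleton 0).compl).union
    (Set.subsingleton_singleton.anti Set.inter_subset_right).measurableSet

theorem exists_haar : ∃ μ : Measure ℚ_[p], μ.IsAddHaarMeasure ∧ μ (closedBall 0 1) = 1 := by
  let K : TopologicalSpace.PositiveCompacts ℚ_[p] := ⟨⟨closedBall 0 1, isCompact_closedBall _ _⟩, 0,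
    Metric.ball_subset_interior_closedBall (Metric.mem_ball_self one_pos)⟩
  exact ⟨Measure.addHaarMeasure K, inferInstance, Measure.addHaarMeasure_self⟩

/-- a measure on the field inducing the counting measure on the value group -/
theorem exists_kappa : ∃ κ : Measure ℚ_[p], SigmaFinite κ ∧ GoodM κ ∧ κ {0} = 0 ∧ MeasurePreserving (fun t : ℚ_[p] => t.valuation) κ Measure.count := by
  obtain ⟨μ, hμ, h1⟩ := exists_haar (p := p)
  have hp1 := pR_one_lt (p := p)
  let c : NNReal := p / (p - 1)
  let ρ : ℚ_[p] → NNReal := fun t => c * (p : NNReal) ^ t.valuation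
  have hρ : Measurable ρ := (measurable_from_top (f := fun z : ℤ => c * (p : NNReal) ^ z)).comp val_meas
  have hc : ((c : NNReal) : ℝ) = ((p / (p - 1) : ℚ) : ℝ) := by
    simp only [c]; push_cast [NNReal.coe_sub (show (1 : NNReal) ≤ p by exact_mod_cast hp.1.one_le)]; rfl
  refine ⟨μ.withDensity fun t => ρ t, SigmaFinite.withDensity _, fun m F hF => ?_, ?_, val_meas, ?_⟩
  · obtain ⟨G, hG, e⟩ := good_haar hμ h1 m _ (mul_mem (mul_mem (CA_const ((p / (p - 1) : ℚ))) (CA_pow ((EF_ext _).sub (DF_coord (Fin.last m))))) hF)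
    refine ⟨G, hG, fun y hy => ?_⟩
    have he : ∀ t, (((((fun _ => (p / (p - 1) : ℚ)) * fun ω => (p : ℚ) ^ (ω (Fin.last m) : ℚ_[p]).valuation) * F : (Fin (m + 1) → ℚ_[p]) → ℚ)
        (snoc y t) : ℚ) : ℝ) = ρ t • (F (snoc y t) : ℝ) := fun t => by
      simp only [Pi.mul_apply, snoc_last, ρ, NNReal.smul_def, smul_eq_mul, NNReal.coe_mul, hc]
      push_cast; rfl
    have hy' := (integrable_withDensity_iff_integrable_smul hρ).1 hy
    rw [← e y (by simpa only [he] using hy'), integral_withDensity_eq_integral_smul hρ]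
    simp only [he]
  · exact withDensity_absolutelyContinuous _ _ (measure_singleton 0)
  · refine Measure.ext_of_singleton fun z => ?_
    rw [Measure.map_apply val_meas (measurableSet_singleton z), Measure.count_singleton, withDensity_apply _ (val_meas (measurableSet_singleton z))]
    have hA : μ ((fun t : ℚ_[p] => t.valuation) ⁻¹' {z}) = ENNReal.ofReal ((p : ℝ) ^ (-z) - (p : ℝ) ^ (-(z + 1))) := by
      have h0 : ∀ n : ℤ, (p : ℚ_[p]) ^ n ≠ 0 := fun n => zpow_ne_zero n pK_ne
      have hb : ∀ n : ℤ, ‖(p : ℚ_[p]) ^ n‖ = (p : ℝ) ^ (-n) := norm_p_zpow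
      have hv : ∀ n : ℤ, ((p : ℚ_[p]) ^ n).valuation = n := fun n => by rw [valuation_zpow, valuation_p, mul_one]
      rw [← measure_sdiff_null (t := {0}) (measure_singleton 0), ENNReal.ofReal_sub _ (by positivity), ← hb, ← hb, ← ball_vol hμ h1 0 (h0 z),
        ← ball_vol hμ h1 0 (h0 (z + 1)), ← measure_sdiff _ Metric.isClosed_closedBall.measurableSet.nullMeasurableSet]
      · congr 1
        ext t
        simp only [Set.mem_sdiff, Set.mem_preimage, Set.mem_singleton_iff, Metric.mem_closedBall, dist_zero_right]
        by_cases ht : t = 0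
        · simp only [ht, norm_zero, norm_nonneg, not_true_eq_false, and_false]
        · rw [norm_le_iff_val ht (h0 _), norm_le_iff_val ht (h0 _), hv, hv]
          simp only [ht, not_false_eq_true, and_true]; omega
      · rw [ball_vol hμ h1 0 (h0 _)]; exact ENNReal.ofReal_ne_top
      · refine Metric.closedBall_subset_closedBall ?_
        rw [norm_le_iff_val (h0 _) (h0 _), hv, hv]; omega
    rw [setLIntegral_congr_fun (g := fun _ => ((c * (p : NNReal) ^ z : NNReal) : ENNReal)) (val_meas (measurableSet_singleton z)) fun t ht => by
      simp only [ρ, show t.valuation = z from ht], setLIntegral_const, hA, ← ENNReal.ofReal_coe_nnreal, ← ENNReal.ofReal_mul NNReal.zero_le_coe, NNReal.coe_mul, hc]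
    rw [← ENNReal.ofReal_one]
    congr 1
    have h2 : (p : ℝ) - 1 ≠ 0 := by linarith
    have h3 : (p : ℝ) ≠ 0 := by linarith
    push_cast
    rw [neg_add, zpow_add₀ h3, zpow_neg, zpow_neg, zpow_one]
    field_simp

end good

section lift
variable {p : ℕ} [hp : Fact p.Prime] {N M K k m : ℕ}

theorem reidx (σ : Fin N → Fin M) {S : Set (Fin N → ℚ_[p])} (hS : QF (DF p N) S) :
    QF (DF p M) {w | (fun i => w (σ i)) ∈ S} :=
  hS.preimage (𝒟' := DF p M) (fun w i => w (σ i)) fun f hf => (DF_isDAlg M).dfun hf _ fun i => DF_coord (σ i)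

theorem lift_fn (α : Fin K → Fin N) (β : Fin M → Fin N) {h} (hh : IsSimpleFn p K M h) :
    ∃ s ∈ EF p N, ∀ y, (∀ i, y (α i) ≠ 0) → s y ≠ 0 ∧ (s y).valuation = h (fun i => (y (α i)).valuation, fun j => y (β j)) := by
  obtain ⟨s, hs, e⟩ := skolem_DF (reidx (append (snoc (fun i => (α i).castSucc) (Fin.last N)) fun j => (β j).castSucc)
    (QF_iff_sub.2 hh))
  refine ⟨s, hs, fun y hy => ?_⟩
  simp only [mem_ofPred_eq, append_left, append_right, Fin.forall_fin_succ', snoc_castSucc, snoc_last] at e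
  have := e y (p ^ h (fun i => (y (α i)).valuation, fun j => y (β j))) ⟨⟨hy, zpow_ne_zero _ pK_ne⟩, by
    rw [valuation_zpow, valuation_p, mul_one]⟩
  exact ⟨this.1.2, this.2⟩

theorem lift (α : Fin K → Fin N) (β : Fin M → Fin N) {f} (hf : f ∈ SimpleAlg p K M) :
    ∃ F ∈ CA (EF p N), ∀ y, (∀ i, y (α i) ≠ 0) → F y = f (fun i => (y (α i)).valuation, fun j => y (β j)) := by
  induction hf using Algebra.adjoin_induction with
  | mem g hg =>
    obtain ⟨h, hh, rfl⟩ | ⟨h, hh, rfl⟩ := hg <;> obtain ⟨s, hs, e⟩ := lift_fn α β hh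
    · exact ⟨_, CA_val hs, fun y hy => by rw [(e y hy).2]⟩
    · exact ⟨_, CA_pow hs, fun y hy => by rw [(e y hy).2]⟩
  | algebraMap c => exact ⟨_, CA_const c, fun y hy => rfl⟩
  | add f g _ _ hf hg | mul f g _ _ hf hg =>
    obtain ⟨F, hF, e⟩ := hf
    obtain ⟨G, hG, e'⟩ := hg
    first
    | exact ⟨_, add_mem hF hG, fun y hy => congr_arg₂ _ (e y hy) (e' y hy)⟩
    | exact ⟨_, mul_mem hF hG, fun y hy => congr_arg₂ _ (e y hy) (e' y hy)⟩

theorem graph_qf {e} (he : e ∈ EF p N) : QF (DF p (N + 1)) {w | ‖e fun i => w i.castSucc‖ = ‖w (Fin.last N)‖} := by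
  obtain ⟨n, hn, l, hl, hlD, h⟩ := (EF_ext N).val e he
  have := hl.to_subtype
  have hE := (EF_ext (p := p) N).dalg
  have hD := DF_isDAlg (p := p) (N + 1)
  refine (QF.fex hD (fun (d : l) (w : Fin (N + 1) → ℚ_[p]) => (fun i => w (Fin.castSucc i)) ∈ {y | ‖e y ^ n‖ = ‖d.1 y‖} ∧
    ‖d.1 (fun i => w (Fin.castSucc i))‖ = ‖w (Fin.last N) ^ n‖) fun d => QF.and (reidx Fin.castSucc ((EF_ext N).qf _
      (QF.norm_eq hE (hE.pow he n) ((EF_ext N).sub (hlD d.2))))) (QF.norm_eq hD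
        (hD.dfun (hlD d.2) _ fun i => DF_coord i.castSucc) (hD.pow (DF_coord _) n))).of_eq ?_
  ext w
  simp only [mem_ofPred_eq, norm_pow]
  constructor
  · rintro ⟨d, h1, h2⟩
    exact (pow_left_inj₀ (norm_nonneg _) (norm_nonneg _) hn.ne').1 (h1.trans h2)
  · intro h3
    obtain ⟨d, h1, h2⟩ := h fun i => w i.castSucc
    exact ⟨⟨d, h1⟩, h2, by rw [← h2, h3]⟩

def FullS (k m : ℕ) (A : Set (Fin (k + m) → ℚ_[p])) : Prop :=
  QF (DF p (k + m)) A ∧ ∀ (z : Fin k → ℤ) (x : Fin m → ℚ_[p]), ∃ t : Fin k → ℚ_[p], (∀ i, t i ≠ 0 ∧ (t i).valuation = z i) ∧ append t x ∈ A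

theorem min_sel (V : Set ℤ) (hV : V.Nonempty) : ∃ b ∈ V, ∀ a ∈ V, ¬ ((0 ≤ a ∧ a < b) ∨ (b < 0 ∧ b < a)) := by
  by_cases h : ∃ a ∈ V, 0 ≤ a
  · obtain ⟨b, h1, h2⟩ := Int.exists_least_of_bdd (P := fun a => a ∈ V ∧ 0 ≤ a) ⟨0, fun z hz => hz.2⟩ h
    exact ⟨b, h1.1, fun a ha => by
      rintro (h3 | h3)
      · have := h2 a ⟨ha, h3.1⟩
        omega
      · omega⟩
  · push Not at h
    obtain ⟨b, h1, h2⟩ := Int.exists_greatest_of_bdd (P := fun a => a ∈ V) ⟨0, fun z hz => (h z hz).le⟩ hV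
    exact ⟨b, h1, fun a ha => by have := h a ha; have := h2 a ha; omega⟩

theorem sel {A} (hA : FullS (p := p) k m A) {e} (he : e ∈ EF p (k + m)) : ∃ A' ⊆ A, FullS k m A' ∧ ∃ h, IsSimpleFn p k m h ∧
    ∀ t x, (∀ i, t i ≠ 0) → append t x ∈ A' → (e (append t x)).valuation = h (fun i => (t i).valuation, x) := by
  classical
  wlog h0 : ∀ y, e y ≠ 0
  · obtain ⟨A', h1, h2, h, h3, h4⟩ := this hA (e := fun y => if e y = 0 then 1 else e y) (pw_ite (EF_full _).pw (QF.zero e he)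
      ((EF_full _).dalg.const 1) he (fun y hy => if_pos hy) fun y hy => if_neg hy) fun y => by split_ifs with h <;> simp [h]
    refine ⟨A', h1, h2, h, h3, fun t x ht hy => ?_⟩
    rw [← h4 t x ht hy]
    split_ifs with h <;> simp [h]
  let V : (Fin k → ℤ) × (Fin m → ℚ_[p]) → Set ℤ := fun w => {a | ∃ t : Fin k → ℚ_[p], (∀ i, t i ≠ 0 ∧ (t i).valuation = w.1 i) ∧
    append t w.2 ∈ A ∧ (e (append t w.2)).valuation = a}
  choose h h1 h2 using fun w => min_sel (V w) (by
    obtain ⟨t, a, b⟩ := hA.2 w.1 w.2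
    exact ⟨_, t, a, b, rfl⟩)
  have hh : IsSimpleFn p k m h := by
    have hD := DF_isDAlg (p := p)
    let L : Fin k → Fin (k + 1 + m) := fun i => castAdd m i.castSucc
    let u : Fin (k + 1 + m) := castAdd m (Fin.last k)
    let C : Set (Fin (k + 1 + m) → ℚ_[p]) := {w | ∃ t, append w t ∈ {w | (∀ i, ‖w (natAdd _ i)‖ = ‖w (castAdd k (L i))‖) ∧
      (fun c => w (append (natAdd _) (fun j => castAdd k (natAdd (k + 1) j)) c)) ∈ A ∧
      (fun c => w (snoc (α := fun _ => Fin (k + 1 + m + k)) (append (natAdd _) (fun j => castAdd k (natAdd (k + 1) j)))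
        (castAdd k u) c)) ∈ {w : Fin (k + m + 1) → ℚ_[p] | ‖e fun i => w i.castSucc‖ = ‖w (Fin.last _)‖}}}
    have hC : QF (DF p (k + 1 + m)) C := proj_multi (QF.and (QF.fall (hD _) _ fun i => QF.norm_eq (hD _) (DF_coord _) (DF_coord _))
      (QF.and (reidx _ hA.1) (reidx _ (graph_qf he))))
    have hC' : ∀ w : Fin (k + 1 + m) → ℚ_[p], (∀ i, w (castAdd m i) ≠ 0) → (w ∈ C ↔ (w u).valuation ∈ V (fun i => (w (L i)).valuation, fun j => w (natAdd (k + 1) j))) := by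
      intro w hw
      refine exists_congr fun t => ?_
      have h3 : (fun c => append w t (append (natAdd _) (fun j => castAdd k (natAdd (k + 1) j)) c)) =
          append t fun j => w (natAdd (k + 1) j) := by
        ext c
        refine Fin.addCases (fun i => ?_) (fun j => ?_) c <;> simp only [append_left, append_right]
      simp only [mem_ofPred_eq, snoc_castSucc, snoc_last, h3, append_left, append_right, norm_eq_iff_val (h0 _) (hw (Fin.last k)), u]
      refine and_congr (forall_congr' fun i => ?_) Iff.rfl
      constructor
      · intro h4
        have h5 : t i ≠ 0 := fun h => hw i.castSucc (norm_eq_zero.1 (by rw [← h4, h, norm_zero]))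
        exact ⟨h5, (norm_eq_iff_val h5 (hw i.castSucc)).1 h4⟩
      · rintro ⟨h5, h6⟩
        exact (norm_eq_iff_val h5 (hw i.castSucc)).2 h6
    let τ : Fin (k + 1 + m) → Fin (k + 1 + m + 1) := Function.update Fin.castSucc u (Fin.last _)
    refine QF_iff_sub.1 ((QF.and (QF.fall (hD _) (fun (i : Fin (k + 1)) (w : Fin (k + 1 + m) → ℚ_[p]) => w (castAdd m i) ≠ 0) fun i => QF.ne (DF_coord _)) (QF.and hC (QF.not (proj_DF (S := {w | w (Fin.last _) ≠ 0 ∧ (fun c => w (τ c)) ∈ C ∧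
      ((‖w (Fin.last _)‖ ≤ ‖(1 : ℚ_[p])‖ ∧ ‖w u.castSucc‖ < ‖w (Fin.last _)‖) ∨ (‖(1 : ℚ_[p])‖ < ‖w u.castSucc‖ ∧ ‖w (Fin.last _)‖ < ‖w u.castSucc‖))})
        (QF.and (QF.ne (DF_coord _)) (QF.and (reidx τ hC) (QF.or (QF.and (QF.norm_le (hD _) (DF_coord _) ((hD _).const 1)) (QF.norm_lt (hD _) (DF_coord _) (DF_coord _)))
          (QF.and (QF.norm_lt (hD _) ((hD _).const 1) (DF_coord _)) (QF.norm_lt (hD _) (DF_coord _) (DF_coord _)))))))))).of_eq ?_)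
    ext w
    refine and_congr_right fun hw => ?_
    have hτ : ∀ t, (fun c => (snoc w t : Fin (k + 1 + m + 1) → ℚ_[p]) (τ c)) = Function.update w u t := fun t => by
      ext c
      by_cases hc : c = u
      · simp only [hc, τ, Function.update_self, snoc_last]
      · simp only [τ, Function.update_of_ne hc, snoc_castSucc]
    have hV : ∀ t, t ≠ 0 → (Function.update w u t ∈ C ↔ t.valuation ∈ V (fun i => (w (L i)).valuation, fun j => w (natAdd (k + 1) j))) := by
      intro t ht
      have hL : ∀ i, L i ≠ u := fun i h => (Fin.castSucc_lt_last i).ne (Fin.castAdd_injective _ _ h)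
      have hN : ∀ j, natAdd (k + 1) j ≠ u := fun j h => by
        have := congr_arg Fin.val h
        simp only [u, Fin.val_natAdd, Fin.val_castAdd, Fin.val_last] at this
        omega
      rw [hC' _ fun i => ?_]
      · simp only [Function.update_self, Function.update_of_ne (hL _), Function.update_of_ne (hN _)]
      · by_cases h : castAdd m i = u
        · rwa [h, Function.update_self]
        · rw [Function.update_of_ne h]; exact hw i
    have hu : w u ≠ 0 := hw _
    have hv1 : (1 : ℚ_[p]).valuation = 0 := Padic.valuation_one
    have hlt : ∀ a b : ℚ_[p], a ≠ 0 → b ≠ 0 → (‖a‖ < ‖b‖ ↔ b.valuation < a.valuation) := fun a b ha hb => by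
      rw [← not_le, norm_le_iff_val hb ha, not_le]
    change (w ∈ C ∧ ¬ ∃ t, _) ↔ (w u).valuation = h (fun i => (w (L i)).valuation, fun j => w (natAdd (k + 1) j))
    simp only [mem_ofPred_eq, snoc_last, snoc_castSucc, hτ]
    generalize hW : ((fun i => (w (L i)).valuation, fun j => w (natAdd (k + 1) j)) : (Fin k → ℤ) × (Fin m → ℚ_[p])) = W at hV
    rw [hC' w hw, hW]
    constructor
    · rintro ⟨h3, h4⟩
      have h5 := h2 W _ h3
      by_contra h6
      have h7 := zpow_ne_zero (h W) (pK_ne (p := p))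
      have h8 : ((p : ℚ_[p]) ^ h W).valuation = h W := by rw [valuation_zpow, valuation_p, mul_one]
      refine h4 ⟨_, h7, (hV _ h7).2 (by rw [h8]; exact h1 W), ?_⟩
      rw [norm_le_iff_val h7 one_ne_zero, hlt _ _ hu h7, hlt _ _ one_ne_zero hu, hlt _ _ h7 hu, hv1, h8]
      omega
    · intro h3
      rw [h3]
      refine ⟨h1 W, ?_⟩
      rintro ⟨t, h7, h8, h9⟩
      rw [norm_le_iff_val h7 one_ne_zero, hlt _ _ hu h7, hlt _ _ one_ne_zero hu, hlt _ _ h7 hu, hv1, h3] at h9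
      exact h2 W _ ((hV t h7).1 h8) h9
  obtain ⟨s, hs, es⟩ := lift_fn (castAdd m) (natAdd k) hh
  have hE := (EF_ext (p := p) (k + m)).dalg
  have es' := fun (t : Fin k → ℚ_[p]) (x : Fin m → ℚ_[p]) (ht : ∀ i, t i ≠ 0) => es (append t x) (by simpa only [append_left] using ht)
  simp only [append_left, append_right] at es'
  refine ⟨_, fun y hy => hy.1, ⟨QF.and hA.1 ((EF_ext _).qf _ (QF.norm_eq hE he hs)), fun z x => ?_⟩, h, hh, fun t x ht hy => ?_⟩
  · obtain ⟨t, a, b, c⟩ := h1 (z, x)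
    have := es' t x fun i => (a i).1
    refine ⟨t, a, b, (norm_eq_iff_val (h0 _) this.1).2 ?_⟩
    rw [c, this.2]; simp only [a]
  · have := es' t x ht
    rw [← this.2]
    exact (norm_eq_iff_val (h0 _) this.1).1 hy.2

theorem descent {G} (hG : G ∈ CA (EF p (k + m))) : ∀ A, FullS k m A → ∃ A' ⊆ A, FullS k m A' ∧ ∃ g ∈ SimpleAlg p k m,
    ∀ t x, (∀ i, t i ≠ 0) → append t x ∈ A' → g (fun i => (t i).valuation, x) = G (append t x) := by
  induction hG using Algebra.adjoin_induction with
  | mem G hG =>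
    intro A hA
    obtain ⟨e, he, rfl⟩ | ⟨e, he, rfl⟩ := hG <;> obtain ⟨A', h1, h2, h, h3, h4⟩ := sel hA he
    · exact ⟨A', h1, h2, _, Algebra.subset_adjoin (Or.inl ⟨h, h3, rfl⟩), fun t x ht hy => by simp only [h4 t x ht hy]⟩
    · exact ⟨A', h1, h2, _, Algebra.subset_adjoin (Or.inr ⟨h, h3, rfl⟩), fun t x ht hy => by simp only [h4 t x ht hy]⟩
  | algebraMap c => exact fun A hA => ⟨A, subset_rfl, hA, _, (SimpleAlg p k m).algebraMap_mem c, fun t x _ _ => rfl⟩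
  | add f g _ _ hf hg | mul f g _ _ hf hg =>
    intro A hA
    obtain ⟨B, h1, h2, f', h3, h4⟩ := hf A hA
    obtain ⟨C, h5, h6, g', h7, h8⟩ := hg B h2
    refine ⟨C, h5.trans h1, h6, ?_⟩
    first
    | exact ⟨_, add_mem h3 h7, fun t x ht hy => congr_arg₂ _ (h4 t x ht (h5 hy)) (h8 t x ht hy)⟩
    | exact ⟨_, mul_mem h3 h7, fun t x ht hy => congr_arg₂ _ (h4 t x ht (h5 hy)) (h8 t x ht hy)⟩

end lift

section fin
variable {p : ℕ} [hp : Fact p.Prime]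

theorem haar_pi {n : ℕ} {ν : Measure (Fin n → ℚ_[p])} (hν : ν.IsAddHaarMeasure) (hν1 : ν (ZpSet p n) = 1) {μ : Measure ℚ_[p]}
    (hμ : μ.IsAddHaarMeasure) (h1 : μ (closedBall 0 1) = 1) : ν = Measure.pi fun _ => μ := by
  have hZ : ZpSet p n = Set.univ.pi fun _ => closedBall 0 1 := by
    ext x; simp only [ZpSet, mem_ofPred_eq, Set.mem_pi, Set.mem_univ, true_imp_iff, Metric.mem_closedBall, dist_zero_right]
  let K : TopologicalSpace.PositiveCompacts (Fin n → ℚ_[p]) := ⟨⟨closedBall 0 1, isCompact_closedBall _ _⟩, 0,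
    Metric.ball_subset_interior_closedBall (Metric.mem_ball_self one_pos)⟩
  have hK : (K : Set (Fin n → ℚ_[p])) = ZpSet p n := by rw [hZ]; exact closedBall_pi 0 zero_le_one
  rw [Measure.addHaarMeasure_unique ν K, Measure.addHaarMeasure_unique (Measure.pi fun _ => μ) K, hK, hν1, hZ, Measure.pi_pi]
  simp only [h1, Finset.prod_const_one]

theorem final (k l m n : ℕ) (ν : Measure (Fin n → ℚ_[p])) (hν : ν.IsAddHaarMeasure) (hν1 : ν (ZpSet p n) = 1)
    (f : (Fin (k + l) → ℤ) × (Fin (m + n) → ℚ_[p]) → ℚ) (hf : f ∈ SimpleAlg p (k + l) (m + n))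
    (hi : ∀ (z₀ : Fin k → ℤ) (lam₀ : Fin m → ℚ_[p]), Integrable (fun w : (Fin l → ℤ) × (Fin n → ℚ_[p]) =>
      (f (append z₀ w.1, append lam₀ w.2) : ℝ)) ((Measure.count : Measure (Fin l → ℤ)).prod ν)) :
    ∃ g ∈ SimpleAlg p k m, ∀ (z : Fin k → ℤ) (lam : Fin m → ℚ_[p]), (g (z, lam) : ℝ) =
      ∑' z' : Fin l → ℤ, ∫ x : Fin n → ℚ_[p], (f (append z z', append lam x) : ℝ) ∂ν := by
  obtain ⟨μ, hμ, h1⟩ := exists_haar (p := p)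
  obtain ⟨κ, _, hκ, hκ0, hκc⟩ := exists_kappa (p := p)
  obtain rfl := haar_pi hν hν1 hμ h1
  obtain ⟨F, hF, eF⟩ := lift (N := k + m + l + n)
    (append (fun i => castAdd n (castAdd l (castAdd m i))) fun i => castAdd n (natAdd (k + m) i))
    (append (fun i => castAdd n (castAdd l (natAdd k i))) fun i => natAdd (k + m + l) i) hf
  obtain ⟨G₁, hG₁, e₁⟩ := good_pi (good_haar hμ h1) n hF
  obtain ⟨G, hG, e⟩ := good_pi hκ l hG₁
  obtain ⟨A, -, hA, g, hg, eg⟩ := descent hG Set.univ ⟨((QF.zero _ ((DF_isDAlg _).const 0)).of_eq (by ext; simp)), fun z x =>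
    ⟨fun i => p ^ z i, fun i => ⟨zpow_ne_zero _ pK_ne, by rw [valuation_zpow, valuation_p, mul_one]⟩, trivial⟩⟩
  refine ⟨g, hg, fun z x => ?_⟩
  obtain ⟨t, ht, htA⟩ := hA.2 z x
  have hz : (fun i => (t i).valuation) = z := funext fun i => (ht i).2
  have hgz := eg t x (fun i => (ht i).1) htA
  rw [hz] at hgz
  have hJ := hi z x
  let Φ : (Fin l → ℚ_[p]) → Fin l → ℤ := fun s i => (s i).valuation
  have hΦ : MeasurePreserving Φ (Measure.pi fun _ => κ) Measure.count := by
    have : Measure.pi (fun _ : Fin l => (Measure.count : Measure ℤ)) = Measure.count := by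
      refine Measure.ext_of_singleton fun z => ?_
      rw [Measure.pi_singleton, Measure.count_singleton]
      simp only [Measure.count_singleton, Finset.prod_const_one]
    rw [← this]
    exact measurePreserving_pi _ _ fun _ => hκc
  have hF' : ∀ s : Fin l → ℚ_[p], (∀ i, s i ≠ 0) → ∀ x', F (append (append (append t x) s) x') =
      f (append z (Φ s), append x x') := by
    intro s hs x'
    rw [eF]
    · congr 2 <;> ext i <;> refine Fin.addCases (fun i => ?_) (fun j => ?_) i <;> simp only [append_left, append_right, ht, Φ]
    · refine Fin.addCases (fun i => ?_) (fun j => ?_) <;> simp only [append_left, append_right]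
      · exact (ht i).1
      · exact hs j
  have hne : ∀ᵐ s ∂(Measure.pi fun _ : Fin l => κ), ∀ i, s i ≠ 0 :=
    ae_all_iff.2 fun i => (Measure.tendsto_eval_ae_ae (μ := fun _ : Fin l => κ) (i := i)).eventually (p := fun a => a ≠ 0) (compl_mem_ae_iff.2 hκ0)
  have hJ2 := (hΦ.prod (MeasurePreserving.id (Measure.pi fun _ : Fin n => μ))).integrable_comp_of_integrable hJ
  have hae : ∀ᵐ s ∂(Measure.pi fun _ : Fin l => κ), ∫ x', (f (append z (Φ s), append x x') : ℝ) ∂(Measure.pi fun _ => μ) =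
      G₁ (append (append t x) s) := by
    filter_upwards [hne, hJ2.prod_right_ae] with s hs hs'
    rw [← e₁]
    · simp only [hF' s hs]
    · simp only [hF' s hs]
      exact hs'
  rw [hgz, ← e _ (hJ2.integral_prod_left.congr hae), ← integral_congr_ae hae]
  have hl := hJ.integral_prod_left
  have h3 := integral_countable' hl
  simp only [measureReal_def, Measure.count_singleton, ENNReal.toReal_one, one_smul] at h3
  rw [← h3, ← hΦ.map_eq, integral_map hΦ.measurable.aemeasurable (by rw [hΦ.map_eq]; exact hl.1)]

end fin

end PadicSub
open PadicSub MeasureTheory in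
open scoped Classical in
/-- Theorem 4.5 of the paper (a conjecture of Denef).  For `f ∈ C_simple(ℤ^{k+l} × ℚ_p^{m+n})`,
the function `I_{k,m}(f) : ℤ^k × ℚ_p^m → ℚ`, defined by
`I_{k,m}(f)(z,λ) = ∑_{z' ∈ ℤ^l} ∫_{ℚ_p^n} f(z,z',λ,x) |dx|` if `(z',x) ↦ f(z,z',λ,x)` is
absolutely integrable (for the product of counting measure and Haar measure) for all
`(z,λ)`, and by `0` otherwise, belongs to `C_simple(ℤ^k × ℚ_p^m)`. -/
theorem simple_constructible_closed_under_integration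
    (p : ℕ) [Fact p.Prime] (k l m n : ℕ)
    (ν : Measure (Fin n → ℚ_[p])) (hν : ν.IsAddHaarMeasure) (hν1 : ν (ZpSet p n) = 1)
    (f : (Fin (k + l) → ℤ) × (Fin (m + n) → ℚ_[p]) → ℚ)
    (hf : f ∈ SimpleAlg p (k + l) (m + n)) :
    ∃ g ∈ SimpleAlg p k m, ∀ (z : Fin k → ℤ) (lam : Fin m → ℚ_[p]),
      (g (z, lam) : ℝ) =
        if ∀ (z₀ : Fin k → ℤ) (lam₀ : Fin m → ℚ_[p]),
            Integrable (fun w : (Fin l → ℤ) × (Fin n → ℚ_[p]) =>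
                (f (Fin.append z₀ w.1, Fin.append lam₀ w.2) : ℝ))
              ((Measure.count : Measure (Fin l → ℤ)).prod ν)
        then ∑' z' : Fin l → ℤ, ∫ x : Fin n → ℚ_[p],
              (f (Fin.append z z', Fin.append lam x) : ℝ) ∂ν
        else 0 := by
  by_cases h : ∀ (z₀ : Fin k → ℤ) (lam₀ : Fin m → ℚ_[p]), Integrable (fun w : (Fin l → ℤ) × (Fin n → ℚ_[p]) =>
      (f (Fin.append z₀ w.1, Fin.append lam₀ w.2) : ℝ)) ((Measure.count : Measure (Fin l → ℤ)).prod ν)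
  · simp only [if_pos h]
    exact final k l m n ν hν hν1 f hf h
  · exact ⟨0, zero_mem _, fun z lam => by rw [if_neg h]; simp⟩
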